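/- Let 2 < α ≤ 3 and let u ∈ C^∞(S²) be a solution of −Δu + α = e^{2u} on S². Suppose p ∈ S² is an umbilical critical point of u (∇u(p) = 0 and D²u(p) has two equal eigenvalues) and in addition ∇u(−p) = 0. Then u is axially symmetric with respect to p, i.e. for every y ∈ S² with y·p = 0 one has u ∘ R_y = u. -/

import Mathlib

open MeasureTheory Real
open scoped RealInnerProductSpace ContDiff

noncomputable section

abbrev E3 : Type := EuclideanSpace ℝ (Fin 3)

/-- The unit sphere `S²` as a subset of `ℝ³`. -/
def S2 : Set E3 := Metric.sphere 0 1

/-- The Euclidean Laplacian of `u : ℝ³ → ℝ`.  For a `0`-homogeneous function it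
coincides on `S²` with the Laplace–Beltrami operator of the round metric applied
to the restriction of `u` to `S²`. -/
def lap (u : E3 → ℝ) (x : E3) : ℝ :=
  ∑ i : Fin 3, iteratedFDeriv ℝ 2 u x ![EuclideanSpace.single i 1, EuclideanSpace.single i 1]

/-- `u : ℝ³ → ℝ` is positively homogeneous of degree `0`, i.e. it is the radial
extension of a function on `S²`. -/
def Hom0 (u : E3 → ℝ) : Prop := ∀ (x : E3) (r : ℝ), 0 < r → u (r • x) = u x

/-- `u` represents a smooth solution of the mean field equation `-Δ_{S²} u + α = e^{2u}`
on `S²`, encoded through its degree-zero homogeneous extension to `ℝ³ \ {0}`. -/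
def MFE (u : E3 → ℝ) (α : ℝ) : Prop :=
  ContDiffOn ℝ ∞ u {(0 : E3)}ᶜ ∧ Hom0 u ∧
    ∀ x ∈ S2, -lap u x + α = Real.exp (2 * u x)

/-- Reflection of `ℝ³` across the plane `{x · y = 0}`. -/
def Refl (y x : E3) : E3 := x - (2 * ⟪x, y⟫) • y

/-- The closed half-sphere `H_y`. -/
def halfSphere (y : E3) : Set E3 := {x ∈ S2 | 0 ≤ ⟪x, y⟫}

/-- The great circle `C_y`. -/
def circleOf (y : E3) : Set E3 := {x ∈ S2 | ⟪x, y⟫ = 0}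

/-- `u` is axially symmetric with respect to `p`: on the sphere it depends only on `x · p`. -/
def AxiallySymmetric (u : E3 → ℝ) (p : E3) : Prop :=
  ∀ x ∈ S2, ∀ y ∈ S2, ⟪x, p⟫ = ⟪y, p⟫ → u x = u y

/-- `p` is an umbilical critical point of `u` (viewed as a function on `S²`):
the (intrinsic) gradient vanishes and the Hessian, as a quadratic form on the
tangent plane `p^⊥`, is a multiple of the metric. -/
def UmbilicalCritical (u : E3 → ℝ) (p : E3) : Prop :=
  fderiv ℝ u p = 0 ∧
    ∃ c : ℝ, ∀ v : E3, ⟪v, p⟫ = 0 → iteratedFDeriv ℝ 2 u p ![v, v] = c * ‖v‖ ^ 2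

/-- `z` is an eigenvector of the Hessian `D²u(q)` viewed as a symmetric bilinear
form on the tangent plane `q^⊥`. -/
def HessEigen (u : E3 → ℝ) (q z : E3) : Prop :=
  ∃ lam : ℝ, ∀ v : E3, ⟪v, q⟫ = 0 → iteratedFDeriv ℝ 2 u q ![z, v] = lam * ⟪z, v⟫

/-- Cross product on `ℝ³`. -/
def cross (a b : E3) : E3 :=
  (WithLp.equiv 2 (Fin 3 → ℝ)).symm
    (crossProduct ((WithLp.equiv 2 (Fin 3 → ℝ)) a) ((WithLp.equiv 2 (Fin 3 → ℝ)) b))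

/-- `Ω` is a nodal domain of `w` on the sphere: a connected component of
`S² \ w⁻¹(0)` (in the subspace topology of `S²`). -/
def IsNodalDomain (w : E3 → ℝ) (Ω : Set E3) : Prop :=
  ∃ x ∈ S2, w x ≠ 0 ∧ Ω = connectedComponentIn {z ∈ S2 | w z ≠ 0} x

end

set_option linter.unusedSectionVars false

noncomputable section

namespace Planar

section

/-- Partial derivative in the real direction. -/
def dx {E : Type*} [NormedAddCommGroup E] [NormedSpace ℝ E] (f : ℂ → E) (z : ℂ) : E :=
  fderiv ℝ f z 1

/-- Partial derivative in the imaginary direction. -/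
def dy {E : Type*} [NormedAddCommGroup E] [NormedSpace ℝ E] (f : ℂ → E) (z : ℂ) : E :=
  fderiv ℝ f z Complex.I

/-- The planar Laplacian. -/
def plap (f : ℂ → ℝ) (z : ℂ) : ℝ := dx (dx f) z + dy (dy f) z

/-- The length of the gradient. -/
def gnorm (f : ℂ → ℝ) (z : ℂ) : ℝ := √(dx f z ^ 2 + dy f z ^ 2)

lemma gnorm_sq (f : ℂ → ℝ) (z : ℂ) : gnorm f z ^ 2 = dx f z ^ 2 + dy f z ^ 2 :=
  Real.sq_sqrt (by positivity)

section
variable {E : Type*} [NormedAddCommGroup E] [NormedSpace ℝ E]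

lemma dx_congr {f g : ℂ → E} {z : ℂ} (h : f =ᶠ[nhds z] g) : dx f z = dx g z := by
  simp [dx, h.fderiv_eq]

lemma dy_congr {f g : ℂ → E} {z : ℂ} (h : f =ᶠ[nhds z] g) : dy f z = dy g z := by
  simp [dy, h.fderiv_eq]

lemma fderiv_eq_dx_dy (f : ℂ → E) (z v : ℂ) :
    fderiv ℝ f z v = v.re • dx f z + v.im • dy f z := by
  have h : v = v.re • (1 : ℂ) + v.im • Complex.I := by
    apply Complex.ext <;> simp
  conv_lhs => rw [h]
  simp only [map_add, map_smul, dx, dy]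

lemma integral_fderiv_eq_zero [CompleteSpace E] {f : ℂ → E} (hf : ContDiff ℝ 1 f)
    (hc : HasCompactSupport f) (v : ℂ) : ∫ z, fderiv ℝ f z v = 0 := by
  obtain ⟨χ, hχ1, hχs, hχd, -⟩ : ∃ χ : ℂ → ℝ, (∀ z ∈ tsupport f, χ z = 1) ∧ HasCompactSupport χ ∧
      ContDiff ℝ 1 χ ∧ True := by
    obtain ⟨R, hR⟩ := hc.isCompact.isBounded.subset_closedBall (0 : ℂ)
    let b : ContDiffBump (0 : ℂ) := ⟨max R 1, max R 1 + 1, by positivity, by linarith⟩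
    refine ⟨b, fun z hz => b.one_of_mem_closedBall ?_, b.hasCompactSupport, b.contDiff, trivial⟩
    exact Metric.closedBall_subset_closedBall (le_max_left _ _) (hR hz)
  have hfd : Continuous (fun z => fderiv ℝ f z v) :=
    (hf.continuous_fderiv (by simp)).clm_apply continuous_const
  have hcd : HasCompactSupport (fun z => fderiv ℝ f z v) := (hc.fderiv (𝕜 := ℝ)).comp_left
    (g := fun L : ℂ →L[ℝ] E => L v) (by simp)
  have hχd' : Continuous (fun z => fderiv ℝ χ z v) :=
    (hχd.continuous_fderiv (by simp)).clm_apply continuous_const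
  have key := integral_smul_fderiv_eq_neg_fderiv_smul_of_integrable (μ := (volume : Measure ℂ))
    (f := χ) (g := f) (v := v) ?_ ?_ ?_ (fun x _ => hχd.differentiable (by simp) x)
    (fun x _ => hf.differentiable (by simp) x)
  · have h1 : ∀ z, χ z • fderiv ℝ f z v = fderiv ℝ f z v := by
      intro z
      by_cases hz : z ∈ tsupport f
      · simp [hχ1 z hz]
      · have : fderiv ℝ f z = 0 := by
          by_contra h
          exact hz (support_fderiv_subset ℝ h)
        simp [this]
    have h2 : ∀ z, fderiv ℝ χ z v • f z = 0 := by
      intro z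
      by_cases hz : z ∈ Function.support f
      · have hev : χ =ᶠ[nhds z] fun _ => 1 := by
          have : Function.support f ∈ nhds z := hf.continuous.isOpen_support.mem_nhds hz
          filter_upwards [this] with w hw using hχ1 w (subset_tsupport f hw)
        simp [hev.fderiv_eq]
      · simp [Function.notMem_support.mp hz]
    simpa [h1, h2] using key
  · exact (hχd'.smul hf.continuous).integrable_of_hasCompactSupport (hc.smul_left)
  · exact (hχd.continuous.smul hfd).integrable_of_hasCompactSupport (hcd.smul_left)
  · exact (hχd.continuous.smul hf.continuous).integrable_of_hasCompactSupport (hc.smul_left)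

lemma contDiffAt_dx {f : ℂ → E} {z : ℂ} {m n : WithTop ℕ∞} (hf : ContDiffAt ℝ n f z)
    (h : m + 1 ≤ n) : ContDiffAt ℝ m (dx f) z :=
  (hf.fderiv_right h).clm_apply contDiffAt_const

lemma contDiffAt_dy {f : ℂ → E} {z : ℂ} {m n : WithTop ℕ∞} (hf : ContDiffAt ℝ n f z)
    (h : m + 1 ≤ n) : ContDiffAt ℝ m (dy f) z :=
  (hf.fderiv_right h).clm_apply contDiffAt_const

lemma continuousAt_dx {f : ℂ → E} {z : ℂ} (hf : ContDiffAt ℝ 1 f z) : ContinuousAt (dx f) z :=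
  (contDiffAt_dx (m := 0) hf (by simp)).continuousAt

lemma continuousAt_dy {f : ℂ → E} {z : ℂ} (hf : ContDiffAt ℝ 1 f z) : ContinuousAt (dy f) z :=
  (contDiffAt_dy (m := 0) hf (by simp)).continuousAt

lemma continuous_dx {f : ℂ → E} (hf : ContDiff ℝ 1 f) : Continuous (dx f) :=
  continuous_iff_continuousAt.2 fun _ => continuousAt_dx hf.contDiffAt

lemma continuous_dy {f : ℂ → E} (hf : ContDiff ℝ 1 f) : Continuous (dy f) :=
  continuous_iff_continuousAt.2 fun _ => continuousAt_dy hf.contDiffAt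

lemma dx_eq_zero_of_notMem {f : ℂ → E} {z : ℂ} (hz : z ∉ tsupport f) : dx f z = 0 := by
  have : fderiv ℝ f z = 0 := by
    by_contra h
    exact hz (support_fderiv_subset ℝ h)
  simp [dx, this]

lemma dy_eq_zero_of_notMem {f : ℂ → E} {z : ℂ} (hz : z ∉ tsupport f) : dy f z = 0 := by
  have : fderiv ℝ f z = 0 := by
    by_contra h
    exact hz (support_fderiv_subset ℝ h)
  simp [dy, this]

lemma continuous_of_zero_off {F : ℂ → E} {K : Set ℂ} (hK : IsClosed K)
    (h0 : ∀ z ∉ K, F z = 0) (h : ∀ z ∈ K, ContinuousAt F z) : Continuous F := by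
  refine continuous_iff_continuousAt.2 fun z => ?_
  by_cases hz : z ∈ K
  · exact h z hz
  · have : F =ᶠ[nhds z] fun _ => 0 := by
      filter_upwards [hK.isOpen_compl.mem_nhds hz] with w hw using h0 w hw
    exact continuousAt_const.congr this.symm

lemma contDiff_of_zero_off {F : ℂ → E} {K : Set ℂ} {n : WithTop ℕ∞} (hK : IsClosed K)
    (h0 : ∀ z ∉ K, F z = 0) (h : ∀ z ∈ K, ContDiffAt ℝ n F z) : ContDiff ℝ n F := by
  refine contDiff_iff_contDiffAt.2 fun z => ?_
  by_cases hz : z ∈ K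
  · exact h z hz
  · have : F =ᶠ[nhds z] fun _ => 0 := by
      filter_upwards [hK.isOpen_compl.mem_nhds hz] with w hw using h0 w hw
    exact contDiffAt_const.congr_of_eventuallyEq this

lemma hasCompactSupport_of_zero_off {F : ℂ → E} {K : Set ℂ} (hK : IsCompact K)
    (h0 : ∀ z ∉ K, F z = 0) : HasCompactSupport F :=
  HasCompactSupport.intro hK h0

lemma tsupport_subset_of_zero_off {F : ℂ → E} {K : Set ℂ} (hK : IsClosed K)
    (h0 : ∀ z ∉ K, F z = 0) : tsupport F ⊆ K := by
  refine closure_minimal (fun z hz => ?_) hK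
  by_contra h
  exact hz (h0 z h)

lemma integrable_of_zero_off {F : ℂ → E} {K : Set ℂ} (hK : IsCompact K)
    (h0 : ∀ z ∉ K, F z = 0) (h : ∀ z ∈ K, ContinuousAt F z) : Integrable F :=
  (continuous_of_zero_off hK.isClosed h0 h).integrable_of_hasCompactSupport
    (hasCompactSupport_of_zero_off hK h0)

lemma integrable_of_zero_off_prod {F : ℂ × ℂ → E} {K L : Set ℂ} (hK : IsCompact K)
    (hL : IsCompact L) (h0 : ∀ z ∉ K ×ˢ L, F z = 0) (h : ∀ z ∈ K ×ˢ L, ContinuousAt F z) :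
    Integrable F (volume.prod volume) := by
  have hc : IsCompact (K ×ˢ L) := hK.prod hL
  refine Continuous.integrable_of_hasCompactSupport ?_ (HasCompactSupport.intro hc h0)
  refine continuous_iff_continuousAt.2 fun z => ?_
  by_cases hz : z ∈ K ×ˢ L
  · exact h z hz
  · have : F =ᶠ[nhds z] fun _ => 0 := by
      filter_upwards [hc.isClosed.isOpen_compl.mem_nhds hz] with w hw using h0 w hw
    exact continuousAt_const.congr this.symm

lemma dx_add {f g : ℂ → E} {z : ℂ} (hf : DifferentiableAt ℝ f z) (hg : DifferentiableAt ℝ g z) :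
    dx (fun w => f w + g w) z = dx f z + dx g z := by
  simp [dx, fderiv_fun_add hf hg]

lemma dy_add {f g : ℂ → E} {z : ℂ} (hf : DifferentiableAt ℝ f z) (hg : DifferentiableAt ℝ g z) :
    dy (fun w => f w + g w) z = dy f z + dy g z := by
  simp [dy, fderiv_fun_add hf hg]

lemma dx_sub {f g : ℂ → E} {z : ℂ} (hf : DifferentiableAt ℝ f z) (hg : DifferentiableAt ℝ g z) :
    dx (fun w => f w - g w) z = dx f z - dx g z := by
  simp [dx, fderiv_fun_sub hf hg]

lemma dy_sub {f g : ℂ → E} {z : ℂ} (hf : DifferentiableAt ℝ f z) (hg : DifferentiableAt ℝ g z) :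
    dy (fun w => f w - g w) z = dy f z - dy g z := by
  simp [dy, fderiv_fun_sub hf hg]

lemma dx_neg (f : ℂ → E) (z : ℂ) : dx (fun w => -f w) z = -dx f z := by
  simp [dx, fderiv_fun_neg]

lemma dy_neg (f : ℂ → E) (z : ℂ) : dy (fun w => -f w) z = -dy f z := by
  simp [dy, fderiv_fun_neg]

lemma dx_mul {A : Type*} [NormedRing A] [NormedAlgebra ℝ A] {f g : ℂ → A} {z : ℂ}
    (hf : DifferentiableAt ℝ f z)
    (hg : DifferentiableAt ℝ g z) : dx (fun w => f w * g w) z = f z * dx g z + dx f z * g z := by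
  simp [dx, fderiv_fun_mul' hf hg]

lemma dy_mul {A : Type*} [NormedRing A] [NormedAlgebra ℝ A] {f g : ℂ → A} {z : ℂ}
    (hf : DifferentiableAt ℝ f z)
    (hg : DifferentiableAt ℝ g z) : dy (fun w => f w * g w) z = f z * dy g z + dy f z * g z := by
  simp [dy, fderiv_fun_mul' hf hg]

lemma dx_comp {θ : ℝ → ℝ} {f : ℂ → ℝ} {z : ℂ} (hθ : DifferentiableAt ℝ θ (f z))
    (hf : DifferentiableAt ℝ f z) : dx (fun w => θ (f w)) z = deriv θ (f z) * dx f z := by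
  have := (hθ.hasDerivAt.comp_hasFDerivAt z hf.hasFDerivAt).fderiv
  simp only [dx]
  change fderiv ℝ (θ ∘ f) z 1 = _
  rw [this]; simp

lemma dy_comp {θ : ℝ → ℝ} {f : ℂ → ℝ} {z : ℂ} (hθ : DifferentiableAt ℝ θ (f z))
    (hf : DifferentiableAt ℝ f z) : dy (fun w => θ (f w)) z = deriv θ (f z) * dy f z := by
  have := (hθ.hasDerivAt.comp_hasFDerivAt z hf.hasFDerivAt).fderiv
  simp only [dy]
  change fderiv ℝ (θ ∘ f) z Complex.I = _
  rw [this]; simp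

end

lemma differentiableAt_of_contDiffAt {E : Type*} [NormedAddCommGroup E] [NormedSpace ℝ E]
    {f : ℂ → E} {z : ℂ} {n : WithTop ℕ∞} (h : ContDiffAt ℝ n f z) (hn : 1 ≤ n) :
    DifferentiableAt ℝ f z := h.differentiableAt (fun h0 => by simp [h0] at hn)

lemma plap_congr {f g : ℂ → ℝ} {z : ℂ} (h : f =ᶠ[nhds z] g) : plap f z = plap g z := by
  have h1 : dx f =ᶠ[nhds z] dx g := h.eventuallyEq_nhds.mono fun w hw => dx_congr hw
  have h2 : dy f =ᶠ[nhds z] dy g := h.eventuallyEq_nhds.mono fun w hw => dy_congr hw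
  rw [plap, plap, dx_congr h1, dy_congr h2]

lemma eventually_differentiableAt {f : ℂ → ℝ} {z : ℂ} (hf : ContDiffAt ℝ 2 f z) :
    ∀ᶠ w in nhds z, DifferentiableAt ℝ f w :=
  (hf.eventually (by simp)).mono fun _ h => differentiableAt_of_contDiffAt h (by norm_num)

lemma plap_sub {f g : ℂ → ℝ} {z : ℂ} (hf : ContDiffAt ℝ 2 f z) (hg : ContDiffAt ℝ 2 g z) :
    plap (fun w => f w - g w) z = plap f z - plap g z := by
  have h1 : dx (fun w => f w - g w) =ᶠ[nhds z] fun w => dx f w - dx g w := by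
    filter_upwards [eventually_differentiableAt hf, eventually_differentiableAt hg] with w h1 h2
      using dx_sub h1 h2
  have h2 : dy (fun w => f w - g w) =ᶠ[nhds z] fun w => dy f w - dy g w := by
    filter_upwards [eventually_differentiableAt hf, eventually_differentiableAt hg] with w h1 h2
      using dy_sub h1 h2
  have e : (1 : WithTop ℕ∞) + 1 ≤ 2 := by norm_num
  rw [plap, dx_congr h1, dy_congr h2,
    dx_sub (differentiableAt_of_contDiffAt (contDiffAt_dx hf e) le_rfl)
      (differentiableAt_of_contDiffAt (contDiffAt_dx hg e) le_rfl),
    dy_sub (differentiableAt_of_contDiffAt (contDiffAt_dy hf e) le_rfl)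
      (differentiableAt_of_contDiffAt (contDiffAt_dy hg e) le_rfl), plap, plap]
  ring

lemma plap_add {f g : ℂ → ℝ} {z : ℂ} (hf : ContDiffAt ℝ 2 f z) (hg : ContDiffAt ℝ 2 g z) :
    plap (fun w => f w + g w) z = plap f z + plap g z := by
  have h1 : dx (fun w => f w + g w) =ᶠ[nhds z] fun w => dx f w + dx g w := by
    filter_upwards [eventually_differentiableAt hf, eventually_differentiableAt hg] with w h1 h2
      using dx_add h1 h2
  have h2 : dy (fun w => f w + g w) =ᶠ[nhds z] fun w => dy f w + dy g w := by
    filter_upwards [eventually_differentiableAt hf, eventually_differentiableAt hg] with w h1 h2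
      using dy_add h1 h2
  have e : (1 : WithTop ℕ∞) + 1 ≤ 2 := by norm_num
  rw [plap, dx_congr h1, dy_congr h2,
    dx_add (differentiableAt_of_contDiffAt (contDiffAt_dx hf e) le_rfl)
      (differentiableAt_of_contDiffAt (contDiffAt_dx hg e) le_rfl),
    dy_add (differentiableAt_of_contDiffAt (contDiffAt_dy hf e) le_rfl)
      (differentiableAt_of_contDiffAt (contDiffAt_dy hg e) le_rfl), plap, plap]
  ring

lemma plap_neg {f : ℂ → ℝ} {z : ℂ} : plap (fun w => -f w) z = -plap f z := by
  have h1 : dx (fun w => -f w) = fun w => -dx f w := funext fun w => dx_neg f w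
  have h2 : dy (fun w => -f w) = fun w => -dy f w := funext fun w => dy_neg f w
  rw [plap, h1, h2, dx_neg, dy_neg, plap]; ring

lemma plap_const_mul {f : ℂ → ℝ} {z : ℂ} (c : ℝ) : plap (fun w => c * f w) z = c * plap f z := by
  have h1 : dx (fun w => c * f w) = fun w => c * dx f w := by
    funext w; simp only [dx]
    change fderiv ℝ (c • f) w 1 = _
    rw [fderiv_const_smul_field]; simp
  have h2 : dy (fun w => c * f w) = fun w => c * dy f w := by
    funext w; simp only [dy]
    change fderiv ℝ (c • f) w Complex.I = _
    rw [fderiv_const_smul_field]; simp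
  have h3 : ∀ g : ℂ → ℝ, dx (fun w => c * g w) z = c * dx g z := by
    intro g; simp only [dx]
    change fderiv ℝ (c • g) z 1 = _
    rw [fderiv_const_smul_field]; simp
  have h4 : ∀ g : ℂ → ℝ, dy (fun w => c * g w) z = c * dy g z := by
    intro g; simp only [dy]
    change fderiv ℝ (c • g) z Complex.I = _
    rw [fderiv_const_smul_field]; simp
  rw [plap, h1, h2, h3, h4, plap]; ring

lemma continuousAt_plap {f : ℂ → ℝ} {z : ℂ} (hf : ContDiffAt ℝ 2 f z) :
    ContinuousAt (plap f) z :=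
  (continuousAt_dx (contDiffAt_dx (m := 1) hf (by norm_num))).add
    (continuousAt_dy (contDiffAt_dy (m := 1) hf (by norm_num)))

/-- Green's first identity for a compactly supported test function. -/
lemma integral_mul_plap {D : Set ℂ} {f w : ℂ → ℝ} (hf : ContDiff ℝ 1 f)
    (hc : HasCompactSupport f) (hfD : tsupport f ⊆ D) (hw : ∀ z ∈ D, ContDiffAt ℝ 2 w z) :
    ∫ z, f z * plap w z = -∫ z, (dx f z * dx w z + dy f z * dy w z) := by
  have hK : IsCompact (tsupport f) := hc.isCompact
  have hf0 : ∀ z ∉ tsupport f, f z = 0 := fun z hz => image_eq_zero_of_notMem_tsupport hz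
  have h1 : ∫ z, dx (fun w' => f w' * dx w w') z = 0 := by
    refine integral_fderiv_eq_zero (contDiff_of_zero_off hK.isClosed ?_ ?_)
      (hasCompactSupport_of_zero_off hK ?_) 1
    · intro z hz; simp [hf0 z hz]
    · intro z hz; exact hf.contDiffAt.mul (contDiffAt_dx (hw z (hfD hz)) (by norm_num))
    · intro z hz; simp [hf0 z hz]
  have h2 : ∫ z, dy (fun w' => f w' * dy w w') z = 0 := by
    refine integral_fderiv_eq_zero (contDiff_of_zero_off hK.isClosed ?_ ?_)
      (hasCompactSupport_of_zero_off hK ?_) Complex.I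
    · intro z hz; simp [hf0 z hz]
    · intro z hz; exact hf.contDiffAt.mul (contDiffAt_dy (hw z (hfD hz)) (by norm_num))
    · intro z hz; simp [hf0 z hz]
  have i1 : Integrable (fun z => f z * plap w z) :=
    integrable_of_zero_off hK (fun z hz => by simp [hf0 z hz])
      (fun z hz => hf.continuous.continuousAt.mul (continuousAt_plap (hw z (hfD hz))))
  have c1 : ∀ z ∈ tsupport f, ContDiffAt ℝ 1 w z := fun z hz => (hw z (hfD hz)).of_le (by norm_num)
  have i2 : Integrable (fun z => dx f z * dx w z + dy f z * dy w z) :=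
    integrable_of_zero_off hK
      (fun z hz => by simp [dx_eq_zero_of_notMem hz, dy_eq_zero_of_notMem hz])
      (fun z hz => ((continuous_dx hf).continuousAt.mul (continuousAt_dx (c1 z hz))).add
        ((continuous_dy hf).continuousAt.mul (continuousAt_dy (c1 z hz))))
  have key : ∀ z, f z * plap w z + (dx f z * dx w z + dy f z * dy w z) =
      dx (fun w' => f w' * dx w w') z + dy (fun w' => f w' * dy w w') z := by
    intro z
    by_cases hz : z ∈ tsupport f
    · have d := differentiableAt_of_contDiffAt hf.contDiffAt le_rfl (z := z)
      rw [dx_mul d (differentiableAt_of_contDiffAt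
          (contDiffAt_dx (m := 1) (hw z (hfD hz)) (by norm_num)) le_rfl),
        dy_mul d (differentiableAt_of_contDiffAt
          (contDiffAt_dy (m := 1) (hw z (hfD hz)) (by norm_num)) le_rfl), plap]
      ring
    · have hev : ∀ g : ℂ → ℝ, (fun w' => f w' * g w') =ᶠ[nhds z] fun _ => 0 := by
        intro g
        filter_upwards [hK.isClosed.isOpen_compl.mem_nhds hz] with w' hw'
        simp [hf0 w' hw']
      rw [dx_congr (hev _), dy_congr (hev _)]
      rw [hf0 z hz, dx_eq_zero_of_notMem hz, dy_eq_zero_of_notMem hz]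
      simp [dx, dy]
  have hsum : ∫ z, (f z * plap w z + (dx f z * dx w z + dy f z * dy w z)) = 0 := by
    have j1 : Integrable (dx (fun w' => f w' * dx w w')) := by
      have : ContDiff ℝ 1 (fun w' => f w' * dx w w') := contDiff_of_zero_off hK.isClosed
        (fun z hz => by simp [hf0 z hz])
        (fun z hz => hf.contDiffAt.mul (contDiffAt_dx (hw z (hfD hz)) (by norm_num)))
      refine integrable_of_zero_off hK (fun z hz => dx_eq_zero_of_notMem fun h => hz ?_)
        fun z _ => (continuous_dx this).continuousAt
      exact tsupport_subset_of_zero_off hK.isClosed (fun z hz => by simp [hf0 z hz]) h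
    have j2 : Integrable (dy (fun w' => f w' * dy w w')) := by
      have : ContDiff ℝ 1 (fun w' => f w' * dy w w') := contDiff_of_zero_off hK.isClosed
        (fun z hz => by simp [hf0 z hz])
        (fun z hz => hf.contDiffAt.mul (contDiffAt_dy (hw z (hfD hz)) (by norm_num)))
      refine integrable_of_zero_off hK (fun z hz => dy_eq_zero_of_notMem fun h => hz ?_)
        fun z _ => (continuous_dy this).continuousAt
      exact tsupport_subset_of_zero_off hK.isClosed (fun z hz => by simp [hf0 z hz]) h
    simp_rw [key]
    rw [integral_add j1 j2, h1, h2, add_zero]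
  rw [integral_add i1 i2] at hsum
  linarith

end

/-- The Wirtinger derivative `∂/∂z`. -/
def dz (F : ℂ → ℂ) (z : ℂ) : ℂ := (dx F z - Complex.I * dy F z) / 2

/-- The Wirtinger derivative `∂/∂z̄`. -/
def dzb (F : ℂ → ℂ) (z : ℂ) : ℂ := (dx F z + Complex.I * dy F z) / 2

/-- `F` is real-differentiable at `z` with Wirtinger derivatives `a` and `b`. -/
def HasW (F : ℂ → ℂ) (a b z : ℂ) : Prop :=
  DifferentiableAt ℝ F z ∧ dz F z = a ∧ dzb F z = b

lemma DifferentiableAt.hasW {F : ℂ → ℂ} {z : ℂ} (h : DifferentiableAt ℝ F z) :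
    HasW F (dz F z) (dzb F z) z := ⟨h, rfl, rfl⟩

lemma HasW.add {F G : ℂ → ℂ} {a b c d z : ℂ} (hF : HasW F a b z) (hG : HasW G c d z) :
    HasW (fun w => F w + G w) (a + c) (b + d) z := by
  obtain ⟨h1, rfl, rfl⟩ := hF
  obtain ⟨h2, rfl, rfl⟩ := hG
  refine ⟨h1.fun_add h2, ?_, ?_⟩ <;> simp only [dz, dzb, dx_add h1 h2, dy_add h1 h2] <;> ring

lemma HasW.mul {F G : ℂ → ℂ} {a b c d z : ℂ} (hF : HasW F a b z) (hG : HasW G c d z) :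
    HasW (fun w => F w * G w) (F z * c + a * G z) (F z * d + b * G z) z := by
  obtain ⟨h1, rfl, rfl⟩ := hF
  obtain ⟨h2, rfl, rfl⟩ := hG
  refine ⟨h1.fun_mul h2, ?_, ?_⟩ <;> simp only [dz, dzb, dx_mul h1 h2, dy_mul h1 h2] <;> ring

lemma HasW.congr_val {F : ℂ → ℂ} {a b c d z : ℂ} (hF : HasW F a b z) (h : a = c) (h' : b = d) :
    HasW F c d z := h ▸ h' ▸ hF

lemma hasW_const (c z : ℂ) : HasW (fun _ => c) 0 0 z := by
  refine ⟨differentiableAt_const _, ?_, ?_⟩ <;> simp [dz, dzb, dx, dy]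

lemma _root_.HasDerivAt.hasW {F : ℂ → ℂ} {a z : ℂ} (h : HasDerivAt F a z) : HasW F a 0 z := by
  have h1 := h.hasFDerivAt.restrictScalars ℝ
  refine ⟨h1.differentiableAt, ?_, ?_⟩ <;> simp only [dz, dzb, dx, dy, h1.fderiv] <;>
    simp [← mul_assoc]

lemma HasW.conj {F : ℂ → ℂ} {a b z : ℂ} (h : HasW F a b z) :
    HasW (fun w => (starRingEnd ℂ) (F w)) ((starRingEnd ℂ) b) ((starRingEnd ℂ) a) z := by
  obtain ⟨h1, rfl, rfl⟩ := h
  have h2 := (Complex.conjCLE.toContinuousLinearMap.hasFDerivAt (x := F z)).comp z h1.hasFDerivAt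
  have h3 : HasFDerivAt (fun w => (starRingEnd ℂ) (F w))
      (Complex.conjCLE.toContinuousLinearMap.comp (fderiv ℝ F z)) z := h2
  refine ⟨h3.differentiableAt, ?_, ?_⟩ <;> simp only [dz, dzb, dx, dy, h3.fderiv] <;>
    simp [map_ofNat] <;> ring

lemma HasW.comp_hasDerivAt {F G : ℂ → ℂ} {a b c z : ℂ} (h : HasW F a b z)
    (hG : HasDerivAt G c (F z)) : HasW (fun w => G (F w)) (c * a) (c * b) z := by
  obtain ⟨h1, rfl, rfl⟩ := h
  have h3 : HasFDerivAt (fun w => G (F w)) _ z :=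
    (hG.hasFDerivAt.restrictScalars ℝ).comp z h1.hasFDerivAt
  refine ⟨h3.differentiableAt, ?_, ?_⟩ <;> simp only [dz, dzb, dx, dy, h3.fderiv] <;>
    simp <;> ring

lemma HasW.comp_of_hol {F G : ℂ → ℂ} {a b c z : ℂ} (hF : HasW F a b (G z))
    (hG : HasDerivAt G c z) :
    HasW (fun w => F (G w)) (a * c) (b * (starRingEnd ℂ) c) z := by
  obtain ⟨h1, rfl, rfl⟩ := hF
  have h3 : HasFDerivAt (fun w => F (G w)) _ z :=
    h1.hasFDerivAt.comp z (hG.hasFDerivAt.restrictScalars ℝ)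
  have e : ∀ v : ℂ, fderiv ℝ F (G z) v = v.re • dx F (G z) + v.im • dy F (G z) :=
    fun v => fderiv_eq_dx_dy F (G z) v
  have ec : (starRingEnd ℂ) c = c.re - c.im * Complex.I := by
    apply Complex.ext <;> simp
  have ec' : c = c.re + c.im * Complex.I := by
    apply Complex.ext <;> simp
  refine ⟨h3.differentiableAt, ?_, ?_⟩ <;> simp only [dz, dzb] <;>
    simp only [dx, dy, h3.fderiv, ContinuousLinearMap.comp_apply] <;> simp [e]
  · linear_combination (- (dx F (G z) - Complex.I * dy F (G z)) / 2) * ec' +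
      (c.im * dy F (G z) / 2) * Complex.I_sq
  · rw [ec]; linear_combination (c.im * dy F (G z) / 2) * Complex.I_sq

/-- The Wirtinger derivative `∂/∂z` or `∂/∂z̄` of a compactly supported function has zero mean. -/
lemma integral_dz_eq_zero {F : ℂ → ℂ} (hF : ContDiff ℝ 1 F) (hc : HasCompactSupport F) :
    ∫ z, dz F z = 0 ∧ ∫ z, dzb F z = 0 := by
  have hx : ∫ z, dx F z = 0 := integral_fderiv_eq_zero hF hc 1
  have hy : ∫ z, dy F z = 0 := integral_fderiv_eq_zero hF hc Complex.I
  have ix : Integrable (dx F) := integrable_of_zero_off hc.isCompact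
    (fun z hz => dx_eq_zero_of_notMem hz) (fun z _ => (continuous_dx hF).continuousAt)
  have iy : Integrable (dy F) := integrable_of_zero_off hc.isCompact
    (fun z hz => dy_eq_zero_of_notMem hz) (fun z _ => (continuous_dy hF).continuousAt)
  constructor
  · simp only [dz, integral_div]
    rw [integral_sub ix (iy.const_mul _), hx, integral_const_mul, hy]; simp
  · simp only [dzb, integral_div]
    rw [integral_add ix (iy.const_mul _), hx, integral_const_mul, hy]; simp

lemma dz_eq_zero_of_notMem {F : ℂ → ℂ} {z : ℂ} (hz : z ∉ tsupport F) : dz F z = 0 := by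
  simp [dz, dx_eq_zero_of_notMem hz, dy_eq_zero_of_notMem hz]

lemma dzb_eq_zero_of_notMem {F : ℂ → ℂ} {z : ℂ} (hz : z ∉ tsupport F) : dzb F z = 0 := by
  simp [dzb, dx_eq_zero_of_notMem hz, dy_eq_zero_of_notMem hz]

lemma continuousAt_dz {F : ℂ → ℂ} {z : ℂ} (hF : ContDiffAt ℝ 1 F z) : ContinuousAt (dz F) z :=
  ((continuousAt_dx hF).sub (continuousAt_const.mul (continuousAt_dy hF))).div_const _

lemma continuousAt_dzb {F : ℂ → ℂ} {z : ℂ} (hF : ContDiffAt ℝ 1 F z) : ContinuousAt (dzb F) z :=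
  ((continuousAt_dx hF).add (continuousAt_const.mul (continuousAt_dy hF))).div_const _

lemma integral_dz_mul {f q : ℂ → ℂ} (hf : ContDiff ℝ 1 f) (hc : HasCompactSupport f)
    (hq : ∀ z ∈ tsupport f, ContDiffAt ℝ 1 q z) :
    ∫ z, dz f z * q z = -∫ z, f z * dz q z ∧ ∫ z, dzb f z * q z = -∫ z, f z * dzb q z := by
  have hK : IsCompact (tsupport f) := hc.isCompact
  have hf0 : ∀ z ∉ tsupport f, f z = 0 := fun z hz => image_eq_zero_of_notMem_tsupport hz
  have hfq0 : ∀ z ∉ tsupport f, f z * q z = 0 := fun z hz => by simp [hf0 z hz]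
  have hfq : ContDiff ℝ 1 (fun z => f z * q z) := contDiff_of_zero_off hK.isClosed hfq0
    (fun z hz => hf.contDiffAt.mul (hq z hz))
  have hfqc := hasCompactSupport_of_zero_off hK hfq0
  have hsub := tsupport_subset_of_zero_off hK.isClosed hfq0
  obtain ⟨h1, h2⟩ := integral_dz_eq_zero hfq hfqc
  have hd : ∀ z ∈ tsupport f, HasW (fun w => f w * q w) (f z * dz q z + dz f z * q z)
      (f z * dzb q z + dzb f z * q z) z := fun z hz =>
    (DifferentiableAt.hasW (differentiableAt_of_contDiffAt hf.contDiffAt le_rfl)).mul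
      (DifferentiableAt.hasW (differentiableAt_of_contDiffAt (hq z hz) le_rfl))
  constructor
  · have e : ∀ z, dz (fun w => f w * q w) z = f z * dz q z + dz f z * q z := by
      intro z
      by_cases hz : z ∈ tsupport f
      · exact (hd z hz).2.1
      · rw [dz_eq_zero_of_notMem (fun h => hz (hsub h)), hf0 z hz, dz_eq_zero_of_notMem hz]; simp
    simp_rw [e] at h1
    rw [integral_add] at h1
    · exact eq_neg_of_add_eq_zero_right h1
    · exact integrable_of_zero_off hK (fun z hz => by simp [hf0 z hz])
        (fun z hz => hf.continuous.continuousAt.mul (continuousAt_dz (hq z hz)))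
    · exact integrable_of_zero_off hK (fun z hz => by simp [dz_eq_zero_of_notMem hz])
        (fun z hz => (continuousAt_dz hf.contDiffAt).mul (hq z hz).continuousAt)
  · have e : ∀ z, dzb (fun w => f w * q w) z = f z * dzb q z + dzb f z * q z := by
      intro z
      by_cases hz : z ∈ tsupport f
      · exact (hd z hz).2.2
      · rw [dzb_eq_zero_of_notMem (fun h => hz (hsub h)), hf0 z hz, dzb_eq_zero_of_notMem hz]; simp
    simp_rw [e] at h2
    rw [integral_add] at h2
    · exact eq_neg_of_add_eq_zero_right h2
    · exact integrable_of_zero_off hK (fun z hz => by simp [hf0 z hz])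
        (fun z hz => hf.continuous.continuousAt.mul (continuousAt_dzb (hq z hz)))
    · exact integrable_of_zero_off hK (fun z hz => by simp [dzb_eq_zero_of_notMem hz])
        (fun z hz => (continuousAt_dzb hf.contDiffAt).mul (hq z hz).continuousAt)

/-- The regularised kernel `Z² / (|Z|² + ε²)`. -/
def ker0 (ε : ℝ) (Z : ℂ) : ℂ := Z ^ 2 / (Z * (starRingEnd ℂ) Z + ε ^ 2)

/-- The first `Z`-derivative of `ker0`. -/
def ker1 (ε : ℝ) (Z : ℂ) : ℂ :=
  (Z ^ 2 * (starRingEnd ℂ) Z + 2 * ε ^ 2 * Z) / (Z * (starRingEnd ℂ) Z + ε ^ 2) ^ 2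

/-- The second `Z`-derivative of `ker0`. -/
def ker2 (ε : ℝ) (Z : ℂ) : ℝ := 2 * ε ^ 4 / (‖Z‖ ^ 2 + ε ^ 2) ^ 3

lemma ker_denom (ε : ℝ) (Z : ℂ) :
    Z * (starRingEnd ℂ) Z + (ε : ℂ) ^ 2 = ((‖Z‖ ^ 2 + ε ^ 2 : ℝ) : ℂ) := by
  rw [Complex.mul_conj, Complex.normSq_eq_norm_sq]; push_cast; ring

lemma ker_denom_ne {ε : ℝ} (hε : 0 < ε) (Z : ℂ) :
    Z * (starRingEnd ℂ) Z + (ε : ℂ) ^ 2 ≠ 0 := by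
  rw [ker_denom]; exact_mod_cast (by positivity : (‖Z‖ ^ 2 + ε ^ 2 : ℝ) ≠ 0)

lemma norm_ker0_le {ε : ℝ} (hε : 0 < ε) (Z : ℂ) : ‖ker0 ε Z‖ ≤ 1 := by
  rw [ker0, ker_denom, norm_div, norm_pow, Complex.norm_real, Real.norm_of_nonneg (by positivity)]
  rw [div_le_one (by positivity)]
  nlinarith [sq_nonneg ε]

lemma HasW.pow_two {F : ℂ → ℂ} {a b z : ℂ} (h : HasW F a b z) :
    HasW (fun w => F w ^ 2) (2 * F z * a) (2 * F z * b) z := by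
  have := h.comp_hasDerivAt (hasDerivAt_pow 2 (F z))
  simpa using this

lemma HasW.div {F G : ℂ → ℂ} {a b c d z : ℂ} (hF : HasW F a b z) (hG : HasW G c d z)
    (h0 : G z ≠ 0) :
    HasW (fun w => F w / G w) ((a * G z - F z * c) / G z ^ 2) ((b * G z - F z * d) / G z ^ 2) z := by
  have h1 := hF.mul (hG.comp_hasDerivAt (hasDerivAt_inv h0))
  simp only [div_eq_mul_inv]
  refine h1.congr_val ?_ ?_ <;> field_simp <;> ring

lemma hasW_id (z : ℂ) : HasW (fun w => w) 1 0 z := (hasDerivAt_id z).hasW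

lemma exists_hasW_ker0 {ε : ℝ} (hε : 0 < ε) (Z : ℂ) : ∃ b, HasW (ker0 ε) (ker1 ε Z) b Z := by
  have hd := ((hasW_id Z).mul (hasW_id Z).conj).add (hasW_const ((ε : ℂ) ^ 2) Z)
  have := (hasW_id Z).pow_two.div hd (ker_denom_ne hε Z)
  refine ⟨_, this.congr_val ?_ rfl⟩
  rw [ker1]; congr 1; simp; ring

lemma exists_hasW_ker1 {ε : ℝ} (hε : 0 < ε) (Z : ℂ) :
    ∃ b, HasW (ker1 ε) (ker2 ε Z : ℂ) b Z := by
  have hd := (((hasW_id Z).mul (hasW_id Z).conj).add (hasW_const ((ε : ℂ) ^ 2) Z)).pow_two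
  have hn := ((hasW_id Z).pow_two.mul (hasW_id Z).conj).add
    ((hasW_const (2 * (ε : ℂ) ^ 2) Z).mul (hasW_id Z))
  have h0 := ker_denom_ne hε Z
  have := hn.div hd (pow_ne_zero 2 h0)
  refine ⟨_, this.congr_val ?_ rfl⟩
  have e : (ker2 ε Z : ℂ) = 2 * (ε : ℂ) ^ 4 / (Z * (starRingEnd ℂ) Z + (ε : ℂ) ^ 2) ^ 3 := by
    rw [ker_denom, ker2]; push_cast; ring
  rw [e]
  simp
  field_simp
  ring

section

lemma integral_radial {b : ℝ} (hb : 0 < b) :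
    Integrable (fun ξ : ℂ => 2 / (b * ‖ξ‖ ^ 2 + 1) ^ 3) ∧
    ∫ ξ : ℂ, 2 / (b * ‖ξ‖ ^ 2 + 1) ^ 3 = π / b := by
  have hd : ∀ x ∈ Set.Ioi (0 : ℝ), HasDerivAt (fun y : ℝ => -(1 / (2 * b)) / (b * y ^ 2 + 1) ^ 2)
      (x * (2 / (b * x ^ 2 + 1) ^ 3)) x := by
    intro x _
    have hp : (b * x ^ 2 + 1) ≠ 0 := by positivity
    have h1 : HasDerivAt (fun y : ℝ => (b * y ^ 2 + 1) ^ 2) (2 * (b * x ^ 2 + 1) * (b * (2 * x))) x := by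
      have := (((hasDerivAt_pow 2 x).const_mul b).add_const 1).fun_pow 2
      simpa using this
    have := (h1.inv (pow_ne_zero 2 hp)).const_mul (-(1 / (2 * b)))
    refine (this.congr_deriv ?_).congr_of_eventuallyEq (Filter.Eventually.of_forall fun y => ?_)
    · field_simp
    · simp [div_eq_mul_inv]
  have hlim : Filter.Tendsto (fun y : ℝ => -(1 / (2 * b)) / (b * y ^ 2 + 1) ^ 2) Filter.atTop
      (nhds 0) := by
    apply Filter.Tendsto.div_atTop tendsto_const_nhds
    apply (Filter.tendsto_pow_atTop (by norm_num)).comp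
    apply Filter.tendsto_atTop_add_const_right
    exact (Filter.tendsto_pow_atTop (by norm_num)).const_mul_atTop hb
  have hcont : ContinuousWithinAt (fun y : ℝ => -(1 / (2 * b)) / (b * y ^ 2 + 1) ^ 2)
      (Set.Ici 0) 0 := by
    apply ContinuousAt.continuousWithinAt
    apply ContinuousAt.div (by fun_prop) (by fun_prop)
    simp
  have hnn : ∀ x ∈ Set.Ioi (0 : ℝ), 0 ≤ x * (2 / (b * x ^ 2 + 1) ^ 3) := by
    intro x hx; have : 0 < x := hx; positivity
  have hInt := integrableOn_Ioi_deriv_of_nonneg hcont hd hnn hlim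
  have hval := integral_Ioi_of_hasDerivAt_of_nonneg hcont hd hnn hlim
  have key := integral_fun_norm_addHaar (volume : Measure ℂ)
    (fun y : ℝ => 2 / (b * y ^ 2 + 1) ^ 3)
  have hI := integrable_fun_norm_addHaar (volume : Measure ℂ)
    (f := fun y : ℝ => 2 / (b * y ^ 2 + 1) ^ 3)
  constructor
  · rw [hI]
    simpa using hInt
  · rw [key]
    simp only [Complex.finrank_real_complex, smul_eq_mul]
    simp only [Nat.add_one_sub_one, pow_one]
    rw [hval]
    simp [Measure.real]
    field_simp

lemma contDiffAt_conj {F : ℂ → ℂ} {z : ℂ} {n : WithTop ℕ∞} (h : ContDiffAt ℝ n F z) :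
    ContDiffAt ℝ n (fun w => (starRingEnd ℂ) (F w)) z :=
  Complex.conjCLE.contDiff.contDiffAt.comp z h

lemma contDiff_ker0 {ε : ℝ} (hε : 0 < ε) : ContDiff ℝ 1 (ker0 ε) := by
  refine contDiff_iff_contDiffAt.2 fun z => ?_
  have h : ContDiffAt ℝ 1 (fun Z : ℂ => Z * (starRingEnd ℂ) Z + (ε : ℂ) ^ 2) z :=
    (contDiffAt_id.mul (contDiffAt_conj contDiffAt_id)).add contDiffAt_const
  have := (contDiffAt_id.pow 2).mul (h.inv (ker_denom_ne hε z))
  exact this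

lemma contDiff_ker1 {ε : ℝ} (hε : 0 < ε) : ContDiff ℝ 1 (ker1 ε) := by
  refine contDiff_iff_contDiffAt.2 fun z => ?_
  have h : ContDiffAt ℝ 1 (fun Z : ℂ => (Z * (starRingEnd ℂ) Z + (ε : ℂ) ^ 2) ^ 2) z :=
    ((contDiffAt_id.mul (contDiffAt_conj contDiffAt_id)).add contDiffAt_const).pow 2
  have h' : ContDiffAt ℝ 1 (fun Z : ℂ => Z ^ 2 * (starRingEnd ℂ) Z + 2 * (ε : ℂ) ^ 2 * Z) z :=
    ((contDiffAt_id.pow 2).mul (contDiffAt_conj contDiffAt_id)).add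
      (contDiffAt_const.mul contDiffAt_id)
  have := h'.mul (h.inv (pow_ne_zero 2 (ker_denom_ne hε z)))
  exact this

lemma continuous_ker2 {ε : ℝ} (hε : 0 < ε) : Continuous (ker2 ε) := by
  unfold ker2
  refine continuous_const.div (by fun_prop) fun z => ?_
  positivity

lemma ker2_nonneg (ε : ℝ) (Z : ℂ) : 0 ≤ ker2 ε Z := by unfold ker2; positivity

section Sobolev

variable {U : Set ℂ} {g : ℂ → ℂ} {f : ℂ → ℝ}

lemma norm_dz_ofReal (hf : ContDiff ℝ 1 f) (z : ℂ) :
    ‖dz (fun w => (f w : ℂ)) z‖ = gnorm f z / 2 := by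
  have h : HasFDerivAt (fun w => (f w : ℂ)) (Complex.ofRealCLM.comp (fderiv ℝ f z)) z :=
    Complex.ofRealCLM.hasFDerivAt.comp z (hf.differentiable (by simp) z).hasFDerivAt
  have : dz (fun w => (f w : ℂ)) z = (((dx f z : ℝ) : ℂ) - Complex.I * ((dy f z : ℝ) : ℂ)) / 2 := by
    simp only [dz, dx, dy, h.fderiv]; simp
  rw [this, norm_div, gnorm]
  congr 1
  · rw [Complex.norm_def, Complex.normSq_apply]; simp; ring_nf
  · simp

lemma contDiff_ofReal {n : WithTop ℕ∞} (hf : ContDiff ℝ n f) :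
    ContDiff ℝ n (fun w => (f w : ℂ)) :=
  Complex.ofRealCLM.contDiff.comp hf

lemma tsupport_ofReal : tsupport (fun w => (f w : ℂ)) = tsupport f := by
  unfold tsupport
  congr 1
  ext z
  simp

variable (hU : IsOpen U) (hg : DifferentiableOn ℂ g U) (hf : ContDiff ℝ 1 f)
  (hc : HasCompactSupport f) (hfU : tsupport f ⊆ U)

include hU hg in
lemma contDiffAt_of_hol {z : ℂ} {n : WithTop ℕ∞} (hz : z ∈ U) : ContDiffAt ℝ n g z :=
  (((hg.analyticOnNhd hU) z hz).contDiffAt (n := n)).restrict_scalars ℝ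

include hU hg hf hc hfU in
lemma integral_ker0 {ε : ℝ} (hε : 0 < ε) (c : ℂ) :
    ∫ z, dz (fun w => (f w : ℂ)) z * (starRingEnd ℂ) (deriv g z) * ker0 ε (g z - c) =
      -∫ z, ((f z * ‖deriv g z‖ ^ 2 : ℝ) : ℂ) * ker1 ε (g z - c) := by
  have hg' : DifferentiableOn ℂ (deriv g) U := hg.deriv hU
  have hq : ∀ z ∈ U, ContDiffAt ℝ 1
      (fun z => (starRingEnd ℂ) (deriv g z) * ker0 ε (g z - c)) z := fun z hz =>
    (contDiffAt_conj (contDiffAt_of_hol hU hg' hz)).mul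
      ((contDiff_ker0 hε).contDiffAt.comp z ((contDiffAt_of_hol hU hg hz).sub contDiffAt_const))
  have := (integral_dz_mul (contDiff_ofReal hf)
    (show HasCompactSupport (fun w => (f w : ℂ)) by
      rw [HasCompactSupport, tsupport_ofReal]; exact hc)
    (fun z hz => hq z (hfU (tsupport_ofReal (f := f) ▸ hz)))).1
  simp_rw [mul_assoc]
  rw [this]
  congr 1
  refine integral_congr_ae (Filter.Eventually.of_forall fun z => ?_)
  simp only
  by_cases hz : z ∈ tsupport f
  · have hzU := hfU hz
    have d1 : HasDerivAt g (deriv g z) z := (hg.differentiableAt (hU.mem_nhds hzU)).hasDerivAt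
    have d2 : HasDerivAt (deriv g) (deriv (deriv g) z) z :=
      (hg'.differentiableAt (hU.mem_nhds hzU)).hasDerivAt
    obtain ⟨b, hb⟩ := exists_hasW_ker0 hε (g z - c)
    have := (d2.hasW.conj).mul (hb.comp_of_hol (G := fun w => g w - c) (d1.sub_const c))
    rw [this.2.1]
    have e : (starRingEnd ℂ) (deriv g z) * (ker1 ε (g z - c) * deriv g z) =
      (‖deriv g z‖ ^ 2 : ℝ) * ker1 ε (g z - c) := by
      rw [← Complex.normSq_eq_norm_sq, Complex.normSq_eq_conj_mul_self]; ring
    rw [e]; push_cast; simp; ring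
  · simp [image_eq_zero_of_notMem_tsupport hz]

include hU hg hf hc hfU in
lemma integral_ker1 {ε : ℝ} (hε : 0 < ε) (a : ℂ) :
    ∫ z, dz (fun w => (f w : ℂ)) z * (starRingEnd ℂ) (deriv g z) * ker1 ε (a - g z) =
      ((∫ z, f z * ‖deriv g z‖ ^ 2 * ker2 ε (a - g z) : ℝ) : ℂ) := by
  have hg' : DifferentiableOn ℂ (deriv g) U := hg.deriv hU
  have hq : ∀ z ∈ U, ContDiffAt ℝ 1
      (fun z => (starRingEnd ℂ) (deriv g z) * ker1 ε (a - g z)) z := fun z hz =>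
    (contDiffAt_conj (contDiffAt_of_hol hU hg' hz)).mul
      ((contDiff_ker1 hε).contDiffAt.comp z (contDiffAt_const.sub (contDiffAt_of_hol hU hg hz)))
  have := (integral_dz_mul (contDiff_ofReal hf)
    (show HasCompactSupport (fun w => (f w : ℂ)) by
      rw [HasCompactSupport, tsupport_ofReal]; exact hc)
    (fun z hz => hq z (hfU (tsupport_ofReal (f := f) ▸ hz)))).1
  simp_rw [mul_assoc]
  rw [this, ← integral_neg, ← integral_complex_ofReal]
  refine integral_congr_ae (Filter.Eventually.of_forall fun z => ?_)
  simp only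
  by_cases hz : z ∈ tsupport f
  · have hzU := hfU hz
    have d1 : HasDerivAt g (deriv g z) z := (hg.differentiableAt (hU.mem_nhds hzU)).hasDerivAt
    have d2 : HasDerivAt (deriv g) (deriv (deriv g) z) z :=
      (hg'.differentiableAt (hU.mem_nhds hzU)).hasDerivAt
    obtain ⟨b, hb⟩ := exists_hasW_ker1 hε (a - g z)
    have := (d2.hasW.conj).mul (hb.comp_of_hol (G := fun w => a - g w) (d1.const_sub a))
    rw [this.2.1]
    have e : (starRingEnd ℂ) (deriv g z) * (ker2 ε (a - g z) * -deriv g z) =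
      -((‖deriv g z‖ ^ 2 : ℝ) * ker2 ε (a - g z)) := by
      rw [← Complex.normSq_eq_norm_sq, Complex.normSq_eq_conj_mul_self]; ring
    rw [e]; push_cast; simp
  · simp [image_eq_zero_of_notMem_tsupport hz]

include hU hg hf hc hfU in
lemma double_integral_ker2_le (hf0 : ∀ z, 0 ≤ f z) {ε : ℝ} (hε : 0 < ε) :
    ∫ z, f z * ‖deriv g z‖ ^ 2 * ∫ ζ, f ζ * ‖deriv g ζ‖ ^ 2 * ker2 ε (g z - g ζ) ≤
      ((∫ z, gnorm f z * ‖deriv g z‖) / 2) ^ 2 := by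
  have hg' : DifferentiableOn ℂ (deriv g) U := hg.deriv hU
  have hK : IsCompact (tsupport f) := hc.isCompact
  set P : ℂ → ℂ := fun z => dz (fun w => (f w : ℂ)) z * (starRingEnd ℂ) (deriv g z) with hP
  set W : ℂ → ℝ := fun z => f z * ‖deriv g z‖ ^ 2 with hW
  have hP0 : ∀ z ∉ tsupport f, P z = 0 := fun z hz => by
    simp only [hP]
    rw [dz_eq_zero_of_notMem (by rwa [tsupport_ofReal])]; simp
  have hW0 : ∀ z ∉ tsupport f, W z = 0 := fun z hz => by
    simp [hW, image_eq_zero_of_notMem_tsupport hz]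
  have cg : ∀ z ∈ tsupport f, ContinuousAt g z := fun z hz =>
    (hg.differentiableAt (hU.mem_nhds (hfU hz))).continuousAt
  have cg' : ∀ z ∈ tsupport f, ContinuousAt (deriv g) z := fun z hz =>
    (hg'.differentiableAt (hU.mem_nhds (hfU hz))).continuousAt
  have cP : ∀ z ∈ tsupport f, ContinuousAt P z := fun z hz =>
    (continuousAt_dz (contDiff_ofReal hf).contDiffAt).mul
      (Complex.continuous_conj.continuousAt.comp (cg' z hz))
  have cW : ∀ z ∈ tsupport f, ContinuousAt W z := fun z hz =>
    hf.continuous.continuousAt.mul ((cg' z hz).norm.pow 2)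
  have hPn : ∀ z, ‖P z‖ = gnorm f z * ‖deriv g z‖ / 2 := fun z => by
    simp only [hP]
    rw [norm_mul, norm_dz_ofReal hf, RCLike.norm_conj]; ring
  have iP : Integrable P := integrable_of_zero_off hK hP0 cP
  -- the double integral as an iterated integral of the regularised kernel
  have key : ∫ ζ, P ζ * ∫ z, P z * ker0 ε (g z - g ζ) =
      -((∫ z, W z * ∫ ζ, W ζ * ker2 ε (g z - g ζ) : ℝ) : ℂ) := by
    have e1 : ∀ ζ, ∫ z, P z * ker0 ε (g z - g ζ) = -∫ z, (W z : ℂ) * ker1 ε (g z - g ζ) :=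
      fun ζ => integral_ker0 hU hg hf hc hfU hε (g ζ)
    have e2 : ∀ z, ∫ ζ, P ζ * ker1 ε (g z - g ζ) =
        ((∫ ζ, W ζ * ker2 ε (g z - g ζ) : ℝ) : ℂ) :=
      fun z => integral_ker1 hU hg hf hc hfU hε (g z)
    simp_rw [e1, mul_neg, integral_neg]
    congr 1
    rw [← integral_complex_ofReal]
    push_cast
    simp_rw [← e2]
    simp_rw [← integral_const_mul]
    rw [integral_integral_swap]
    · congr 1; ext z; congr 1; ext ζ; ring
    · refine integrable_of_zero_off_prod hK hK ?_ ?_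
      · rintro ⟨ζ, z⟩ h
        simp only [Function.uncurry, Set.mem_prod, not_and_or] at h ⊢
        rcases h with h | h
        · simp [hP0 ζ h]
        · simp [hW0 z h]
      · rintro ⟨ζ, z⟩ ⟨h1, h2⟩
        have a1 : ContinuousAt (fun x : ℂ × ℂ => P x.1) (ζ, z) :=
          ContinuousAt.comp_of_eq (cP ζ h1) continuousAt_fst rfl
        have a2 : ContinuousAt (fun x : ℂ × ℂ => W x.2) (ζ, z) :=
          ContinuousAt.comp_of_eq (cW z h2) continuousAt_snd rfl
        have a3 : ContinuousAt (fun x : ℂ × ℂ => g x.1) (ζ, z) :=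
          ContinuousAt.comp_of_eq (cg ζ h1) continuousAt_fst rfl
        have a4 : ContinuousAt (fun x : ℂ × ℂ => g x.2) (ζ, z) :=
          ContinuousAt.comp_of_eq (cg z h2) continuousAt_snd rfl
        exact a1.mul ((Complex.continuous_ofReal.continuousAt.comp a2).mul
          ((contDiff_ker1 hε).continuous.continuousAt.comp (a4.sub a3)))
  have hJ : 0 ≤ ∫ z, W z * ∫ ζ, W ζ * ker2 ε (g z - g ζ) := by
    have hWn : ∀ z, 0 ≤ W z := fun z => mul_nonneg (hf0 z) (sq_nonneg _)
    exact integral_nonneg fun z => mul_nonneg (hWn z) (integral_nonneg fun ζ =>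
      mul_nonneg (hWn ζ) (ker2_nonneg _ _))
  have hb : ‖∫ ζ, P ζ * ∫ z, P z * ker0 ε (g z - g ζ)‖ ≤ (∫ z, ‖P z‖) ^ 2 := by
    have hin : ∀ ζ, ‖∫ z, P z * ker0 ε (g z - g ζ)‖ ≤ ∫ z, ‖P z‖ := fun ζ => by
      refine norm_integral_le_of_norm_le iP.norm (Filter.Eventually.of_forall fun z => ?_)
      rw [norm_mul]
      exact mul_le_of_le_one_right (norm_nonneg _) (norm_ker0_le hε _)
    calc _ ≤ ∫ ζ, ‖P ζ‖ * ∫ z, ‖P z‖ := by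
          refine norm_integral_le_of_norm_le (iP.norm.mul_const _)
            (Filter.Eventually.of_forall fun ζ => ?_)
          rw [norm_mul]
          exact mul_le_mul_of_nonneg_left (hin ζ) (norm_nonneg _)
      _ = _ := by rw [integral_mul_const]; ring
  rw [key, norm_neg, Complex.norm_real, Real.norm_of_nonneg hJ] at hb
  refine hb.trans (le_of_eq ?_)
  simp_rw [hPn, integral_div]

include hU hg hf hc hfU in
lemma sobolev_of_measurable (hf0 : ∀ z, 0 ≤ f z) (hgm : Measurable g) :
    4 * π * ∫ z, f z ^ 2 * ‖deriv g z‖ ^ 2 ≤ (∫ z, gnorm f z * ‖deriv g z‖) ^ 2 := by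
  have hg' : DifferentiableOn ℂ (deriv g) U := hg.deriv hU
  have hK : IsCompact (tsupport f) := hc.isCompact
  set W : ℂ → ℝ := fun z => f z * ‖deriv g z‖ ^ 2 with hW
  set A := ∫ z, gnorm f z * ‖deriv g z‖ with hA
  have hWn : ∀ z, 0 ≤ W z := fun z => mul_nonneg (hf0 z) (sq_nonneg _)
  have hW0 : ∀ z ∉ tsupport f, W z = 0 := fun z hz => by
    simp [hW, image_eq_zero_of_notMem_tsupport hz]
  have cg : ∀ z ∈ tsupport f, ContinuousAt g z := fun z hz =>
    (hg.differentiableAt (hU.mem_nhds (hfU hz))).continuousAt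
  have cg' : ∀ z ∈ tsupport f, ContinuousAt (deriv g) z := fun z hz =>
    (hg'.differentiableAt (hU.mem_nhds (hfU hz))).continuousAt
  have cW : ∀ z ∈ tsupport f, ContinuousAt W z := fun z hz =>
    hf.continuous.continuousAt.mul ((cg' z hz).norm.pow 2)
  have cWg : Continuous W := continuous_of_zero_off hK.isClosed hW0 cW
  set e : ℕ → ℝ := fun n => 1 / ((n : ℝ) + 1) with he
  have he0 : ∀ n, 0 < e n := fun n => by simp only [he]; positivity
  have helim : Filter.Tendsto e Filter.atTop (nhds 0) := tendsto_one_div_add_atTop_nhds_zero_nat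
  set R : ℕ → ℂ → ℂ → ℝ := fun n z ξ =>
    W (z + (e n) • ξ) * (2 / ((‖g z - g (z + (e n) • ξ)‖ / e n) ^ 2 + 1) ^ 3) with hR
  have hRn : ∀ n z ξ, 0 ≤ R n z ξ := fun n z ξ => mul_nonneg (hWn _) (by positivity)
  have inner : ∀ n z, Integrable (R n z) ∧
      ∫ ξ, R n z ξ = ∫ ζ, W ζ * ker2 (e n) (g z - g ζ) := by
    intro n z
    set H : ℂ → ℝ := fun ζ => W ζ * ker2 (e n) (g z - g ζ) with hH
    have hHi : Integrable H := by
      refine integrable_of_zero_off hK (fun ζ hζ => by simp [hH, hW0 ζ hζ]) fun ζ hζ => ?_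
      exact (cW ζ hζ).mul ((continuous_ker2 (he0 n)).continuousAt.comp_of_eq
        (continuousAt_const.sub (cg ζ hζ)) rfl)
    have hRH : R n z = fun ξ => (e n) ^ 2 * H (z + (e n) • ξ) := by
      ext ξ
      have := he0 n
      simp only [hR, hH, ker2]
      field_simp
    constructor
    · rw [hRH]
      exact ((hHi.comp_add_left z).comp_smul (he0 n).ne').const_mul _
    · rw [hRH, integral_const_mul, Measure.integral_comp_smul (volume : Measure ℂ)
        (fun ξ => H (z + ξ)) (e n), integral_add_left_eq_self H z]
      simp only [Complex.finrank_real_complex, smul_eq_mul]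
      rw [abs_of_pos (by have := he0 n; positivity), ← mul_assoc, mul_inv_cancel₀, one_mul]
      exact pow_ne_zero 2 (he0 n).ne'
  have Rmeas : ∀ n, Measurable (fun q : ℂ × ℂ => ENNReal.ofReal (W q.1 * R n q.1 q.2)) := by
    intro n
    have := cWg.measurable
    simp only [hR]
    fun_prop
  have bound : ∀ n, ∫⁻ z, ∫⁻ ξ, ENNReal.ofReal (W z * R n z ξ) ≤ ENNReal.ofReal ((A / 2) ^ 2) := by
    intro n
    have h1 : ∀ z, ∫⁻ ξ, ENNReal.ofReal (W z * R n z ξ) =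
        ENNReal.ofReal (W z * ∫ ζ, W ζ * ker2 (e n) (g z - g ζ)) := by
      intro z
      rw [← ofReal_integral_eq_lintegral_ofReal ((inner n z).1.const_mul _)
        (Filter.Eventually.of_forall fun ξ => mul_nonneg (hWn z) (hRn n z ξ)),
        integral_const_mul, (inner n z).2]
    simp_rw [h1]
    rw [← ofReal_integral_eq_lintegral_ofReal]
    · exact ENNReal.ofReal_le_ofReal (double_integral_ker2_le hU hg hf hc hfU hf0 (he0 n))
    · have : Integrable (fun q : ℂ × ℂ => W q.1 * (W q.2 * ker2 (e n) (g q.1 - g q.2)))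
          (volume.prod volume) := by
        refine integrable_of_zero_off_prod hK hK ?_ ?_
        · rintro ⟨z, ζ⟩ h
          simp only [Set.mem_prod, not_and_or] at h ⊢
          rcases h with h | h
          · simp [hW0 z h]
          · simp [hW0 ζ h]
        · rintro ⟨z, ζ⟩ ⟨h1, h2⟩
          have a1 : ContinuousAt (fun x : ℂ × ℂ => W x.1) (z, ζ) :=
            ContinuousAt.comp_of_eq (cW z h1) continuousAt_fst rfl
          have a2 : ContinuousAt (fun x : ℂ × ℂ => W x.2) (z, ζ) :=
            ContinuousAt.comp_of_eq (cW ζ h2) continuousAt_snd rfl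
          have a3 : ContinuousAt (fun x : ℂ × ℂ => g x.1) (z, ζ) :=
            ContinuousAt.comp_of_eq (cg z h1) continuousAt_fst rfl
          have a4 : ContinuousAt (fun x : ℂ × ℂ => g x.2) (z, ζ) :=
            ContinuousAt.comp_of_eq (cg ζ h2) continuousAt_snd rfl
          exact a1.mul (a2.mul ((continuous_ker2 (he0 n)).continuousAt.comp (a3.sub a4)))
      refine this.integral_prod_left.congr (Filter.Eventually.of_forall fun z => ?_)
      simp only [integral_const_mul]
    · exact Filter.Eventually.of_forall fun z => mul_nonneg (hWn z) (integral_nonneg fun ζ =>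
        mul_nonneg (hWn ζ) (ker2_nonneg _ _))
  have lim : ∀ z ξ, Filter.Tendsto (fun n => ENNReal.ofReal (W z * R n z ξ)) Filter.atTop
      (nhds (ENNReal.ofReal (W z * (W z * (2 / (‖deriv g z‖ ^ 2 * ‖ξ‖ ^ 2 + 1) ^ 3))))) := by
    intro z ξ
    by_cases hz : z ∈ tsupport f
    · refine ENNReal.tendsto_ofReal (Filter.Tendsto.const_mul _ ?_)
      have t1 : Filter.Tendsto (fun n => z + (e n) • ξ) Filter.atTop (nhds z) := by
        have := (helim.smul_const ξ).const_add z
        simpa using this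
      have t2 := (cWg.tendsto z).comp t1
      have d1 : HasDerivAt g (deriv g z) z :=
        (hg.differentiableAt (hU.mem_nhds (hfU hz))).hasDerivAt
      have d2 : HasDerivAt (fun t : ℝ => g (z + t • ξ)) (deriv g z * ξ) 0 := by
        have hl : HasDerivAt (fun t : ℝ => z + t • ξ) ξ 0 := by
          simpa using ((hasDerivAt_id (0 : ℝ)).smul_const ξ).const_add z
        exact HasDerivAt.comp_of_eq (h₂ := g) (0 : ℝ) d1 hl (by simp)
      have t3 := d2.tendsto_slope_zero
      simp only [zero_add, zero_smul, add_zero] at t3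
      have te : Filter.Tendsto e Filter.atTop (nhdsWithin 0 {0}ᶜ) :=
        tendsto_nhdsWithin_iff.2 ⟨helim, Filter.Eventually.of_forall fun n => (he0 n).ne'⟩
      have t4 := (t3.comp te).norm
      have t5 : Filter.Tendsto (fun n => (‖g z - g (z + (e n) • ξ)‖ / e n)) Filter.atTop
          (nhds (‖deriv g z‖ * ‖ξ‖)) := by
        rw [← norm_mul]
        refine t4.congr fun n => ?_
        simp only [Function.comp]
        rw [norm_smul, norm_inv, Real.norm_of_nonneg (he0 n).le, norm_sub_rev]
        ring
      have t6 : Filter.Tendsto (fun n => 2 / ((‖g z - g (z + (e n) • ξ)‖ / e n) ^ 2 + 1) ^ 3)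
          Filter.atTop (nhds (2 / (‖deriv g z‖ ^ 2 * ‖ξ‖ ^ 2 + 1) ^ 3)) := by
        rw [← mul_pow]
        exact tendsto_const_nhds.div (((t5.pow 2).add_const 1).pow 3) (by positivity)
      exact t2.mul t6
    · simp [hW0 z hz]
  have fatou : ∫⁻ z, ∫⁻ ξ : ℂ, ENNReal.ofReal
      (W z * (W z * (2 / (‖deriv g z‖ ^ 2 * ‖ξ‖ ^ 2 + 1) ^ 3))) ≤
      ENNReal.ofReal ((A / 2) ^ 2) := by
    calc _ = ∫⁻ z, ∫⁻ ξ, Filter.liminf (fun n => ENNReal.ofReal (W z * R n z ξ)) Filter.atTop := by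
          simp_rw [fun z ξ => (lim z ξ).liminf_eq]
      _ ≤ ∫⁻ z, Filter.liminf (fun n => ∫⁻ ξ, ENNReal.ofReal (W z * R n z ξ)) Filter.atTop :=
          lintegral_mono fun z => lintegral_liminf_le fun n =>
            (Rmeas n).comp measurable_prodMk_left
      _ ≤ Filter.liminf (fun n => ∫⁻ z, ∫⁻ ξ, ENNReal.ofReal (W z * R n z ξ)) Filter.atTop :=
          lintegral_liminf_le fun n => (Rmeas n).lintegral_prod_right'
      _ ≤ _ := by
          refine Filter.liminf_le_of_frequently_le' (Filter.Frequently.of_forall bound)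
  have val : ∀ z, ∫⁻ ξ : ℂ, ENNReal.ofReal
      (W z * (W z * (2 / (‖deriv g z‖ ^ 2 * ‖ξ‖ ^ 2 + 1) ^ 3))) =
      ENNReal.ofReal (π * (f z ^ 2 * ‖deriv g z‖ ^ 2)) := by
    intro z
    rcases eq_or_ne (deriv g z) 0 with h0 | h0
    · simp [hW, h0]
    · have hb : 0 < ‖deriv g z‖ ^ 2 := by positivity
      obtain ⟨i1, i2⟩ := integral_radial hb
      rw [← ofReal_integral_eq_lintegral_ofReal ((i1.const_mul _).const_mul _)
        (Filter.Eventually.of_forall fun ξ => mul_nonneg (hWn z) (mul_nonneg (hWn z)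
          (by positivity))), integral_const_mul, integral_const_mul, i2]
      congr 1
      simp only [hW]
      field_simp
  simp_rw [val] at fatou
  have hfi : Integrable (fun z => f z ^ 2 * ‖deriv g z‖ ^ 2) := by
    refine integrable_of_zero_off hK (fun z hz => by
      simp [image_eq_zero_of_notMem_tsupport hz]) fun z hz => ?_
    exact (hf.continuous.continuousAt.pow 2).mul ((cg' z hz).norm.pow 2)
  rw [← ofReal_integral_eq_lintegral_ofReal (hfi.const_mul _)
    (Filter.Eventually.of_forall fun z => by positivity), integral_const_mul,
    ENNReal.ofReal_le_ofReal_iff (sq_nonneg _)] at fatou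
  linarith

include hU hg hf hc hfU in
/-- The isoperimetric Sobolev inequality `4π ∫ f²|g'|² ≤ (∫ |∇f||g'|)²`. -/
lemma sobolev (hf0 : ∀ z, 0 ≤ f z) :
    4 * π * ∫ z, f z ^ 2 * ‖deriv g z‖ ^ 2 ≤ (∫ z, gnorm f z * ‖deriv g z‖) ^ 2 := by
  classical
  set G : ℂ → ℂ := U.piecewise g 0 with hG
  have hGm : Measurable G := ContinuousOn.measurable_piecewise hg.continuousOn
    continuousOn_const hU.measurableSet
  have hd : ∀ z ∈ U, deriv G z = deriv g z := fun z hz =>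
    Filter.EventuallyEq.deriv_eq (Filter.eventuallyEq_of_mem (hU.mem_nhds hz)
      fun w hw => Set.piecewise_eq_of_mem _ _ _ hw)
  have hGd : DifferentiableOn ℂ G U := hg.congr fun w hw => Set.piecewise_eq_of_mem _ _ _ hw
  have := sobolev_of_measurable hU hGd hf hc hfU hf0 hGm
  have e1 : ∀ z, f z ^ 2 * ‖deriv G z‖ ^ 2 = f z ^ 2 * ‖deriv g z‖ ^ 2 := fun z => by
    by_cases hz : z ∈ tsupport f
    · rw [hd z (hfU hz)]
    · simp [image_eq_zero_of_notMem_tsupport hz]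
  have e2 : ∀ z, gnorm f z * ‖deriv G z‖ = gnorm f z * ‖deriv g z‖ := fun z => by
    by_cases hz : z ∈ tsupport f
    · rw [hd z (hfU hz)]
    · simp [gnorm, dx_eq_zero_of_notMem hz, dy_eq_zero_of_notMem hz]
  simpa only [e1, e2] using this

end Sobolev

end

lemma integral_radial_two :
    Integrable (fun ξ : ℂ => 1 / (‖ξ‖ ^ 2 + 1) ^ 2) ∧
    ∫ ξ : ℂ, 1 / (‖ξ‖ ^ 2 + 1) ^ 2 = π := by
  have hd : ∀ x ∈ Set.Ioi (0 : ℝ), HasDerivAt (fun y : ℝ => -(1 / 2) / (y ^ 2 + 1))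
      (x * (1 / (x ^ 2 + 1) ^ 2)) x := by
    intro x _
    have hp : (x ^ 2 + 1) ≠ 0 := by positivity
    have h1 : HasDerivAt (fun y : ℝ => y ^ 2 + 1) (2 * x) x := by
      simpa using (hasDerivAt_pow 2 x).add_const 1
    have := (h1.inv hp).const_mul (-(1 / 2))
    refine (this.congr_deriv ?_).congr_of_eventuallyEq (Filter.Eventually.of_forall fun y => ?_)
    · field_simp
    · simp [div_eq_mul_inv]
  have hlim : Filter.Tendsto (fun y : ℝ => -(1 / 2) / (y ^ 2 + 1)) Filter.atTop (nhds 0) := by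
    apply Filter.Tendsto.div_atTop tendsto_const_nhds
    apply Filter.tendsto_atTop_add_const_right
    exact Filter.tendsto_pow_atTop (by norm_num)
  have hcont : ContinuousWithinAt (fun y : ℝ => -(1 / 2) / (y ^ 2 + 1)) (Set.Ici 0) 0 := by
    apply ContinuousAt.continuousWithinAt
    apply ContinuousAt.div (by fun_prop) (by fun_prop)
    simp
  have hnn : ∀ x ∈ Set.Ioi (0 : ℝ), 0 ≤ x * (1 / (x ^ 2 + 1) ^ 2) := by
    intro x hx; have : 0 < x := hx; positivity
  have hInt := integrableOn_Ioi_deriv_of_nonneg hcont hd hnn hlim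
  have hval := integral_Ioi_of_hasDerivAt_of_nonneg hcont hd hnn hlim
  have key := integral_fun_norm_addHaar (volume : Measure ℂ) (fun y : ℝ => 1 / (y ^ 2 + 1) ^ 2)
  have hI := integrable_fun_norm_addHaar (volume : Measure ℂ)
    (f := fun y : ℝ => 1 / (y ^ 2 + 1) ^ 2)
  constructor
  · rw [hI]
    simpa using hInt
  · rw [key]
    simp only [Complex.finrank_real_complex, smul_eq_mul]
    simp only [Nat.add_one_sub_one, pow_one]
    rw [hval]
    simp [Measure.real]
    ring

lemma integral_inv_norm_aux {R : ℝ} (hR : 0 ≤ R) :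
    Integrable (fun z : ℂ => (Set.Iio R).indicator (fun r : ℝ => r⁻¹) ‖z‖) ∧
      ∫ z : ℂ, (Set.Iio R).indicator (fun r : ℝ => r⁻¹) ‖z‖ = 2 * π * R := by
  have e : ∀ y ∈ Set.Ioi (0 : ℝ), y * (Set.Iio R).indicator (fun r : ℝ => r⁻¹) y =
      (Set.Iio R).indicator (fun _ => (1 : ℝ)) y := by
    intro y hy
    by_cases h : y ∈ Set.Iio R
    · simp only [Set.indicator_of_mem h]; exact mul_inv_cancel₀ (ne_of_gt hy)
    · simp [Set.indicator_of_notMem h]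
  constructor
  · rw [integrable_fun_norm_addHaar (volume : Measure ℂ)]
    simp only [Complex.finrank_real_complex, smul_eq_mul]
    simp only [Nat.add_one_sub_one, pow_one]
    refine IntegrableOn.congr_fun ?_ (fun y hy => (e y hy).symm) measurableSet_Ioi
    refine (integrable_indicator_iff measurableSet_Iio).2 (integrableOn_const ?_)
    rw [Measure.restrict_apply measurableSet_Iio, Set.inter_comm, Set.Ioi_inter_Iio]
    simp
  · rw [integral_fun_norm_addHaar (volume : Measure ℂ)]
    simp only [Complex.finrank_real_complex, smul_eq_mul]
    simp only [Nat.add_one_sub_one, pow_one]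
    rw [setIntegral_congr_fun measurableSet_Ioi e, setIntegral_indicator measurableSet_Iio]
    simp [Measure.real, Set.Ioi_inter_Iio, hR]
    ring

lemma integrableOn_inv_norm (w : ℂ) {R : ℝ} (hR : 0 ≤ R) :
    IntegrableOn (fun z : ℂ => ‖z - w‖⁻¹) (Metric.ball w R) ∧
      ∫ z in Metric.ball w R, ‖z - w‖⁻¹ = 2 * π * R := by
  obtain ⟨h1, h2⟩ := integral_inv_norm_aux hR
  have e : (fun z : ℂ => (Set.Iio R).indicator (fun r : ℝ => r⁻¹) ‖z - w‖) =
      (Metric.ball w R).indicator (fun z => ‖z - w‖⁻¹) := by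
    ext z
    by_cases hz : z ∈ Metric.ball w R
    · rw [Set.indicator_of_mem hz, Set.indicator_of_mem]
      simpa [dist_eq_norm] using hz
    · rw [Set.indicator_of_notMem hz, Set.indicator_of_notMem]
      simpa [dist_eq_norm] using hz
  have h1' := h1.comp_sub_right w
  have h2' := integral_sub_right_eq_self
    (fun z : ℂ => (Set.Iio R).indicator (fun r : ℝ => r⁻¹) ‖z‖) w (μ := volume)
  rw [e] at h1' h2'
  rw [integrable_indicator_iff Metric.isOpen_ball.measurableSet] at h1'
  rw [integral_indicator Metric.isOpen_ball.measurableSet, h2] at h2'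
  exact ⟨h1', h2'⟩

lemma integrable_mul_inv_norm {f : ℂ → ℝ} (hf : Continuous f) (hc : HasCompactSupport f) (w : ℂ) :
    Integrable (fun z => f z * ‖z - w‖⁻¹) := by
  obtain ⟨C, hC⟩ := hf.bounded_above_of_compact_support hc
  obtain ⟨R, hR0, hR⟩ := hc.isCompact.isBounded.subset_ball_lt 0 w
  have h := (integrableOn_inv_norm w hR0.le).1
  have e : (fun z => f z * ‖z - w‖⁻¹) =
      (Metric.ball w R).indicator (fun z => f z * ‖z - w‖⁻¹) := by
    ext z
    by_cases hz : z ∈ Metric.ball w R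
    · rw [Set.indicator_of_mem hz]
    · rw [Set.indicator_of_notMem hz, image_eq_zero_of_notMem_tsupport fun h => hz (hR h), zero_mul]
  rw [e, integrable_indicator_iff Metric.isOpen_ball.measurableSet]
  exact h.bdd_mul hf.aestronglyMeasurable (Filter.Eventually.of_forall hC)

/-- A regularisation of the Cauchy kernel `1/Z`. -/
def kerN (ε : ℝ) (Z : ℂ) : ℂ := (starRingEnd ℂ) Z / (Z * (starRingEnd ℂ) Z + ε ^ 2)

lemma exists_hasW_kerN {ε : ℝ} (hε : 0 < ε) (Z : ℂ) :
    ∃ a, HasW (kerN ε) a ((ε ^ 2 / (‖Z‖ ^ 2 + ε ^ 2) ^ 2 : ℝ) : ℂ) Z := by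
  have hd := ((hasW_id Z).mul (hasW_id Z).conj).add (hasW_const ((ε : ℂ) ^ 2) Z)
  have := (hasW_id Z).conj.div hd (ker_denom_ne hε Z)
  refine ⟨_, this.congr_val rfl ?_⟩
  rw [ker_denom]
  have e := ker_denom ε Z
  push_cast at e ⊢
  rw [← e]
  simp
  ring

lemma contDiff_kerN {ε : ℝ} (hε : 0 < ε) : ContDiff ℝ 1 (kerN ε) := by
  refine contDiff_iff_contDiffAt.2 fun z => ?_
  have h : ContDiffAt ℝ 1 (fun Z : ℂ => Z * (starRingEnd ℂ) Z + (ε : ℂ) ^ 2) z :=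
    (contDiffAt_id.mul (contDiffAt_conj contDiffAt_id)).add contDiffAt_const
  have := (contDiffAt_conj contDiffAt_id).mul (h.inv (ker_denom_ne hε z))
  exact this

lemma norm_kerN_le {ε : ℝ} (hε : 0 < ε) (Z : ℂ) : ‖kerN ε Z‖ ≤ ‖Z‖⁻¹ := by
  rw [kerN, ker_denom, norm_div, RCLike.norm_conj, Complex.norm_real,
    Real.norm_of_nonneg (by positivity)]
  rcases eq_or_ne Z 0 with rfl | h
  · simp
  · have : 0 < ‖Z‖ := norm_pos_iff.2 h
    rw [div_le_iff₀ (by positivity), mul_add]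
    have : ‖Z‖⁻¹ * ‖Z‖ ^ 2 = ‖Z‖ := by field_simp
    rw [this]
    have : 0 ≤ ‖Z‖⁻¹ * ε ^ 2 := by positivity
    linarith

/-- The Cauchy–Pompeiu formula. -/
lemma cauchy_pompeiu {F : ℂ → ℂ} (hF : ContDiff ℝ 1 F) (hc : HasCompactSupport F) (w : ℂ) :
    ∫ z, dzb F z / (z - w) = -(π * F w) := by
  set e : ℕ → ℝ := fun n => 1 / ((n : ℝ) + 1) with he
  have he0 : ∀ n, 0 < e n := fun n => by simp only [he]; positivity
  have helim : Filter.Tendsto e Filter.atTop (nhds 0) := tendsto_one_div_add_atTop_nhds_zero_nat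
  have cd : Continuous (dzb F) :=
    continuous_iff_continuousAt.2 fun z => continuousAt_dzb hF.contDiffAt
  have sd : HasCompactSupport (dzb F) :=
    hasCompactSupport_of_zero_off hc.isCompact fun z hz => dzb_eq_zero_of_notMem hz
  have ibp : ∀ n, ∫ z, dzb F z * kerN (e n) (z - w) =
      -∫ ξ : ℂ, F (w + (e n) • ξ) * ((1 / (‖ξ‖ ^ 2 + 1) ^ 2 : ℝ) : ℂ) := by
    intro n
    have hq : ContDiff ℝ 1 (fun z => kerN (e n) (z - w)) :=
      (contDiff_kerN (he0 n)).comp (contDiff_id.sub contDiff_const)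
    rw [(integral_dz_mul hF hc fun z _ => hq.contDiffAt).2]
    congr 1
    set H : ℂ → ℂ := fun z => F z * (((e n) ^ 2 / (‖z - w‖ ^ 2 + (e n) ^ 2) ^ 2 : ℝ) : ℂ) with hH
    have h1 : ∀ z, F z * dzb (fun z => kerN (e n) (z - w)) z = H z := by
      intro z
      obtain ⟨a, ha⟩ := exists_hasW_kerN (he0 n) (z - w)
      have := (ha.comp_of_hol (G := fun z => z - w) ((hasDerivAt_id z).sub_const w)).2.2
      rw [this]; simp [hH]
    have h2 : ∀ ξ : ℂ, F (w + (e n) • ξ) * ((1 / (‖ξ‖ ^ 2 + 1) ^ 2 : ℝ) : ℂ) =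
        ((e n) ^ 2 : ℝ) • H (w + (e n) • ξ) := by
      intro ξ
      simp only [hH, add_sub_cancel_left,
        Complex.real_smul]
      rw [← mul_assoc, mul_comm _ (F _), mul_assoc, ← Complex.ofReal_mul]
      congr 2
      have := he0 n
      rw [← Complex.real_smul, norm_smul, Real.norm_of_nonneg this.le]
      field_simp
    simp_rw [h1, h2]
    rw [integral_smul, Measure.integral_comp_smul (volume : Measure ℂ)
        (fun ξ => H (w + ξ)) (e n), integral_add_left_eq_self H w, smul_smul]
    simp only [Complex.finrank_real_complex]
    rw [abs_of_pos (by have := he0 n; positivity), mul_inv_cancel₀, one_smul]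
    exact pow_ne_zero 2 (he0 n).ne'
  have l1 : Filter.Tendsto (fun n => ∫ z, dzb F z * kerN (e n) (z - w)) Filter.atTop
      (nhds (∫ z, dzb F z / (z - w))) := by
    refine tendsto_integral_of_dominated_convergence (fun z => ‖dzb F z‖ * ‖z - w‖⁻¹) ?_
      (integrable_mul_inv_norm cd.norm sd.norm w) ?_ ?_
    · intro n
      exact (cd.mul ((contDiff_kerN (he0 n)).continuous.comp
        (continuous_id.sub continuous_const))).aestronglyMeasurable
    · intro n
      refine Filter.Eventually.of_forall fun z => ?_
      rw [norm_mul]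
      exact mul_le_mul_of_nonneg_left (norm_kerN_le (he0 n) _) (norm_nonneg _)
    · have hne : ∀ᵐ z : ℂ, z ≠ w := by
        simp [ae_iff, measure_singleton]
      filter_upwards [hne] with z hz
      have hz' : z - w ≠ 0 := sub_ne_zero.2 hz
      rw [div_eq_mul_inv]
      refine Filter.Tendsto.const_mul _ ?_
      have hc' : (starRingEnd ℂ) (z - w) ≠ 0 := (map_ne_zero _).2 hz'
      have hv : (starRingEnd ℂ) (z - w) / ((z - w) * (starRingEnd ℂ) (z - w) +
          ((0 : ℝ) : ℂ) ^ 2) = (z - w)⁻¹ := by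
        rw [Complex.ofReal_zero, zero_pow two_ne_zero, add_zero, div_mul_cancel_right₀ hc']
      rw [← hv]
      refine tendsto_const_nhds.div (tendsto_const_nhds.add
        (((Complex.continuous_ofReal.tendsto 0).comp helim).pow 2)) ?_
      rw [Complex.ofReal_zero, zero_pow two_ne_zero, add_zero]
      exact mul_ne_zero hz' hc'
  have l2 : Filter.Tendsto (fun n => ∫ ξ : ℂ, F (w + (e n) • ξ) *
      ((1 / (‖ξ‖ ^ 2 + 1) ^ 2 : ℝ) : ℂ)) Filter.atTop (nhds (∫ ξ : ℂ, F w *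
      ((1 / (‖ξ‖ ^ 2 + 1) ^ 2 : ℝ) : ℂ))) := by
    obtain ⟨C, hC⟩ := hF.continuous.bounded_above_of_compact_support hc
    refine tendsto_integral_of_dominated_convergence (fun ξ => C * (1 / (‖ξ‖ ^ 2 + 1) ^ 2)) ?_
      (integral_radial_two.1.const_mul C) ?_ ?_
    · intro n
      refine ((hF.continuous.comp (by fun_prop)).mul (Complex.continuous_ofReal.comp
        (continuous_const.div (by fun_prop) fun ξ => ?_))).aestronglyMeasurable
      positivity
    · intro n
      refine Filter.Eventually.of_forall fun ξ => ?_
      rw [norm_mul, Complex.norm_real, Real.norm_of_nonneg (by positivity)]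
      exact mul_le_mul_of_nonneg_right (hC _) (by positivity)
    · refine Filter.Eventually.of_forall fun ξ => Filter.Tendsto.mul_const _ ?_
      refine (hF.continuous.tendsto w).comp ?_
      simpa using (helim.smul_const ξ).const_add w
  rw [integral_const_mul, integral_complex_ofReal, integral_radial_two.2] at l2
  have := tendsto_nhds_unique l1 (by simpa only [ibp] using l2.neg)
  rw [this]; ring

lemma exists_bump {K D : Set ℂ} (hK : IsCompact K) (hD : IsOpen D) (hKD : K ⊆ D) :
    ∃ χ : ℂ → ℝ, ContDiff ℝ ∞ χ ∧ HasCompactSupport χ ∧ tsupport χ ⊆ D ∧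
      (∀ᶠ z in nhdsSet K, χ z = 1) ∧ ∀ z, χ z ∈ Set.Icc (0 : ℝ) 1 := by
  obtain ⟨δ, hδ, hδD⟩ := hK.exists_cthickening_subset_open hD hKD
  have hInt : K ⊆ interior (Metric.cthickening δ K) :=
    (Metric.self_subset_thickening hδ K).trans
      (interior_maximal (Metric.thickening_subset_cthickening δ K) Metric.isOpen_thickening)
  obtain ⟨f, h1, h0, hf⟩ := exists_contMDiffMap_one_nhds_of_subset_interior
    (modelWithCornersSelf ℝ ℂ) (n := (⊤ : ℕ∞)) hK.isClosed hInt
  have hcc : IsCompact (Metric.cthickening δ K) := hK.cthickening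
  exact ⟨f, f.contMDiff.contDiff, hasCompactSupport_of_zero_off hcc h0,
    (tsupport_subset_of_zero_off hcc.isClosed h0).trans hδD, h1, hf⟩

lemma dist_log_ratio {z ζ ζ0 : ℂ} {ρ : ℝ} (hρ : 0 < ρ) (hz : ρ ≤ ‖z - ζ0‖)
    (hζ : ‖ζ - ζ0‖ ≤ ρ / 2) :
    z - ζ0 ≠ 0 ∧ z - ζ ≠ 0 ∧ (z - ζ) / (z - ζ0) = 1 + (ζ0 - ζ) / (z - ζ0) ∧
      ‖(ζ0 - ζ) / (z - ζ0)‖ ≤ 1 / 2 ∧ ρ / 2 ≤ ‖z - ζ‖ := by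
  have h1 : 0 < ‖z - ζ0‖ := hρ.trans_le hz
  have h0 : z - ζ0 ≠ 0 := norm_pos_iff.1 h1
  have h3 : ρ / 2 ≤ ‖z - ζ‖ := by
    have : ‖z - ζ0‖ ≤ ‖z - ζ‖ + ‖ζ - ζ0‖ := by
      simpa using norm_add_le (z - ζ) (ζ - ζ0)
    linarith
  refine ⟨h0, norm_pos_iff.1 (by linarith), ?_, ?_, h3⟩
  · field_simp; ring
  · rw [norm_div, norm_sub_rev, div_le_iff₀ h1]; linarith

lemma hasDerivAt_log_ratio {z ζ ζ0 : ℂ} {ρ : ℝ} (hρ : 0 < ρ) (hz : ρ ≤ ‖z - ζ0‖)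
    (hζ : ‖ζ - ζ0‖ ≤ ρ / 2) :
    HasDerivAt (fun z => Complex.log ((z - ζ) / (z - ζ0))) (1 / (z - ζ) - 1 / (z - ζ0)) z := by
  obtain ⟨h0, h1, h2, h3, -⟩ := dist_log_ratio hρ hz hζ
  have hs : (z - ζ) / (z - ζ0) ∈ Complex.slitPlane := by
    rw [h2]; exact Complex.mem_slitPlane_of_norm_lt_one (by linarith)
  have := (((hasDerivAt_id z).sub_const ζ).div ((hasDerivAt_id z).sub_const ζ0) h0).clog hs
  refine this.congr_deriv ?_
  simp only [id, Pi.div_apply]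
  field_simp

lemma exact_add {F G : ℂ → ℂ} {U : Set ℂ} (hF : Complex.IsExactOn F U)
    (hG : Complex.IsExactOn G U) : Complex.IsExactOn (fun z => F z + G z) U := by
  obtain ⟨f, hf⟩ := hF
  obtain ⟨g, hg⟩ := hG
  exact ⟨fun z => f z + g z, fun z hz => (hf z hz).add (hg z hz)⟩

lemma exact_const_mul {F : ℂ → ℂ} {U : Set ℂ} (hF : Complex.IsExactOn F U) (c : ℂ) :
    Complex.IsExactOn (fun z => c * F z) U := by
  obtain ⟨f, hf⟩ := hF
  exact ⟨fun z => c * f z, fun z hz => (hf z hz).const_mul c⟩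

lemma exact_congr {F G : ℂ → ℂ} {U : Set ℂ} (hF : Complex.IsExactOn F U)
    (h : ∀ z ∈ U, F z = G z) : Complex.IsExactOn G U := by
  obtain ⟨f, hf⟩ := hF
  exact ⟨f, fun z hz => h z hz ▸ hf z hz⟩

/-- If `1/(z-ζ)` is exact for one `ζ` of a connected set uniformly away from `U`, it is exact for
all of them. -/
lemma exact_inv_of_isPreconnected {C U : Set ℂ} (hC : IsPreconnected C)
    (hd : ∀ ζ ∈ C, ∃ ρ > 0, ∀ z ∈ U, ρ ≤ ‖z - ζ‖) {ζ1 : ℂ} (h1 : ζ1 ∈ C)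
    (he : Complex.IsExactOn (fun z => 1 / (z - ζ1)) U) {ζ : ℂ} (hζ : ζ ∈ C) :
    Complex.IsExactOn (fun z => 1 / (z - ζ)) U := by
  have := hC.induction₂ (fun a b => Complex.IsExactOn (fun z => 1 / (z - b) - 1 / (z - a)) U)
    ?_ ?_ ?_ h1 hζ
  · exact exact_congr (exact_add he this) fun z _ => by ring
  · intro ζ0 h0
    obtain ⟨ρ, hρ, hU⟩ := hd ζ0 h0
    refine Filter.Eventually.filter_mono nhdsWithin_le_nhds ?_
    filter_upwards [Metric.closedBall_mem_nhds ζ0 (half_pos hρ)] with ζ hζ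
    rw [mem_closedBall_iff_norm] at hζ
    exact ⟨_, fun z hz => hasDerivAt_log_ratio hρ (hU z hz) hζ⟩
  · intro a b c _ _ _ h h'
    exact exact_congr (exact_add h h') fun z _ => by ring
  · intro a b _ _ h
    exact exact_congr (exact_const_mul h (-1)) fun z _ => by ring

lemma exact_integral_local {U : Set ℂ} (hU : IsOpen U) {ζ0 : ℂ} {ρ : ℝ} (hρ : 0 < ρ)
    (hUρ : ∀ z ∈ U, ρ ≤ ‖z - ζ0‖) (he : Complex.IsExactOn (fun z => 1 / (z - ζ0)) U)
    {ψ : ℂ → ℂ} (hψ : Integrable ψ) (h0 : ∀ ζ ∉ Metric.ball ζ0 (ρ / 2), ψ ζ = 0) :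
    Complex.IsExactOn (fun z => ∫ ζ, ψ ζ / (z - ζ)) U ∧
      ∀ z ∈ U, Integrable (fun ζ => ψ ζ / (z - ζ)) := by
  have hin : ∀ ζ ∈ Metric.ball ζ0 (ρ / 2), ‖ζ - ζ0‖ ≤ ρ / 2 := fun ζ hζ =>
    (mem_ball_iff_norm.1 hζ).le
  have key : ∀ z0 ∈ U, Integrable (fun ζ => ψ ζ * (1 / (z0 - ζ) - 1 / (z0 - ζ0))) ∧
      HasDerivAt (fun z => ∫ ζ, ψ ζ * Complex.log ((z - ζ) / (z - ζ0)))
        (∫ ζ, ψ ζ * (1 / (z0 - ζ) - 1 / (z0 - ζ0))) z0 := by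
    intro z0 hz0
    have meas : ∀ z : ℂ, AEStronglyMeasurable
        (fun ζ => ψ ζ * Complex.log ((z - ζ) / (z - ζ0))) := fun z =>
      hψ.aestronglyMeasurable.mul
        (Complex.measurable_log.comp (by fun_prop)).aestronglyMeasurable
    refine hasDerivAt_integral_of_dominated_loc_of_deriv_le (hU.mem_nhds hz0)
      (F := fun z ζ => ψ ζ * Complex.log ((z - ζ) / (z - ζ0)))
      (F' := fun z ζ => ψ ζ * (1 / (z - ζ) - 1 / (z - ζ0)))
      (bound := fun ζ => ‖ψ ζ‖ * (2 / ρ + 1 / ρ))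
      (Filter.Eventually.of_forall meas) ?_ ?_ ?_ (hψ.norm.mul_const _) ?_
    · refine (hψ.norm.mul_const 1).mono' (meas z0) (Filter.Eventually.of_forall fun ζ => ?_)
      rw [norm_mul]
      by_cases hζ : ζ ∈ Metric.ball ζ0 (ρ / 2)
      · obtain ⟨-, -, h2, h3, -⟩ := dist_log_ratio hρ (hUρ z0 hz0) (hin ζ hζ)
        refine mul_le_mul_of_nonneg_left ?_ (norm_nonneg _)
        rw [h2]
        have := Complex.norm_log_one_add_half_le_self h3
        linarith
      · simp [h0 ζ hζ]
    · exact hψ.aestronglyMeasurable.mul (Measurable.aestronglyMeasurable (by fun_prop))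
    · refine Filter.Eventually.of_forall fun ζ z hz => ?_
      rw [norm_mul]
      by_cases hζ : ζ ∈ Metric.ball ζ0 (ρ / 2)
      · obtain ⟨h1, h2, -, -, h3⟩ := dist_log_ratio hρ (hUρ z hz) (hin ζ hζ)
        refine mul_le_mul_of_nonneg_left ((norm_sub_le _ _).trans (add_le_add ?_ ?_)) (norm_nonneg _)
        · rw [norm_div, norm_one, show (2 : ℝ) / ρ = 1 / (ρ / 2) by field_simp]
          exact one_div_le_one_div_of_le (by positivity) h3
        · rw [norm_div, norm_one]
          exact one_div_le_one_div_of_le hρ (hUρ z hz)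
      · simp [h0 ζ hζ]
    · refine Filter.Eventually.of_forall fun ζ z hz => ?_
      by_cases hζ : ζ ∈ Metric.ball ζ0 (ρ / 2)
      · exact (hasDerivAt_log_ratio hρ (hUρ z hz) (hin ζ hζ)).const_mul _
      · simpa [h0 ζ hζ] using hasDerivAt_const z (0 : ℂ)
  have hsplit : ∀ z ζ : ℂ, ψ ζ * (1 / (z - ζ) - 1 / (z - ζ0)) + ψ ζ * (1 / (z - ζ0)) =
      ψ ζ / (z - ζ) := fun z ζ => by ring
  have hI : ∀ z ∈ U, Integrable (fun ζ => ψ ζ / (z - ζ)) := fun z hz => by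
    simpa only [Pi.add_def, hsplit] using (key z hz).1.add (hψ.mul_const (1 / (z - ζ0)))
  refine ⟨?_, hI⟩
  have e1 : Complex.IsExactOn (fun z => ∫ ζ, ψ ζ * (1 / (z - ζ) - 1 / (z - ζ0))) U :=
    ⟨_, fun z hz => (key z hz).2⟩
  refine exact_congr (exact_add e1 (exact_const_mul he (∫ ζ, ψ ζ))) fun z hz => ?_
  rw [← integral_mul_const, ← integral_add (key z hz).1 (hψ.mul_const (1 / (z - ζ0)))]
  simp only [hsplit]

lemma exact_integral {U S : Set ℂ} (hU : IsOpen U) (hS : IsCompact S)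
    (hd : ∀ ζ ∈ S, ∃ ρ > 0, ∀ z ∈ U, ρ ≤ ‖z - ζ‖)
    (he : ∀ ζ ∈ S, Complex.IsExactOn (fun z => 1 / (z - ζ)) U)
    {ψ : ℂ → ℂ} (hψ : Integrable ψ) (h0 : ∀ ζ ∉ S, ψ ζ = 0) :
    Complex.IsExactOn (fun z => ∫ ζ, ψ ζ / (z - ζ)) U := by
  have : ∃ t, MeasurableSet t ∧ S ⊆ t ∧ ∀ ψ : ℂ → ℂ, Integrable ψ → (∀ ζ ∉ t, ψ ζ = 0) →
      (Complex.IsExactOn (fun z => ∫ ζ, ψ ζ / (z - ζ)) U ∧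
      ∀ z ∈ U, Integrable (fun ζ => ψ ζ / (z - ζ))) := by
    refine hS.induction_on (p := fun S => ∃ t, MeasurableSet t ∧ S ⊆ t ∧ ∀ ψ : ℂ → ℂ,
      Integrable ψ → (∀ ζ ∉ t, ψ ζ = 0) →
      (Complex.IsExactOn (fun z => ∫ ζ, ψ ζ / (z - ζ)) U ∧
      ∀ z ∈ U, Integrable (fun ζ => ψ ζ / (z - ζ)))) ?_ ?_ ?_ ?_
    · refine ⟨∅, MeasurableSet.empty, le_rfl, fun ψ _ h => ?_⟩
      have : ψ = 0 := by ext ζ; exact h ζ (Set.notMem_empty ζ)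
      subst this
      exact ⟨⟨fun _ => 0, fun z _ => by simpa using hasDerivAt_const z (0 : ℂ)⟩,
        fun z _ => by simp⟩
    · rintro s t hst ⟨t', h1, h2, h3⟩
      exact ⟨t', h1, hst.trans h2, h3⟩
    · rintro s t ⟨s', hs1, hs2, hs3⟩ ⟨t', ht1, ht2, ht3⟩
      refine ⟨s' ∪ t', hs1.union ht1, Set.union_subset_union hs2 ht2, fun ψ hψ h => ?_⟩
      have a := hs3 (s'.indicator ψ) (hψ.indicator hs1) fun ζ hζ => Set.indicator_of_notMem hζ _
      have b := ht3 (s'ᶜ.indicator ψ) (hψ.indicator hs1.compl) fun ζ hζ => by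
        by_cases hs : ζ ∈ s'
        · exact Set.indicator_of_notMem (by simpa using hs) _
        · rw [Set.indicator_of_mem hs, h ζ (by simp [hs, hζ])]
      have e : ∀ z ζ : ℂ, s'.indicator ψ ζ / (z - ζ) + s'ᶜ.indicator ψ ζ / (z - ζ) =
          ψ ζ / (z - ζ) := fun z ζ => by
        rw [← add_div]; congr 1; exact congrFun (Set.indicator_self_add_compl s' ψ) ζ
      refine ⟨exact_congr (exact_add a.1 b.1) fun z hz => ?_, fun z hz => ?_⟩
      · rw [← integral_add (a.2 z hz) (b.2 z hz)]; simp only [e]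
      · simpa only [Pi.add_def, e] using (a.2 z hz).add (b.2 z hz)
    · intro ζ0 hζ0
      obtain ⟨ρ, hρ, hUρ⟩ := hd ζ0 hζ0
      exact ⟨Metric.ball ζ0 (ρ / 2), nhdsWithin_le_nhds (Metric.ball_mem_nhds ζ0 (half_pos hρ)),
        Metric.ball ζ0 (ρ / 2), Metric.isOpen_ball.measurableSet, le_rfl, fun ψ hψ h =>
        exact_integral_local hU hρ hUρ (he ζ0 hζ0) hψ h⟩
  obtain ⟨t, -, ht, h⟩ := this
  exact (h ψ hψ fun ζ hζ => h0 ζ fun h' => hζ (ht h')).1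

lemma isPreconnected_infDist_lt {B : Set ℂ} (hB : IsPreconnected B) (hB' : B.Nonempty) (r : ℝ) :
    IsPreconnected {z | Metric.infDist z B < r} := by
  by_cases hr : 0 < r
  · obtain ⟨b, hb⟩ := hB'
    have hsub : B ⊆ {z | Metric.infDist z B < r} := fun z hz => by
      simpa [Metric.infDist_zero_of_mem hz] using hr
    refine isPreconnected_of_forall b fun y hy => ?_
    obtain ⟨y', hy', hd⟩ := (Metric.infDist_lt_iff ⟨b, hb⟩).1 hy
    refine ⟨B ∪ Metric.ball y' r, Set.union_subset hsub fun z hz => ?_, Or.inl hb,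
      Or.inr (Metric.mem_ball.2 hd), hB.union y' hy' (Metric.mem_ball_self hr)
        (convex_ball y' r).isPreconnected⟩
    exact (Metric.infDist_le_dist_of_mem hy').trans_lt hz
  · convert isPreconnected_empty
    ext z
    simp only [Set.mem_ofPred_eq, Set.mem_empty_iff_false, iff_false, not_lt]
    exact (not_lt.1 hr).trans Metric.infDist_nonneg

lemma isPreconnected_infDist_le {B : Set ℂ} (hB : IsPreconnected B) (hB' : B.Nonempty)
    (hc : IsClosed B) {r : ℝ} (hr : 0 ≤ r) :
    IsPreconnected {z | Metric.infDist z B ≤ r} := by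
  have ⟨b, hb⟩ := hB'
  have hsub : B ⊆ {z | Metric.infDist z B ≤ r} := fun z hz => by
    simpa [Metric.infDist_zero_of_mem hz] using hr
  refine isPreconnected_of_forall b fun y hy => ?_
  obtain ⟨y', hy', hd⟩ := hc.exists_infDist_eq_dist hB' y
  refine ⟨B ∪ Metric.closedBall y' r, Set.union_subset hsub fun z hz => ?_, Or.inl hb,
    Or.inr (Metric.mem_closedBall.2 (hd ▸ hy)), hB.union y' hy' (Metric.mem_closedBall_self hr)
      (convex_closedBall y' r).isPreconnected⟩
  exact (Metric.infDist_le_dist_of_mem hy').trans hz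

/-- On a bounded open set with connected complement, every holomorphic function has a primitive
near every compact subset. -/
lemma exists_exact_nhd {D K : Set ℂ} (hD : IsOpen D) (hb : Bornology.IsBounded D)
    (hDc : IsPreconnected Dᶜ) (hK : IsCompact K) (hKD : K ⊆ D) :
    ∃ U, IsOpen U ∧ K ⊆ U ∧ U ⊆ D ∧ IsPreconnected Uᶜ ∧
      ∀ F : ℂ → ℂ, DifferentiableOn ℂ F D → Complex.IsExactOn F U := by
  obtain ⟨R, hR0, hR⟩ := hb.subset_ball_lt 0 0
  have hRD : (R : ℂ) ∈ Dᶜ := fun h => by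
    have := hR h
    simp [abs_of_pos hR0] at this
  have hne : Dᶜ.Nonempty := ⟨_, hRD⟩
  obtain ⟨δ, hδ, hδD⟩ := hK.exists_thickening_subset_open hD hKD
  set r := δ / 2 with hr
  have hr0 : 0 < r := half_pos hδ
  set d : ℂ → ℝ := fun z => Metric.infDist z Dᶜ with hd
  have dc : Continuous d := Metric.continuous_infDist_pt _
  have hdD : ∀ z, 0 < d z → z ∈ D := fun z hz => by
    by_contra h
    exact hz.ne' (Metric.infDist_zero_of_mem h)
  set U := {z | r < d z} with hU
  have hUo : IsOpen U := isOpen_lt continuous_const dc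
  have hUD : U ⊆ D := fun z hz => hdD z (hr0.trans hz)
  refine ⟨U, hUo, fun z hz => ?_, hUD, ?_, fun F hF => ?_⟩
  · by_contra h
    have h' : d z < δ := (not_lt.1 h).trans_lt (by linarith)
    obtain ⟨y, hy, hyd⟩ := (Metric.infDist_lt_iff hne).1 h'
    exact hy (hδD (Metric.mem_thickening_iff.2 ⟨z, hz, by rwa [dist_comm]⟩))
  · have : Uᶜ = {z | d z ≤ r} := by ext z; simp [hU]
    rw [this]
    exact isPreconnected_infDist_le hDc hne hD.isClosed_compl hr0.le
  set C := {z | d z < r} with hC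
  have hCp : IsPreconnected C := isPreconnected_infDist_lt hDc hne r
  have sep : ∀ ζ ∈ C, ∃ ρ > 0, ∀ z ∈ U, ρ ≤ ‖z - ζ‖ := fun ζ hζ => by
    refine ⟨r - d ζ, sub_pos.2 hζ, fun z hz => ?_⟩
    have : d z ≤ d ζ + dist z ζ := Metric.infDist_le_infDist_add_dist
    have hz' : r < d z := hz
    rw [← dist_eq_norm]; linarith
  have hRC : (R : ℂ) ∈ C := by
    show d R < r
    simp only [hd, Metric.infDist_zero_of_mem hRD, hr0]
  have hex1 : Complex.IsExactOn (fun z => 1 / (z - (R : ℂ))) U := by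
    refine ⟨fun z => Complex.log (1 + -(z / R)), fun z hz => ?_⟩
    have hn : ‖-(z / (R : ℂ))‖ < 1 := by
      have := hR (hUD hz)
      rw [norm_neg, norm_div, Complex.norm_real, Real.norm_of_nonneg hR0.le, div_lt_one hR0]
      simpa using this
    have hs := Complex.mem_slitPlane_of_norm_lt_one hn
    have hR' : (R : ℂ) ≠ 0 := by exact_mod_cast hR0.ne'
    have h1 := ((((hasDerivAt_id z).div_const (R : ℂ)).neg).const_add 1).clog hs
    refine h1.congr_deriv ?_
    have h2 : (1 : ℂ) + -(z / R) ≠ 0 := Complex.slitPlane_ne_zero hs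
    have h3 : z - R ≠ 0 := fun h => h2 (by rw [sub_eq_zero.1 h, div_self hR']; ring)
    have h4 : (1 : ℂ) + -(z / R) = -(z - R) / R := by field_simp; ring
    simp only [id, Pi.neg_apply]
    rw [h4]
    field_simp
  have hex : ∀ ζ ∈ C, Complex.IsExactOn (fun z => 1 / (z - ζ)) U := fun ζ hζ =>
    exact_inv_of_isPreconnected hCp sep hRC hex1 hζ
  set K1 := {z | r / 2 ≤ d z} with hK1
  have hK1D : K1 ⊆ D := fun z hz => hdD z (by have : r / 2 ≤ d z := hz; linarith)
  have hK1c : IsCompact K1 := Metric.isCompact_of_isClosed_isBounded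
    (isClosed_le continuous_const dc) (hb.subset hK1D)
  obtain ⟨χ, χs, χc, χD, χ1, -⟩ := exists_bump hK1c hD hK1D
  set G : ℂ → ℂ := fun z => (χ z : ℂ) * F z with hG
  have hG0 : ∀ z ∉ tsupport χ, G z = 0 := fun z hz => by
    simp [hG, image_eq_zero_of_notMem_tsupport hz]
  have hGs : ContDiff ℝ 1 G := contDiff_of_zero_off χc.isCompact.isClosed hG0 fun z hz =>
    (contDiff_ofReal (χs.of_le (by exact_mod_cast le_top))).contDiffAt.mul
      (contDiffAt_of_hol hD hF (χD hz))
  have hGc : HasCompactSupport G := hasCompactSupport_of_zero_off χc.isCompact hG0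
  have hGF : ∀ z, r / 2 < d z → G =ᶠ[nhds z] F := fun z hz => by
    filter_upwards [(isOpen_lt continuous_const dc).mem_nhds hz] with w hw
    have : χ w = 1 := χ1.self_of_nhdsSet w (le_of_lt hw : r / 2 ≤ d w)
    simp [hG, this]
  set S := tsupport χ ∩ {z | d z ≤ r / 2} with hS
  have hSc : IsCompact S := χc.isCompact.inter_right (isClosed_le dc continuous_const)
  have hSC : S ⊆ C := fun z hz => by
    have : d z ≤ r / 2 := hz.2
    show d z < r
    linarith
  have hbar0 : ∀ z ∉ S, dzb G z / π = 0 := fun z hz => by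
    by_cases h1 : z ∈ tsupport χ
    · have h2 : r / 2 < d z := not_le.1 fun h => hz ⟨h1, h⟩
      have h3 : dzb G z = dzb F z := by
        simp only [dzb, dx_congr (hGF z h2), dy_congr (hGF z h2)]
      rw [h3, (hF.differentiableAt (hD.mem_nhds (χD h1))).hasDerivAt.hasW.2.2, zero_div]
    · rw [dzb_eq_zero_of_notMem, zero_div]
      exact fun h => h1 (tsupport_subset_of_zero_off χc.isCompact.isClosed hG0 h)
  have := exact_integral hUo hSc (fun ζ hζ => sep ζ (hSC hζ)) (fun ζ hζ => hex ζ (hSC hζ))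
    (integrable_of_zero_off hSc hbar0 fun z _ =>
      (continuousAt_dzb hGs.contDiffAt).div_const _) hbar0
  refine exact_congr this fun w hw => ?_
  have hw' : r / 2 < d w := by have : r < d w := hw; linarith
  rw [← (hGF w hw').eq_of_nhds]
  have cp := cauchy_pompeiu hGs hGc w
  have hpi : (π : ℂ) ≠ 0 := by exact_mod_cast pi_ne_zero
  have e : ∀ z, dzb G z / π / (w - z) = (-1 / π) * (dzb G z / (z - w)) := fun z => by
    rw [show w - z = -(z - w) by ring, div_neg]; ring
  simp_rw [e]
  rw [integral_const_mul, cp]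
  field_simp

lemma dx_dy_comm {h : ℂ → ℝ} {z : ℂ} (hh : ContDiffAt ℝ 2 h z) : dx (dy h) z = dy (dx h) z := by
  have hs : IsSymmSndFDerivAt ℝ h z := hh.isSymmSndFDerivAt (by simp)
  have hd : DifferentiableAt ℝ (fderiv ℝ h) z :=
    (hh.fderiv_right (m := 1) (by norm_num)).differentiableAt (by norm_num)
  have e : ∀ v w : ℂ, fderiv ℝ (fun x => fderiv ℝ h x v) z w = fderiv ℝ (fderiv ℝ h) z w v := by
    intro v w
    rw [fderiv_clm_apply hd (differentiableAt_const v)]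
    simp
  exact (e Complex.I 1).trans ((hs _ _).trans (e 1 Complex.I).symm)

/-- The complex gradient of a harmonic function is holomorphic. -/
lemma differentiableAt_gradient {h : ℂ → ℝ} {z : ℂ} (hh : ContDiffAt ℝ 2 h z)
    (h0 : plap h z = 0) :
    DifferentiableAt ℂ (fun w => ((dx h w : ℝ) : ℂ) - Complex.I * ((dy h w : ℝ) : ℂ)) z := by
  have c1 := (contDiffAt_dx hh (m := 1) (by norm_num)).differentiableAt (by norm_num)
  have c2 := (contDiffAt_dy hh (m := 1) (by norm_num)).differentiableAt (by norm_num)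
  have d1 : HasFDerivAt (fun w => ((dx h w : ℝ) : ℂ)) (Complex.ofRealCLM.comp (fderiv ℝ (dx h) z)) z :=
    Complex.ofRealCLM.hasFDerivAt.comp z c1.hasFDerivAt
  have d2 : HasFDerivAt (fun w => ((dy h w : ℝ) : ℂ)) (Complex.ofRealCLM.comp (fderiv ℝ (dy h) z)) z :=
    Complex.ofRealCLM.hasFDerivAt.comp z c2.hasFDerivAt
  have d3 := d1.sub (d2.const_mul Complex.I)
  rw [differentiableAt_complex_iff_differentiableAt_real]
  refine ⟨d3.differentiableAt, ?_⟩
  have hf : fderiv ℝ (fun w => ((dx h w : ℝ) : ℂ) - Complex.I * ((dy h w : ℝ) : ℂ)) z = _ := d3.fderiv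
  rw [hf]
  have s : ((dy (dx h) z : ℝ) : ℂ) = ((dx (dy h) z : ℝ) : ℂ) := by rw [dx_dy_comm hh]
  have l : ((dx (dx h) z : ℝ) : ℂ) + ((dy (dy h) z : ℝ) : ℂ) = 0 := by exact_mod_cast h0
  change ((dy (dx h) z : ℝ) : ℂ) - Complex.I * ((dy (dy h) z : ℝ) : ℂ) =
    Complex.I • (((dx (dx h) z : ℝ) : ℂ) - Complex.I * ((dx (dy h) z : ℝ) : ℂ))
  rw [smul_eq_mul, s]
  linear_combination (-Complex.I) * l + ((dx (dy h) z : ℝ) : ℂ) * Complex.I_sq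

/-- Near a compact subset of a bounded simply connected domain, `exp h` with `h` harmonic is the
modulus of the derivative of a holomorphic function. -/
lemma exists_conformal {D K : Set ℂ} (hD : IsOpen D) (hb : Bornology.IsBounded D)
    (hDc : IsPreconnected Dᶜ) (hK : IsCompact K) (hKD : K ⊆ D) {h : ℂ → ℝ}
    (hh : ∀ z ∈ D, ContDiffAt ℝ 2 h z) (h0 : ∀ z ∈ D, plap h z = 0) :
    ∃ (U : Set ℂ) (g : ℂ → ℂ), IsOpen U ∧ K ⊆ U ∧ U ⊆ D ∧ DifferentiableOn ℂ g U ∧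
      ∀ z ∈ U, ‖deriv g z‖ = exp (h z) := by
  obtain ⟨U, hU, hKU, hUD, hUc, hex⟩ := exists_exact_nhd hD hb hDc hK hKD
  obtain ⟨H, hH⟩ := hex _ fun z hz =>
    (differentiableAt_gradient (hh z hz) (h0 z hz)).differentiableWithinAt
  have key : ∀ z ∈ U, HasFDerivAt (fun w => h w - (H w).re) (0 : ℂ →L[ℝ] ℝ) z := by
    intro z hz
    have a1 : HasFDerivAt h (fderiv ℝ h z) z :=
      ((hh z (hUD hz)).differentiableAt (by norm_num)).hasFDerivAt
    have a2 := (hH z hz).complexToReal_fderiv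
    have a3 := a1.sub (Complex.reCLM.hasFDerivAt.comp z a2)
    refine a3.congr_fderiv ?_
    ext v
    simp only [sub_apply, ContinuousLinearMap.comp_apply,
      zero_apply, fderiv_eq_dx_dy h z v]
    simp
    ring
  set G : ℂ → ℂ := fun z => Complex.exp (H z + ((h z - (H z).re : ℝ) : ℂ)) with hG
  have hGd : DifferentiableOn ℂ G U := fun z hz => by
    have b1 : HasFDerivAt (fun w => ((h w - (H w).re : ℝ) : ℂ)) (0 : ℂ →L[ℂ] ℂ) z := by
      have := Complex.ofRealCLM.hasFDerivAt.comp z (key z hz)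
      rw [ContinuousLinearMap.comp_zero] at this
      rw [hasFDerivAt_iff_isLittleO_nhds_zero] at this ⊢
      simpa using this
    exact ((hH z hz).differentiableAt.add b1.differentiableAt).cexp.differentiableWithinAt
  obtain ⟨V, hV, hKV, hVU, -, hex'⟩ := exists_exact_nhd hU (hb.subset hUD) hUc hK hKU
  obtain ⟨g, hg⟩ := hex' G hGd
  refine ⟨V, g, hV, hKV, hVU.trans hUD, fun z hz =>
    (hg z hz).differentiableAt.differentiableWithinAt, fun z hz => ?_⟩
  rw [(hg z hz).deriv, hG, Complex.norm_exp]
  congr 1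
  simp

/-- Weighted Sobolev inequality with weight `exp (2 * h)`, `h` harmonic. -/
lemma weighted_sobolev {D : Set ℂ} (hD : IsOpen D) (hb : Bornology.IsBounded D)
    (hDc : IsPreconnected Dᶜ) {h f : ℂ → ℝ}
    (hh : ∀ z ∈ D, ContDiffAt ℝ 2 h z) (h0 : ∀ z ∈ D, plap h z = 0)
    (hf : ContDiff ℝ 1 f) (hc : HasCompactSupport f) (hfD : tsupport f ⊆ D) (hf0 : ∀ z, 0 ≤ f z) :
    4 * π * ∫ z, f z ^ 2 * exp (2 * h z) ≤ (∫ z, gnorm f z * exp (h z)) ^ 2 := by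
  obtain ⟨U, g, hU, hKU, -, hg, hgh⟩ := exists_conformal hD hb hDc hc hfD hh h0
  have e1 : ∀ z, f z ^ 2 * exp (2 * h z) = f z ^ 2 * ‖deriv g z‖ ^ 2 := fun z => by
    by_cases hz : z ∈ tsupport f
    · rw [hgh z (hKU hz), ← Real.exp_nat_mul]; norm_num
    · simp [image_eq_zero_of_notMem_tsupport hz]
  have e2 : ∀ z, gnorm f z * exp (h z) = gnorm f z * ‖deriv g z‖ := fun z => by
    by_cases hz : z ∈ tsupport f
    · rw [hgh z (hKU hz)]
    · simp [gnorm, dx_eq_zero_of_notMem hz, dy_eq_zero_of_notMem hz]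
  simp_rw [e1, e2]
  exact sobolev hU hg hf hc hKU hf0

section

lemma deriv_deriv_nonpos_of_isLocalMax {g : ℝ → ℝ} {x : ℝ} (hg : ContinuousAt g x)
    (hm : IsLocalMax g x) : deriv (deriv g) x ≤ 0 := by
  by_contra h
  push Not at h
  have h2 := isLocalMin_of_deriv_deriv_pos h hm.deriv_eq_zero hg
  have hc : g =ᶠ[nhds x] fun _ => g x := by
    filter_upwards [hm, h2] with y h3 h4 using le_antisymm h3 h4
  have : deriv (deriv g) x = 0 := by
    rw [hc.deriv.deriv_eq]
    simp
  linarith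

lemma deriv_deriv_line {f : ℂ → ℝ} {z : ℂ} (hf : ContDiffAt ℝ 2 f z) (v : ℂ) :
    deriv (deriv fun t : ℝ => f (z + t * v)) 0 = fderiv ℝ (fun w => fderiv ℝ f w v) z v := by
  have hl : ∀ t : ℝ, HasDerivAt (fun t : ℝ => z + t * v) v t := fun t => by
    simpa using ((Complex.ofRealCLM.hasDerivAt (x := t)).mul_const v).const_add z
  have hc : ContinuousAt (fun t : ℝ => z + t * v) 0 := (hl 0).continuousAt
  have h0 : z + ((0 : ℝ) : ℂ) * v = z := by simp
  have e1 : (deriv fun t : ℝ => f (z + t * v)) =ᶠ[nhds 0]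
      fun t : ℝ => (fun w => fderiv ℝ f w v) (z + t * v) := by
    have := hc.eventually (h0.symm ▸ eventually_differentiableAt hf)
    filter_upwards [this] with t ht
    exact (ht.hasFDerivAt.comp_hasDerivAt t (hl t)).deriv
  rw [e1.deriv_eq]
  have hd : DifferentiableAt ℝ (fun w => fderiv ℝ f w v) z :=
    ((hf.fderiv_right (m := 1) (by norm_num)).differentiableAt (by norm_num)).clm_apply
      (differentiableAt_const v)
  exact (HasFDerivAt.comp_hasDerivAt_of_eq 0 hd.hasFDerivAt (hl 0) h0.symm).deriv

lemma plap_nonpos_of_isLocalMax {f : ℂ → ℝ} {z : ℂ} (hf : ContDiffAt ℝ 2 f z)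
    (hm : IsLocalMax f z) : plap f z ≤ 0 := by
  have key : ∀ v : ℂ, fderiv ℝ (fun w => fderiv ℝ f w v) z v ≤ 0 := fun v => by
    rw [← deriv_deriv_line hf v]
    have hc : ContinuousAt (fun t : ℝ => z + (t : ℂ) * v) 0 := by fun_prop
    have h0 : z + ((0 : ℝ) : ℂ) * v = z := by simp
    refine deriv_deriv_nonpos_of_isLocalMax
      (ContinuousAt.comp (by rw [h0]; exact hf.continuousAt) hc) ?_
    have := hc.eventually (h0.symm ▸ hm)
    filter_upwards [this] with t ht
    simpa using ht
  exact add_nonpos (key 1) (key Complex.I)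

lemma plap_norm_sub_sq (c z : ℂ) : plap (fun w => ‖w - c‖ ^ 2) z = 4 := by
  have e : ∀ w : ℂ, ‖w - c‖ ^ 2 = (w.re - c.re) ^ 2 + (w.im - c.im) ^ 2 := fun w => by
    rw [← Complex.normSq_eq_norm_sq, Complex.normSq_apply]; simp; ring
  have hd : ∀ w : ℂ, HasFDerivAt (fun w : ℂ => ‖w - c‖ ^ 2)
      ((2 * (w.re - c.re)) • Complex.reCLM + (2 * (w.im - c.im)) • Complex.imCLM) w := fun w => by
    simp_rw [e]
    have a := ((Complex.reCLM.hasFDerivAt (x := w)).sub_const c.re).pow 2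
    have b := ((Complex.imCLM.hasFDerivAt (x := w)).sub_const c.im).pow 2
    refine (a.add b).congr_fderiv ?_
    ext v
    simp
  have hx : dx (fun w : ℂ => ‖w - c‖ ^ 2) = fun w => 2 * (w.re - c.re) := by
    ext w; simp [dx, (hd w).fderiv]
  have hy : dy (fun w : ℂ => ‖w - c‖ ^ 2) = fun w => 2 * (w.im - c.im) := by
    ext w; simp [dy, (hd w).fderiv]
  rw [plap, hx, hy]
  have a := (((Complex.reCLM.hasFDerivAt (x := z)).sub_const c.re).const_mul 2)
  have b := (((Complex.imCLM.hasFDerivAt (x := z)).sub_const c.im).const_mul 2)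
  have a' : fderiv ℝ (fun w : ℂ => 2 * (w.re - c.re)) z = _ := a.fderiv
  have b' : fderiv ℝ (fun w : ℂ => 2 * (w.im - c.im)) z = _ := b.fderiv
  rw [dx, dy, a', b']
  simp
  norm_num

lemma dx_re_of_hasDerivAt {g : ℂ → ℂ} {g' z : ℂ} (h : HasDerivAt g g' z) :
    dx (fun w => (g w).re) z = g'.re ∧ dy (fun w => (g w).re) z = -g'.im := by
  have := Complex.reCLM.hasFDerivAt.comp z h.complexToReal_fderiv
  have e : fderiv ℝ (fun w => (g w).re) z = _ := this.fderiv
  simp [dx, dy, e]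

lemma contDiffAt_re {g : ℂ → ℂ} {U : Set ℂ} (hU : IsOpen U) (hg : DifferentiableOn ℂ g U) {z : ℂ}
    (hz : z ∈ U) {n : WithTop ℕ∞} : ContDiffAt ℝ n (fun w => (g w).re) z :=
  Complex.reCLM.contDiff.contDiffAt.comp z (contDiffAt_of_hol hU hg hz)

/-- The real part of a holomorphic function is harmonic. -/
lemma plap_re_of_hol {g : ℂ → ℂ} {U : Set ℂ} (hU : IsOpen U) (hg : DifferentiableOn ℂ g U) {z : ℂ}
    (hz : z ∈ U) : plap (fun w => (g w).re) z = 0 := by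
  have hda : ∀ w ∈ U, HasDerivAt g (deriv g w) w := fun w hw =>
    (hg.differentiableAt (hU.mem_nhds hw)).hasDerivAt
  have hd2 : HasDerivAt (deriv g) (deriv (deriv g) z) z :=
    ((hg.deriv hU).differentiableAt (hU.mem_nhds hz)).hasDerivAt
  have e1 : dx (fun w => (g w).re) =ᶠ[nhds z] fun w => (deriv g w).re := by
    filter_upwards [hU.mem_nhds hz] with w hw using (dx_re_of_hasDerivAt (hda w hw)).1
  have e2 : dy (fun w => (g w).re) =ᶠ[nhds z] fun w => (Complex.I * deriv g w).re := by
    filter_upwards [hU.mem_nhds hz] with w hw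
    rw [(dx_re_of_hasDerivAt (hda w hw)).2]; simp
  rw [plap, dx_congr e1, dy_congr e2, (dx_re_of_hasDerivAt hd2).1,
    (dx_re_of_hasDerivAt (hd2.const_mul Complex.I)).2]
  simp

/-- The Poisson integral over the circle of center `c` and radius `R`. -/
def poisson (c : ℂ) (R : ℝ) (f : ℂ → ℝ) (w : ℂ) : ℝ :=
  circleAverage (fun ζ => poissonKernel c w ζ * f ζ) c R

section poisson

variable {c : ℂ} {R : ℝ} {f : ℂ → ℝ}

lemma exists_poisson_eq_re (hf : CircleIntegrable f c R) :
    ∃ g : ℂ → ℂ, DifferentiableOn ℂ g (Metric.ball c R) ∧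
      ∀ w ∈ Metric.ball c R, poisson c R f w = (g w).re := by
  have hf0 : CircleIntegrable (fun z => f (z + c)) 0 R := by
    have e : ∀ θ, circleMap c R θ = circleMap 0 R θ + c := fun θ => by simp [circleMap, add_comm]
    simpa only [CircleIntegrable, e] using hf
  have hf1 : CircleIntegrable (fun z => ((f (z + c) : ℝ) : ℂ)) 0 R := by
    simp only [CircleIntegrable, intervalIntegrable_iff] at hf0 ⊢
    exact Complex.ofRealCLM.integrable_comp hf0
  refine ⟨fun w => circleAverage (fun ζ => herglotzRieszKernel 0 (w - c) ζ • ((f (ζ + c) : ℝ) : ℂ))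
    0 R, ?_, fun w hw => ?_⟩
  · exact (differentiableOn_circleAverage_herglotzRieszKernel_smul hf1).comp (by fun_prop)
      fun w hw => by simpa [dist_eq_norm] using hw
  · rw [re_circleAverage_herglotzRieszKernel_smul hf0 (by simpa [dist_eq_norm] using hw),
      poisson, ← circleAverage_map_add_const]
    congr 1
    ext ζ
    simp [poissonKernel_eq_re_herglotzRieszKernel, herglotzRieszKernel_add_const]

lemma contDiffAt_poisson (hf : CircleIntegrable f c R) {n : WithTop ℕ∞} {w : ℂ}
    (hw : w ∈ Metric.ball c R) :
    ContDiffAt ℝ n (poisson c R f) w ∧ plap (poisson c R f) w = 0 := by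
  obtain ⟨g, hg, he⟩ := exists_poisson_eq_re hf
  have e : poisson c R f =ᶠ[nhds w] fun w => (g w).re := by
    filter_upwards [Metric.isOpen_ball.mem_nhds hw] with x hx using he x hx
  exact ⟨(contDiffAt_re Metric.isOpen_ball hg hw).congr_of_eventuallyEq e,
    (plap_congr e).trans (plap_re_of_hol Metric.isOpen_ball hg hw)⟩

lemma poissonKernel_nonneg {w ζ : ℂ} (hw : w ∈ Metric.ball c R) (hζ : ζ ∈ Metric.sphere c R) :
    0 ≤ poissonKernel c w ζ := by
  rw [mem_sphere_iff_norm] at hζ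
  rw [mem_ball_iff_norm] at hw
  refine div_nonneg ?_ (by positivity)
  rw [hζ]
  nlinarith [norm_nonneg (w - c)]

lemma continuousOn_poissonKernel {w : ℂ} (hw : w ∈ Metric.ball c R) :
    ContinuousOn (poissonKernel c w) (Metric.sphere c |R|) := by
  rw [poissonKernel_eq_re_herglotzRieszKernel]
  exact Complex.continuous_re.comp_continuousOn (continuousOn_herglotzRieszKernel_sphere hw)

lemma poisson_const (a : ℝ) {w : ℂ} (hw : w ∈ Metric.ball c R) :
    poisson c R (fun _ => a) w = a := by
  have h1 : DiffContOnCl ℂ (fun _ : ℂ => (1 : ℂ)) (Metric.ball c R) := diffContOnCl_const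
  have h2 := h1.circleAverage_poissonKernel_smul hw
  have h3 : circleAverage (poissonKernel c w) c R = 1 := by
    have hi : CircleIntegrable (poissonKernel c w) c R :=
      (continuousOn_poissonKernel hw).circleIntegrable'
    have := Complex.ofRealCLM.circleAverage_comp_comm hi
    rw [← Complex.ofReal_inj, ← Complex.ofRealCLM_apply, ← this, Complex.ofReal_one, ← h2]
    congr 1
    ext ζ
    simp
  have h4 := circleAverage_fun_smul (c := c) (R := R) (a := a) (f := poissonKernel c w)
  simp only [smul_eq_mul] at h4
  simp only [poisson, mul_comm _ a, h4, h3, mul_one]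

lemma poisson_boundary (hR : 0 < R) (hf : ContinuousOn f (Metric.sphere c R)) {ζ0 : ℂ}
    (h0 : ζ0 ∈ Metric.sphere c R) :
    Filter.Tendsto (poisson c R f) (nhdsWithin ζ0 (Metric.ball c R)) (nhds (f ζ0)) := by
  obtain ⟨M, hM⟩ := (isCompact_sphere c R).exists_bound_of_continuousOn hf
  have hM0 : 0 ≤ M := (norm_nonneg _).trans (hM ζ0 h0)
  rw [Metric.tendsto_nhdsWithin_nhds]
  intro ε hε
  obtain ⟨δ, hδ, hfδ⟩ := Metric.continuousOn_iff.1 hf ζ0 h0 (ε / 2) (half_pos hε)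
  have hcont : Filter.Tendsto (fun w => (R ^ 2 - ‖w - c‖ ^ 2) * (2 * M / (δ / 2) ^ 2)) (nhds ζ0)
      (nhds 0) := by
    have : Continuous fun w : ℂ => (R ^ 2 - ‖w - c‖ ^ 2) * (2 * M / (δ / 2) ^ 2) := by fun_prop
    convert this.tendsto ζ0 using 2
    rw [mem_sphere_iff_norm.1 h0]; ring
  obtain ⟨δ', hδ', hd⟩ := Metric.tendsto_nhds_nhds.1 hcont (ε / 2) (half_pos hε)
  refine ⟨min δ' (δ / 2), by positivity, fun {w} hw hwd => ?_⟩
  have hw1 := hd (hwd.trans_le (min_le_left _ _))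
  have hw2 : dist w ζ0 < δ / 2 := hwd.trans_le (min_le_right _ _)
  rw [Real.dist_eq, sub_zero] at hw1
  have hcP := continuousOn_poissonKernel hw
  rw [abs_of_pos hR] at hcP
  have ci : ∀ {g : ℂ → ℝ}, ContinuousOn g (Metric.sphere c R) → CircleIntegrable g c R :=
    fun hg => ContinuousOn.circleIntegrable hR.le hg
  have e : poisson c R f w - f ζ0 =
      circleAverage (fun ζ => poissonKernel c w ζ * (f ζ - f ζ0)) c R := by
    conv_lhs => rw [← poisson_const (f ζ0) hw]
    have i1 : CircleIntegrable (fun ζ => poissonKernel c w ζ * f ζ) c R := ci (hcP.mul hf)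
    have i2 : CircleIntegrable (fun ζ => poissonKernel c w ζ * f ζ0) c R := ci (hcP.mul_const _)
    rw [poisson, poisson, ← circleAverage_fun_sub i1 i2]
    simp only [mul_sub]
  rw [Real.dist_eq, e]
  have hin : ContinuousOn (fun ζ => poissonKernel c w ζ * (f ζ - f ζ0)) (Metric.sphere c R) :=
    hcP.mul (hf.sub continuousOn_const)
  refine (abs_circleAverage_le_circleAverage_abs).trans_lt ?_
  have hle : circleAverage |fun ζ => poissonKernel c w ζ * (f ζ - f ζ0)| c R ≤
      circleAverage (fun ζ => poissonKernel c w ζ * (ε / 2) +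
        (R ^ 2 - ‖w - c‖ ^ 2) * (2 * M / (δ / 2) ^ 2)) c R := by
    refine circleAverage_mono (ci hin.abs)
      (ci ((hcP.mul_const _).add continuousOn_const)) fun ζ hζ => ?_
    rw [abs_of_pos hR] at hζ
    have hP := poissonKernel_nonneg hw hζ
    have hRw : 0 ≤ R ^ 2 - ‖w - c‖ ^ 2 := by
      rw [mem_ball_iff_norm] at hw
      nlinarith [norm_nonneg (w - c)]
    show |poissonKernel c w ζ * (f ζ - f ζ0)| ≤ _
    rw [abs_mul, abs_of_nonneg hP]
    by_cases hζd : dist ζ ζ0 < δ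
    · have h1 := (hfδ ζ hζ hζd).le
      rw [Real.dist_eq] at h1
      have := mul_le_mul_of_nonneg_left h1 hP
      have h2 : 0 ≤ (R ^ 2 - ‖w - c‖ ^ 2) * (2 * M / (δ / 2) ^ 2) := by positivity
      linarith
    · have h1 : δ / 2 ≤ ‖(ζ - c) - (w - c)‖ := by
        have := dist_triangle ζ w ζ0
        rw [sub_sub_sub_cancel_right, ← dist_eq_norm]
        linarith [not_lt.1 hζd]
      have h2 : |f ζ - f ζ0| ≤ 2 * M := by
        have a := hM ζ hζ
        have b := hM ζ0 h0
        rw [Real.norm_eq_abs] at a b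
        have := abs_sub (f ζ) (f ζ0)
        linarith
      have h3 : poissonKernel c w ζ ≤ (R ^ 2 - ‖w - c‖ ^ 2) / (δ / 2) ^ 2 := by
        rw [poissonKernel, mem_sphere_iff_norm.1 hζ]
        gcongr
      have h4 : poissonKernel c w ζ * |f ζ - f ζ0| ≤
          (R ^ 2 - ‖w - c‖ ^ 2) / (δ / 2) ^ 2 * (2 * M) :=
        mul_le_mul h3 h2 (abs_nonneg _) (by positivity)
      have h5 : (R ^ 2 - ‖w - c‖ ^ 2) / (δ / 2) ^ 2 * (2 * M) =
          (R ^ 2 - ‖w - c‖ ^ 2) * (2 * M / (δ / 2) ^ 2) := by ring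
      have := mul_nonneg hP (half_pos hε).le
      linarith
  refine hle.trans_lt ?_
  rw [circleAverage_fun_add (ci (hcP.mul_const _)) (ci continuousOn_const), circleAverage_const]
  have := poisson_const (ε / 2) hw
  rw [poisson] at this
  rw [this]
  linarith [(abs_lt.1 hw1).2]

end poisson

end

section

/-- Subharmonicity in the viscosity sense. -/
def Subharm (D : Set ℂ) (s : ℂ → ℝ) : Prop :=
  ∀ z ∈ D, ∀ ψ : ℂ → ℝ, ContDiffAt ℝ 2 ψ z → IsLocalMax (fun w => s w - ψ w) z → 0 ≤ plap ψ z

lemma subharm_at {s ψ : ℂ → ℝ} {z : ℂ} (hs : ContDiffAt ℝ 2 s z) (h : 0 ≤ plap s z)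
    (hψ : ContDiffAt ℝ 2 ψ z) (hm : IsLocalMax (fun w => s w - ψ w) z) : 0 ≤ plap ψ z := by
  have := plap_nonpos_of_isLocalMax (hs.sub hψ) hm
  rw [plap_sub hs hψ] at this
  linarith

lemma Subharm.le_of_sphere {c : ℂ} {R : ℝ} {s H : ℂ → ℝ}
    (hs : ContinuousOn s (Metric.closedBall c R)) (hsub : Subharm (Metric.ball c R) s)
    (hH : ContinuousOn H (Metric.closedBall c R))
    (hH2 : ∀ z ∈ Metric.ball c R, ContDiffAt ℝ 2 H z ∧ plap H z ≤ 0)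
    (hle : ∀ z ∈ Metric.sphere c R, s z ≤ H z) :
    ∀ z ∈ Metric.closedBall c R, s z ≤ H z := by
  intro z0 hz0
  by_contra hlt
  push Not at hlt
  set δ := s z0 - H z0 with hδ
  have hδ0 : 0 < δ := sub_pos.2 hlt
  set ε := δ / (2 * (R ^ 2 + 1)) with hε
  have hε0 : 0 < ε := by positivity
  have hεR : ε * R ^ 2 < δ := by
    rw [hε, div_mul_eq_mul_div, div_lt_iff₀ (by positivity)]
    nlinarith [sq_nonneg R]
  obtain ⟨z1, hz1, hmax⟩ := (isCompact_closedBall c R).exists_isMaxOn ⟨z0, hz0⟩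
    (f := fun z => s z - (H z - ε * ‖z - c‖ ^ 2)) (by fun_prop)
  have h01 : δ ≤ s z1 - (H z1 - ε * ‖z1 - c‖ ^ 2) := by
    have h1 : s z0 - (H z0 - ε * ‖z0 - c‖ ^ 2) ≤ s z1 - (H z1 - ε * ‖z1 - c‖ ^ 2) := hmax hz0
    have h2 : 0 ≤ ε * ‖z0 - c‖ ^ 2 := by positivity
    linarith
  have hz1b : z1 ∈ Metric.ball c R := by
    rw [mem_closedBall_iff_norm] at hz1
    rw [mem_ball_iff_norm]
    refine lt_of_le_of_ne hz1 fun he => ?_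
    have := hle z1 (mem_sphere_iff_norm.2 he)
    rw [he] at h01
    linarith
  have hn : ContDiffAt ℝ 2 (fun w : ℂ => ‖w - c‖ ^ 2) z1 :=
    (((contDiff_id.sub contDiff_const).norm_sq ℝ).contDiffAt)
  have hn' : ContDiffAt ℝ 2 (fun w : ℂ => ε * ‖w - c‖ ^ 2) z1 := contDiffAt_const.mul hn
  have := hsub z1 hz1b (fun w => H w - ε * ‖w - c‖ ^ 2) ((hH2 z1 hz1b).1.sub hn')
    (hmax.isLocalMax (Filter.mem_of_superset (Metric.isOpen_ball.mem_nhds hz1b)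
      Metric.ball_subset_closedBall))
  rw [plap_sub (hH2 z1 hz1b).1 hn', plap_const_mul, plap_norm_sub_sq] at this
  linarith [(hH2 z1 hz1b).2]

open Classical in
/-- Replace a function by its Poisson integral on a disc. -/
def sweep (c : ℂ) (R : ℝ) (s : ℂ → ℝ) (z : ℂ) : ℝ :=
  if z ∈ Metric.ball c R then poisson c R s z else s z

section sweep

variable {D : Set ℂ} {c : ℂ} {R : ℝ} {s : ℂ → ℝ}

lemma sweep_of_mem {z : ℂ} (hz : z ∈ Metric.ball c R) : sweep c R s z = poisson c R s z :=
  if_pos hz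

lemma sweep_of_notMem {z : ℂ} (hz : z ∉ Metric.ball c R) : sweep c R s z = s z := if_neg hz

variable (hD : IsOpen D) (hR : 0 < R) (hB : Metric.closedBall c R ⊆ D) (hs : ContinuousOn s D)
include hR hB hs

lemma circleIntegrable_of_subset : CircleIntegrable s c R :=
  ContinuousOn.circleIntegrable hR.le (hs.mono (Metric.sphere_subset_closedBall.trans hB))

lemma contDiffAt_sweep {n : WithTop ℕ∞} {w : ℂ} (hw : w ∈ Metric.ball c R) :
    ContDiffAt ℝ n (sweep c R s) w ∧ plap (sweep c R s) w = 0 := by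
  have e : sweep c R s =ᶠ[nhds w] poisson c R s := by
    filter_upwards [Metric.isOpen_ball.mem_nhds hw] with x hx using sweep_of_mem hx
  obtain ⟨h1, h2⟩ := contDiffAt_poisson (n := n) (circleIntegrable_of_subset hR hB hs) hw
  exact ⟨h1.congr_of_eventuallyEq e, (plap_congr e).trans h2⟩

include hD in
lemma continuousOn_sweep : ContinuousOn (sweep c R s) D := by
  intro z hz
  refine ContinuousAt.continuousWithinAt ?_
  by_cases h1 : z ∈ Metric.ball c R
  · exact (contDiffAt_sweep (n := 0) hR hB hs h1).1.continuousAt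
  · rw [ContinuousAt, ← nhdsWithin_univ, ← Set.union_compl_self (Metric.ball c R),
      nhdsWithin_union]
    refine Filter.Tendsto.sup ?_ ?_
    · by_cases h2 : z ∈ Metric.sphere c R
      · have := poisson_boundary hR (hs.mono (Metric.sphere_subset_closedBall.trans hB)) h2
        rw [sweep_of_notMem h1]
        exact this.congr' (eventually_nhdsWithin_of_forall fun w hw => (sweep_of_mem hw).symm)
      · have : z ∉ closure (Metric.ball c R) := fun h => by
          have h3 := Metric.closure_ball_subset_closedBall h
          rw [Metric.mem_closedBall] at h3
          rw [Metric.mem_ball] at h1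
          rw [Metric.mem_sphere] at h2
          exact h1 (lt_of_le_of_ne h3 h2)
        rw [mem_closure_iff_nhdsWithin_neBot, Filter.not_neBot] at this
        rw [this]
        exact Filter.tendsto_bot
    · rw [sweep_of_notMem h1]
      exact ((hs.continuousAt (hD.mem_nhds hz)).tendsto.mono_left nhdsWithin_le_nhds).congr'
        (eventually_nhdsWithin_of_forall fun w hw => (sweep_of_notMem hw).symm)

include hD in
lemma le_sweep (hsub : Subharm D s) : ∀ z, s z ≤ sweep c R s z := by
  intro z
  by_cases hz : z ∈ Metric.ball c R
  · refine Subharm.le_of_sphere (hs.mono hB)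
      (fun w hw => hsub w (hB (Metric.ball_subset_closedBall hw)))
      ((continuousOn_sweep hD hR hB hs).mono hB)
      (fun w hw => ⟨(contDiffAt_sweep hR hB hs hw).1, (contDiffAt_sweep (n := 2) hR hB hs hw).2.le⟩)
      (fun w hw => ?_) z (Metric.ball_subset_closedBall hz)
    rw [sweep_of_notMem]
    rw [Metric.mem_sphere] at hw
    simp [hw]
  · rw [sweep_of_notMem hz]

include hD in
lemma subharm_sweep (hsub : Subharm D s) : Subharm D (sweep c R s) := by
  intro z hz ψ hψ hm
  by_cases hzb : z ∈ Metric.ball c R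
  · exact subharm_at (contDiffAt_sweep hR hB hs hzb).1
      (contDiffAt_sweep (n := 2) hR hB hs hzb).2.ge hψ hm
  · refine hsub z hz ψ hψ ?_
    filter_upwards [hm] with w hw
    rw [sweep_of_notMem hzb] at hw
    have := le_sweep hD hR hB hs hsub w
    linarith

include hD in
lemma sweep_le {T : ℂ → ℝ} (hT : ∀ z ∈ D, ContDiffAt ℝ 2 T z ∧ plap T z ≤ 0)
    (hle : ∀ z ∈ D, s z ≤ T z) : ∀ z ∈ D, sweep c R s z ≤ T z := by
  intro z hz
  by_cases hzb : z ∈ Metric.ball c R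
  · refine Subharm.le_of_sphere ((continuousOn_sweep hD hR hB hs).mono hB) ?_
      (fun w hw => (hT w (hB hw)).1.continuousAt.continuousWithinAt)
      (fun w hw => hT w (hB (Metric.ball_subset_closedBall hw))) (fun w hw => ?_) z
      (Metric.ball_subset_closedBall hzb)
    · intro w hw ψ hψ hm
      exact subharm_at (contDiffAt_sweep hR hB hs hw).1
        (contDiffAt_sweep (n := 2) hR hB hs hw).2.ge hψ hm
    · rw [sweep_of_notMem]
      · exact hle w (hB (Metric.sphere_subset_closedBall hw))
      · rw [Metric.mem_sphere] at hw
        simp [hw]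
  · rw [sweep_of_notMem hzb]
    exact hle z hz

end sweep

/-- Bounded monotone limits of Poisson integrals are Poisson integrals. -/
lemma tendsto_poisson {c : ℂ} {R : ℝ} (hR : 0 < R) {s : ℕ → ℂ → ℝ} {h : ℂ → ℝ} {M : ℝ}
    (hs : ∀ n, ContinuousOn (s n) (Metric.sphere c R))
    (hM : ∀ n, ∀ z ∈ Metric.sphere c R, |s n z| ≤ M)
    (hl : ∀ z ∈ Metric.sphere c R, Filter.Tendsto (fun n => s n z) Filter.atTop (nhds (h z))) :
    CircleIntegrable h c R ∧ ∀ w ∈ Metric.ball c R,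
      Filter.Tendsto (fun n => poisson c R (s n) w) Filter.atTop (nhds (poisson c R h w)) := by
  have hmem : ∀ θ, circleMap c R θ ∈ Metric.sphere c R := fun θ => circleMap_mem_sphere c hR.le θ
  have hcm : ∀ n, Continuous fun θ => s n (circleMap c R θ) := fun n =>
    (hs n).comp_continuous (continuous_circleMap c R) hmem
  have hhm : AEStronglyMeasurable (fun θ => h (circleMap c R θ)) :=
    aestronglyMeasurable_of_tendsto_ae Filter.atTop (fun n => (hcm n).aestronglyMeasurable)
      (Filter.Eventually.of_forall fun θ => hl _ (hmem θ))
  have hhM : ∀ z ∈ Metric.sphere c R, |h z| ≤ M := fun z hz =>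
    le_of_tendsto (hl z hz).abs (Filter.Eventually.of_forall fun n => hM n z hz)
  refine ⟨?_, fun w hw => ?_⟩
  · exact (intervalIntegrable_const (c := M)).mono_fun hhm.restrict
      (Filter.Eventually.of_forall fun θ => by
        rw [Real.norm_eq_abs]
        exact (hhM _ (hmem θ)).trans (le_abs_self M))
  · have hcP := continuousOn_poissonKernel hw
    rw [abs_of_pos hR] at hcP
    have hP : Continuous fun θ => poissonKernel c w (circleMap c R θ) :=
      hcP.comp_continuous (continuous_circleMap c R) hmem
    simp only [poisson, circleAverage_def]
    refine Filter.Tendsto.const_smul ?_ _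
    refine intervalIntegral.tendsto_integral_filter_of_dominated_convergence
      (fun θ => |poissonKernel c w (circleMap c R θ)| * M)
      (Filter.Eventually.of_forall fun n => (hP.mul (hcm n)).aestronglyMeasurable)
      (Filter.Eventually.of_forall fun n => Filter.Eventually.of_forall fun θ _ => ?_)
      ((hP.abs.mul continuous_const).intervalIntegrable _ _)
      (Filter.Eventually.of_forall fun θ _ => (hl _ (hmem θ)).const_mul _)
    rw [norm_mul, Real.norm_eq_abs, Real.norm_eq_abs]
    exact mul_le_mul_of_nonneg_left (hM n _ (hmem θ)) (abs_nonneg _)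

/-- There is a harmonic function between a subharmonic and a superharmonic one. -/
lemma exists_harmonic_between {D : Set ℂ} (hD : IsOpen D) {a b : ℂ → ℝ}
    (ha : ∀ z ∈ D, ContDiffAt ℝ 2 a z ∧ 0 ≤ plap a z)
    (hb : ∀ z ∈ D, ContDiffAt ℝ 2 b z ∧ plap b z ≤ 0) (hab : ∀ z ∈ D, a z ≤ b z) :
    ∃ h : ℂ → ℝ, ∀ z ∈ D, ContDiffAt ℝ ∞ h z ∧ plap h z = 0 ∧ a z ≤ h z ∧ h z ≤ b z := by
  rcases D.eq_empty_or_nonempty with rfl | hne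
  · exact ⟨0, by simp⟩
  have hr : ∀ z : ℂ, ∃ r : ℝ, 0 < r ∧ (z ∈ D → Metric.closedBall z r ⊆ D) := fun z => by
    by_cases hz : z ∈ D
    · obtain ⟨r, hr, h⟩ := Metric.nhds_basis_closedBall.mem_iff.1 (hD.mem_nhds hz)
      exact ⟨r, hr, fun _ => h⟩
    · exact ⟨1, one_pos, fun h => absurd h hz⟩
  choose r hr0 hrD using hr
  obtain ⟨t, htD, htc, htU⟩ := TopologicalSpace.countable_cover_nhdsWithin (s := D)
    (f := fun z => Metric.ball z (r z))
    fun z _ => nhdsWithin_le_nhds (Metric.ball_mem_nhds z (hr0 z))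
  have htne : t.Nonempty := by
    obtain ⟨z, hz⟩ := hne
    obtain ⟨w, hw, -⟩ := Set.mem_iUnion₂.1 (htU hz)
    exact ⟨w, hw⟩
  obtain ⟨c, rfl⟩ := htc.exists_eq_range htne
  have hcD : ∀ k, Metric.closedBall (c k) (r (c k)) ⊆ D := fun k =>
    hrD _ (htD (Set.mem_range_self k))
  set s : ℕ → ℂ → ℝ := fun n => Nat.rec a
    (fun n f => sweep (c n.unpair.1) (r (c n.unpair.1)) f) n with hs
  have hs1 : ∀ n, s (n + 1) = sweep (c n.unpair.1) (r (c n.unpair.1)) (s n) := fun n => rfl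
  have hprop : ∀ n, ContinuousOn (s n) D ∧ Subharm D (s n) ∧ ∀ z ∈ D, s n z ≤ b z := by
    intro n
    induction n with
    | zero =>
      exact ⟨fun z hz => (ha z hz).1.continuousAt.continuousWithinAt,
        fun z hz ψ hψ hm => subharm_at (ha z hz).1 (ha z hz).2 hψ hm, hab⟩
    | succ n ih =>
      obtain ⟨h1, h2, h3⟩ := ih
      rw [hs1]
      exact ⟨continuousOn_sweep hD (hr0 _) (hcD _) h1, subharm_sweep hD (hr0 _) (hcD _) h1 h2,
        sweep_le hD (hr0 _) (hcD _) h1 hb h3⟩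
  have hmono : ∀ z, Monotone fun n => s n z := fun z => monotone_nat_of_le_succ fun n => by
    rw [hs1]
    exact le_sweep hD (hr0 _) (hcD _) (hprop n).1 (hprop n).2.1 z
  have hal : ∀ n z, a z ≤ s n z := fun n z => hmono z (Nat.zero_le n)
  set h : ℂ → ℝ := fun z => ⨆ n, s n z with hh
  have hlim : ∀ z ∈ D, Filter.Tendsto (fun n => s n z) Filter.atTop (nhds (h z)) := fun z hz =>
    tendsto_atTop_ciSup (hmono z) ⟨b z, by rintro _ ⟨n, rfl⟩; exact (hprop n).2.2 z hz⟩
  refine ⟨h, fun z hz => ?_⟩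
  have hz2 : a z ≤ h z ∧ h z ≤ b z :=
    ⟨ge_of_tendsto (hlim z hz) (Filter.Eventually.of_forall fun n => hal n z),
      le_of_tendsto (hlim z hz) (Filter.Eventually.of_forall fun n => (hprop n).2.2 z hz)⟩
  obtain ⟨w, ⟨k, rfl⟩, hzk⟩ := Set.mem_iUnion₂.1 (htU hz)
  have hsph : Metric.sphere (c k) (r (c k)) ⊆ D := Metric.sphere_subset_closedBall.trans (hcD k)
  obtain ⟨M1, hM1⟩ := (isCompact_sphere (c k) (r (c k))).exists_bound_of_continuousOn
    (f := a) fun w hw => (ha w (hsph hw)).1.continuousAt.continuousWithinAt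
  obtain ⟨M2, hM2⟩ := (isCompact_sphere (c k) (r (c k))).exists_bound_of_continuousOn
    (f := b) fun w hw => (hb w (hsph hw)).1.continuousAt.continuousWithinAt
  have hpair : Filter.Tendsto (fun j => Nat.pair k j) Filter.atTop Filter.atTop :=
    Filter.tendsto_atTop_mono (fun j => Nat.right_le_pair k j) Filter.tendsto_id
  obtain ⟨hci, hpl⟩ := tendsto_poisson (hr0 (c k)) (s := fun j => s (Nat.pair k j)) (h := h)
    (M := max M1 M2) (fun n => (hprop _).1.mono hsph)
    (fun n w hw => by
      have h1 := abs_le.1 (hM1 w hw)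
      have h2 := abs_le.1 (hM2 w hw)
      have h3 := hal (Nat.pair k n) w
      have h4 := (hprop (Nat.pair k n)).2.2 w (hsph hw)
      rw [abs_le]
      constructor
      · linarith [le_max_left M1 M2]
      · linarith [le_max_right M1 M2])
    (fun w hw => (hlim w (hsph hw)).comp hpair)
  have heq : ∀ w ∈ Metric.ball (c k) (r (c k)), h w = poisson (c k) (r (c k)) h w := by
    intro w hw
    have h1 : Filter.Tendsto (fun j => s (Nat.pair k j + 1) w) Filter.atTop (nhds (h w)) :=
      (hlim w (hcD k (Metric.ball_subset_closedBall hw))).comp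
        ((Filter.tendsto_add_atTop_nat 1).comp hpair)
    refine tendsto_nhds_unique h1 ((hpl w hw).congr fun j => ?_)
    rw [hs1, Nat.unpair_pair, sweep_of_mem hw]
  have e : h =ᶠ[nhds z] poisson (c k) (r (c k)) h := by
    filter_upwards [Metric.isOpen_ball.mem_nhds hzk] with w hw using heq w hw
  obtain ⟨h1, h2⟩ := contDiffAt_poisson (n := ∞) hci hzk
  exact ⟨h1.congr_of_eventuallyEq e, (plap_congr e).trans h2, hz2⟩

end

section

lemma le_of_forall_exists_gt_of_lower_lipschitz {F : ℝ → ℝ} {a b C : ℝ} (hab : a ≤ b)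
    (h1 : ∀ s t, a ≤ s → s ≤ t → t ≤ b → F s - C * (t - s) ≤ F t)
    (h2 : ∀ t, a ≤ t → t < b → ∃ s, t < s ∧ s ≤ b ∧ F t ≤ F s) : F a ≤ F b := by
  set S := {t | a ≤ t ∧ t ≤ b ∧ F a ≤ F t} with hS
  have haS : a ∈ S := ⟨le_rfl, hab, le_rfl⟩
  have hbd : BddAbove S := ⟨b, fun t ht => ht.2.1⟩
  set τ := sSup S with hτ
  have haτ : a ≤ τ := le_csSup hbd haS
  have hτb : τ ≤ b := csSup_le ⟨a, haS⟩ fun t ht => ht.2.1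
  have hFτ : F a ≤ F τ := by
    by_contra hlt
    push Not at hlt
    set ε := (F a - F τ) / (|C| + 1) with hε
    have hε0 : 0 < ε := div_pos (sub_pos.2 hlt) (by positivity)
    obtain ⟨s, hs, hsτ⟩ := exists_lt_of_lt_csSup ⟨a, haS⟩ (sub_lt_self τ hε0)
    have hs2 : s ≤ τ := le_csSup hbd hs
    have h3 := h1 s τ hs.1 hs2 hτb
    have h4 : C * (τ - s) ≤ |C| * ε :=
      mul_le_mul (le_abs_self C) (by linarith) (by linarith) (abs_nonneg _)
    have h5 : (|C| + 1) * ε = F a - F τ := by rw [hε]; field_simp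
    linarith [hs.2.2]
  rcases hτb.lt_or_eq with h | h
  · obtain ⟨s, hs1, hs2, hs3⟩ := h2 τ haτ h
    exact absurd (le_csSup hbd (show s ∈ S from ⟨haτ.trans hs1.le, hs2, hFτ.trans hs3⟩)) (not_le.2 hs1)
  · exact h ▸ hFτ

/-- The isoperimetric deficit functional. -/
def deficit (c1 c2 : ℝ) (m M : ℝ → ℝ) (t : ℝ) : ℝ :=
  M t * (4 * π - c2 * M t) - exp (2 * t) * (m t * (4 * π - c1 * m t))

section deficit

variable {m M : ℝ → ℝ} {a b c1 c2 g : ℝ}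

lemma deficit_sub {s t : ℝ} :
    deficit c1 c2 m M t - deficit c1 c2 m M s =
      exp (2 * s) * (m s - m t) * ((c2 * M s - c1 * m s) + (c2 * M t - c1 * m t)) +
      ((M s - M t) - exp (2 * s) * (m s - m t)) * (c2 * (M s + M t) - 4 * π) -
      (exp (2 * t) - exp (2 * s)) * (m t * (4 * π - c1 * m t)) := by
  unfold deficit; ring

lemma deficit_ge (hc2 : 0 ≤ c2) (hM0 : ∀ t, 0 ≤ M t) (hm : Antitone m)
    (hcmp : ∀ s t, s ≤ t → exp (2 * s) * (m s - m t) ≤ M s - M t ∧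
      M s - M t ≤ exp (2 * t) * (m s - m t))
    {s t : ℝ} (hst : s ≤ t) :
    exp (2 * s) * (m s - m t) * ((c2 * M s - c1 * m s) + (c2 * M t - c1 * m t)) -
      (exp (2 * t) - exp (2 * s)) * ((m s - m t) * (2 * c2 * M s + 4 * π)) -
      (exp (2 * t) - exp (2 * s)) * (m t * (4 * π - c1 * m t)) ≤
    deficit c1 c2 m M t - deficit c1 c2 m M s := by
  rw [deficit_sub]
  obtain ⟨h1, h2⟩ := hcmp s t hst
  have hd : 0 ≤ m s - m t := sub_nonneg.2 (hm hst)
  have hMst : M t ≤ M s := by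
    have : 0 ≤ exp (2 * s) * (m s - m t) := by positivity
    linarith
  set r := (M s - M t) - exp (2 * s) * (m s - m t) with hr
  have hr0 : 0 ≤ r := by linarith
  have hr1 : r ≤ (exp (2 * t) - exp (2 * s)) * (m s - m t) := by
    rw [hr, sub_mul]; linarith
  have hK : 0 ≤ 2 * c2 * M s + 4 * π := by have := hM0 s; positivity
  have h3 : -(2 * c2 * M s + 4 * π) ≤ c2 * (M s + M t) - 4 * π := by
    have a1 := mul_nonneg hc2 (hM0 s)
    have a2 := mul_nonneg hc2 (hM0 t)
    nlinarith
  have h4 : -(r * (2 * c2 * M s + 4 * π)) ≤ r * (c2 * (M s + M t) - 4 * π) := by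
    rw [← mul_neg]; exact mul_le_mul_of_nonneg_left h3 hr0
  have h5 := mul_le_mul_of_nonneg_right hr1 hK
  linarith

lemma deficit_mono (hc1 : 0 ≤ c1) (hc2 : 0 ≤ c2) (hm0 : ∀ t, 0 ≤ m t) (hM0 : ∀ t, 0 ≤ M t)
    (hm : Antitone m)
    (hcmp : ∀ s t, s ≤ t → exp (2 * s) * (m s - m t) ≤ M s - M t ∧
      M s - M t ≤ exp (2 * t) * (m s - m t))
    (ha : 0 ≤ a) (hab : a ≤ b) (hg : 0 ≤ g)
    (hmR : ∀ t, ContinuousWithinAt m (Set.Ioi t) t) (hMR : ∀ t, ContinuousWithinAt M (Set.Ioi t) t)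
    (hP0 : ∀ t, a ≤ t → t ≤ b → 0 ≤ c2 * M t - c1 * m t)
    (hP : ∀ t, a ≤ t → t < b → 0 < m t → 0 < c2 * M t - c1 * m t)
    (hz : ∀ t, a ≤ t → t < b → m t = 0 → g = 0 ∧ M t = 0)
    (hstep : ∀ t, a ≤ t → t < b → 0 < m t → ∀ ε > 0, ∀ᶠ δ in nhdsWithin 0 (Set.Ioi (0 : ℝ)),
      δ * (m t * (4 * π - c1 * m t) + g - ε) ≤ (m t - m (t + δ)) * (c2 * M t - c1 * m t)) :
    deficit c1 c2 m M a + 2 * g * (b - a) ≤ deficit c1 c2 m M b := by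
  have hMa : Antitone M := fun s t hst => by
    have h1 := (hcmp s t hst).1
    have : 0 ≤ exp (2 * s) * (m s - m t) := mul_nonneg (exp_pos _).le (sub_nonneg.2 (hm hst))
    linarith
  suffices H : ∀ ε > 0, deficit c1 c2 m M a - (2 * g - ε) * a ≤
      deficit c1 c2 m M b - (2 * g - ε) * b by
    refine le_of_forall_pos_le_add fun ε hε => ?_
    have hba : 0 < b - a + 1 := by linarith
    have h1 := H (ε / (b - a + 1)) (div_pos hε hba)
    have h2 : ε / (b - a + 1) * (b - a) ≤ ε := by
      rw [div_mul_eq_mul_div, div_le_iff₀ hba]; nlinarith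
    linarith
  intro ε hε
  have hE : ∀ s t : ℝ, s ≤ t → t ≤ b → exp (2 * t) - exp (2 * s) ≤ 2 * exp (2 * b) * (t - s) := by
    intro s t hst htb
    have h1 := add_one_le_exp (2 * s - 2 * t)
    have h2 : exp (2 * s) = exp (2 * t) * exp (2 * s - 2 * t) := by rw [← exp_add]; ring_nf
    have h3 : exp (2 * t) ≤ exp (2 * b) := exp_le_exp.2 (by linarith)
    have h4 : exp (2 * t) - exp (2 * s) ≤ exp (2 * t) * (2 * (t - s)) := by
      rw [h2]; nlinarith [exp_pos (2 * t)]
    have h5 := mul_le_mul_of_nonneg_right h3 (show 0 ≤ 2 * (t - s) by linarith)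
    linarith
  refine le_of_forall_exists_gt_of_lower_lipschitz (F := fun t => deficit c1 c2 m M t -
    (2 * g - ε) * t) (C := 2 * exp (2 * b) * (m a * (2 * c2 * M a + 4 * π) + m a * (4 * π)) +
      |2 * g - ε|) hab ?_ ?_
  · intro s t has hst htb
    have h1 := deficit_ge (c1 := c1) hc2 hM0 hm hcmp hst
    have hd : 0 ≤ m s - m t := sub_nonneg.2 (hm hst)
    have h2 : 0 ≤ exp (2 * s) * (m s - m t) *
        ((c2 * M s - c1 * m s) + (c2 * M t - c1 * m t)) :=
      mul_nonneg (mul_nonneg (exp_pos _).le hd)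
        (add_nonneg (hP0 s has (hst.trans htb)) (hP0 t (has.trans hst) htb))
    have hE0 : 0 ≤ exp (2 * t) - exp (2 * s) := sub_nonneg.2 (exp_le_exp.2 (by linarith))
    have hms : m s ≤ m a := hm has
    have hMs : M s ≤ M a := hMa has
    have h3 : (m s - m t) * (2 * c2 * M s + 4 * π) ≤ m a * (2 * c2 * M a + 4 * π) := by
      have q1 := hm0 t
      have q2 := hM0 s
      refine mul_le_mul (by linarith) ?_ (by positivity) (hm0 a)
      linarith [mul_le_mul_of_nonneg_left hMs hc2]
    have h4 : m t * (4 * π - c1 * m t) ≤ m a * (4 * π) := by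
      have h5 : m t ≤ m a := hm (has.trans hst)
      have h6 : 0 ≤ c1 * m t := mul_nonneg hc1 (hm0 t)
      nlinarith [hm0 t, pi_pos]
    have hK0 : 0 ≤ m a * (2 * c2 * M a + 4 * π) + m a * (4 * π) := by
      have := hM0 a
      have := hm0 a
      positivity
    have h7 := mul_le_mul_of_nonneg_left (add_le_add h3 h4) hE0
    have h8 := mul_le_mul_of_nonneg_right (hE s t hst htb) hK0
    have h9 : (2 * g - ε) * (t - s) ≤ |2 * g - ε| * (t - s) :=
      mul_le_mul_of_nonneg_right (le_abs_self _) (sub_nonneg.2 hst)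
    linarith
  · intro t hat htb
    rcases (hm0 t).eq_or_lt with h0 | h0
    · obtain ⟨hg0, hMt⟩ := hz t hat htb h0.symm
      have hmb : m b = 0 := le_antisymm ((hm htb.le).trans h0.symm.le) (hm0 b)
      have hMb : M b = 0 := le_antisymm ((hMa htb.le).trans hMt.le) (hM0 b)
      refine ⟨b, htb, le_rfl, ?_⟩
      simp only [deficit, hmb, hMb, ← h0, hMt, hg0]
      nlinarith
    · have hPt := hP t hat htb h0
      set P := c2 * M t - c1 * m t with hPdef
      set X := m t * (4 * π - c1 * m t) with hX
      set e := exp (2 * t) with he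
      have he0 : 0 < e := exp_pos _
      have he1 : 1 ≤ e := one_le_exp (by linarith)
      have hsh : Filter.Tendsto (fun δ : ℝ => t + δ) (nhdsWithin 0 (Set.Ioi 0))
          (nhdsWithin t (Set.Ioi t)) := by
        refine tendsto_nhdsWithin_iff.2 ⟨?_, ?_⟩
        · have : Filter.Tendsto (fun δ : ℝ => t + δ) (nhds 0) (nhds (t + 0)) :=
            (continuous_const.add continuous_id).tendsto 0
          rw [add_zero] at this
          exact this.mono_left nhdsWithin_le_nhds
        · exact eventually_nhdsWithin_of_forall fun δ hδ => by
            have : (0 : ℝ) < δ := hδ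
            simpa using this
      have lm : Filter.Tendsto (fun δ => m (t + δ)) (nhdsWithin 0 (Set.Ioi 0)) (nhds (m t)) :=
        (hmR t).tendsto.comp hsh
      have lM : Filter.Tendsto (fun δ => M (t + δ)) (nhdsWithin 0 (Set.Ioi 0)) (nhds (M t)) :=
        (hMR t).tendsto.comp hsh
      have lE : Filter.Tendsto (fun δ => (exp (2 * (t + δ)) - e) / δ) (nhdsWithin 0 (Set.Ioi 0))
          (nhds (2 * e)) := by
        have hd : HasDerivAt (fun x => exp (2 * x)) (2 * e) t := by
          have := ((hasDerivAt_id t).const_mul 2).exp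
          simpa [he, mul_comm] using this
        have h1 := hd.tendsto_slope_zero_right
        refine h1.congr fun δ => ?_
        rw [smul_eq_mul, div_eq_inv_mul]
      set ε' := ε / (2 * e + 1) with hε'
      have hε0 : 0 < ε' := by positivity
      have lL : Filter.Tendsto (fun δ => e * (X + g - ε') * (1 + (c2 * M (t + δ) -
          c1 * m (t + δ)) / P) - (exp (2 * (t + δ)) - e) / δ *
          ((m t - m (t + δ)) * (2 * c2 * M t + 4 * π)) -
          (exp (2 * (t + δ)) - e) / δ * (m (t + δ) * (4 * π - c1 * m (t + δ))))
          (nhdsWithin 0 (Set.Ioi 0)) (nhds (e * (X + g - ε') * (1 + P / P) - 2 * e *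
          ((m t - m t) * (2 * c2 * M t + 4 * π)) - 2 * e * X)) := by
        refine Filter.Tendsto.sub (Filter.Tendsto.sub ?_ ?_) ?_
        · exact (((((lM.const_mul c2).sub (lm.const_mul c1)).div_const P).const_add 1).const_mul _)
        · exact lE.mul ((lm.const_sub (m t)).mul_const _)
        · exact lE.mul (lm.mul ((lm.const_mul c1).const_sub (4 * π)))
      have hlim : 2 * g - ε < e * (X + g - ε') * (1 + P / P) - 2 * e *
          ((m t - m t) * (2 * c2 * M t + 4 * π)) - 2 * e * X := by
        rw [div_self hPt.ne', sub_self]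
        have h1 : (2 * e + 1) * ε' = ε := by rw [hε']; field_simp
        nlinarith
      have hev := (((lL.eventually (lt_mem_nhds hlim)).and (hstep t hat htb h0 ε' hε0)).and
        (Ioc_mem_nhdsGT (sub_pos.2 htb))).exists
      obtain ⟨δ, ⟨hδ1, hδ2⟩, hδ3, hδ4⟩ := hev
      refine ⟨t + δ, by linarith, by linarith, ?_⟩
      have hge := deficit_ge (c1 := c1) hc2 hM0 hm hcmp (show t ≤ t + δ by linarith)
      rw [← hPdef, ← he] at hge
      set P' := c2 * M (t + δ) - c1 * m (t + δ) with hP'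
      have hP'0 : 0 ≤ P' := hP0 (t + δ) (by linarith) (by linarith)
      have h1 : e * (X + g - ε') * (1 + P' / P) * δ ≤ e * (m t - m (t + δ)) * (P + P') := by
        have : (1 + P' / P) * P = P + P' := by field_simp
        rw [← this]
        have h2 := mul_le_mul_of_nonneg_left hδ2
          (show 0 ≤ e * (1 + P' / P) from mul_nonneg he0.le (by positivity))
        linarith
      have h3 := mul_lt_mul_of_pos_right hδ1 hδ3
      have h4 : ∀ y, (exp (2 * (t + δ)) - e) / δ * y * δ = (exp (2 * (t + δ)) - e) * y := fun y => by
        field_simp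
      rw [sub_mul, sub_mul, sub_mul, h4, h4] at h3
      show deficit c1 c2 m M t - (2 * g - ε) * t ≤
        deficit c1 c2 m M (t + δ) - (2 * g - ε) * (t + δ)
      linarith

end deficit

end

lemma exists_ramp {a b k : ℝ} (hab : a < b) (hk : 1 < k * (b - a)) :
    ∃ θ : ℝ → ℝ, ContDiff ℝ 1 θ ∧ (∀ x ≤ a, θ x = 0) ∧ (∀ x, b ≤ x → θ x = 1) ∧
      (∀ x, 0 ≤ deriv θ x) ∧ (∀ x, deriv θ x ≤ k) ∧
      (∀ x, b < x → deriv θ x = 0) ∧ ∀ x, θ x ∈ Set.Icc (0 : ℝ) 1 := by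
  have hk0 : 0 < k := by
    by_contra h
    push Not at h
    nlinarith
  set ε := (b - a - 1 / k) / 2 with hε
  have hε0 : 0 < ε := by
    have : 1 / k < b - a := by rw [div_lt_iff₀ hk0]; linarith
    rw [hε]; linarith
  have hk1 : 0 < 1 / k := by positivity
  set ρ : ℝ → ℝ := fun x => max 0 (min 1 (min ((x - a) / ε) ((b - x) / ε))) with hρ
  have hρc : Continuous ρ := by fun_prop
  have hρ0 : ∀ x, 0 ≤ ρ x := fun x => le_max_left _ _
  have hρ1 : ∀ x, ρ x ≤ 1 := fun x => max_le zero_le_one (min_le_left _ _)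
  have hρa : ∀ x ≤ a, ρ x = 0 := fun x hx => max_eq_left <| (min_le_right _ _).trans <|
    (min_le_left _ _).trans (div_nonpos_of_nonpos_of_nonneg (by linarith) hε0.le)
  have hρb : ∀ x, b ≤ x → ρ x = 0 := fun x hx => max_eq_left <| (min_le_right _ _).trans <|
    (min_le_right _ _).trans (div_nonpos_of_nonpos_of_nonneg (by linarith) hε0.le)
  have hii : ∀ x y, IntervalIntegrable ρ volume x y := fun x y => hρc.intervalIntegrable x y
  set I := ∫ x in a..b, ρ x with hI
  have hIk : 1 / k ≤ I := by
    have h1 : ∫ x in (a + ε)..(b - ε), (1 : ℝ) ≤ ∫ x in (a + ε)..(b - ε), ρ x := by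
      refine intervalIntegral.integral_mono_on (by linarith) (by simp) (hii _ _) fun x hx => ?_
      refine le_max_of_le_right (le_min le_rfl (le_min ?_ ?_))
      · rw [le_div_iff₀ hε0]; linarith [hx.1]
      · rw [le_div_iff₀ hε0]; linarith [hx.2]
    have h2 : ∫ x in (a + ε)..(b - ε), ρ x ≤ I := by
      refine intervalIntegral.integral_mono_interval (by linarith) (by linarith) (by linarith)
        (Filter.Eventually.of_forall hρ0) (hii _ _)
    simp at h1
    linarith
  have hI0 : 0 < I := hk1.trans_le hIk
  have hd : ∀ x, HasDerivAt (fun x => (∫ t in a..x, ρ t) / I) (ρ x / I) x := fun x =>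
    (intervalIntegral.integral_hasDerivAt_right (hii _ _)
      (hρc.stronglyMeasurableAtFilter _ _) hρc.continuousAt).div_const I
  have hd' : deriv (fun x => (∫ t in a..x, ρ t) / I) = fun x => ρ x / I :=
    funext fun x => (hd x).deriv
  have ha0 : ∀ x ≤ a, (∫ t in a..x, ρ t) / I = 0 := fun x hx => by
    rw [intervalIntegral.integral_symm, intervalIntegral.integral_congr (g := fun _ => 0)]
    · simp
    · intro t ht
      rw [Set.uIcc_of_le hx] at ht
      exact hρa t ht.2
  have hb1 : ∀ x, b ≤ x → (∫ t in a..x, ρ t) / I = 1 := fun x hx => by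
    rw [← intervalIntegral.integral_add_adjacent_intervals (hii a b) (hii b x),
      intervalIntegral.integral_congr (a := b) (g := fun _ => 0)]
    · simp only [intervalIntegral.integral_zero, add_zero]
      exact div_self hI0.ne'
    · intro t ht
      rw [Set.uIcc_of_le hx] at ht
      exact hρb t ht.1
  have hmono : Monotone fun x => (∫ t in a..x, ρ t) / I :=
    monotone_of_hasDerivAt_nonneg hd fun x => div_nonneg (hρ0 x) hI0.le
  refine ⟨fun x => (∫ t in a..x, ρ t) / I, ?_, ha0, hb1, ?_, ?_, ?_, ?_⟩
  · rw [contDiff_one_iff_deriv, hd']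
    exact ⟨fun x => (hd x).differentiableAt, hρc.div_const _⟩
  · intro x; rw [hd']; exact div_nonneg (hρ0 x) hI0.le
  · intro x; rw [hd']
    have : 1 ≤ k * I := by rwa [div_le_iff₀ hk0, mul_comm] at hIk
    exact (div_le_iff₀ hI0).2 ((hρ1 x).trans this)
  · intro x hx; rw [hd']; simp [hρb x hx.le]
  · intro x
    constructor
    · have h1 := hmono (min_le_left x a)
      simp only [ha0 _ (min_le_right x a)] at h1
      exact h1
    · have h1 := hmono (le_max_left x b)
      simp only [hb1 _ (le_max_right x b)] at h1
      exact h1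

lemma integral_mul_sq_le {X : Type*} [MeasurableSpace X] {μ : Measure X} {u v : X → ℝ}
    (hum : AEStronglyMeasurable u μ) (hvm : AEStronglyMeasurable v μ)
    (hu : Integrable (fun x => u x ^ 2) μ) (hv : Integrable (fun x => v x ^ 2) μ) :
    (∫ x, u x * v x ∂μ) ^ 2 ≤ (∫ x, u x ^ 2 ∂μ) * ∫ x, v x ^ 2 ∂μ := by
  have huv : Integrable (fun x => u x * v x) μ := by
    refine (hu.add hv).mono' (hum.mul hvm) (Filter.Eventually.of_forall fun x => ?_)
    rw [norm_mul, norm_eq_abs, norm_eq_abs, Pi.add_apply, ← sq_abs (u x), ← sq_abs (v x)]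
    nlinarith [sq_nonneg (|u x| - |v x|), abs_nonneg (u x), abs_nonneg (v x)]
  have h := discrim_le_zero (a := ∫ x, u x ^ 2 ∂μ) (b := -2 * ∫ x, u x * v x ∂μ)
    (c := ∫ x, v x ^ 2 ∂μ) fun y => by
      have h1 : 0 ≤ ∫ x, (y * u x - v x) ^ 2 ∂μ := integral_nonneg fun x => sq_nonneg _
      have h2 : ∀ x, (y * u x - v x) ^ 2 = y * y * u x ^ 2 - 2 * y * (u x * v x) + v x ^ 2 :=
        fun x => by ring
      simp only [h2] at h1
      have i1 := hu.const_mul (y * y)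
      have i2 := huv.const_mul (2 * y)
      have i3 : Integrable (fun x => y * y * u x ^ 2 - 2 * y * (u x * v x)) μ := i1.sub i2
      rw [integral_add i3 hv, integral_sub i1 i2, integral_const_mul,
        integral_const_mul] at h1
      linarith
  rw [discrim] at h
  nlinarith

lemma measurableSet_superlevel {D : Set ℂ} {η : ℂ → ℝ} (hD : IsOpen D) (hη : ContinuousOn η D)
    (t : ℝ) : MeasurableSet {z ∈ D | t < η z} :=
  (hη.isOpen_inter_preimage hD isOpen_Ioi).measurableSet

lemma integral_superlevel_le {D : Set ℂ} (hD : IsOpen D) (hb : Bornology.IsBounded D)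
    (hDc : IsPreconnected Dᶜ) {h η Q : ℂ → ℝ} (hh : ∀ z ∈ D, ContDiffAt ℝ 2 h z)
    (h0 : ∀ z ∈ D, plap h z = 0) (hη : ∀ z ∈ D, ContDiffAt ℝ 2 η z) {t δ : ℝ} (hδ : 0 < δ)
    (hK : ∀ s, t < s → IsCompact {z ∈ D | s ≤ η z})
    (hQ : ∀ z ∈ D, -plap η z ≤ Q z) (hQ0 : ∀ z ∈ D, 0 ≤ Q z)
    (hQi : IntegrableOn Q D) (hhi : IntegrableOn (fun z => exp (2 * h z)) D) :
    4 * π * δ * ∫ z in {z ∈ D | t + δ < η z}, exp (2 * h z) ≤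
      ((∫ z in {z ∈ D | t < η z}, exp (2 * h z)) - ∫ z in {z ∈ D | t + δ < η z}, exp (2 * h z)) *
        ∫ z in {z ∈ D | t < η z}, Q z := by
  have hηc : ContinuousOn η D := fun z hz => (hη z hz).continuousAt.continuousWithinAt
  have hhc : ContinuousOn h D := fun z hz => (hh z hz).continuousAt.continuousWithinAt
  set A := {z ∈ D | t < η z} with hA
  set B := {z ∈ D | t + δ < η z} with hB
  have hAm : MeasurableSet A := measurableSet_superlevel hD hηc t
  have hBm : MeasurableSet B := measurableSet_superlevel hD hηc (t + δ)
  have hAD : A ⊆ D := fun z hz => hz.1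
  have hBA : B ⊆ A := fun z hz => ⟨hz.1, by linarith [hz.2]⟩
  have hLi : IntegrableOn (fun z => exp (2 * h z)) (A \ B) :=
    hhi.mono_set (Set.sdiff_subset.trans hAD)
  rw [← setIntegral_sdiff hBm (hhi.mono_set hAD) hBA]
  set E := ∫ z in A \ B, exp (2 * h z) with hE
  have hE0 : 0 ≤ E := integral_nonneg fun z => (exp_pos _).le
  set q := ∫ z in A, Q z with hq
  have hq0 : 0 ≤ q := setIntegral_nonneg hAm fun z hz => hQ0 z hz.1
  suffices H : ∀ k, 1 / δ < k → 4 * π * ∫ z in B, exp (2 * h z) ≤ k * (E * q) by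
    have h1 : 4 * π * ∫ z in B, exp (2 * h z) ≤ 1 / δ * (E * q) := by
      refine ge_of_tendsto (f := fun k => k * (E * q)) (x := nhdsWithin (1 / δ) (Set.Ioi (1 / δ)))
        ?_ (eventually_nhdsWithin_of_forall H)
      exact ((continuous_id.mul continuous_const).tendsto _).mono_left nhdsWithin_le_nhds
    have h2 := mul_le_mul_of_nonneg_right h1 hδ.le
    have h3 : 1 / δ * (E * q) * δ = E * q := by field_simp
    linarith
  intro k hk
  have hk0 : 0 < k := lt_trans (by positivity) hk
  have hk1 : 1 < k * δ := by rwa [div_lt_iff₀ hδ] at hk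
  obtain ⟨t', ht1, ht2⟩ : ∃ t', t < t' ∧ 1 < k * (t + δ - t') := by
    refine ⟨t + (δ - 1 / k) / 2, ?_, ?_⟩
    · have : 1 / k < δ := by rw [div_lt_iff₀ hk0]; linarith
      linarith
    · have : k * (t + δ - (t + (δ - 1 / k) / 2)) = (k * δ + 1) / 2 := by field_simp; ring
      rw [this]; linarith
  have htb : t' < t + δ := by
    by_contra hc
    push Not at hc
    nlinarith
  obtain ⟨θ, hθ, hθa, hθb, hd0, hdk, hdb, hθI⟩ := exists_ramp htb ht2
  set K := {z ∈ D | t' ≤ η z} with hKdef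
  have hKc : IsCompact K := hK t' ht1
  classical
  set f : ℂ → ℝ := fun z => if z ∈ D then θ (η z) else 0 with hf
  have hfD : ∀ z ∈ D, f =ᶠ[nhds z] fun w => θ (η w) := fun z hz => by
    filter_upwards [hD.mem_nhds hz] with w hw
    simp [hf, hw]
  have hfe : ∀ z ∈ D, f z = θ (η z) := fun z hz => (hfD z hz).eq_of_nhds
  have hfK : ∀ z ∉ K, f z = 0 := fun z hz => by
    by_cases hzD : z ∈ D
    · rw [hfe z hzD]
      exact hθa _ (le_of_not_ge fun hc => hz ⟨hzD, hc⟩)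
    · simp [hf, hzD]
  have hKD : K ⊆ D := fun z hz => hz.1
  have hf1 : ContDiff ℝ 1 f := contDiff_of_zero_off hKc.isClosed hfK fun z hz =>
    (hθ.contDiffAt.comp z ((hη z hz.1).of_le one_le_two)).congr_of_eventuallyEq (hfD z hz.1)
  have hfc : HasCompactSupport f := hasCompactSupport_of_zero_off hKc hfK
  have hfs : tsupport f ⊆ K := tsupport_subset_of_zero_off hKc.isClosed hfK
  have hf0 : ∀ z, 0 ≤ f z := fun z => by
    by_cases hzD : z ∈ D
    · rw [hfe z hzD]; exact (hθI _).1
    · simp [hf, hzD]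
  have hfle : ∀ z, f z ≤ 1 := fun z => by
    by_cases hzD : z ∈ D
    · rw [hfe z hzD]; exact (hθI _).2
    · simp [hf, hzD]
  have hdηz : ∀ z ∈ D, DifferentiableAt ℝ η z := fun z hz =>
    differentiableAt_of_contDiffAt (hη z hz) (by norm_num)
  have hdx : ∀ z ∈ D, dx f z = deriv θ (η z) * dx η z := fun z hz => by
    rw [dx_congr (hfD z hz), dx_comp ((hθ.differentiable one_ne_zero) _) (hdηz z hz)]
  have hdy : ∀ z ∈ D, dy f z = deriv θ (η z) * dy η z := fun z hz => by
    rw [dy_congr (hfD z hz), dy_comp ((hθ.differentiable one_ne_zero) _) (hdηz z hz)]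
  have hdx0 : ∀ z ∉ K, dx f z = 0 := fun z hz => dx_eq_zero_of_notMem fun h => hz (hfs h)
  have hdy0 : ∀ z ∉ K, dy f z = 0 := fun z hz => dy_eq_zero_of_notMem fun h => hz (hfs h)
  have hgc : Continuous (gnorm f) :=
    (((continuous_dx hf1).pow 2).add ((continuous_dy hf1).pow 2)).sqrt
  have hg0 : ∀ z ∉ K, gnorm f z = 0 := fun z hz => by simp [gnorm, hdx0 z hz, hdy0 z hz]
  have hglayer : ∀ z ∉ A \ B, gnorm f z = 0 := fun z hz => by
    by_cases hzK : z ∈ K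
    · have hzA : z ∈ A := ⟨hzK.1, ht1.trans_le hzK.2⟩
      have hzB : z ∈ B := by
        by_contra hc
        exact hz ⟨hzA, hc⟩
      simp [gnorm, hdx z hzK.1, hdy z hzK.1, hdb _ hzB.2]
    · exact hg0 z hzK
  have hsob := weighted_sobolev hD hb hDc hh h0 hf1 hfc (hfs.trans hKD) hf0
  have hL : ∫ z in B, exp (2 * h z) ≤ ∫ z, f z ^ 2 * exp (2 * h z) := by
    rw [← integral_indicator hBm]
    refine integral_mono_of_nonneg (Filter.Eventually.of_forall fun z =>
      Set.indicator_nonneg (fun _ _ => (exp_pos _).le) z) ?_ (Filter.Eventually.of_forall fun z => ?_)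
    · refine integrable_of_zero_off hKc (fun z hz => by simp [hfK z hz]) fun z hz => ?_
      exact (hf1.continuous.continuousAt.pow 2).mul
        (((hh z hz.1).continuousAt.const_mul 2).rexp)
    · by_cases hz : z ∈ B
      · simp [Set.indicator_of_mem hz, hfe z hz.1, hθb _ hz.2.le]
      · rw [Set.indicator_of_notMem hz]; positivity
  have hR1 : ∫ z, gnorm f z * exp (h z) =
      ∫ z, gnorm f z * (A \ B).indicator (fun z => exp (h z)) z := by
    refine integral_congr_ae (Filter.Eventually.of_forall fun z => ?_)
    by_cases hz : z ∈ A \ B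
    · simp only [Set.indicator_of_mem hz]
    · simp [hglayer z hz]
  have hsq : ∀ z, (A \ B).indicator (fun z => exp (h z)) z ^ 2 =
      (A \ B).indicator (fun z => exp (2 * h z)) z := fun z => by
    by_cases hz : z ∈ A \ B
    · simp only [Set.indicator_of_mem hz]; rw [← exp_nat_mul]; norm_num
    · simp [Set.indicator_of_notMem hz]
  have hCS := integral_mul_sq_le (μ := volume) (u := gnorm f)
    (v := (A \ B).indicator fun z => exp (h z)) hgc.aestronglyMeasurable
    ((aestronglyMeasurable_indicator_iff (hAm.diff hBm)).2
      ((hhc.rexp.mono (Set.sdiff_subset.trans hAD)).aestronglyMeasurable (hAm.diff hBm)))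
    (integrable_of_zero_off hKc (fun z hz => by simp [hg0 z hz])
      fun z _ => (hgc.pow 2).continuousAt)
    (by simp only [hsq]; exact hLi.integrable_indicator (hAm.diff hBm))
  simp only [hsq] at hCS
  rw [integral_indicator (hAm.diff hBm), ← hR1, ← hE] at hCS
  have hgreen := integral_mul_plap hf1 hfc (hfs.trans hKD) hη
  have hdi : Integrable fun z => dx f z * dx η z + dy f z * dy η z := by
    refine integrable_of_zero_off hKc (fun z hz => by simp [hdx0 z hz, hdy0 z hz]) fun z hz => ?_
    have h1 := (hη z hz.1).of_le one_le_two
    exact ((continuous_dx hf1).continuousAt.mul (continuousAt_dx h1)).add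
      ((continuous_dy hf1).continuousAt.mul (continuousAt_dy h1))
  have hG : ∫ z, gnorm f z ^ 2 ≤ k * ∫ z, (dx f z * dx η z + dy f z * dy η z) := by
    rw [← integral_const_mul]
    refine integral_mono_of_nonneg (Filter.Eventually.of_forall fun z => sq_nonneg _)
      (hdi.const_mul _) (Filter.Eventually.of_forall fun z => ?_)
    show gnorm f z ^ 2 ≤ k * (dx f z * dx η z + dy f z * dy η z)
    by_cases hz : z ∈ K
    · rw [gnorm_sq, hdx z hz.1, hdy z hz.1]
      have h1 : 0 ≤ deriv θ (η z) * (dx η z ^ 2 + dy η z ^ 2) := mul_nonneg (hd0 _) (by positivity)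
      have h2 := mul_le_mul_of_nonneg_right (hdk (η z)) h1
      linarith
    · simp [hg0 z hz, hdx0 z hz, hdy0 z hz]
  have hq1 : ∫ z, (dx f z * dx η z + dy f z * dy η z) ≤ q := by
    have h1 : ∫ z, (dx f z * dx η z + dy f z * dy η z) = ∫ z, f z * -plap η z := by
      have : ∀ z, f z * -plap η z = -(f z * plap η z) := fun z => by ring
      simp only [this]
      rw [integral_neg, hgreen, neg_neg]
    rw [h1, hq, ← integral_indicator hAm]
    refine integral_mono ?_ ((hQi.mono_set hAD).integrable_indicator hAm) fun z => ?_
    · refine integrable_of_zero_off hKc (fun z hz => by simp [hfK z hz]) fun z hz => ?_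
      exact hf1.continuous.continuousAt.mul (continuousAt_plap (hη z hz.1)).neg
    · by_cases hz : z ∈ A
      · simp only [Set.indicator_of_mem hz]
        have h2 := mul_le_mul_of_nonneg_left (hQ z hz.1) (hf0 z)
        have h3 := mul_le_mul_of_nonneg_right (hfle z) (hQ0 z hz.1)
        linarith
      · have : z ∉ K := fun hzK => hz ⟨hzK.1, ht1.trans_le hzK.2⟩
        simp [Set.indicator_of_notMem hz, hfK z this]
  calc 4 * π * ∫ z in B, exp (2 * h z) ≤ 4 * π * ∫ z, f z ^ 2 * exp (2 * h z) := by gcongr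
    _ ≤ (∫ z, gnorm f z * exp (h z)) ^ 2 := hsob
    _ ≤ (∫ z, gnorm f z ^ 2) * E := hCS
    _ ≤ (k * q) * E := by
        refine mul_le_mul_of_nonneg_right (hG.trans ?_) hE0
        exact mul_le_mul_of_nonneg_left hq1 hk0.le
    _ = k * (E * q) := by ring

section

/-- The mass of `w` on the superlevel set `{t < η}` of `η` in `D`. -/
def lev (D : Set ℂ) (η w : ℂ → ℝ) (t : ℝ) : ℝ := ∫ z in {z ∈ D | t < η z}, w z

section lev

variable {D : Set ℂ} {η w : ℂ → ℝ}

lemma lev_nonneg (hD : IsOpen D) (hη : ContinuousOn η D) (hw0 : ∀ z ∈ D, 0 ≤ w z) (t : ℝ) :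
    0 ≤ lev D η w t :=
  setIntegral_nonneg (measurableSet_superlevel hD hη t) fun z hz => hw0 z hz.1

lemma lev_eq_zero {t : ℝ} (h : ∀ z ∈ D, η z ≤ t) : lev D η w t = 0 := by
  have : {z ∈ D | t < η z} = ∅ := Set.eq_empty_of_forall_notMem fun z hz =>
    absurd hz.2 (not_lt.2 (h z hz.1))
  rw [lev, this, setIntegral_empty]

lemma lev_sub (hD : IsOpen D) (hη : ContinuousOn η D) (hw : IntegrableOn w D) {s t : ℝ}
    (hst : s ≤ t) : lev D η w s - lev D η w t =
      ∫ z in {z ∈ D | s < η z} \ {z ∈ D | t < η z}, w z := by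
  rw [setIntegral_sdiff (measurableSet_superlevel hD hη t) (hw.mono_set fun z hz => hz.1)
    (show {z ∈ D | t < η z} ⊆ {z ∈ D | s < η z} from fun z hz => ⟨hz.1, hst.trans_lt hz.2⟩),
    lev, lev]

lemma lev_antitone (hD : IsOpen D) (hη : ContinuousOn η D) (hw0 : ∀ z ∈ D, 0 ≤ w z)
    (hw : IntegrableOn w D) : Antitone (lev D η w) := fun s t hst => by
  rw [← sub_nonneg, lev_sub hD hη hw hst]
  exact setIntegral_nonneg ((measurableSet_superlevel hD hη s).diff
    (measurableSet_superlevel hD hη t)) fun z hz => hw0 z hz.1.1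

lemma lev_continuousWithinAt (hD : IsOpen D) (hη : ContinuousOn η D) (hw : IntegrableOn w D)
    (t : ℝ) : ContinuousWithinAt (lev D η w) (Set.Ioi t) t := by
  have h1 : ∀ s, lev D η w s = ∫ z in D, {z ∈ D | s < η z}.indicator w z := fun s => by
    rw [setIntegral_indicator (measurableSet_superlevel hD hη s), lev]
    congr 2
    ext z
    exact ⟨fun h => ⟨h.1, h⟩, fun h => h.2⟩
  unfold ContinuousWithinAt
  rw [h1 t, funext h1]
  refine tendsto_integral_filter_of_dominated_convergence (fun z => ‖w z‖) ?_ ?_ hw.norm ?_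
  · exact Filter.Eventually.of_forall fun s =>
      hw.aestronglyMeasurable.indicator (measurableSet_superlevel hD hη s)
  · exact Filter.Eventually.of_forall fun s => Filter.Eventually.of_forall fun z =>
      norm_indicator_le_norm_self _ _
  · refine (ae_restrict_mem hD.measurableSet).mono fun z hz => ?_
    refine tendsto_const_nhds.congr' ?_
    by_cases h : t < η z
    · filter_upwards [mem_nhdsWithin_of_mem_nhds (Iio_mem_nhds h)] with s hs
      rw [Set.indicator_of_mem (show z ∈ {z ∈ D | t < η z} from ⟨hz, h⟩),
        Set.indicator_of_mem (show z ∈ {z ∈ D | s < η z} from ⟨hz, hs⟩)]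
    · filter_upwards [self_mem_nhdsWithin] with s hs
      rw [Set.indicator_of_notMem (fun hc : z ∈ {z ∈ D | t < η z} => h hc.2),
        Set.indicator_of_notMem (fun hc : z ∈ {z ∈ D | s < η z} => h (lt_trans hs hc.2))]

lemma lev_cmp (hD : IsOpen D) (hη : ContinuousOn η D) (hw0 : ∀ z ∈ D, 0 ≤ w z)
    (hw : IntegrableOn w D) {W : ℂ → ℝ} (hW : IntegrableOn W D)
    (hWw : ∀ z ∈ D, W z = exp (2 * η z) * w z) {s t : ℝ} (hst : s ≤ t) :
    exp (2 * s) * (lev D η w s - lev D η w t) ≤ lev D η W s - lev D η W t ∧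
      lev D η W s - lev D η W t ≤ exp (2 * t) * (lev D η w s - lev D η w t) := by
  rw [lev_sub hD hη hw hst, lev_sub hD hη hW hst, ← integral_const_mul, ← integral_const_mul]
  have hL := (measurableSet_superlevel hD hη s).diff (measurableSet_superlevel hD hη t)
  have hLD : {z ∈ D | s < η z} \ {z ∈ D | t < η z} ⊆ D := fun z hz => hz.1.1
  constructor
  · refine setIntegral_mono_on ((hw.mono_set hLD).const_mul _) (hW.mono_set hLD) hL fun z hz => ?_
    rw [hWw z hz.1.1]
    exact mul_le_mul_of_nonneg_right (exp_le_exp.2 (by linarith [hz.1.2])) (hw0 z hz.1.1)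
  · refine setIntegral_mono_on (hW.mono_set hLD) ((hw.mono_set hLD).const_mul _) hL fun z hz => ?_
    rw [hWw z hz.1.1]
    have : η z ≤ t := le_of_not_gt fun hc => hz.2 ⟨hz.1.1, hc⟩
    exact mul_le_mul_of_nonneg_right (exp_le_exp.2 (by linarith)) (hw0 z hz.1.1)

end lev

lemma tendsto_add_nhdsGT (t : ℝ) : Filter.Tendsto (fun δ : ℝ => t + δ)
    (nhdsWithin 0 (Set.Ioi 0)) (nhdsWithin t (Set.Ioi t)) := by
  refine tendsto_nhdsWithin_iff.2 ⟨?_, ?_⟩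
  · have : Filter.Tendsto (fun δ : ℝ => t + δ) (nhds 0) (nhds (t + 0)) :=
      (continuous_const.add continuous_id).tendsto 0
    rw [add_zero] at this
    exact this.mono_left nhdsWithin_le_nhds
  · exact eventually_nhdsWithin_of_forall fun δ hδ => by
      have : (0 : ℝ) < δ := hδ
      simpa using this

/-- Alexandrov-type inequality: comparing the area of a metric of curvature at most `κ` with the
area of the flat metric having the same boundary length. -/
lemma alexandrov {D : Set ℂ} (hD : IsOpen D) (hb : Bornology.IsBounded D)
    (hDc : IsPreconnected Dᶜ) {h V : ℂ → ℝ} {κ T : ℝ} (hκ : 0 < κ)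
    (hh : ∀ z ∈ D, ContDiffAt ℝ 2 h z) (h0 : ∀ z ∈ D, plap h z = 0)
    (hV : ∀ z ∈ D, ContDiffAt ℝ 2 V z) (hVκ : ∀ z ∈ D, -plap V z ≤ κ * exp (2 * V z))
    (hT : ∀ z ∈ D, V z - h z ≤ T)
    (hK : ∀ s, 0 < s → IsCompact {z ∈ D | s ≤ V z - h z})
    (hVi : IntegrableOn (fun z => exp (2 * V z)) D)
    (hhi : IntegrableOn (fun z => exp (2 * h z)) D) :
    (∫ z in D, exp (2 * V z)) * (4 * π - κ * ∫ z in D, exp (2 * V z)) ≤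
      4 * π * ∫ z in D, exp (2 * h z) := by
  set η : ℂ → ℝ := fun z => V z - h z with hη
  have hηs : ∀ z ∈ D, ContDiffAt ℝ 2 η z := fun z hz => (hV z hz).sub (hh z hz)
  have hηc : ContinuousOn η D := fun z hz => (hηs z hz).continuousAt.continuousWithinAt
  have hηp : ∀ z ∈ D, -plap η z ≤ κ * exp (2 * V z) := fun z hz => by
    rw [hη, plap_sub (hV z hz) (hh z hz), h0 z hz, sub_zero]
    exact hVκ z hz
  set m := lev D η fun z => exp (2 * h z) with hm
  set M := lev D η fun z => exp (2 * V z) with hM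
  have hcmp : ∀ s t, s ≤ t → exp (2 * s) * (m s - m t) ≤ M s - M t ∧
      M s - M t ≤ exp (2 * t) * (m s - m t) := fun s t hst =>
    lev_cmp hD hηc (fun _ _ => (exp_pos _).le) hhi hVi (fun z _ => by
      rw [← exp_add, hη]; ring_nf) hst
  have hm0 : ∀ t, 0 ≤ m t := lev_nonneg hD hηc fun _ _ => (exp_pos _).le
  have hM0 : ∀ t, 0 ≤ M t := lev_nonneg hD hηc fun _ _ => (exp_pos _).le
  have hma : Antitone m := lev_antitone hD hηc (fun _ _ => (exp_pos _).le) hhi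
  set b := max T 0 with hb'
  have hmb : m b = 0 := lev_eq_zero fun z hz => (hT z hz).trans (le_max_left _ _)
  have hMb : M b = 0 := lev_eq_zero fun z hz => (hT z hz).trans (le_max_left _ _)
  have hdef : deficit 0 κ m M 0 + 2 * 0 * (b - 0) ≤ deficit 0 κ m M b := by
    refine deficit_mono le_rfl hκ.le hm0 hM0 hma hcmp le_rfl (le_max_right _ _) le_rfl
      (lev_continuousWithinAt hD hηc hhi) (lev_continuousWithinAt hD hηc hVi) ?_ ?_ ?_ ?_
    · intro t _ _
      have := hM0 t
      rw [zero_mul, sub_zero]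
      positivity
    · intro t _ htb hmt
      have h1 := (hcmp t b htb.le).1
      rw [hmb, hMb, sub_zero, sub_zero] at h1
      have : 0 < M t := lt_of_lt_of_le (by positivity) h1
      rw [zero_mul, sub_zero]
      positivity
    · intro t _ htb hmt
      have h1 := (hcmp t b htb.le).2
      rw [hmb, hMb, sub_zero, sub_zero, hmt, mul_zero] at h1
      exact ⟨rfl, le_antisymm h1 (hM0 t)⟩
    · intro t hat htb hmt ε hε
      have hlim := ((lev_continuousWithinAt hD hηc hhi t).tendsto.comp (tendsto_add_nhdsGT t)).const_mul (4 * π)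
      have hev := hlim.eventually (lt_mem_nhds (show 4 * π * m t - ε < 4 * π * m t by linarith))
      filter_upwards [hev, self_mem_nhdsWithin] with δ h1 hδ
      have hδ : 0 < δ := hδ
      have h2 := integral_superlevel_le hD hb hDc hh h0 hηs (t := t) hδ
        (fun s hs => hK s (hat.trans_lt hs)) hηp (fun z _ => by positivity) (hVi.const_mul κ) hhi
      rw [integral_const_mul] at h2
      change 4 * π * δ * m (t + δ) ≤ (m t - m (t + δ)) * (κ * M t) at h2
      have h3 := mul_le_mul_of_nonneg_left h1.le hδ.le
      simp only [Function.comp] at h3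
      linarith
  simp only [deficit, hmb, hMb] at hdef
  simp at hdef
  have hsplit : ∀ w : ℂ → ℝ, IntegrableOn w D →
      ∫ z in D, w z = lev D η w 0 + ∫ z in D \ {z ∈ D | 0 < η z}, w z := fun w hw => by
    rw [setIntegral_sdiff (measurableSet_superlevel hD hηc 0) hw fun z hz => hz.1, lev]
    ring
  rw [hsplit _ hVi, hsplit _ hhi]
  have hle : ∫ z in D \ {z ∈ D | 0 < η z}, exp (2 * V z) ≤
      ∫ z in D \ {z ∈ D | 0 < η z}, exp (2 * h z) := by
    refine setIntegral_mono_on (hVi.mono_set Set.sdiff_subset) (hhi.mono_set Set.sdiff_subset)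
      (hD.measurableSet.diff (measurableSet_superlevel hD hηc 0)) fun z hz => ?_
    have : η z ≤ 0 := le_of_not_gt fun hc => hz.2 ⟨hz.1, hc⟩
    refine exp_le_exp.2 ?_
    simp only [hη] at this
    linarith
  set β := ∫ z in D \ {z ∈ D | 0 < η z}, exp (2 * V z)
  set γ := ∫ z in D \ {z ∈ D | 0 < η z}, exp (2 * h z)
  have hβ : 0 ≤ β := integral_nonneg fun z => (exp_pos _).le
  have hM00 := hM0 0
  change (M 0 + β) * (4 * π - κ * (M 0 + β)) ≤ 4 * π * (m 0 + γ)
  have h1 : 0 ≤ κ * (2 * M 0 * β + β ^ 2) := by positivity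
  nlinarith [pi_pos]

end

lemma isPreconnected_compl_superlevel {Ω : Set ℂ} (hΩ : IsOpen Ω) (hb : Bornology.IsBounded Ω)
    (hΩc : IsPreconnected Ωᶜ) {φ : ℂ → ℝ} (hφ : ∀ z ∈ Ω, ContDiffAt ℝ 2 φ z)
    (hp : ∀ z ∈ Ω, plap φ z < 0) (t : ℝ) : IsPreconnected {z ∈ Ω | t < φ z}ᶜ := by
  have hφc : ContinuousOn φ Ω := fun z hz => (hφ z hz).continuousAt.continuousWithinAt
  set W := {z ∈ Ω | t < φ z} with hW
  have hWo : IsOpen W := hφc.isOpen_inter_preimage hΩ isOpen_Ioi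
  have hsub : Ωᶜ ⊆ Wᶜ := Set.compl_subset_compl.2 fun z hz => hz.1
  have key : ∀ A B : Set ℂ, IsClosed A → IsClosed B → Wᶜ ⊆ A ∪ B → (Wᶜ ∩ B).Nonempty →
      ¬(Wᶜ ∩ (A ∩ B)).Nonempty → ¬ Ωᶜ ⊆ A := by
    intro A B hA hB hAB hBn hdis hΩA
    set K := Wᶜ ∩ B with hK
    have hKΩ : K ⊆ Ω := fun z hz => by
      by_contra hc
      exact hdis ⟨z, hz.1, hΩA hc, hz.2⟩
    have hKc : IsCompact K :=
      Metric.isCompact_of_isClosed_isBounded (hWo.isClosed_compl.inter hB) (hb.subset hKΩ)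
    obtain ⟨x, hx, hmin⟩ := hKc.exists_isMinOn hBn (hφc.mono hKΩ)
    have hxA : x ∉ A := fun h => hdis ⟨x, hx.1, h, hx.2⟩
    have hxt : φ x ≤ t := le_of_not_gt fun hc => hx.1 ⟨hKΩ hx, hc⟩
    have hloc : IsLocalMax (fun w => -φ w) x := by
      filter_upwards [hΩ.mem_nhds (hKΩ hx), hA.isOpen_compl.mem_nhds hxA] with w hw hwA
      have : φ x ≤ φ w := by
        by_cases hwW : w ∈ W
        · exact hxt.trans hwW.2.le
        · exact hmin ⟨hwW, (hAB hwW).resolve_left hwA⟩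
      linarith
    have h1 := plap_nonpos_of_isLocalMax (hφ x (hKΩ hx)).neg hloc
    rw [plap_neg] at h1
    linarith [hp x (hKΩ hx)]
  rw [isPreconnected_closed_iff]
  intro A B hA hB hAB hAn hBn
  by_contra hdis
  have hor : Ωᶜ ⊆ A ∨ Ωᶜ ⊆ B := by
    by_contra hc
    push Not at hc
    obtain ⟨h1, h2⟩ := hc
    rw [Set.not_subset] at h1 h2
    obtain ⟨a, ha, haA⟩ := h1
    obtain ⟨b, hb, hbB⟩ := h2
    obtain ⟨z, hz, hz'⟩ := isPreconnected_closed_iff.1 hΩc A B hA hB (hsub.trans hAB)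
      ⟨b, hb, (hAB (hsub hb)).resolve_right hbB⟩ ⟨a, ha, (hAB (hsub ha)).resolve_left haA⟩
    exact hdis ⟨z, hsub hz, hz'⟩
  rcases hor with h | h
  · exact key A B hA hB hAB hBn hdis h
  · exact key B A hB hA (by rwa [Set.union_comm]) hAn (by rwa [Set.inter_comm B A]) h

/-- The sphere covering inequality. -/
theorem sphere_covering {Ω : Set ℂ} (hΩ : IsOpen Ω) (hb : Bornology.IsBounded Ω)
    (hne : Ω.Nonempty) (hΩc : IsPreconnected Ωᶜ) {U V : ℂ → ℝ} {κ : ℝ} (hκ0 : 0 < κ) (hκ1 : κ < 1)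
    (hU : ContDiff ℝ 2 U) (hV : ContDiff ℝ 2 V)
    (hVκ : ∀ z ∈ Ω, -plap V z ≤ κ * exp (2 * V z))
    (hUV : ∀ z ∈ Ω, plap U z - plap V z = -(exp (2 * U z) - exp (2 * V z)))
    (hlt : ∀ z ∈ Ω, V z < U z) (hfr : ∀ z ∈ frontier Ω, U z = V z) :
    4 * π < ∫ z in Ω, (exp (2 * U z) + exp (2 * V z)) := by
  have hcl : IsCompact (closure Ω) := hb.isCompact_closure
  have hUc := hU.continuous
  have hVc := hV.continuous
  set φ : ℂ → ℝ := fun z => U z - V z with hφ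
  have hφs : ContDiff ℝ 2 φ := hU.sub hV
  have hφc : Continuous φ := hφs.continuous
  have hφp : ∀ z ∈ Ω, plap φ z = -(exp (2 * U z) - exp (2 * V z)) := fun z hz => by
    rw [hφ, plap_sub hU.contDiffAt hV.contDiffAt, hUV z hz]
  have hQ0 : ∀ z ∈ Ω, 0 < exp (2 * U z) - exp (2 * V z) := fun z hz =>
    sub_pos.2 (exp_lt_exp.2 (by linarith [hlt z hz]))
  have hφpos : ∀ z ∈ Ω, 0 < φ z := fun z hz => sub_pos.2 (hlt z hz)
  have hInt : ∀ {w : ℂ → ℝ}, Continuous w → IntegrableOn w Ω := fun hw =>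
    (hw.continuousOn.integrableOn_compact hcl).mono_set subset_closure
  have hUi : IntegrableOn (fun z => exp (2 * U z)) Ω := hInt (by fun_prop)
  have hVi : IntegrableOn (fun z => exp (2 * V z)) Ω := hInt (by fun_prop)
  have hcomp : ∀ s, 0 < s → IsCompact {z ∈ Ω | s ≤ φ z} := fun s hs => by
    have : {z ∈ Ω | s ≤ φ z} = closure Ω ∩ φ ⁻¹' Set.Ici s := by
      ext z
      refine ⟨fun h => ⟨subset_closure h.1, h.2⟩, fun h => ⟨?_, h.2⟩⟩
      by_contra hz
      have h1 : φ z = 0 := sub_eq_zero.2 (hfr z (by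
        rw [hΩ.frontier_eq]; exact ⟨h.1, hz⟩))
      have h2 : s ≤ φ z := h.2
      linarith
    rw [this]
    exact hcl.inter_right (isClosed_Ici.preimage hφc)
  obtain ⟨T, hT⟩ : ∃ T, ∀ z ∈ Ω, φ z ≤ T := by
    obtain ⟨T, hT⟩ := hcl.bddAbove_image hφc.continuousOn
    exact ⟨T, fun z hz => hT ⟨z, subset_closure hz, rfl⟩⟩
  set m := lev Ω φ fun z => exp (2 * V z) with hm
  set M := lev Ω φ fun z => exp (2 * U z) with hM
  have hcmp : ∀ s t, s ≤ t → exp (2 * s) * (m s - m t) ≤ M s - M t ∧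
      M s - M t ≤ exp (2 * t) * (m s - m t) := fun s t hst =>
    lev_cmp hΩ hφc.continuousOn (fun _ _ => (exp_pos _).le) hVi hUi (fun z _ => by
      rw [← exp_add, hφ]; ring_nf) hst
  have hm0 : ∀ t, 0 ≤ m t := lev_nonneg hΩ hφc.continuousOn fun _ _ => (exp_pos _).le
  have hM0 : ∀ t, 0 ≤ M t := lev_nonneg hΩ hφc.continuousOn fun _ _ => (exp_pos _).le
  have hma : Antitone m := lev_antitone hΩ hφc.continuousOn (fun _ _ => (exp_pos _).le) hVi
  have hmR := lev_continuousWithinAt hΩ hφc.continuousOn hVi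
  have hMR := lev_continuousWithinAt hΩ hφc.continuousOn hUi
  have hzero : ∀ t, T ≤ t → m t = 0 ∧ M t = 0 := fun t ht =>
    ⟨lev_eq_zero fun z hz => (hT z hz).trans ht, lev_eq_zero fun z hz => (hT z hz).trans ht⟩
  have hge : ∀ t, exp (2 * t) * m t ≤ M t := fun t => by
    have h1 := (hcmp t (max T t) (le_max_right _ _)).1
    obtain ⟨h2, h3⟩ := hzero (max T t) (le_max_left _ _)
    rw [h2, h3, sub_zero, sub_zero] at h1
    exact h1
  have hMz : ∀ t, m t = 0 → M t = 0 := fun t h => by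
    have h1 := (hcmp t (max T t) (le_max_right _ _)).2
    obtain ⟨h2, h3⟩ := hzero (max T t) (le_max_left _ _)
    rw [h2, h3, sub_zero, sub_zero, h, mul_zero] at h1
    exact le_antisymm h1 (hM0 t)
  have hle : ∀ t, 0 ≤ t → m t ≤ M t := fun t ht => by
    have h1 : 1 ≤ exp (2 * t) := one_le_exp (by linarith)
    nlinarith [hge t, hm0 t]
  have hlt' : ∀ t, 0 < t → 0 < m t → m t < M t := fun t ht hmt => by
    have h1 : 1 < exp (2 * t) := one_lt_exp_iff.2 (by linarith)
    nlinarith [hge t]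
  -- the differential inequality at a level
  have hstep : ∀ t, 0 < t → ∀ g, g ≤ (1 - κ) * m t ^ 2 → ∀ ε > 0,
      ∀ᶠ δ in nhdsWithin 0 (Set.Ioi (0 : ℝ)),
        δ * (m t * (4 * π - 1 * m t) + g - ε) ≤ (m t - m (t + δ)) * (1 * M t - 1 * m t) := by
    intro t ht g hg ε hε
    set D := {z ∈ Ω | t < φ z} with hD
    have hDΩ : D ⊆ Ω := fun z hz => hz.1
    have hDo : IsOpen D := hφc.continuousOn.isOpen_inter_preimage hΩ isOpen_Ioi
    have hDb : Bornology.IsBounded D := hb.subset hDΩ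
    have hDc : IsPreconnected Dᶜ := isPreconnected_compl_superlevel hΩ hb hΩc
      (fun z _ => hφs.contDiffAt) (fun z hz => by rw [hφp z hz]; linarith [hQ0 z hz]) t
    -- harmonic replacement of `V`
    obtain ⟨C, hC0, hC⟩ : ∃ C, 0 < C ∧ ∀ z ∈ D,
        |plap V z| ≤ C * (exp (2 * U z) - exp (2 * V z)) := by
      have hpc : Continuous (plap V) :=
        continuous_iff_continuousAt.2 fun z => continuousAt_plap hV.contDiffAt
      obtain ⟨L, hL⟩ := hcl.exists_bound_of_continuousOn hpc.continuousOn
      obtain ⟨N, hN⟩ := hcl.exists_bound_of_continuousOn hVc.continuousOn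
      have hc0 : 0 < exp (-(2 * N)) * (2 * t) := by positivity
      refine ⟨(|L| + 1) / (exp (-(2 * N)) * (2 * t)), by positivity, fun z hz => ?_⟩
      have hzc := subset_closure (hDΩ hz)
      have h1 := hL z hzc
      have h2 := hN z hzc
      rw [norm_eq_abs] at h1 h2
      have h3 : exp (-(2 * N)) ≤ exp (2 * V z) := exp_le_exp.2 (by linarith [(abs_le.1 h2).1])
      have h4 : 2 * t ≤ exp (2 * φ z) - 1 := by
        have := add_one_le_exp (2 * φ z)
        have := hz.2
        linarith
      have h5 : exp (2 * U z) = exp (2 * V z) * exp (2 * φ z) := by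
        rw [← exp_add, hφ]; ring_nf
      have h6 : exp (-(2 * N)) * (2 * t) ≤ exp (2 * U z) - exp (2 * V z) := by
        have := mul_le_mul h3 h4 (by linarith) (exp_pos _).le
        rw [h5]; linarith
      rw [div_mul_eq_mul_div, le_div_iff₀ hc0]
      have h7 : |plap V z| ≤ |L| + 1 := h1.trans (by linarith [le_abs_self L])
      exact mul_le_mul h7 h6 hc0.le (by positivity)
    have hψ : ∀ c : ℝ, ContDiff ℝ 2 fun z => c * (φ z - t) := fun c =>
      contDiff_const.mul (hφs.sub contDiff_const)
    have hψp : ∀ c : ℝ, ∀ z ∈ D, plap (fun z => c * (φ z - t)) z =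
        -(c * (exp (2 * U z) - exp (2 * V z))) := fun c z hz => by
      rw [plap_const_mul, plap_sub hφs.contDiffAt contDiffAt_const, hφp z (hDΩ hz)]
      have : plap (fun _ : ℂ => t) z = 0 := by
        have e1 : dx (fun _ : ℂ => t) = fun _ => 0 := funext fun z => by simp [dx]
        have e2 : dy (fun _ : ℂ => t) = fun _ => 0 := funext fun z => by simp [dy]
        simp [plap, e1, e2, dx, dy]
      rw [this]; ring
    obtain ⟨h, hh⟩ := exists_harmonic_between hDo (a := fun z => V z - C * (φ z - t))
      (b := fun z => V z + C * (φ z - t))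
      (fun z hz => ⟨(hV.sub (hψ C)).contDiffAt, by
        rw [plap_sub hV.contDiffAt (hψ C).contDiffAt, hψp C z hz]
        linarith [(abs_le.1 (hC z hz)).1]⟩)
      (fun z hz => ⟨(hV.add (hψ C)).contDiffAt, by
        rw [plap_add hV.contDiffAt (hψ C).contDiffAt, hψp C z hz]
        linarith [(abs_le.1 (hC z hz)).2]⟩)
      (fun z hz => by
        have : 0 < C * (φ z - t) := mul_pos hC0 (sub_pos.2 hz.2)
        linarith)
    have hhs : ∀ z ∈ D, ContDiffAt ℝ 2 h z := fun z hz => (hh z hz).1.of_le (WithTop.coe_le_coe.2 le_top)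
    have hh0 : ∀ z ∈ D, plap h z = 0 := fun z hz => (hh z hz).2.1
    have hhi : IntegrableOn (fun z => exp (2 * h z)) D := by
      have hcont : Continuous fun z => exp (2 * (V z + C * (φ z - t))) := by fun_prop
      refine ((hInt hcont).mono_set hDΩ).mono' ?_ ?_
      · refine ContinuousOn.aestronglyMeasurable (fun z hz => ?_) hDo.measurableSet
        exact (((hhs z hz).continuousAt.const_mul 2).rexp).continuousWithinAt
      · refine (ae_restrict_mem hDo.measurableSet).mono fun z hz => ?_
        rw [norm_of_nonneg (exp_pos _).le]
        exact exp_le_exp.2 (by linarith [(hh z hz).2.2.2])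
    have hA := alexandrov hDo hDb hDc (T := C * (T - t)) hκ0 hhs hh0 (fun z _ => hV.contDiffAt)
      (fun z hz => hVκ z (hDΩ hz)) (fun z hz => by
        have h1 := (hh z hz).2.2.1
        have h2 : C * (φ z - t) ≤ C * (T - t) :=
          mul_le_mul_of_nonneg_left (by linarith [hT z (hDΩ hz)]) hC0.le
        linarith) (fun s hs => by
        have hsC : 0 < s / C := by positivity
        have heq : {z ∈ D | s ≤ V z - h z} =
            {z ∈ {z ∈ Ω | t + s / C ≤ φ z} | s ≤ V z - h z} := by
          ext z
          refine ⟨fun hz => ⟨⟨hDΩ hz.1, ?_⟩, hz.2⟩, fun hz => ⟨⟨hz.1.1, ?_⟩, hz.2⟩⟩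
          · have h1 := (hh z hz.1).2.2.1
            have h2 : s ≤ C * (φ z - t) := by linarith [hz.2]
            have : s / C ≤ φ z - t := by rw [div_le_iff₀ hC0]; linarith
            linarith
          · have := hz.1.2
            linarith
        rw [heq]
        have hK := hcomp (t + s / C) (by positivity)
        have hcont : ContinuousOn (fun z => V z - h z) {z ∈ Ω | t + s / C ≤ φ z} := fun z hz => by
          have hzD : z ∈ D := ⟨hz.1, by have := hz.2; linarith⟩
          exact (hVc.continuousAt.sub (hhs z hzD).continuousAt).continuousWithinAt
        exact hK.of_isClosed_subset (hcont.preimage_isClosed_of_isClosed hK.isClosed isClosed_Ici)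
          fun z hz => hz.1) (hVi.mono_set hDΩ) hhi
    set H := lev D φ fun z => exp (2 * h z) with hH
    have hlevD : ∀ s, t ≤ s → ∀ w : ℂ → ℝ, lev D φ w s = lev Ω φ w s := fun s hs w => by
      unfold lev
      congr 2
      ext z
      exact ⟨fun hz => ⟨hDΩ hz.1, hz.2⟩, fun hz => ⟨⟨hz.1, hs.trans_lt hz.2⟩, hz.2⟩⟩
    have hDt : ∀ w : ℂ → ℝ, ∫ z in D, w z = lev D φ w t := fun w => by
      rw [hlevD t le_rfl]; rfl
    rw [hDt, hDt, hlevD t le_rfl] at hA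
    change m t * (4 * π - κ * m t) ≤ 4 * π * H t at hA
    have hlim : Filter.Tendsto (fun δ => exp (-(2 * (C * δ))) * (4 * π * H (t + δ)))
        (nhdsWithin 0 (Set.Ioi 0)) (nhds (exp (-(2 * (C * 0))) * (4 * π * H t))) := by
      refine Filter.Tendsto.mul ?_ (((lev_continuousWithinAt hDo hφc.continuousOn hhi
        t).tendsto.comp (tendsto_add_nhdsGT t)).const_mul (4 * π))
      have : Continuous fun δ : ℝ => exp (-(2 * (C * δ))) := by fun_prop
      exact (this.tendsto 0).mono_left nhdsWithin_le_nhds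
    have hev := hlim.eventually (lt_mem_nhds (show m t * (4 * π - 1 * m t) + g - ε <
      exp (-(2 * (C * 0))) * (4 * π * H t) by
        simp only [mul_zero, neg_zero, exp_zero, one_mul]
        nlinarith))
    filter_upwards [hev, self_mem_nhdsWithin] with δ h1 hδ
    have hδ : 0 < δ := hδ
    have h2 := integral_superlevel_le hDo hDb hDc hhs hh0 (η := φ)
      (Q := fun z => exp (2 * U z) - exp (2 * V z)) (fun z _ => hφs.contDiffAt) (t := t) hδ
      (fun s hs => by
        have : {z ∈ D | s ≤ φ z} = {z ∈ Ω | s ≤ φ z} := by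
          ext z
          exact ⟨fun hz => ⟨hDΩ hz.1, hz.2⟩, fun hz => ⟨⟨hz.1, hs.trans_le hz.2⟩, hz.2⟩⟩
        rw [this]
        exact hcomp s (ht.trans hs)) (fun z hz => by rw [hφp z (hDΩ hz), neg_neg])
      (fun z hz => (hQ0 z (hDΩ hz)).le) ((hUi.mono_set hDΩ).sub (hVi.mono_set hDΩ)) hhi
    change 4 * π * δ * H (t + δ) ≤ (H t - H (t + δ)) * lev D φ _ t at h2
    have hq : lev D φ (fun z => exp (2 * U z) - exp (2 * V z)) t = M t - m t := by
      rw [hlevD t le_rfl]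
      exact integral_sub (hUi.mono_set fun z hz => hz.1) (hVi.mono_set fun z hz => hz.1)
    rw [hq] at h2
    have hlayer : H t - H (t + δ) ≤ exp (2 * (C * δ)) * (m t - m (t + δ)) := by
      have hst : t ≤ t + δ := by linarith
      have e1 : m t - m (t + δ) = lev D φ (fun z => exp (2 * V z)) t -
          lev D φ (fun z => exp (2 * V z)) (t + δ) := by
        rw [hlevD t le_rfl, hlevD _ hst]
      rw [e1, lev_sub hDo hφc.continuousOn hhi hst,
        lev_sub hDo hφc.continuousOn (hVi.mono_set hDΩ) hst, ← integral_const_mul]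
      have hsub : {z ∈ D | t < φ z} \ {z ∈ D | t + δ < φ z} ⊆ D := fun z hz => hz.1.1
      refine setIntegral_mono_on (hhi.mono_set hsub)
        (((hVi.mono_set hDΩ).mono_set hsub).const_mul _)
        ((measurableSet_superlevel hDo hφc.continuousOn _).diff
          (measurableSet_superlevel hDo hφc.continuousOn _)) fun z hz => ?_
      have h3 : φ z ≤ t + δ := le_of_not_gt fun hc => hz.2 ⟨hz.1.1, hc⟩
      have h4 : C * (φ z - t) ≤ C * δ := mul_le_mul_of_nonneg_left (by linarith) hC0.le
      rw [← exp_add]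
      exact exp_le_exp.2 (by linarith [(hh z hz.1.1).2.2.2])
    have hMm : 0 ≤ M t - m t := sub_nonneg.2 (hle t ht.le)
    have h3 : 4 * π * δ * H (t + δ) ≤ exp (2 * (C * δ)) * (m t - m (t + δ)) * (M t - m t) :=
      h2.trans (mul_le_mul_of_nonneg_right hlayer hMm)
    have h4 := mul_le_mul_of_nonneg_left h3 (exp_pos (-(2 * (C * δ)))).le
    have h5 : exp (-(2 * (C * δ))) * exp (2 * (C * δ)) = 1 := by
      rw [← exp_add]; simp
    have h6 := mul_le_mul_of_nonneg_left h1.le hδ.le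
    rw [one_mul (M t), one_mul (m t)]
    rw [one_mul (m t)] at h6
    calc _ ≤ _ := h6
      _ = exp (-(2 * (C * δ))) * (4 * π * δ * H (t + δ)) := by
        ring
      _ ≤ _ := h4
      _ = (exp (-(2 * (C * δ))) * exp (2 * (C * δ))) * ((m t - m (t + δ)) * (M t - m t)) := by ring
      _ = _ := by rw [h5, one_mul]
  have hmono : ∀ a b, 0 < a → a ≤ b → ∀ g, 0 ≤ g → (∀ t, a ≤ t → t < b → g ≤ (1 - κ) * m t ^ 2) →
      deficit 1 1 m M a + 2 * g * (b - a) ≤ deficit 1 1 m M b := by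
    intro a b ha hab g hg hgm
    refine deficit_mono zero_le_one zero_le_one hm0 hM0 hma hcmp ha.le hab hg hmR hMR ?_ ?_ ?_ ?_
    · intro t hat _; linarith [hle t (ha.le.trans hat)]
    · intro t hat _ hmt; linarith [hlt' t (ha.trans_le hat) hmt]
    · intro t hat htb hmt
      have := hgm t hat htb
      rw [hmt] at this
      exact ⟨by linarith, hMz t hmt⟩
    · intro t hat htb _ ε hε
      exact hstep t (ha.trans_le hat) g (hgm t hat htb) ε hε
  have hΩ0 : ∀ w : ℂ → ℝ, lev Ω φ w 0 = ∫ z in Ω, w z := fun w => by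
    unfold lev
    congr 2
    ext z
    exact ⟨fun hz => hz.1, fun hz => ⟨hz, hφpos z hz⟩⟩
  have hm00 : 0 < m 0 := by
    rw [hm, hΩ0, setIntegral_pos_iff_support_of_nonneg_ae
      (Filter.Eventually.of_forall fun z => (exp_pos _).le) hVi]
    have : (Function.support fun z => exp (2 * V z)) = Set.univ :=
      Set.eq_univ_of_forall fun z => (exp_pos _).ne'
    rw [this, Set.univ_inter]
    exact hΩ.measure_pos _ hne
  obtain ⟨t1, hmt1, ht1⟩ : ∃ t1, 0 < m t1 ∧ 0 < t1 :=
    (((hmR 0).tendsto.eventually (lt_mem_nhds hm00)).and self_mem_nhdsWithin).exists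
  have ht1T : t1 ≤ T := le_of_not_ge fun hc => hmt1.ne' (hzero t1 hc).1
  set g := (1 - κ) * m t1 ^ 2 with hg
  have hg0 : 0 < g := mul_pos (by linarith) (by positivity)
  have hT0 : deficit 1 1 m M T = 0 := by
    obtain ⟨h1, h2⟩ := hzero T le_rfl
    simp [deficit, h1, h2]
  have h1 := hmono t1 T ht1 ht1T 0 le_rfl fun t _ _ =>
    mul_nonneg (by linarith) (sq_nonneg _)
  have h2 : ∀ a, 0 < a → a ≤ t1 / 2 → deficit 1 1 m M a ≤ -(g * t1) := fun a ha hat => by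
    have h3 := hmono a t1 ha (by linarith) g hg0.le fun t _ htb => by
      have := hma htb.le
      exact mul_le_mul_of_nonneg_left (pow_le_pow_left₀ hmt1.le this 2) (by linarith)
    nlinarith
  have h3 : deficit 1 1 m M 0 ≤ -(g * t1) := by
    have hlim : Filter.Tendsto (deficit 1 1 m M) (nhdsWithin 0 (Set.Ioi 0))
        (nhds (deficit 1 1 m M 0)) := by
      unfold deficit
      refine Filter.Tendsto.sub ?_ (Filter.Tendsto.mul ?_ ?_)
      · exact (hMR 0).tendsto.mul (((hMR 0).tendsto.const_mul 1).const_sub _)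
      · have : Continuous fun t : ℝ => exp (2 * t) := by fun_prop
        exact (this.tendsto 0).mono_left nhdsWithin_le_nhds
      · exact (hmR 0).tendsto.mul (((hmR 0).tendsto.const_mul 1).const_sub _)
    refine le_of_tendsto hlim ?_
    filter_upwards [Ioc_mem_nhdsGT (show 0 < t1 / 2 by linarith)] with a ha
    exact h2 a ha.1 ha.2
  rw [integral_add hUi hVi]
  have h4 : M 0 = ∫ z in Ω, exp (2 * U z) := hΩ0 _
  have h5 : m 0 = ∫ z in Ω, exp (2 * V z) := hΩ0 _
  rw [← h4, ← h5]
  simp only [deficit, mul_zero, exp_zero, one_mul] at h3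
  have h6 := hle 0 le_rfl
  have h7 : 0 < g * t1 := mul_pos hg0 ht1
  by_contra hc
  push Not at hc
  nlinarith [mul_nonneg (sub_nonneg.2 h6) (sub_nonneg.2 hc)]

/-- The Cauchy transform of a bounded, compactly supported function that is continuous off the
origin is continuous at the origin. -/
lemma continuousAt_cauchyTransform {g : ℂ → ℂ} {M R : ℝ}
    (hg : ∀ z, z ≠ 0 → ContinuousAt g z) (hM : ∀ z, z ≠ 0 → ‖g z‖ ≤ M)
    (hR : ∀ z, R ≤ ‖z‖ → g z = 0) :
    ContinuousAt (fun w => ∫ z, g z / (z - w)) 0 := by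
  have hgm : Measurable g := by
    refine measurable_of_continuousOn_compl_singleton 0 fun z hz => ?_
    exact (hg z hz).continuousWithinAt
  have hM0 : 0 ≤ M := (norm_nonneg _).trans (hM 1 one_ne_zero)
  have e : (fun w => ∫ z, g z / (z - w)) = fun w => ∫ z, g (z + w) / z := by
    funext w
    rw [← integral_add_right_eq_self (fun z => g z / (z - w)) w]
    simp
  rw [e]
  set B : ℝ := max R 0 + 1
  have hB : 0 ≤ B := by positivity
  have hInt := (integrableOn_inv_norm 0 hB).1
  refine continuousAt_of_dominated (bound := fun z => (Metric.ball (0 : ℂ) B).indicator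
    (fun z => M * ‖z - 0‖⁻¹) z) ?_ ?_ ?_ ?_
  · refine Filter.Eventually.of_forall fun w => ?_
    exact ((hgm.comp (measurable_id.add_const w)).div measurable_id).aestronglyMeasurable
  · filter_upwards [Metric.ball_mem_nhds (0 : ℂ) one_pos] with w hw
    have : ∀ᵐ z : ℂ, z ≠ -w := by simp [ae_iff, measure_singleton]
    filter_upwards [this] with z hz
    have hz' : z + w ≠ 0 := fun h => hz (eq_neg_of_add_eq_zero_left h)
    by_cases hb : z ∈ Metric.ball (0 : ℂ) B
    · rw [Set.indicator_of_mem hb, norm_div, sub_zero, div_eq_mul_inv]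
      exact mul_le_mul_of_nonneg_right (hM _ hz') (by positivity)
    · rw [Set.indicator_of_notMem hb, hR, zero_div, norm_zero]
      simp only [Metric.mem_ball, dist_zero_right, not_lt] at hb hw
      have h1 : ‖z‖ ≤ ‖z + w‖ + ‖w‖ := by
        simpa using norm_sub_le (z + w) w
      have h2 := le_max_left R 0
      linarith
  · rw [integrable_indicator_iff measurableSet_ball]
    exact hInt.const_mul M
  · have : ∀ᵐ z : ℂ, z ≠ 0 := by simp [ae_iff, measure_singleton]
    filter_upwards [this] with z hz
    have h : ContinuousAt (fun w => g (z + w)) 0 :=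
      ContinuousAt.comp (f := fun w => z + w) (by simpa using hg z hz)
        (continuous_const.add continuous_id).continuousAt
    exact h.div_const z

/-- The Cauchy–Pompeiu formula for functions with an isolated singularity that is milder than a
pole. -/
lemma cauchy_pompeiu_punctured {F : ℂ → ℂ} {M R : ℝ}
    (hF : ∀ z, z ≠ 0 → ContDiffAt ℝ 1 F z) (hM : ∀ z, z ≠ 0 → ‖dzb F z‖ ≤ M)
    (hR : ∀ z, R ≤ ‖z‖ → F z = 0)
    (ho : ∀ ε > 0, ∀ᶠ z in nhdsWithin 0 {0}ᶜ, ‖F z‖ * ‖z‖ ≤ ε) {w : ℂ} (hw : w ≠ 0) :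
    ∫ z, dzb F z / (z - w) = -(π * F w) := by
  obtain ⟨β, hβ, hβc, hβs, hβ1, hβI⟩ := exists_bump (isCompact_closedBall (0 : ℂ) 1)
    Metric.isOpen_ball (Metric.closedBall_subset_ball (x := (0 : ℂ)) one_lt_two)
  have hM0 : 0 ≤ M := (norm_nonneg _).trans (hM 1 one_ne_zero)
  have hβC : ContDiff ℝ 1 (fun z => (β z : ℂ)) := contDiff_ofReal (hβ.of_le (by norm_cast))
  obtain ⟨B, hB⟩ : ∃ B, ∀ z, ‖dzb (fun z => (β z : ℂ)) z‖ ≤ B := by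
    have c : Continuous (dzb (fun z => (β z : ℂ))) :=
      continuous_iff_continuousAt.2 fun z => continuousAt_dzb hβC.contDiffAt
    refine c.bounded_above_of_compact_support ?_ |>.imp fun B h => h
    refine hβc.mono' ?_
    intro z hz
    by_contra h
    exact hz (dzb_eq_zero_of_notMem (by rwa [tsupport_ofReal]))
  have hB0 : 0 ≤ B := (norm_nonneg _).trans (hB 0)
  have hβout : ∀ z, 2 ≤ ‖z‖ → z ∉ tsupport β := fun z hz h => by
    have := hβs h
    simp at this
    linarith
  have hβin : ∀ z, ‖z‖ ≤ 1 → β z = 1 := fun z hz =>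
    hβ1.self_of_nhdsSet z (by simpa using hz)
  set m : ℕ → ℝ := fun k => (k : ℝ) + 1 with hm
  have hm0 : ∀ k, 0 < m k := fun k => by simp only [hm]; positivity
  have hmt : Filter.Tendsto m Filter.atTop Filter.atTop :=
    Filter.tendsto_atTop_add_const_right _ _ tendsto_natCast_atTop_atTop
  set b : ℕ → ℂ → ℂ := fun k z => (β ((m k : ℂ) * z) : ℂ) with hb
  have hbC : ∀ k, ContDiff ℝ 1 (b k) := fun k => hβC.comp (contDiff_const.mul contDiff_id)
  have hbW : ∀ k z, HasW (b k) (dz (fun z => (β z : ℂ)) ((m k : ℂ) * z) * m k)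
      (dzb (fun z => (β z : ℂ)) ((m k : ℂ) * z) * m k) z := fun k z => by
    have h1 := DifferentiableAt.hasW (hβC.differentiable (by simp) ((m k : ℂ) * z))
    have h2 : HasDerivAt (fun z : ℂ => (m k : ℂ) * z) (m k) z := by
      simpa using (hasDerivAt_id z).const_mul (m k : ℂ)
    exact (h1.comp_of_hol h2).congr_val rfl (by simp)
  have hbz : ∀ k z, 2 ≤ m k * ‖z‖ → b k z = 0 ∧ dzb (b k) z = 0 := fun k z hz => by
    have h : (m k : ℂ) * z ∉ tsupport β := hβout _ (by
      rw [norm_mul, Complex.norm_real, Real.norm_of_nonneg (hm0 k).le]; exact hz)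
    refine ⟨by simp [hb, image_eq_zero_of_notMem_tsupport h], ?_⟩
    rw [(hbW k z).2.2, dzb_eq_zero_of_notMem (by rwa [tsupport_ofReal]), zero_mul]
  have hbI : ∀ k z, ‖1 - b k z‖ ≤ 1 := fun k z => by
    have := hβI ((m k : ℂ) * z)
    simp only [hb]
    rw [← Complex.ofReal_one, ← Complex.ofReal_sub, Complex.norm_real, Real.norm_eq_abs, abs_le]
    constructor <;> linarith [this.1, this.2]
  have hFm : Measurable F := measurable_of_continuousOn_compl_singleton 0 fun z hz =>
    (hF z hz).continuousAt.continuousWithinAt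
  have hdm : Measurable (dzb F) := measurable_of_continuousOn_compl_singleton 0 fun z hz =>
    (continuousAt_dzb (hF z hz)).continuousWithinAt
  have hd0 : ∀ z, R < ‖z‖ → dzb F z = 0 := fun z hz => by
    have h : F =ᶠ[nhds z] fun _ => 0 := by
      filter_upwards [continuous_norm.continuousAt.eventually_const_lt hz] with y hy
        using hR y hy.le
    rw [dzb, dx_congr h, dy_congr h]; simp [dx, dy]
  have hne0 : ∀ᵐ z : ℂ, z ≠ 0 := by simp [ae_iff, measure_singleton]
  have hG : ∀ k, ∫ z, dzb (fun z => (1 - b k z) * F z) z / (z - w) =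
      -(π * ((1 - b k w) * F w)) := fun k => by
    refine cauchy_pompeiu (F := fun z => (1 - b k z) * F z) ?_ ?_ w
    · refine contDiff_iff_contDiffAt.2 fun z => ?_
      by_cases hz : z = 0
      · subst hz
        refine contDiffAt_const (c := (0 : ℂ)) |>.congr_of_eventuallyEq ?_
        have : Metric.ball (0 : ℂ) (1 / m k) ∈ nhds (0 : ℂ) :=
          Metric.ball_mem_nhds _ (by have := hm0 k; positivity)
        filter_upwards [this] with z hz
        have h1 : ‖(m k : ℂ) * z‖ ≤ 1 := by
          rw [norm_mul, Complex.norm_real, Real.norm_of_nonneg (hm0 k).le]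
          rw [mem_ball_zero_iff, lt_div_iff₀ (hm0 k)] at hz
          linarith
        simp [hb, hβin _ h1]
      · exact (contDiffAt_const.sub (hbC k).contDiffAt).mul (hF z hz)
    · refine HasCompactSupport.intro (isCompact_closedBall (0 : ℂ) R) fun z hz => ?_
      rw [mem_closedBall_zero_iff, not_le] at hz
      simp [hR z hz.le]
  have hGd : ∀ k z, z ≠ 0 → dzb (fun z => (1 - b k z) * F z) z =
      (1 - b k z) * dzb F z - dzb (b k) z * F z := fun k z hz => by
    have h1 : HasW (fun z => 1 - b k z) (-dz (b k) z) (-dzb (b k) z) z := by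
      have h := (hasW_const 1 z).add ((hasW_const (-1) z).mul
        (DifferentiableAt.hasW ((hbC k).differentiable (by simp) z)))
      have e : (fun z => 1 - b k z) = fun w => 1 + -1 * b k w := by funext; ring
      rw [e]
      exact h.congr_val (by ring) (by ring)
    have h2 := h1.mul (DifferentiableAt.hasW ((hF z hz).differentiableAt (by simp)))
    rw [h2.2.2]; ring
  set S : ℝ := max R 0 + ‖w‖ + 1
  have hS : 0 ≤ S := by positivity
  have hdom : Integrable (fun z => (Metric.ball w S).indicator (fun z => M * ‖z - w‖⁻¹) z) := by
    rw [integrable_indicator_iff measurableSet_ball]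
    exact (integrableOn_inv_norm w hS).1.const_mul M
  have hdle : ∀ z, z ≠ 0 → ‖dzb F z / (z - w)‖ ≤
      (Metric.ball w S).indicator (fun z => M * ‖z - w‖⁻¹) z := fun z hz => by
    by_cases hzb : z ∈ Metric.ball w S
    · rw [Set.indicator_of_mem hzb, norm_div, div_eq_mul_inv]
      exact mul_le_mul_of_nonneg_right (hM z hz) (by positivity)
    · rw [Set.indicator_of_notMem hzb, hd0, zero_div, norm_zero]
      rw [mem_ball_iff_norm, not_lt] at hzb
      have h1 := norm_sub_le z w
      have h2 := le_max_left R 0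
      linarith
  have hAle : ∀ k z, z ≠ 0 → ‖(1 - b k z) * dzb F z / (z - w)‖ ≤
      (Metric.ball w S).indicator (fun z => M * ‖z - w‖⁻¹) z := fun k z hz => by
    refine le_trans ?_ (hdle z hz)
    rw [mul_div_assoc, norm_mul]
    exact mul_le_of_le_one_left (norm_nonneg _) (hbI k z)
  have hAm : ∀ k, Measurable fun z => (1 - b k z) * dzb F z / (z - w) := fun k =>
    (((measurable_const.sub (hbC k).continuous.measurable)).mul hdm).div
      (measurable_id.sub_const w)
  have hAi : ∀ k, Integrable fun z => (1 - b k z) * dzb F z / (z - w) := fun k => by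
    refine hdom.mono' (hAm k).aestronglyMeasurable ?_
    filter_upwards [hne0] with z hz using hAle k z hz
  have hA : Filter.Tendsto (fun k => ∫ z, (1 - b k z) * dzb F z / (z - w)) Filter.atTop
      (nhds (∫ z, dzb F z / (z - w))) := by
    refine tendsto_integral_of_dominated_convergence _ (fun k => (hAm k).aestronglyMeasurable)
      hdom (fun k => by filter_upwards [hne0] with z hz using hAle k z hz) ?_
    filter_upwards [hne0] with z hz
    refine tendsto_const_nhds.congr' ?_
    filter_upwards [hmt.eventually_ge_atTop (2 / ‖z‖)] with k hk
    rw [div_le_iff₀ (by positivity)] at hk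
    simp [(hbz k z hk).1]
  have hBm : ∀ k, Measurable fun z => dzb (b k) z * F z / (z - w) := fun k =>
    (((continuous_iff_continuousAt.2 fun z =>
      continuousAt_dzb (hbC k).contDiffAt).measurable.mul hFm)).div (measurable_id.sub_const w)
  have hBle : ∀ ε > 0, ∀ᶠ k in Filter.atTop, ∀ z, z ≠ 0 → ‖dzb (b k) z * F z / (z - w)‖ ≤
      (Metric.ball (0 : ℂ) (2 / m k)).indicator
        (fun z => B * m k * ε * (2 / ‖w‖) * ‖z - 0‖⁻¹) z := fun ε hε => by
    obtain ⟨r, hr, hrF⟩ := Metric.mem_nhdsWithin_iff.1 (ho ε hε)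
    have hw' : 0 < ‖w‖ := norm_pos_iff.2 hw
    filter_upwards [hmt.eventually_gt_atTop (2 / r), hmt.eventually_gt_atTop (4 / ‖w‖)]
      with k hk1 hk2 z hz
    have hmk := hm0 k
    have hz' : 0 < ‖z‖ := norm_pos_iff.2 hz
    by_cases hzb : z ∈ Metric.ball (0 : ℂ) (2 / m k)
    · rw [Set.indicator_of_mem hzb]
      rw [mem_ball_zero_iff] at hzb
      have e1 : 2 / m k < r := by
        rw [div_lt_iff₀ hmk]; rw [div_lt_iff₀ hr] at hk1; linarith
      have e2 : 2 / m k < ‖w‖ / 2 := by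
        rw [div_lt_iff₀ hmk]; rw [div_lt_iff₀ hw'] at hk2; linarith
      have h1 : ‖F z‖ * ‖z‖ ≤ ε := hrF ⟨by simpa using hzb.trans e1, hz⟩
      have h2 : ‖w‖ / 2 ≤ ‖z - w‖ := by
        have := norm_sub_norm_le w z
        rw [norm_sub_rev] at this
        linarith
      have h3 : ‖dzb (b k) z‖ ≤ B * m k := by
        rw [(hbW k z).2.2, norm_mul, Complex.norm_real, Real.norm_of_nonneg hmk.le]
        exact mul_le_mul_of_nonneg_right (hB _) hmk.le
      have h4 : ‖F z‖ ≤ ε * ‖z - 0‖⁻¹ := by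
        rw [sub_zero, ← div_eq_mul_inv, le_div_iff₀ hz']; exact h1
      have h5 : ‖z - w‖⁻¹ ≤ 2 / ‖w‖ := by
        rw [inv_le_comm₀ (by linarith) (by positivity), inv_div]; exact h2
      rw [norm_div, norm_mul, div_eq_mul_inv]
      calc _ ≤ (B * m k) * (ε * ‖z - 0‖⁻¹) * (2 / ‖w‖) := by gcongr
        _ = _ := by ring
    · rw [Set.indicator_of_notMem hzb, (hbz k z ?_).2]
      · simp
      · rw [mem_ball_zero_iff, not_lt, div_le_iff₀ hmk] at hzb
        linarith
  have hBdom : ∀ ε k, Integrable fun z => (Metric.ball (0 : ℂ) (2 / m k)).indicator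
        (fun z => B * m k * ε * (2 / ‖w‖) * ‖z - 0‖⁻¹) z := fun ε k => by
    rw [integrable_indicator_iff measurableSet_ball]
    exact (integrableOn_inv_norm 0 (by have := hm0 k; positivity)).1.const_mul _
  have hBint : ∀ ε > 0, ∀ᶠ k in Filter.atTop, Integrable (fun z => dzb (b k) z * F z / (z - w)) ∧
      ‖∫ z, dzb (b k) z * F z / (z - w)‖ ≤ 8 * π * B * ε / ‖w‖ := fun ε hε => by
    filter_upwards [hBle ε hε] with k hk
    have hk' : ∀ᵐ z : ℂ, ‖dzb (b k) z * F z / (z - w)‖ ≤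
      (Metric.ball (0 : ℂ) (2 / m k)).indicator
        (fun z => B * m k * ε * (2 / ‖w‖) * ‖z - 0‖⁻¹) z := by
      filter_upwards [hne0] with z hz using hk z hz
    refine ⟨(hBdom ε k).mono' (hBm k).aestronglyMeasurable hk', ?_⟩
    refine (norm_integral_le_of_norm_le (hBdom ε k) hk').trans ?_
    have hmk := hm0 k
    rw [integral_indicator measurableSet_ball, integral_const_mul,
      (integrableOn_inv_norm 0 (by positivity)).2]
    field_simp
    norm_num
  have hBlim : Filter.Tendsto (fun k => ∫ z, dzb (b k) z * F z / (z - w)) Filter.atTop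
      (nhds 0) := by
    rw [NormedAddGroup.tendsto_nhds_zero]
    intro η hη
    have hw' : 0 < ‖w‖ := norm_pos_iff.2 hw
    filter_upwards [hBint (η * ‖w‖ / (8 * π * B + 1)) (by positivity)] with k hk
    refine hk.2.trans_lt ?_
    rw [div_lt_iff₀ hw', mul_div_assoc', div_lt_iff₀ (by positivity)]
    have : 0 < η * ‖w‖ := by positivity
    nlinarith
  have hlim : Filter.Tendsto (fun k => ∫ z, dzb (fun z => (1 - b k z) * F z) z / (z - w))
      Filter.atTop (nhds (∫ z, dzb F z / (z - w))) := by
    have := hA.sub hBlim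
    rw [sub_zero] at this
    refine this.congr' ?_
    filter_upwards [hBint 1 one_pos] with k hk
    rw [← integral_sub (hAi k) hk.1]
    refine integral_congr_ae ?_
    filter_upwards [hne0] with z hz
    rw [hGd k z hz]; ring
  refine tendsto_nhds_unique hlim (tendsto_const_nhds.congr' ?_)
  have hw' : 0 < ‖w‖ := norm_pos_iff.2 hw
  filter_upwards [hmt.eventually_ge_atTop (2 / ‖w‖)] with k hk
  rw [div_le_iff₀ hw'] at hk
  rw [hG k, (hbz k w hk).1]; simp

/-- A continuously differentiable function on the punctured plane, vanishing near infinity, with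
bounded `∂̄`-derivative and a singularity at the origin that is milder than a pole. -/
structure MildSing (F : ℂ → ℂ) (M R : ℝ) : Prop where
  contDiffAt : ∀ z, z ≠ 0 → ContDiffAt ℝ 1 F z
  bound : ∀ z, z ≠ 0 → ‖dzb F z‖ ≤ M
  zero_off : ∀ z, R ≤ ‖z‖ → F z = 0
  mild : ∀ ε > 0, ∀ᶠ z in nhdsWithin 0 {0}ᶜ, ‖F z‖ * ‖z‖ ≤ ε

lemma MildSing.dzb_eq_zero {F : ℂ → ℂ} {M R : ℝ} (h : MildSing F M R) {z : ℂ} (hz : R ≤ ‖z‖)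
    (hz0 : z ≠ 0) : dzb F z = 0 := by
  have key : ∀ z, R < ‖z‖ → dzb F z = 0 := fun z hz => by
    have h : F =ᶠ[nhds z] fun _ => 0 := by
      filter_upwards [continuous_norm.continuousAt.eventually_const_lt hz] with y hy
        using h.zero_off y hy.le
    rw [dzb, dx_congr h, dy_congr h]; simp [dx, dy]
  have hc := continuousAt_dzb (h.contDiffAt z hz0)
  have ht : Filter.Tendsto (fun t : ℝ => (t : ℂ) * z) (nhdsWithin 1 (Set.Ioi 1)) (nhds z) := by
    have : ContinuousAt (fun t : ℝ => (t : ℂ) * z) 1 := by fun_prop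
    have h2 := this.tendsto
    simp only [Complex.ofReal_one, one_mul] at h2
    exact h2.mono_left nhdsWithin_le_nhds
  refine tendsto_nhds_unique (hc.tendsto.comp ht) (tendsto_const_nhds.congr' ?_)
  filter_upwards [self_mem_nhdsWithin] with t ht
  have ht' : (1 : ℝ) < t := ht
  have hzp : 0 < ‖z‖ := norm_pos_iff.2 hz0
  refine (key _ ?_).symm
  rw [norm_mul, Complex.norm_real, Real.norm_of_nonneg (by linarith)]
  nlinarith

lemma MildSing.exists_limit {F : ℂ → ℂ} {M R : ℝ} (h : MildSing F M R) :
    ∃ c, Filter.Tendsto F (nhdsWithin 0 {0}ᶜ) (nhds c) := by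
  have hc := continuousAt_cauchyTransform (g := dzb F) (M := M) (R := max R 1)
    (fun z hz => continuousAt_dzb (h.contDiffAt z hz)) h.bound
    (fun z hz => h.dzb_eq_zero ((le_max_left _ _).trans hz) (by
      intro h0; simp [h0] at hz; exact absurd (hz.2) (by norm_num)))
  refine ⟨_, ((hc.tendsto.mono_left nhdsWithin_le_nhds).const_mul (-(1 / π : ℂ))).congr' ?_⟩
  filter_upwards [self_mem_nhdsWithin] with w hw
  rw [cauchy_pompeiu_punctured h.contDiffAt h.bound h.zero_off h.mild hw]
  have : (π : ℂ) ≠ 0 := by exact_mod_cast pi_ne_zero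
  field_simp

lemma MildSing.norm_le {F : ℂ → ℂ} {M R : ℝ} (h : MildSing F M R) (hR : 0 < R) {w : ℂ}
    (hw : w ≠ 0) : ‖F w‖ ≤ 4 * R * M := by
  have hM0 : 0 ≤ M := (norm_nonneg _).trans (h.bound 1 one_ne_zero)
  by_cases hwR : R ≤ ‖w‖
  · rw [h.zero_off w hwR, norm_zero]; positivity
  push Not at hwR
  have hne0 : ∀ᵐ z : ℂ, z ≠ 0 := by simp [ae_iff, measure_singleton]
  have hi := integrableOn_inv_norm w (R := 2 * R) (by positivity)
  have hdom : Integrable (fun z => (Metric.ball w (2 * R)).indicator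
      (fun z => M * ‖z - w‖⁻¹) z) := by
    rw [integrable_indicator_iff measurableSet_ball]
    exact hi.1.const_mul M
  have hle : ∀ᵐ z : ℂ, ‖dzb F z / (z - w)‖ ≤ (Metric.ball w (2 * R)).indicator
      (fun z => M * ‖z - w‖⁻¹) z := by
    filter_upwards [hne0] with z hz
    by_cases hzb : z ∈ Metric.ball w (2 * R)
    · rw [Set.indicator_of_mem hzb, norm_div, div_eq_mul_inv]
      exact mul_le_mul_of_nonneg_right (h.bound z hz) (by positivity)
    · rw [Set.indicator_of_notMem hzb, h.dzb_eq_zero ?_ hz, zero_div, norm_zero]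
      rw [mem_ball_iff_norm, not_lt] at hzb
      have h1 := norm_sub_le z w
      linarith
  have h1 := norm_integral_le_of_norm_le hdom hle
  rw [cauchy_pompeiu_punctured h.contDiffAt h.bound h.zero_off h.mild hw,
    integral_indicator measurableSet_ball, integral_const_mul, hi.2, norm_neg, norm_mul,
    Complex.norm_real, Real.norm_of_nonneg pi_pos.le] at h1
  have := pi_pos
  nlinarith

/-- Dividing a cut-off function by a power of the coordinate. -/
lemma mildSing_quotient {f : ℂ → ℂ} {χ : ℂ → ℝ} {n : ℕ} {ρ R K B : ℝ} (hf : ContDiff ℝ 1 f)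
    (hχ : ContDiff ℝ 1 χ) (hχI : ∀ z, χ z ∈ Set.Icc (0 : ℝ) 1) (hχR : ∀ z, R ≤ ‖z‖ → χ z = 0)
    (hρ : 0 < ρ) (hχ1 : ∀ z, ‖z‖ ≤ ρ → dzb (fun z => (χ z : ℂ)) z = 0)
    (hB : ∀ z, ‖dzb (fun z => (χ z : ℂ)) z * f z‖ ≤ B)
    (hK : ∀ z, ‖χ z * dzb f z‖ ≤ K * ‖z‖ ^ n)
    (ho : ∀ ε > 0, ∀ᶠ z in nhdsWithin 0 {0}ᶜ, ‖f z‖ * ‖z‖ ≤ ε * ‖z‖ ^ n) :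
    MildSing (fun z => χ z * f z / z ^ n) (B / ρ ^ n + K) R := by
  have hχC := contDiff_ofReal hχ
  have hB0 : 0 ≤ B := (norm_nonneg _).trans (hB 0)
  constructor
  · intro z hz
    have hp : ContDiffAt ℝ 1 (fun z : ℂ => (z ^ n)⁻¹) z :=
      (contDiffAt_id.pow n).inv (pow_ne_zero _ hz)
    exact (hχC.contDiffAt.mul hf.contDiffAt).mul hp
  · intro z hz
    have hzn : 0 < ‖z‖ ^ n := by have := norm_pos_iff.2 hz; positivity
    have h1 := (DifferentiableAt.hasW (hχC.differentiable (by simp) z)).mul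
      (DifferentiableAt.hasW (hf.differentiable (by simp) z))
    have h2 := h1.div (hasDerivAt_pow n z).hasW (pow_ne_zero _ hz)
    have e : dzb (fun z => χ z * f z / z ^ n) z =
        (dzb (fun z => (χ z : ℂ)) z * f z + χ z * dzb f z) / z ^ n := by
      rw [h2.2.2]
      have := pow_ne_zero n hz
      field_simp
      ring
    rw [e, norm_div, norm_pow, div_le_iff₀ hzn, add_mul]
    refine (norm_add_le _ _).trans (add_le_add ?_ (hK z))
    by_cases hzρ : ‖z‖ ≤ ρ
    · rw [hχ1 z hzρ, zero_mul, norm_zero]; positivity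
    · refine (hB z).trans ?_
      rw [div_mul_eq_mul_div, le_div_iff₀ (by positivity)]
      push Not at hzρ
      gcongr
  · intro z hz
    simp [hχR z hz]
  · intro ε hε
    filter_upwards [ho ε hε, self_mem_nhdsWithin] with z hz hz0
    have hzn : 0 < ‖z‖ ^ n := by
      have : 0 < ‖z‖ := norm_pos_iff.2 hz0
      positivity
    rw [norm_div, norm_mul, norm_pow, div_mul_eq_mul_div, div_le_iff₀ hzn, Complex.norm_real,
      Real.norm_of_nonneg (hχI z).1]
    have := mul_le_of_le_one_left (by positivity : 0 ≤ ‖f z‖ * ‖z‖) (hχI z).2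
    linarith

/-- The complex gradient of a real function. -/
def cgrad (φ : ℂ → ℝ) : ℂ → ℂ := dz (fun w => (φ w : ℂ))

lemma cgrad_eq {φ : ℂ → ℝ} {z : ℂ} (h : DifferentiableAt ℝ φ z) :
    cgrad φ z = (((dx φ z : ℝ) : ℂ) - Complex.I * ((dy φ z : ℝ) : ℂ)) / 2 := by
  have h : HasFDerivAt (fun w => (φ w : ℂ)) (Complex.ofRealCLM.comp (fderiv ℝ φ z)) z :=
    Complex.ofRealCLM.hasFDerivAt.comp z h.hasFDerivAt
  simp only [cgrad, dz, dx, dy, h.fderiv]; simp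

lemma norm_dzb_ofReal {φ : ℂ → ℝ} {z : ℂ} (h : DifferentiableAt ℝ φ z) :
    ‖dzb (fun w => (φ w : ℂ)) z‖ = ‖cgrad φ z‖ := by
  have e : dzb (fun w => (φ w : ℂ)) z = (starRingEnd ℂ) (cgrad φ z) := by
    rw [cgrad_eq h]
    have h : HasFDerivAt (fun w => (φ w : ℂ)) (Complex.ofRealCLM.comp (fderiv ℝ φ z)) z :=
      Complex.ofRealCLM.hasFDerivAt.comp z h.hasFDerivAt
    simp only [dzb, dx, dy, h.fderiv]; simp [Complex.conj_ofNat]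
  rw [e, RCLike.norm_conj]

lemma contDiff_cgrad {φ : ℂ → ℝ} (h : ContDiff ℝ 2 φ) : ContDiff ℝ 1 (cgrad φ) := by
  have h' := contDiff_ofReal h
  refine contDiff_iff_contDiffAt.2 fun z => ?_
  have h1 : ContDiffAt ℝ 1 (dx fun w => (φ w : ℂ)) z := contDiffAt_dx h'.contDiffAt (by norm_num)
  have h2 : ContDiffAt ℝ 1 (dy fun w => (φ w : ℂ)) z := contDiffAt_dy h'.contDiffAt (by norm_num)
  exact (h1.sub (contDiffAt_const.mul h2)).div_const 2

lemma dzb_cgrad {φ : ℂ → ℝ} (h : ContDiff ℝ 2 φ) (z : ℂ) :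
    dzb (cgrad φ) z = (plap φ z / 4 : ℝ) := by
  have hd : Differentiable ℝ φ := h.differentiable (by simp)
  have e : cgrad φ = fun z => (((dx φ z : ℝ) : ℂ) - Complex.I * ((dy φ z : ℝ) : ℂ)) / 2 := by
    funext z; exact cgrad_eq (hd z)
  have h1 : DifferentiableAt ℝ (dx φ) z :=
    (contDiffAt_dx (m := 1) h.contDiffAt (by norm_num)).differentiableAt (by simp)
  have h2 : DifferentiableAt ℝ (dy φ) z :=
    (contDiffAt_dy (m := 1) h.contDiffAt (by norm_num)).differentiableAt (by simp)
  have a1 : HasFDerivAt (fun w => ((dx φ w : ℝ) : ℂ)) (Complex.ofRealCLM.comp (fderiv ℝ (dx φ) z)) z :=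
    Complex.ofRealCLM.hasFDerivAt.comp z h1.hasFDerivAt
  have a2 : HasFDerivAt (fun w => ((dy φ w : ℝ) : ℂ)) (Complex.ofRealCLM.comp (fderiv ℝ (dy φ) z)) z :=
    Complex.ofRealCLM.hasFDerivAt.comp z h2.hasFDerivAt
  have a3 := (a1.sub (a2.const_mul Complex.I)).mul_const (2⁻¹ : ℂ)
  have e2 : (fun z => (((dx φ z : ℝ) : ℂ) - Complex.I * ((dy φ z : ℝ) : ℂ)) / 2) =
      fun z => (((dx φ z : ℝ) : ℂ) - Complex.I * ((dy φ z : ℝ) : ℂ)) * 2⁻¹ := by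
    funext z; ring
  have hs := dx_dy_comm h.contDiffAt (z := z)
  rw [e, e2]
  rw [dzb, dx, dy]
  have a3' : HasFDerivAt (fun z => (((dx φ z : ℝ) : ℂ) - Complex.I * ((dy φ z : ℝ) : ℂ)) * 2⁻¹) _ z := a3
  rw [a3'.fderiv]
  simp only [dx, dy] at hs
  simp [plap, dx, dy, hs]
  ring_nf
  simp
  ring

section

lemma norm_fderiv_le_cgrad {φ : ℂ → ℝ} {z : ℂ} (h : DifferentiableAt ℝ φ z) :
    ‖fderiv ℝ φ z‖ ≤ 2 * ‖cgrad φ z‖ := by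
  refine ContinuousLinearMap.opNorm_le_bound _ (by positivity) fun v => ?_
  have e : fderiv ℝ φ z v = (2 * cgrad φ z * v).re := by
    rw [fderiv_eq_dx_dy, cgrad_eq h]
    simp
    ring
  rw [e]
  refine (Complex.abs_re_le_norm _).trans ?_
  simp

lemma isLittleO_of_cgrad {φ : ℂ → ℝ} (hφ : ContDiff ℝ 1 φ) (h0 : φ 0 = 0) {m : ℕ}
    (ho : ∀ ε > 0, ∀ᶠ z in nhds 0, ‖cgrad φ z‖ ≤ ε * ‖z‖ ^ m) :
    ∀ ε > 0, ∀ᶠ z in nhds 0, |φ z| ≤ ε * ‖z‖ ^ (m + 1) := by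
  intro ε hε
  have hd : Differentiable ℝ φ := hφ.differentiable (by simp)
  obtain ⟨r, hr, h⟩ := Metric.eventually_nhds_iff.1 (ho (ε / 2) (by positivity))
  filter_upwards [Metric.ball_mem_nhds (0 : ℂ) hr] with z hz
  rw [mem_ball_zero_iff] at hz
  have := Convex.norm_image_sub_le_of_norm_fderiv_le (𝕜 := ℝ) (f := φ) (C := ε * ‖z‖ ^ m)
    (s := Metric.closedBall 0 ‖z‖) (x := 0) (y := z) (fun x _ => hd x) ?_
    (convex_closedBall _ _) (by simp) (by simp)
  · simpa [h0, pow_succ, mul_assoc] using this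
  · intro x hx
    rw [mem_closedBall_zero_iff] at hx
    have h1 := h (y := x) (by rw [dist_zero_right]; linarith)
    have h2 : ‖x‖ ^ m ≤ ‖z‖ ^ m := by gcongr
    calc ‖fderiv ℝ φ x‖ ≤ 2 * ‖cgrad φ x‖ := norm_fderiv_le_cgrad (hd x)
      _ ≤ 2 * (ε / 2 * ‖z‖ ^ m) := by
        gcongr
        exact h1.trans (by gcongr)
      _ = _ := by ring

/-- A smooth cut-off function adapted to concentric discs. -/
lemma exists_radial_cutoff {R : ℝ} (hR : 0 < R) : ∃ χ : ℂ → ℝ, ContDiff ℝ 1 χ ∧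
    (∀ z, χ z ∈ Set.Icc (0 : ℝ) 1) ∧ (∀ z, R ≤ ‖z‖ → χ z = 0) ∧
    (∀ z, ‖z‖ ≤ R / 2 → χ z = 1 ∧ dzb (fun z => (χ z : ℂ)) z = 0) ∧
    ∀ {f : ℂ → ℂ}, Continuous f → ∃ B, ∀ z, ‖dzb (fun z => (χ z : ℂ)) z * f z‖ ≤ B := by
  obtain ⟨χ, h1, h2, h3, h4, h5⟩ := exists_bump (isCompact_closedBall (0 : ℂ) (R / 2))
    Metric.isOpen_ball (Metric.closedBall_subset_ball (x := (0 : ℂ)) (half_lt_self hR))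
  have h1' : ContDiff ℝ 1 χ := h1.of_le (by norm_cast)
  refine ⟨χ, h1', h5, fun z hz => ?_, fun z hz => ?_, fun {f} hf => ?_⟩
  · refine image_eq_zero_of_notMem_tsupport fun h => ?_
    have := h3 h
    rw [mem_ball_zero_iff] at this
    linarith
  · have h6 := eventually_nhdsSet_iff_forall.1 h4 z (by simpa using hz)
    refine ⟨h6.self_of_nhds, ?_⟩
    have h7 : (fun z => (χ z : ℂ)) =ᶠ[nhds z] fun _ => 1 := by
      filter_upwards [h6] with w hw using by simp [hw]
    rw [dzb, dx_congr h7, dy_congr h7]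
    simp [dx, dy]
  · have c : Continuous (dzb (fun z => (χ z : ℂ))) :=
      continuous_iff_continuousAt.2 fun z => continuousAt_dzb (contDiff_ofReal h1').contDiffAt
    refine (c.mul hf).bounded_above_of_compact_support ?_
    refine h2.mono' fun z hz => ?_
    by_contra h
    exact hz (by simp [dzb_eq_zero_of_notMem (F := fun z => (χ z : ℂ)) (by rwa [tsupport_ofReal])])

variable {φ : ℂ → ℝ} {C r : ℝ}

lemma exists_limit_cgrad (hφ : ContDiff ℝ 2 φ) (h0 : φ 0 = 0) (hr : 0 < r)
    (hC : ∀ z, ‖z‖ < r → |plap φ z| ≤ C * |φ z|) {m : ℕ}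
    (ho : ∀ ε > 0, ∀ᶠ z in nhds 0, ‖cgrad φ z‖ ≤ ε * ‖z‖ ^ m) :
    ∃ c, Filter.Tendsto (fun z => cgrad φ z / z ^ (m + 1)) (nhdsWithin 0 {0}ᶜ) (nhds c) := by
  have h1 := isLittleO_of_cgrad (hφ.of_le (by norm_num)) h0 ho 1 one_pos
  obtain ⟨s, hs, hs1⟩ := Metric.eventually_nhds_iff.1 h1
  set R := min r s
  have hR : 0 < R := lt_min hr hs
  obtain ⟨χ, c1, c2, c3, c4, c5⟩ := exists_radial_cutoff hR
  have hf := contDiff_cgrad hφ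
  obtain ⟨B, hB⟩ := c5 hf.continuous
  have hm := mildSing_quotient (n := m + 1) (ρ := R / 2) (K := |C| / 4) hf c1 c2 c3 (by positivity)
    (fun z hz => (c4 z hz).2) hB ?_ ?_
  · obtain ⟨c, hc⟩ := hm.exists_limit
    refine ⟨c, hc.congr' ?_⟩
    have : Metric.ball (0 : ℂ) (R / 2) ∈ nhdsWithin (0 : ℂ) {0}ᶜ :=
      nhdsWithin_le_nhds (Metric.ball_mem_nhds _ (by positivity))
    filter_upwards [this] with z hz
    rw [(c4 z (by simpa using (mem_ball_zero_iff.1 hz).le)).1]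
    simp
  · intro z
    by_cases hz : R ≤ ‖z‖
    · simp [c3 z hz]; positivity
    push Not at hz
    rw [dzb_cgrad hφ, norm_mul, Complex.norm_real, Complex.norm_real,
      Real.norm_of_nonneg (c2 z).1, Real.norm_eq_abs, abs_div]
    have a1 := hC z (hz.trans_le (min_le_left _ _))
    have a2 := hs1 (y := z) (by simpa using hz.trans_le (min_le_right _ _))
    have a3 : |plap φ z| ≤ |C| * ‖z‖ ^ (m + 1) := by
      refine a1.trans ?_
      calc C * |φ z| ≤ |C| * |φ z| := by gcongr; exact le_abs_self C
        _ ≤ _ := by gcongr; simpa using a2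
    have a4 : |(4 : ℝ)| = 4 := by norm_num
    calc χ z * (|plap φ z| / |4|) ≤ 1 * (|plap φ z| / |4|) := by gcongr; exact (c2 z).2
      _ ≤ _ := by rw [a4]; linarith
  · intro ε hε
    filter_upwards [nhdsWithin_le_nhds (ho ε hε)] with z hz
    rw [pow_succ, ← mul_assoc]
    gcongr

/-- A solution vanishing to infinite order at a point vanishes near that point. -/
lemma eventually_eq_zero_of_flat (hφ : ContDiff ℝ 2 φ) (h0 : φ 0 = 0) (hr : 0 < r)
    (hC : ∀ z, ‖z‖ < r → |plap φ z| ≤ C * |φ z|)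
    (ho : ∀ m : ℕ, ∀ ε > 0, ∀ᶠ z in nhds 0, ‖cgrad φ z‖ ≤ ε * ‖z‖ ^ m) :
    ∀ᶠ z in nhds 0, φ z = 0 := by
  set D := 1 + |C| with hD
  have hD0 : 0 < D := by positivity
  set R := min r (1 / (8 * D)) with hRd
  have hR : 0 < R := lt_min hr (by positivity)
  have hRD : 4 * R * D ≤ 1 / 2 := by
    have : R ≤ 1 / (8 * D) := min_le_right _ _
    rw [le_div_iff₀ (by positivity)] at this
    linarith
  obtain ⟨χ, c1, c2, c3, c4, c5⟩ := exists_radial_cutoff hR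
  have hf := contDiff_cgrad hφ
  have hφC := contDiff_ofReal (hφ.of_le (by norm_num) : ContDiff ℝ 1 φ)
  have hφd : Differentiable ℝ φ := hφ.differentiable (by simp)
  obtain ⟨B1, hB1⟩ := c5 hf.continuous
  obtain ⟨B2, hB2⟩ := c5 hφC.continuous
  set B := max B1 B2
  have hB0 : 0 ≤ B := (norm_nonneg _).trans ((hB1 0).trans (le_max_left _ _))
  have hφo := fun m => isLittleO_of_cgrad (hφ.of_le (by norm_num)) h0 (ho m)
  let P : ℕ → ℝ → Prop := fun n T => ∀ z, ‖χ z * cgrad φ z‖ ≤ T * ‖z‖ ^ n ∧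
    ‖χ z * (φ z : ℂ)‖ ≤ T * ‖z‖ ^ n
  have hstep : ∀ n T, 1 ≤ n → 0 ≤ T → P n T → P n (4 * R * (B / (R / 2) ^ n) + T / 2) := by
    intro n T hn hT hP
    have m1 := mildSing_quotient (n := n) (ρ := R / 2) (K := D * T) hf c1 c2 c3 (by positivity)
      (fun z hz => (c4 z hz).2) (fun z => (hB1 z).trans (le_max_left _ _ : B1 ≤ B)) (fun z => by
        by_cases hz : R ≤ ‖z‖
        · simp [c3 z hz]; positivity
        push Not at hz
        rw [dzb_cgrad hφ, norm_mul, Complex.norm_real, Complex.norm_real,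
          Real.norm_of_nonneg (c2 z).1, Real.norm_eq_abs, abs_div]
        have a1 := hC z (hz.trans_le (min_le_left _ _))
        have a2 := (hP z).2
        rw [norm_mul, Complex.norm_real, Complex.norm_real,
          Real.norm_of_nonneg (c2 z).1, Real.norm_eq_abs] at a2
        have a3 : |plap φ z| / |(4 : ℝ)| ≤ D * |φ z| := by
          have a4 : |(4 : ℝ)| = 4 := by norm_num
          rw [a4]
          have := le_abs_self C
          have := abs_nonneg (φ z)
          have := abs_nonneg (plap φ z)
          have : C * |φ z| ≤ D * |φ z| := by gcongr; linarith
          linarith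
        calc χ z * (|plap φ z| / |4|) ≤ χ z * (D * |φ z|) := by gcongr; exact (c2 z).1
          _ = D * (χ z * |φ z|) := by ring
          _ ≤ D * (T * ‖z‖ ^ n) := by gcongr
          _ = _ := by ring) (fun ε hε => by
        obtain ⟨k, rfl⟩ : ∃ k, n = k + 1 := ⟨n - 1, by omega⟩
        filter_upwards [nhdsWithin_le_nhds (ho k ε hε)] with z hz
        rw [pow_succ, ← mul_assoc]
        gcongr)
    have m2 := mildSing_quotient (n := n) (ρ := R / 2) (K := D * T) hφC c1 c2 c3 (by positivity)
      (fun z hz => (c4 z hz).2) (fun z => (hB2 z).trans (le_max_right _ _ : B2 ≤ B)) (fun z => by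
        rw [norm_mul, norm_dzb_ofReal (hφd z), ← norm_mul]
        refine (hP z).1.trans ?_
        have : T ≤ D * T := le_mul_of_one_le_left hT (by simp [hD])
        gcongr) (fun ε hε => by
        filter_upwards [nhdsWithin_le_nhds (hφo n ε hε),
          nhdsWithin_le_nhds (Metric.ball_mem_nhds (0 : ℂ) one_pos)] with z hz hz1
        rw [mem_ball_zero_iff] at hz1
        rw [Complex.norm_real, Real.norm_eq_abs]
        have := norm_nonneg z
        have : |φ z| * ‖z‖ ≤ |φ z| * 1 := by gcongr
        have : ε * ‖z‖ ^ (n + 1) ≤ ε * ‖z‖ ^ n := by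
          gcongr ε * ?_
          exact pow_le_pow_of_le_one (norm_nonneg _) hz1.le (by omega)
        linarith)
    have hle : 4 * R * (B / (R / 2) ^ n + D * T) ≤ 4 * R * (B / (R / 2) ^ n) + T / 2 := by
      nlinarith
    have hcg : cgrad φ 0 = 0 := by
      have h := (ho 0 · · |>.self_of_nhds)
      by_contra hne
      have := h (‖cgrad φ 0‖ / 2) (by positivity)
      have h2 : 0 < ‖cgrad φ 0‖ := by positivity
      simp at this
      linarith
    intro z
    by_cases hz : z = 0
    · subst hz
      rw [hcg, h0]
      simp
      have : 0 ≤ 4 * R * (B / (R / 2) ^ n) + T / 2 := by positivity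
      positivity
    · have hzn : 0 < ‖z‖ ^ n := by
        have : 0 < ‖z‖ := norm_pos_iff.2 hz
        positivity
      have b1 := (m1.norm_le hR hz).trans hle
      have b2 := (m2.norm_le hR hz).trans hle
      rw [norm_div, norm_pow, div_le_iff₀ hzn] at b1 b2
      exact ⟨b1, b2⟩
  have hinit : ∀ n, 1 ≤ n → ∃ T, 0 ≤ T ∧ P n T := by
    intro n hn
    have aux : ∀ g : ℂ → ℂ, Continuous g → (∀ᶠ z in nhds 0, ‖g z‖ ≤ ‖z‖ ^ n) →
        ∃ T, 0 ≤ T ∧ ∀ z, ‖χ z * g z‖ ≤ T * ‖z‖ ^ n := by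
      intro g hg hgn
      obtain ⟨A, hA⟩ := ((Complex.continuous_ofReal.comp c1.continuous).mul
        hg).bounded_above_of_compact_support (HasCompactSupport.intro
          (isCompact_closedBall (0 : ℂ) R) fun z hz => by
            rw [mem_closedBall_zero_iff, not_le] at hz
            simp [c3 z hz.le])
      have hA0 : 0 ≤ A := (norm_nonneg _).trans (hA 0)
      obtain ⟨δ, hδ, hδg⟩ := Metric.eventually_nhds_iff.1 hgn
      refine ⟨1 + A / δ ^ n, by positivity, fun z => ?_⟩
      by_cases hz : ‖z‖ < δ
      · have a1 := hδg (y := z) (by simpa using hz)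
        rw [norm_mul, Complex.norm_real, Real.norm_of_nonneg (c2 z).1]
        calc χ z * ‖g z‖ ≤ 1 * ‖z‖ ^ n := by gcongr; exact (c2 z).2
          _ ≤ _ := by gcongr; linarith [(by positivity : 0 ≤ A / δ ^ n)]
      · push Not at hz
        refine (hA z).trans ?_
        rw [add_mul, div_mul_eq_mul_div]
        have a1 : A ≤ A * ‖z‖ ^ n / δ ^ n := by
          rw [le_div_iff₀ (by positivity)]
          gcongr
        have : 0 ≤ 1 * ‖z‖ ^ n := by positivity
        linarith
    obtain ⟨T1, hT1, h1⟩ := aux _ hf.continuous (by simpa using ho n 1 one_pos)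
    obtain ⟨T2, hT2, h2⟩ := aux _ hφC.continuous (by
      obtain ⟨k, rfl⟩ : ∃ k, n = k + 1 := ⟨n - 1, by omega⟩
      simpa using hφo k 1 one_pos)
    refine ⟨T1 + T2, by positivity, fun z => ⟨(h1 z).trans ?_, (h2 z).trans ?_⟩⟩ <;> gcongr <;>
      linarith
  have hfin : ∀ n, 1 ≤ n → P n (8 * R * (B / (R / 2) ^ n)) := by
    intro n hn
    obtain ⟨T, hT, hPT⟩ := hinit n hn
    set A := 4 * R * (B / (R / 2) ^ n) with hA
    have hA0 : 0 ≤ A := by positivity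
    have hk : ∀ k : ℕ, P n (2 * A + T / 2 ^ k) := by
      intro k
      induction k with
      | zero =>
        intro z
        have := hPT z
        have h2 : T * ‖z‖ ^ n ≤ (2 * A + T / 2 ^ 0) * ‖z‖ ^ n := by
          gcongr; simp; exact hA0
        exact ⟨this.1.trans h2, this.2.trans h2⟩
      | succ k ih =>
        have := hstep n _ hn (by positivity) ih
        convert this using 1
        rw [← hA, pow_succ]
        field_simp
        ring
    have hlim : Filter.Tendsto (fun k : ℕ => 2 * A + T / 2 ^ k) Filter.atTop (nhds (2 * A)) := by
      have : Filter.Tendsto (fun k : ℕ => T * (1 / 2 : ℝ) ^ k) Filter.atTop (nhds (T * 0)) :=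
        (tendsto_pow_atTop_nhds_zero_of_lt_one (by norm_num) (by norm_num)).const_mul T
      have h2 := this.const_add (2 * A)
      simp only [mul_zero, add_zero] at h2
      refine h2.congr fun k => ?_
      simp [div_eq_mul_inv]
    intro z
    have e : 8 * R * (B / (R / 2) ^ n) = 2 * A := by rw [hA]; ring
    rw [e]
    exact ⟨ge_of_tendsto' (hlim.mul_const _) fun k => (hk k z).1,
      ge_of_tendsto' (hlim.mul_const _) fun k => (hk k z).2⟩
  filter_upwards [Metric.ball_mem_nhds (0 : ℂ) (by positivity : 0 < R / 2)] with z hz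
  rw [mem_ball_zero_iff] at hz
  have hlim : Filter.Tendsto (fun n : ℕ => 8 * R * B * (‖z‖ / (R / 2)) ^ n) Filter.atTop
      (nhds (8 * R * B * 0)) :=
    (tendsto_pow_atTop_nhds_zero_of_lt_one (by positivity)
      (by rw [div_lt_one (by positivity)]; exact hz)).const_mul _
  have hle : |φ z| ≤ 8 * R * B * 0 := by
    refine ge_of_tendsto hlim ?_
    filter_upwards [Filter.eventually_ge_atTop 1] with n hn
    have := (hfin n hn z).2
    rw [(c4 z hz.le).1] at this
    simp only [Complex.ofReal_one, one_mul, Complex.norm_real, Real.norm_eq_abs] at this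
    refine this.trans (le_of_eq ?_)
    rw [div_pow ‖z‖]
    have : (R / 2) ^ n ≠ 0 := by positivity
    generalize (R / 2) ^ n = q at *
    field_simp
  rw [mul_zero] at hle
  exact abs_eq_zero.1 (le_antisymm hle (abs_nonneg _))

lemma hartman_wintner_order (hφ : ContDiff ℝ 2 φ) (h0 : φ 0 = 0) (hr : 0 < r)
    (hC : ∀ z, ‖z‖ < r → |plap φ z| ≤ C * |φ z|) :
    (∀ᶠ z in nhds 0, φ z = 0) ∨ ∃ n : ℕ, ∃ c ≠ 0,
      Filter.Tendsto (fun z => cgrad φ z / z ^ n) (nhdsWithin 0 {0}ᶜ) (nhds c) := by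
  by_contra! hcon
  obtain ⟨hc1, hc2⟩ := hcon
  have hcont : Continuous (cgrad φ) := (contDiff_cgrad hφ).continuous
  have hg0 : cgrad φ 0 = 0 := by
    by_contra hne
    refine hc2 0 _ hne ?_
    simpa using (hcont.tendsto 0).mono_left nhdsWithin_le_nhds
  have hflat : ∀ m : ℕ, ∀ ε > 0, ∀ᶠ z in nhds 0, ‖cgrad φ z‖ ≤ ε * ‖z‖ ^ m := by
    intro m
    induction m with
    | zero =>
      intro ε hε
      have := (hcont.norm.tendsto 0)
      rw [hg0, norm_zero] at this
      filter_upwards [this.eventually (gt_mem_nhds hε)] with z hz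
      simpa using hz.le
    | succ m ih =>
      obtain ⟨c, hc⟩ := exists_limit_cgrad hφ h0 hr hC ih
      have hc0 : c = 0 := by
        by_contra hne
        exact hc2 _ _ hne hc
      subst hc0
      intro ε hε
      have h1 := hc.norm.eventually_lt_const (u := ε) (by simpa using hε)
      rw [eventually_nhdsWithin_iff] at h1
      filter_upwards [h1] with z hz
      by_cases hz0 : z = 0
      · subst hz0; simp [hg0]
      · have := (hz hz0).le
        have hp : 0 < ‖z‖ := norm_pos_iff.2 hz0
        rwa [norm_div, norm_pow, div_le_iff₀ (by positivity)] at this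
  have := eventually_eq_zero_of_flat hφ h0 hr hC hflat
  exact hc1 (this.mono fun z hz h => h hz)

/-- The Hartman–Wintner expansion at a zero. -/
theorem hartman_wintner (hφ : ContDiff ℝ 2 φ) (h0 : φ 0 = 0) (hr : 0 < r)
    (hC : ∀ z, ‖z‖ < r → |plap φ z| ≤ C * |φ z|) :
    (∀ᶠ z in nhds 0, φ z = 0) ∨ ∃ n : ℕ, ∃ c ≠ 0,
      Filter.Tendsto (fun z => cgrad φ z / z ^ n) (nhdsWithin 0 {0}ᶜ) (nhds (c * (n + 1) / 2)) ∧
      ∀ ε > 0, ∀ᶠ z in nhds 0, |φ z - (c * z ^ (n + 1)).re| ≤ ε * ‖z‖ ^ (n + 1) := by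
  refine (hartman_wintner_order hφ h0 hr hC).imp_right ?_
  rintro ⟨n, c, hc, hlim⟩
  have hn : ((n : ℂ) + 1) ≠ 0 := by exact_mod_cast Nat.succ_ne_zero n
  refine ⟨n, 2 * c / (n + 1), by simp [hc, hn], ?_, ?_⟩
  · convert hlim using 2
    field_simp
  have hpow : ContDiff ℝ 2 (fun z : ℂ => 2 * c / (n + 1) * z ^ (n + 1)) :=
    contDiff_const.mul (contDiff_id.pow _)
  have hre : ContDiff ℝ 2 (fun z : ℂ => (2 * c / (n + 1) * z ^ (n + 1)).re) :=
    Complex.reCLM.contDiff.comp hpow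
  refine isLittleO_of_cgrad ((hφ.sub hre).of_le (by norm_num)) (by simp [h0]) ?_
  have e : ∀ z, cgrad (fun z => φ z - (2 * c / (n + 1) * z ^ (n + 1)).re) z =
      cgrad φ z - c * z ^ n := by
    intro z
    have d1 := hφ.differentiable (by simp) z
    have d2 := hre.differentiable (by simp) z
    have d3 : HasDerivAt (fun z : ℂ => 2 * c / (n + 1) * z ^ (n + 1)) (2 * c * z ^ n) z := by
      refine ((hasDerivAt_pow (n + 1) z).const_mul _).congr_deriv ?_
      rw [Nat.add_sub_cancel]
      push_cast
      field_simp
    have d4 : HasFDerivAt (fun z : ℂ => (2 * c / (n + 1) * z ^ (n + 1)).re) _ z :=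
      Complex.reCLM.hasFDerivAt.comp z (d3.hasFDerivAt.restrictScalars ℝ)
    rw [cgrad_eq (φ := fun z => φ z - (2 * c / (n + 1) * z ^ (n + 1)).re) (d1.sub d2), cgrad_eq d1, dx_sub d1 d2, dy_sub d1 d2]
    rw [dx, dy, dx, dy, d4.fderiv]
    generalize z ^ n = Z at *
    apply Complex.ext <;> simp <;> ring
  intro ε hε
  simp_rw [e]
  have hcont : Continuous (cgrad φ) := (contDiff_cgrad hφ).continuous
  have h1 := (hlim.sub_const c).norm.eventually_lt_const (u := ε) (by simpa using hε)
  have h2 : cgrad φ 0 - c * 0 ^ n = 0 := by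
    have t1 : Filter.Tendsto (fun z : ℂ => cgrad φ z - c * z ^ n) (nhdsWithin 0 {0}ᶜ)
        (nhds (cgrad φ 0 - c * 0 ^ n)) :=
      ((hcont.sub (continuous_const.mul (continuous_pow n))).tendsto 0).mono_left
        nhdsWithin_le_nhds
    have t2 : Filter.Tendsto (fun z : ℂ => (cgrad φ z / z ^ n - c) * z ^ n) (nhdsWithin 0 {0}ᶜ)
        (nhds ((c - c) * 0 ^ n)) :=
      (hlim.sub_const c).mul (((continuous_pow n).tendsto 0).mono_left nhdsWithin_le_nhds)
    rw [sub_self, zero_mul] at t2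
    refine tendsto_nhds_unique t1 (t2.congr' ?_)
    filter_upwards [self_mem_nhdsWithin] with z hz
    have : z ^ n ≠ 0 := pow_ne_zero _ hz
    field_simp
  rw [eventually_nhdsWithin_iff] at h1
  filter_upwards [h1] with z hz
  by_cases hz0 : z = 0
  · subst hz0
    rw [h2, norm_zero]
    positivity
  · have hzn : z ^ n ≠ 0 := pow_ne_zero _ hz0
    have h3 : cgrad φ z - c * z ^ n = (cgrad φ z / z ^ n - c) * z ^ n := by field_simp
    rw [h3, norm_mul, norm_pow]
    exact mul_le_mul_of_nonneg_right (hz hz0).le (by positivity)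

end

lemma dx_comp_add {E : Type*} [NormedAddCommGroup E] [NormedSpace ℝ E] (f : ℂ → E) (a : ℂ) :
    dx (fun z => f (z + a)) = fun z => dx f (z + a) := by
  funext z
  simp only [dx, fderiv_comp_add_right]

lemma dy_comp_add {E : Type*} [NormedAddCommGroup E] [NormedSpace ℝ E] (f : ℂ → E) (a : ℂ) :
    dy (fun z => f (z + a)) = fun z => dy f (z + a) := by
  funext z
  simp only [dy, fderiv_comp_add_right]

/-- A `C²` function that locally satisfies a linear differential inequality. -/
def SubLinear (φ : ℂ → ℝ) : Prop :=
  ContDiff ℝ 2 φ ∧ ∀ a, ∃ C r : ℝ, 0 < r ∧ ∀ z, ‖z - a‖ < r → |plap φ z| ≤ C * |φ z|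

lemma SubLinear.expansion {φ : ℂ → ℝ} (hφ : SubLinear φ) {a : ℂ} (h0 : φ a = 0) :
    (∀ᶠ z in nhds a, φ z = 0) ∨ ∃ n : ℕ, ∃ c ≠ 0,
      Filter.Tendsto (fun z => cgrad φ z / (z - a) ^ n) (nhdsWithin a {a}ᶜ)
        (nhds (c * (n + 1) / 2)) ∧
      ∀ ε > 0, ∀ᶠ z in nhds a, |φ z - (c * (z - a) ^ (n + 1)).re| ≤ ε * ‖z - a‖ ^ (n + 1) := by
  obtain ⟨h2, h⟩ := hφ
  obtain ⟨C, r, hr, hC⟩ := h a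
  have e1 : plap (fun z => φ (z + a)) = fun z => plap φ (z + a) := by
    funext z
    simp only [plap, dx_comp_add, dy_comp_add]
  have e2 : cgrad (fun z => φ (z + a)) = fun z => cgrad φ (z + a) := by
    funext z
    simp only [cgrad, dz]
    rw [dx_comp_add (fun w => (φ w : ℂ)) a, dy_comp_add (fun w => (φ w : ℂ)) a]
  have ht : Filter.Tendsto (fun z => z - a) (nhds a) (nhds 0) := by
    have : ContinuousAt (fun z => z - a) a := by fun_prop
    simpa using this.tendsto
  have htp : Filter.Tendsto (fun z => z - a) (nhdsWithin a {a}ᶜ) (nhdsWithin 0 {0}ᶜ) := by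
    refine tendsto_nhdsWithin_iff.2 ⟨ht.mono_left nhdsWithin_le_nhds, ?_⟩
    filter_upwards [self_mem_nhdsWithin] with z hz
    simpa [sub_eq_zero] using hz
  have key := hartman_wintner (φ := fun z => φ (z + a)) (C := C) (r := r)
    (h2.comp (contDiff_id.add contDiff_const)) (by simpa using h0) hr (fun z hz => by
      rw [e1]; exact hC _ (by simpa using hz))
  rcases key with h | ⟨n, c, hc, h, h'⟩
  · left
    filter_upwards [ht.eventually h] with z hz
    simpa using hz
  · right
    refine ⟨n, c, hc, ?_, fun ε hε => ?_⟩
    · rw [e2] at h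
      simpa [Function.comp_def] using h.comp htp
    · filter_upwards [ht.eventually (h' ε hε)] with z hz
      simpa using hz

/-- Unique continuation. -/
lemma SubLinear.eq_zero {φ : ℂ → ℝ} (hφ : SubLinear φ) {a : ℂ}
    (ha : ∀ᶠ z in nhds a, φ z = 0) : ∀ z, φ z = 0 := by
  set A := {z | ∀ᶠ w in nhds z, φ w = 0} with hA
  have hAo : IsOpen A := isOpen_setOfPred_eventually_nhds
  have hAc : IsClosed A := by
    refine closure_subset_iff_isClosed.1 fun z hz => ?_
    have hcl : IsClosed {z | φ z = 0} := isClosed_eq hφ.1.continuous continuous_const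
    have hz0 : φ z = 0 :=
      closure_minimal (fun w (hw : ∀ᶠ w in nhds w, φ w = 0) => hw.self_of_nhds) hcl hz
    rcases hφ.expansion hz0 with h | ⟨n, c, hc, h, -⟩
    · exact h
    by_contra hzA
    have hne : c * (n + 1) / 2 ≠ 0 := by
      have hn : ((n : ℂ) + 1) ≠ 0 := by exact_mod_cast Nat.succ_ne_zero n
      simp [hc, hn]
    have h1 := h.eventually_ne hne
    rw [eventually_nhdsWithin_iff] at h1
    obtain ⟨w, hw, hwA⟩ := mem_closure_iff_nhds.1 hz _ h1
    have hwz : w ≠ z := by rintro rfl; exact hzA hwA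
    refine hw hwz ?_
    have e : (fun w => (φ w : ℂ)) =ᶠ[nhds w] fun _ => 0 := by
      filter_upwards [hwA] with y hy using by simp [hy]
    rw [cgrad, dz, dx_congr e, dy_congr e]
    simp [dx, dy]
  have : A = Set.univ := IsClopen.eq_univ ⟨hAc, hAo⟩ ⟨a, ha⟩
  intro z
  have hz : ∀ᶠ w in nhds z, φ w = 0 := this.symm.subset (Set.mem_univ z)
  exact hz.self_of_nhds

lemma exists_unit_pow (c : ℂ) {N : ℕ} (hN : 0 < N) :
    ∃ v : ℂ, ‖v‖ = 1 ∧ (c * v ^ N).re = ‖c‖ := by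
  refine ⟨Complex.exp ((-(c.arg / N) : ℝ) * Complex.I), Complex.norm_exp_ofReal_mul_I _, ?_⟩
  have hN' : (N : ℂ) ≠ 0 := by exact_mod_cast hN.ne'
  have hp := Complex.norm_mul_exp_arg_mul_I c
  generalize c.arg = θ at hp ⊢
  have e : c * Complex.exp ((-(θ / N) : ℝ) * Complex.I) ^ N = ‖c‖ := by
    have : (θ : ℂ) * Complex.I + N * ((-(θ / N) : ℝ) * Complex.I) = 0 := by
      push_cast; field_simp; ring
    calc c * Complex.exp ((-(θ / N) : ℝ) * Complex.I) ^ N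
        = ‖c‖ * Complex.exp (θ * Complex.I) * Complex.exp ((-(θ / N) : ℝ) * Complex.I) ^ N := by
          rw [hp]
      _ = ‖c‖ := by
        rw [← Complex.exp_nat_mul, mul_assoc, ← Complex.exp_add, this, Complex.exp_zero, mul_one]
  rw [e, Complex.ofReal_re]

lemma SubLinear.neg {φ : ℂ → ℝ} (hφ : SubLinear φ) : SubLinear fun z => -φ z := by
  refine ⟨hφ.1.neg, fun a => ?_⟩
  obtain ⟨C, r, hr, h⟩ := hφ.2 a
  exact ⟨C, r, hr, fun z hz => by rw [plap_neg, abs_neg, abs_neg]; exact h z hz⟩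

/-- A nontrivial solution changes sign near each of its zeros. -/
lemma SubLinear.frequently_pos {φ : ℂ → ℝ} (hφ : SubLinear φ) (hne : ∃ z, φ z ≠ 0) {a : ℂ}
    (h0 : φ a = 0) : ∃ᶠ z in nhds a, 0 < φ z := by
  rcases hφ.expansion h0 with h | ⟨n, c, hc, -, h⟩
  · obtain ⟨z, hz⟩ := hne
    exact absurd (hφ.eq_zero h z) hz
  obtain ⟨v, hv, hvc⟩ := exists_unit_pow c n.succ_pos
  have hc0 : 0 < ‖c‖ := norm_pos_iff.2 hc
  have h1 := h (‖c‖ / 2) (by positivity)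
  have ht : Filter.Tendsto (fun t : ℝ => a + t * v) (nhdsWithin 0 (Set.Ioi 0)) (nhds a) := by
    have : ContinuousAt (fun t : ℝ => a + t * v) 0 := by fun_prop
    have h2 := this.tendsto
    simp only [Complex.ofReal_zero, zero_mul, add_zero] at h2
    exact h2.mono_left nhdsWithin_le_nhds
  refine ht.frequently (Filter.Eventually.frequently ?_)
  filter_upwards [ht.eventually h1, self_mem_nhdsWithin] with t ht1 ht0
  have ht0 : 0 < t := ht0
  rw [add_sub_cancel_left, norm_mul, hv, Complex.norm_real, Real.norm_of_nonneg ht0.le,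
    mul_one] at ht1
  have e : (c * (t * v) ^ (n + 1)).re = t ^ (n + 1) * ‖c‖ := by
    rw [← hvc, mul_pow, mul_left_comm, ← Complex.ofReal_pow, Complex.re_ofReal_mul]
  rw [e, abs_le] at ht1
  have : 0 < t ^ (n + 1) * ‖c‖ := by positivity
  linarith [ht1.1]

lemma log_lift_const {g h : ℝ → ℂ} (hg : Continuous g) (hh : Continuous h)
    (e : ∀ t, Complex.exp (g t) = h t) (hre : ∀ t, 0 ≤ (h t).re) (a b : ℝ) :
    g a - Complex.log (h a) = g b - Complex.log (h b) := by
  have hs : ∀ t, h t ∈ Complex.slitPlane := by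
    intro t
    rw [Complex.mem_slitPlane_iff]
    rcases (hre t).lt_or_eq with h1 | h1
    · exact Or.inl h1
    · refine Or.inr fun h2 => ?_
      have : h t = 0 := Complex.ext h1.symm h2
      exact Complex.exp_ne_zero (g t) (by rw [e, this])
  have hk : Continuous fun t => g t - Complex.log (h t) := hg.sub (hh.clog hs)
  have h1 : ∀ t, ∃ n : ℤ, g t - Complex.log (h t) = n * (2 * π * Complex.I) := by
    intro t
    rw [← Complex.exp_eq_one_iff, Complex.exp_sub, Complex.exp_log, e, div_self]
    all_goals exact Complex.slitPlane_ne_zero (hs t)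
  choose n hn using h1
  have hnc : Continuous n := by
    rw [Int.isClosedEmbedding_coe_real.continuous_iff]
    have : (Int.cast ∘ n : ℝ → ℝ) = fun t => (g t - Complex.log (h t)).im / (2 * π) := by
      funext t
      have := pi_pos.ne'
      rw [hn t]
      simp
    rw [this]
    exact (Complex.continuous_im.comp hk).div_const _
  rw [hn a, hn b, PreconnectedSpace.constant inferInstance hnc]

/-- Paths in a vertical strip cannot be linked on its boundary without crossing. -/
lemma crossing {A B : ℝ → ℂ} (hA : Continuous A) (hB : Continuous B) {T θ₁ θ₂ θ₃ : ℝ}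
    (hAT : ∀ s, |(A s).re| ≤ T) (hBT : ∀ s, |(B s).re| ≤ T)
    (hA0 : A 0 = T + θ₁ * Complex.I) (hA1 : A 1 = T + θ₃ * Complex.I)
    (hB0 : B 0 = T + θ₂ * Complex.I) (hB1 : (B 1).re = -T)
    (h12 : θ₁ < θ₂) (h23 : θ₂ < θ₃) : ∃ s t, A s = B t := by
  by_contra! hne
  obtain ⟨L, ⟨-, hL⟩, -⟩ := Complex.isCoveringMapOn_exp.existsUnique_continuousMap_lifts
    (A := ℝ × ℝ) ⟨fun x => A x.1 - B x.2, by fun_prop⟩ (a₀ := (0, 0))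
    (e₀ := Complex.log (A 0 - B 0)) (Complex.exp_log (sub_ne_zero.2 (hne 0 0)))
    (fun x => sub_ne_zero.2 (hne x.1 x.2))
  have hL : ∀ s t, Complex.exp (L (s, t)) = A s - B t := fun s t => congrFun hL (s, t)
  have hAT' := fun s => abs_le.1 (hAT s)
  have hBT' := fun s => abs_le.1 (hBT s)
  have e1 := log_lift_const (g := fun t => L (0, t)) (h := fun t => A 0 - B t) (by fun_prop)
    (by fun_prop) (fun t => hL 0 t) (fun t => by simp [hA0]; linarith [(hBT' t).2]) 0 1
  have e2 := log_lift_const (g := fun s => L (s, 1)) (h := fun s => A s - B 1) (by fun_prop)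
    (by fun_prop) (fun t => hL t 1) (fun t => by simp [hB1]; linarith [(hAT' t).1]) 0 1
  have e3 := log_lift_const (g := fun t => L (1, t)) (h := fun t => A 1 - B t) (by fun_prop)
    (by fun_prop) (fun t => hL 1 t) (fun t => by simp [hA1]; linarith [(hBT' t).2]) 1 0
  have e4 := log_lift_const (g := fun s => L (s, 0) + π * Complex.I) (h := fun s => B 0 - A s)
    (by fun_prop) (by fun_prop) (fun t => by rw [Complex.exp_add, hL, Complex.exp_pi_mul_I]; ring)
    (fun t => by simp [hB0]; linarith [(hAT' t).2]) 0 1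
  have f1 := (e1.trans e2).trans e3
  have k1 : A 0 - B 0 = ((θ₂ - θ₁ : ℝ) : ℂ) * -Complex.I := by rw [hA0, hB0]; push_cast; ring
  have k2 : B 0 - A 0 = ((θ₂ - θ₁ : ℝ) : ℂ) * Complex.I := by rw [hA0, hB0]; push_cast; ring
  have k3 : A 1 - B 0 = ((θ₃ - θ₂ : ℝ) : ℂ) * Complex.I := by rw [hA1, hB0]; push_cast; ring
  have k4 : B 0 - A 1 = ((θ₃ - θ₂ : ℝ) : ℂ) * -Complex.I := by rw [hA1, hB0]; push_cast; ring
  rw [k1, k3, Complex.log_ofReal_mul (sub_pos.2 h12) (by simp),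
    Complex.log_ofReal_mul (sub_pos.2 h23) (by simp), Complex.log_I, Complex.log_neg_I] at f1
  rw [k2, k4, Complex.log_ofReal_mul (sub_pos.2 h12) (by simp),
    Complex.log_ofReal_mul (sub_pos.2 h23) (by simp), Complex.log_I, Complex.log_neg_I] at e4
  have : (2 * π * Complex.I : ℂ) = 0 := by linear_combination f1 - e4
  have hh := congrArg Complex.im this
  simp [pi_pos.ne'] at hh

/-- The conformal map from the strip `|Im W| < π / 2` onto the unit disc. -/
def stripMap (W : ℂ) : ℂ := (Complex.exp W - 1) / (Complex.exp W + 1)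

def strip : Set ℂ := {W | |W.im| < π / 2}

lemma exp_re_pos {W : ℂ} (hW : W ∈ strip) : 0 < (Complex.exp W).re := by
  rw [Complex.exp_re]
  have := abs_lt.1 (show |W.im| < π / 2 from hW)
  exact mul_pos (Real.exp_pos _) (Real.cos_pos_of_mem_Ioo ⟨this.1, this.2⟩)

lemma exp_add_one_ne {W : ℂ} (hW : W ∈ strip) : Complex.exp W + 1 ≠ 0 := by
  intro h
  have := congrArg Complex.re h
  simp only [Complex.add_re, Complex.one_re, Complex.zero_re] at this
  linarith [exp_re_pos hW]

lemma stripMap_mem {W : ℂ} (hW : W ∈ strip) : stripMap W ∈ Metric.ball (0 : ℂ) 1 := by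
  rw [mem_ball_zero_iff, stripMap, norm_div, div_lt_one (norm_pos_iff.2 (exp_add_one_ne hW))]
  refine lt_of_pow_lt_pow_left₀ 2 (norm_nonneg _) ?_
  rw [← Complex.normSq_eq_norm_sq, ← Complex.normSq_eq_norm_sq, Complex.normSq_apply,
    Complex.normSq_apply]
  simp only [Complex.sub_re, Complex.one_re, Complex.sub_im, Complex.one_im, Complex.add_re,
    Complex.add_im]
  nlinarith [exp_re_pos hW]

lemma continuousOn_stripMap : ContinuousOn stripMap strip := by
  intro W hW
  refine ContinuousAt.continuousWithinAt ?_
  unfold stripMap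
  exact ContinuousAt.div (by fun_prop) (by fun_prop) (exp_add_one_ne hW)

lemma stripMap_neg {W : ℂ} (hW : W ∈ strip) : stripMap (-W) = -stripMap W := by
  have h := exp_add_one_ne hW
  have h0 := Complex.exp_ne_zero W
  rw [stripMap, stripMap, Complex.exp_neg]
  have h1 : (Complex.exp W)⁻¹ + 1 ≠ 0 := by
    intro h2
    field_simp at h2
    exact h (by rw [add_comm, h2, mul_zero])
  have h3 : 1 + Complex.exp W ≠ 0 := by rwa [add_comm]
  field_simp
  ring

def stripInv (z : ℂ) : ℂ := Complex.log ((1 + z) / (1 - z))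

lemma stripInv_aux {z : ℂ} (hz : z ∈ Metric.ball (0 : ℂ) 1) : 0 < ((1 + z) / (1 - z)).re := by
  have h : z.re ^ 2 + z.im ^ 2 < 1 := by
    have := mem_ball_zero_iff.1 hz
    have h2 : ‖z‖ ^ 2 < 1 := by nlinarith [norm_nonneg z]
    rw [← Complex.normSq_eq_norm_sq, Complex.normSq_apply] at h2
    nlinarith
  have h1 : 0 < Complex.normSq (1 - z) := by
    rw [Complex.normSq_pos]
    intro h0
    rw [← sub_eq_zero.1 h0] at h
    simp at h
  rw [Complex.div_re, ← add_div]
  refine div_pos ?_ h1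
  simp
  nlinarith

lemma sub_ne_of_mem_ball {z : ℂ} (hz : z ∈ Metric.ball (0 : ℂ) 1) : 1 - z ≠ 0 := by
  intro h
  rw [mem_ball_zero_iff, ← sub_eq_zero.1 h] at hz
  simp at hz

lemma continuousOn_stripInv : ContinuousOn stripInv (Metric.ball 0 1) := by
  intro z hz
  refine ContinuousAt.continuousWithinAt ?_
  unfold stripInv
  refine ContinuousAt.clog ?_ (Complex.mem_slitPlane_iff.2 (Or.inl (stripInv_aux hz)))
  exact ContinuousAt.div (by fun_prop) (by fun_prop) (sub_ne_of_mem_ball hz)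

lemma stripInv_mem {z : ℂ} (hz : z ∈ Metric.ball (0 : ℂ) 1) : stripInv z ∈ strip := by
  change |(Complex.log _).im| < _
  rw [Complex.log_im]
  exact Complex.abs_arg_lt_pi_div_two_iff.2 (Or.inl (stripInv_aux hz))

lemma stripMap_stripInv {z : ℂ} (hz : z ∈ Metric.ball (0 : ℂ) 1) : stripMap (stripInv z) = z := by
  have h1 := sub_ne_of_mem_ball hz
  have h2 : (1 + z) / (1 - z) ≠ 0 := by
    intro h
    have := stripInv_aux hz
    rw [h] at this
    simp at this
  rw [stripMap, stripInv, Complex.exp_log h2]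
  have h3 : 1 + z + (1 - z) ≠ 0 := by ring_nf; norm_num
  field_simp
  ring

lemma stripInv_stripMap {W : ℂ} (hW : W ∈ strip) : stripInv (stripMap W) = W := by
  have h := exp_add_one_ne hW
  have : (1 + stripMap W) / (1 - stripMap W) = Complex.exp W := by
    have h0 : 1 - stripMap W ≠ 0 := sub_ne_of_mem_ball (stripMap_mem hW)
    rw [div_eq_iff h0, stripMap]
    field_simp
    ring
  rw [stripInv, this]
  have := abs_lt.1 (show |W.im| < π / 2 from hW)
  exact Complex.log_exp (by linarith [pi_pos]) (by linarith [pi_pos])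

lemma ray_mem_strip {θ : ℝ} (hθ : |θ| < π / 2) (S : ℝ) : (S + θ * Complex.I : ℂ) ∈ strip := by
  simpa [strip] using hθ

lemma tendsto_exp_neg_ray (θ : ℝ) :
    Filter.Tendsto (fun S : ℝ => Complex.exp (-(S + θ * Complex.I))) Filter.atTop (nhds 0) := by
  rw [tendsto_zero_iff_norm_tendsto_zero]
  have : (fun S : ℝ => ‖Complex.exp (-(S + θ * Complex.I))‖) = fun S => Real.exp (-S) := by
    funext S
    rw [Complex.norm_exp]
    simp
  rw [this]
  exact Real.tendsto_exp_neg_atTop_nhds_zero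

lemma stripMap_sub_one {W : ℂ} (hW : W ∈ strip) :
    stripMap W - 1 = -2 * Complex.exp (-W) / (1 + Complex.exp (-W)) := by
  have h := exp_add_one_ne hW
  have h0 := Complex.exp_ne_zero W
  rw [stripMap, Complex.exp_neg]
  have h1 : 1 + (Complex.exp W)⁻¹ ≠ 0 := by
    intro h2
    field_simp at h2
    exact h (by rw [h2, mul_zero])
  field_simp
  ring

lemma tendsto_stripMap {θ : ℝ} (hθ : |θ| < π / 2) :
    Filter.Tendsto (fun S : ℝ => stripMap (S + θ * Complex.I)) Filter.atTop (nhds 1) := by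
  rw [← tendsto_sub_nhds_zero_iff]
  have := tendsto_exp_neg_ray θ
  have h2 := (this.const_mul (-2 : ℂ)).div (this.const_add 1) (by simp)
  simp only [mul_zero, zero_div] at h2
  refine h2.congr fun S => ?_
  rw [stripMap_sub_one (ray_mem_strip hθ S)]
  rfl

/-- The sign of `φ` along a ray ending at `1`. -/
lemma ray_pos {φ : ℂ → ℝ} {c : ℂ} {N : ℕ} {θ : ℝ} (hθ : |θ| < π / 2)
    (h : ∀ ε > 0, ∀ᶠ z in nhds (1 : ℂ), |φ z - (c * (z - 1) ^ N).re| ≤ ε * ‖z - 1‖ ^ N)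
    (hc : 0 < (c * (-1) ^ N * Complex.exp (-(N * θ : ℝ) * Complex.I)).re) :
    ∀ᶠ S : ℝ in Filter.atTop, 0 < φ (stripMap (S + θ * Complex.I)) := by
  set A := (c * (-1) ^ N * Complex.exp (-(N * θ : ℝ) * Complex.I)).re with hA
  let e : ℝ → ℂ := fun S => Complex.exp (-(S + θ * Complex.I))
  have he : Filter.Tendsto e Filter.atTop (nhds 0) := tendsto_exp_neg_ray θ
  have h1 := (tendsto_stripMap hθ).eventually (h (A / 3) (by positivity))
  have h2 : Filter.Tendsto (fun S => (c * (-1) ^ N * Complex.exp (-(N * θ : ℝ) * Complex.I) *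
      (‖1 + e S‖ / (1 + e S)) ^ N).re) Filter.atTop (nhds A) := by
    have h3 : Filter.Tendsto (fun S => (‖1 + e S‖ : ℂ) / (1 + e S)) Filter.atTop (nhds 1) := by
      have h4 := he.const_add 1
      have h5 := (Complex.continuous_ofReal.tendsto _).comp h4.norm
      have h6 := h5.div h4 (by simp)
      simp only [add_zero, norm_one, Complex.ofReal_one, div_one] at h6
      exact h6
    have h7 := (Complex.continuous_re.tendsto _).comp ((h3.pow N).const_mul
      (c * (-1) ^ N * Complex.exp (-(N * θ : ℝ) * Complex.I)))
    simp only [one_pow, mul_one] at h7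
    exact h7
  have h8 := h2.eventually_const_lt (u := A / 2) (by linarith)
  have h9 := (he.const_add 1).eventually_ne (b₂ := 0) (by simp)
  filter_upwards [h1, h8, h9] with S hS1 hS2 hS3
  set z := stripMap (S + θ * Complex.I) with hz
  have hz1 : z - 1 = -2 * e S / (1 + e S) := stripMap_sub_one (ray_mem_strip hθ S)
  have hn : 0 < ‖z - 1‖ := by
    rw [hz1, norm_pos_iff]
    exact div_ne_zero (mul_ne_zero (by norm_num) (Complex.exp_ne_zero _)) hS3
  have hes : e S = Real.exp (-S) * Complex.exp (-θ * Complex.I) := by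
    rw [Complex.ofReal_exp, ← Complex.exp_add]
    change Complex.exp _ = _
    congr 1
    push_cast; ring
  have hne : ‖e S‖ = Real.exp (-S) := by
    rw [Complex.norm_exp]; simp
  have key : c * (z - 1) ^ N = ((‖z - 1‖ ^ N : ℝ) : ℂ) *
      (c * (-1) ^ N * Complex.exp (-(N * θ : ℝ) * Complex.I) * (‖1 + e S‖ / (1 + e S)) ^ N) := by
    have e1 : Complex.exp (-(N * θ : ℝ) * Complex.I) = Complex.exp (-θ * Complex.I) ^ N := by
      rw [← Complex.exp_nat_mul]; congr 1; push_cast; ring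
    have e2 : z - 1 = ‖z - 1‖ * (-1 * Complex.exp (-θ * Complex.I) * (‖1 + e S‖ / (1 + e S))) := by
      have hn1 : (‖1 + e S‖ : ℂ) ≠ 0 := by
        exact_mod_cast (norm_pos_iff.2 hS3).ne'
      rw [hz1, norm_div, norm_mul, hne]
      push_cast
      rw [show ‖(-2 : ℂ)‖ = 2 by simp]
      have h10 : e S / (1 + e S) = Real.exp (-S) * Complex.exp (-θ * Complex.I) / (1 + e S) := by
        rw [hes]
      rw [mul_div_assoc, h10]
      push_cast
      field_simp
    calc c * (z - 1) ^ N = c * (‖z - 1‖ *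
          (-1 * Complex.exp (-θ * Complex.I) * (‖1 + e S‖ / (1 + e S)))) ^ N := by rw [← e2]
      _ = _ := by rw [e1]; push_cast; rw [mul_pow, mul_pow, mul_pow]; ring
  rw [key, Complex.re_ofReal_mul] at hS1
  have := (abs_le.1 hS1).1
  have hp : 0 < ‖z - 1‖ ^ N := by positivity
  nlinarith

lemma exists_angles {N : ℕ} (hN : 0 < N) {γ : ℂ} (hγ : γ ≠ 0) :
    ∃ s : ℝ, (s = 1 ∨ s = -1) ∧ ∃ θ : ℕ → ℝ, StrictMono θ ∧ ∀ j < N, |θ j| < π / 2 ∧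
      0 < s * (-1) ^ j * (γ * Complex.exp (-(N * θ j : ℝ) * Complex.I)).re := by
  set β := γ.arg with hβ
  set x : ℝ := -(N / 2) - β / π with hx
  set k : ℤ := ⌊x⌋ + 1 with hk
  set η : ℝ := (k - x) / 3 with hη
  have hN' : (0 : ℝ) < N := by exact_mod_cast hN
  have hk1 : x < k := by rw [hk]; push_cast; exact Int.lt_floor_add_one x
  have hk2 : (k : ℝ) ≤ x + 1 := by rw [hk]; push_cast; linarith [Int.floor_le x]
  have hπ := pi_pos
  refine ⟨(-1) ^ k, by rw [neg_one_zpow_eq_ite]; split_ifs <;> simp, fun j => (β + π * (k + j - η)) / N, ?_, ?_⟩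
  · intro i j hij
    have : (i : ℝ) < j := by exact_mod_cast hij
    dsimp only
    gcongr
  · intro j hj
    have hj1 : (j : ℝ) + 1 ≤ N := by exact_mod_cast hj
    have hj0 : (0 : ℝ) ≤ j := Nat.cast_nonneg j
    have e0 : β = -π * x - π * (N / 2) := by rw [hx]; field_simp; ring
    constructor
    · rw [abs_lt, lt_div_iff₀ hN', div_lt_iff₀ hN', e0]
      constructor
      · nlinarith
      · nlinarith
    · have e1 : (N : ℝ) * ((β + π * (k + j - η)) / N) = β + π * (k + j - η) := by
        field_simp
      rw [e1]
      have e2 : γ * Complex.exp (-(β + π * (k + j - η) : ℝ) * Complex.I) =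
          ‖γ‖ * Complex.exp ((-(π * (k + j - η)) : ℝ) * Complex.I) := by
        conv_lhs => rw [← Complex.norm_mul_exp_arg_mul_I γ]
        rw [mul_assoc, ← Complex.exp_add, ← hβ]
        congr 2
        push_cast; ring
      rw [e2, Complex.re_ofReal_mul, Complex.exp_ofReal_mul_I_re, Real.cos_neg]
      have e3 : π * (k + j - η) = ((k + j : ℤ) : ℝ) * π - π * η := by push_cast; ring
      rw [e3, Real.cos_int_mul_pi_sub, zpow_add₀ (by norm_num : (-1 : ℝ) ≠ 0) k]
      have hcos : 0 < Real.cos (π * η) :=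
        Real.cos_pos_of_mem_Ioo ⟨by nlinarith, by nlinarith⟩
      have hγ' : 0 < ‖γ‖ := norm_pos_iff.2 hγ
      have e4 : ((-1 : ℝ) ^ k) * ((-1) ^ k) = 1 := by
        rw [← mul_zpow]; norm_num
      have e5 : ((-1 : ℝ) ^ j) * ((-1) ^ j) = 1 := by
        rw [← mul_pow]; norm_num
      have : (-1 : ℝ) ^ k * (-1) ^ j * (‖γ‖ * ((-1) ^ k * (-1) ^ (j : ℤ) * Real.cos (π * η))) =
          ‖γ‖ * Real.cos (π * η) := by
        rw [zpow_natCast]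
        linear_combination ‖γ‖ * Real.cos (π * η) * ((-1) ^ j * (-1) ^ j) * e4 +
          ‖γ‖ * Real.cos (π * η) * e5
      rw [this]
      positivity

section

lemma joinedIn_horizontal {Q : Set ℂ} {a b θ : ℝ} (hab : a ≤ b)
    (h : ∀ S ∈ Set.Icc a b, (S + θ * Complex.I : ℂ) ∈ Q) :
    JoinedIn Q (a + θ * Complex.I) (b + θ * Complex.I) := by
  refine JoinedIn.ofLine (f := fun t : ℝ => (((1 - t) * a + t * b : ℝ) : ℂ) + θ * Complex.I)
    (by fun_prop) (by simp) (by simp) ?_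
  rintro _ ⟨t, ⟨h0, h1⟩, rfl⟩
  exact h _ ⟨by nlinarith, by nlinarith⟩

lemma JoinedIn.exists_bound {F : Set ℂ} {x y : ℂ} (h : JoinedIn F x y) :
    ∃ R : ℝ, ∀ T, R ≤ T → JoinedIn (F ∩ {W | |W.re| ≤ T}) x y := by
  obtain ⟨γ, hγ⟩ := h
  have hc : IsCompact (Set.range γ) := isCompact_range γ.continuous
  obtain ⟨R, hR⟩ := hc.isBounded.exists_norm_le
  exact ⟨R, fun T hT => ⟨γ, fun t => ⟨hγ t,
    (Complex.abs_re_le_norm _).trans ((hR _ ⟨t, rfl⟩).trans hT)⟩⟩⟩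

lemma JoinedIn.strip_lift {Ω : Set ℂ} (hΩ : Ω ⊆ Metric.ball 0 1) {V W : ℂ} (hV : V ∈ strip)
    (hW : W ∈ strip) (h : JoinedIn Ω (stripMap V) (stripMap W)) :
    JoinedIn {W ∈ strip | stripMap W ∈ Ω} V W := by
  have h1 := h.map_continuousOn (continuousOn_stripInv.mono hΩ)
  rw [stripInv_stripMap hV, stripInv_stripMap hW] at h1
  refine h1.mono ?_
  rintro _ ⟨z, hz, rfl⟩
  exact ⟨stripInv_mem (hΩ hz), by rw [stripMap_stripInv (hΩ hz)]; exact hz⟩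

/-- Two disjoint path connected subsets of the disc cannot be linked at the boundary. -/
lemma not_linked {Ω Ω' : Set ℂ} (hΩ : Ω ⊆ Metric.ball 0 1) (hΩ' : Ω' ⊆ Metric.ball 0 1)
    (hp : IsPathConnected Ω) (hp' : IsPathConnected Ω') (hd : Disjoint Ω Ω')
    {θ₁ θ₂ θ₃ θ T : ℝ} (h1 : |θ₁| < π / 2) (h2 : |θ₂| < π / 2) (h3 : |θ₃| < π / 2)
    (h4 : |θ| < π / 2) (h12 : θ₁ < θ₂) (h23 : θ₂ < θ₃)
    (r1 : ∀ S : ℝ, T ≤ S → stripMap (S + θ₁ * Complex.I) ∈ Ω)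
    (r2 : ∀ S : ℝ, T ≤ S → stripMap (S + θ₂ * Complex.I) ∈ Ω')
    (r3 : ∀ S : ℝ, T ≤ S → stripMap (S + θ₃ * Complex.I) ∈ Ω)
    (r4 : ∀ S : ℝ, S ≤ -T → stripMap (S + θ * Complex.I) ∈ Ω') : False := by
  have j1 := JoinedIn.strip_lift hΩ (ray_mem_strip h1 T) (ray_mem_strip h3 T)
    (hp.joinedIn _ (r1 T le_rfl) _ (r3 T le_rfl))
  have j2 := JoinedIn.strip_lift hΩ' (ray_mem_strip h2 T) (ray_mem_strip h4 (-T))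
    (hp'.joinedIn _ (r2 T le_rfl) _ (by exact_mod_cast r4 (-T) le_rfl))
  obtain ⟨R1, hR1⟩ := JoinedIn.exists_bound j1
  obtain ⟨R2, hR2⟩ := JoinedIn.exists_bound j2
  set R := max (max R1 R2) |T| with hR
  have hRT : T ≤ R := (le_abs_self T).trans (le_max_right _ _)
  have hRT' : -T ≤ R := (neg_le_abs T).trans (le_max_right _ _)
  have k1 := hR1 R ((le_max_left _ _).trans (le_max_left _ _))
  have k2 := hR2 R ((le_max_right _ _).trans (le_max_left _ _))
  have a1 : JoinedIn ({W ∈ strip | stripMap W ∈ Ω} ∩ {W | |W.re| ≤ R})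
      (R + θ₁ * Complex.I) (R + θ₃ * Complex.I) := by
    refine JoinedIn.trans (JoinedIn.symm ?_) (JoinedIn.trans k1 ?_)
    all_goals
      refine joinedIn_horizontal hRT fun S hS => ⟨⟨ray_mem_strip ‹_› S, ?_⟩, ?_⟩
      · first | exact r1 S hS.1 | exact r3 S hS.1
      · change |(_ : ℂ).re| ≤ R
        simp only [Complex.add_re, Complex.ofReal_re, Complex.re_ofReal_mul, Complex.I_re,
          mul_zero, add_zero]
        exact abs_le.2 ⟨by linarith [hS.1], hS.2⟩
  have a2 : JoinedIn ({W ∈ strip | stripMap W ∈ Ω'} ∩ {W | |W.re| ≤ R})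
      (R + θ₂ * Complex.I) ((-R : ℝ) + θ * Complex.I) := by
    refine JoinedIn.trans (JoinedIn.symm ?_) (JoinedIn.trans k2 (JoinedIn.symm ?_))
    · refine joinedIn_horizontal hRT fun S hS => ⟨⟨ray_mem_strip h2 S, r2 S hS.1⟩, ?_⟩
      change |(_ : ℂ).re| ≤ R
      simp only [Complex.add_re, Complex.ofReal_re, Complex.re_ofReal_mul, Complex.I_re,
        mul_zero, add_zero]
      exact abs_le.2 ⟨by linarith [hS.1], hS.2⟩
    · refine joinedIn_horizontal (by linarith) fun S hS => ⟨⟨ray_mem_strip h4 S, r4 S hS.2⟩, ?_⟩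
      change |(_ : ℂ).re| ≤ R
      simp only [Complex.add_re, Complex.ofReal_re, Complex.re_ofReal_mul, Complex.I_re,
        mul_zero, add_zero]
      exact abs_le.2 ⟨hS.1, by linarith [hS.2]⟩
  obtain ⟨A, hA⟩ := a1
  obtain ⟨B, hB⟩ := a2
  have hA' : ∀ s, A.extend s ∈ {W ∈ strip | stripMap W ∈ Ω} ∩ {W | |W.re| ≤ R} := by
    intro s
    have : A.extend s ∈ Set.range A := by rw [← A.extend_range]; exact ⟨s, rfl⟩
    obtain ⟨t, ht⟩ := this
    rw [← ht]; exact hA t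
  have hB' : ∀ s, B.extend s ∈ {W ∈ strip | stripMap W ∈ Ω'} ∩ {W | |W.re| ≤ R} := by
    intro s
    have : B.extend s ∈ Set.range B := by rw [← B.extend_range]; exact ⟨s, rfl⟩
    obtain ⟨t, ht⟩ := this
    rw [← ht]; exact hB t
  obtain ⟨s, t, hst⟩ := crossing A.continuous_extend B.continuous_extend (fun s => (hA' s).2)
    (fun s => (hB' s).2) A.extend_zero A.extend_one B.extend_zero
    (by rw [B.extend_one]; simp) h12 h23
  exact Set.disjoint_left.1 hd (hA' s).1.2 (by rw [hst]; exact (hB' t).1.2)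

/-- The nodal domain of `φ` in the unit disc containing `z`. -/
def nodal (φ : ℂ → ℝ) (z : ℂ) : Set ℂ :=
  connectedComponentIn {w ∈ Metric.ball (0 : ℂ) 1 | φ w ≠ 0} z

section nodal
variable {φ : ℂ → ℝ}

lemma nodal_subset (z : ℂ) : nodal φ z ⊆ {w ∈ Metric.ball (0 : ℂ) 1 | φ w ≠ 0} :=
  connectedComponentIn_subset _ _

lemma isOpen_nodal (hφ : Continuous φ) (z : ℂ) : IsOpen (nodal φ z) :=
  IsOpen.connectedComponentIn (Metric.isOpen_ball.inter (hφ.isOpen_preimage _ isOpen_ne))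

lemma isPreconnected_nodal (z : ℂ) : IsPreconnected (nodal φ z) :=
  isPreconnected_connectedComponentIn

lemma mem_nodal {z : ℂ} (hz : z ∈ Metric.ball (0 : ℂ) 1) (h : φ z ≠ 0) : z ∈ nodal φ z :=
  mem_connectedComponentIn ⟨hz, h⟩

lemma isPathConnected_nodal (hφ : Continuous φ) {z : ℂ} (hz : z ∈ Metric.ball (0 : ℂ) 1)
    (h : φ z ≠ 0) : IsPathConnected (nodal φ z) :=
  (isOpen_nodal hφ z).isConnected_iff_isPathConnected.1 ⟨⟨z, mem_nodal hz h⟩,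
    isPreconnected_nodal z⟩

lemma nodal_pos (hφ : Continuous φ) {z w : ℂ} (hz : 0 < φ z) (hw : w ∈ nodal φ z) :
    0 < φ w := by
  have hzm : z ∈ nodal φ z := by
    have : z ∈ {w ∈ Metric.ball (0 : ℂ) 1 | φ w ≠ 0} := by
      by_contra h
      rw [nodal, connectedComponentIn_eq_empty h] at hw
      exact hw
    exact mem_connectedComponentIn this
  by_contra! hneg
  obtain ⟨x, hx, hx0⟩ := (isPreconnected_nodal z).intermediate_value hw hzm hφ.continuousOn
    ⟨hneg, hz.le⟩
  exact (nodal_subset z hx).2 hx0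

lemma nodal_disjoint {z w : ℂ} (h : nodal φ z ≠ nodal φ w) : Disjoint (nodal φ z) (nodal φ w) := by
  by_contra hd
  obtain ⟨x, hx, hy⟩ := Set.not_disjoint_iff.1 hd
  exact h ((connectedComponentIn_eq hx).trans (connectedComponentIn_eq hy).symm)

lemma nodal_neg (z : ℂ) : nodal (fun w => -φ w) z = nodal φ z := by
  unfold nodal; simp

lemma nodal_disjoint_of_sign (hφ : Continuous φ) {z w : ℂ} (hz : 0 < φ z) (hw : φ w < 0) :
    Disjoint (nodal φ z) (nodal φ w) := by
  rw [Set.disjoint_left]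
  intro x hx hy
  have h1 := nodal_pos hφ hz hx
  rw [← nodal_neg] at hy
  have h2 := nodal_pos (φ := fun w => -φ w) hφ.neg (by simpa using hw) hy
  linarith

lemma subset_nodal {A : Set ℂ} (hA : IsPreconnected A) {z : ℂ} (hz : z ∈ A)
    (h : A ⊆ {w ∈ Metric.ball (0 : ℂ) 1 | φ w ≠ 0}) : A ⊆ nodal φ z :=
  hA.subset_connectedComponentIn hz h

end nodal

lemma ray_subset_nodal {φ : ℂ → ℝ} {θ T : ℝ} (hθ : |θ| < π / 2)
    (h : ∀ S : ℝ, T ≤ S → φ (stripMap (S + θ * Complex.I)) ≠ 0) (S : ℝ) (hS : T ≤ S) :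
    stripMap (S + θ * Complex.I) ∈ nodal φ (stripMap (T + θ * Complex.I)) := by
  have hc : IsPreconnected ((fun S : ℝ => stripMap (S + θ * Complex.I)) '' Set.Ici T) := by
    refine isPreconnected_Ici.image _ (ContinuousOn.comp continuousOn_stripMap (by fun_prop) ?_)
    exact fun S _ => ray_mem_strip hθ S
  refine subset_nodal hc ⟨T, Set.self_mem_Ici, rfl⟩ ?_ ⟨S, hS, rfl⟩
  rintro _ ⟨S, hS, rfl⟩
  exact ⟨stripMap_mem (ray_mem_strip hθ S), h S hS⟩

lemma nodal_comp_neg {φ : ℂ → ℝ} {z w : ℂ} (h : w ∈ nodal (fun z => φ (-z)) z) :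
    -w ∈ nodal φ (-z) := by
  have hz : z ∈ {w ∈ Metric.ball (0 : ℂ) 1 | φ (-w) ≠ 0} := by
    by_contra hz
    rw [nodal, connectedComponentIn_eq_empty hz] at h
    exact h
  have hc := (isPreconnected_nodal (φ := fun z => φ (-z)) z).image (fun w => -w)
    continuous_neg.continuousOn
  refine subset_nodal hc ⟨z, mem_connectedComponentIn hz, rfl⟩ ?_ ⟨w, h, rfl⟩
  rintro _ ⟨x, hx, rfl⟩
  have := nodal_subset x (φ := fun z => φ (-z)) (mem_nodal (nodal_subset z hx).1
    (nodal_subset z hx).2)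
  exact ⟨by simpa using this.1, this.2⟩

lemma ray_mem_closure {θ T : ℝ} (hθ : |θ| < π / 2) {Ω : Set ℂ}
    (h : ∀ S : ℝ, T ≤ S → stripMap (S + θ * Complex.I) ∈ Ω) : (1 : ℂ) ∈ closure Ω :=
  mem_closure_of_tendsto (tendsto_stripMap hθ) (by
    filter_upwards [Filter.eventually_ge_atTop T] with S hS using h S hS)

/-- A function vanishing to third order at `1` and to second order at `-1` has three
nodal domains in the disc that touch its boundary. -/
lemma exists_three_nodal_aux {φ : ℂ → ℝ} (hφ : Continuous φ) {θ : ℕ → ℝ} (hθ : StrictMono θ)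
    (hθ' : ∀ j < 3, |θ j| < π / 2) {β : ℝ} (hβ : |β| < π / 2)
    (h0 : ∀ᶠ S : ℝ in Filter.atTop, 0 < φ (stripMap (S + θ 0 * Complex.I)))
    (h1 : ∀ᶠ S : ℝ in Filter.atTop, φ (stripMap (S + θ 1 * Complex.I)) < 0)
    (h2 : ∀ᶠ S : ℝ in Filter.atTop, 0 < φ (stripMap (S + θ 2 * Complex.I)))
    (h3 : ∀ᶠ S : ℝ in Filter.atTop, φ (-stripMap (S + β * Complex.I)) < 0) :
    ∃ z : Fin 3 → ℂ, (∀ i, z i ∈ Metric.ball (0 : ℂ) 1 ∧ φ (z i) ≠ 0) ∧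
      Pairwise (fun i j => Disjoint (nodal φ (z i)) (nodal φ (z j))) ∧
      ∀ i, (closure (nodal φ (z i)) ∩ (Metric.ball (0 : ℂ) 1)ᶜ).Nonempty := by
  obtain ⟨T, hT⟩ := Filter.eventually_atTop.1 (h0.and (h1.and (h2.and h3)))
  have b0 := hθ' 0 (by norm_num)
  have b1 := hθ' 1 (by norm_num)
  have b2 := hθ' 2 (by norm_num)
  have r0 := ray_subset_nodal b0 fun S hS => (hT S hS).1.ne'
  have r1 := ray_subset_nodal b1 fun S hS => (hT S hS).2.1.ne
  have r2 := ray_subset_nodal b2 fun S hS => (hT S hS).2.2.1.ne'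
  have r3 := ray_subset_nodal (φ := fun z => φ (-z)) hβ fun S hS => (hT S hS).2.2.2.ne
  have m := fun (t : ℝ) (ht : |t| < π / 2) => stripMap_mem (ray_mem_strip ht T)
  have hT' := hT T le_rfl
  have out : ∀ w : ℂ, ‖w‖ = 1 → w ∈ (Metric.ball (0 : ℂ) 1)ᶜ := fun w hw => by simp [hw]
  have c0 : ∀ {t : ℝ}, |t| < π / 2 → (∀ S : ℝ, T ≤ S → stripMap (S + t * Complex.I) ∈
      nodal φ (stripMap (T + t * Complex.I))) →
      (closure (nodal φ (stripMap (T + t * Complex.I))) ∩ (Metric.ball (0 : ℂ) 1)ᶜ).Nonempty :=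
    fun ht h => ⟨1, ray_mem_closure ht h, out 1 (by simp)⟩
  set z0 := stripMap (T + θ 0 * Complex.I)
  set z1 := stripMap (T + θ 1 * Complex.I)
  set z2 := stripMap (T + θ 2 * Complex.I)
  set z3 := -stripMap (T + β * Complex.I) with hz3
  have r3' : ∀ S : ℝ, T ≤ S → -stripMap (S + β * Complex.I) ∈ nodal φ z3 :=
    fun S hS => nodal_comp_neg (r3 S hS)
  have d01 := nodal_disjoint_of_sign hφ hT'.1 hT'.2.1
  have d21 := nodal_disjoint_of_sign hφ hT'.2.2.1 hT'.2.1
  have d03 := nodal_disjoint_of_sign hφ hT'.1 hT'.2.2.2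
  have pw : ∀ a b c : ℂ, Disjoint (nodal φ a) (nodal φ b) → Disjoint (nodal φ a) (nodal φ c) →
      Disjoint (nodal φ b) (nodal φ c) →
      Pairwise (fun i j : Fin 3 => Disjoint (nodal φ (![a, b, c] i)) (nodal φ (![a, b, c] j))) := by
    intro a b c hab hac hbc i j hij
    fin_cases i <;> fin_cases j <;> first | exact absurd rfl hij | skip
    exacts [hab, hac, hab.symm, hbc, hac.symm, hbc.symm]
  by_cases h02 : nodal φ z0 = nodal φ z2
  · have d13 : Disjoint (nodal φ z1) (nodal φ z3) := by
      refine nodal_disjoint fun h13 => ?_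
      refine not_linked (T := T) (fun x hx => (nodal_subset z0 hx).1)
        (fun x hx => (nodal_subset z1 hx).1) (isPathConnected_nodal hφ (m _ b0) hT'.1.ne')
        (isPathConnected_nodal hφ (m _ b1) hT'.2.1.ne) d01 b0 b1 b2 (θ := -β) (by rwa [abs_neg])
        (hθ (by norm_num)) (hθ (by norm_num)) r0 r1 (by rw [h02]; exact r2) ?_
      intro S hS
      have := r3' (-S) (by linarith)
      rw [← stripMap_neg (ray_mem_strip hβ _), ← h13] at this
      convert this using 2
      push_cast; ring
    refine ⟨![z0, z1, z3], ?_, pw _ _ _ d01 d03 d13, ?_⟩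
    · intro i
      fin_cases i
      · exact ⟨m _ b0, hT'.1.ne'⟩
      · exact ⟨m _ b1, hT'.2.1.ne⟩
      · exact ⟨by simpa [hz3] using m _ hβ, hT'.2.2.2.ne⟩
    · intro i
      fin_cases i
      · exact c0 b0 r0
      · exact c0 b1 r1
      · refine ⟨-1, ?_, out _ (by simp)⟩
        exact mem_closure_of_tendsto (tendsto_stripMap hβ).neg (by
          filter_upwards [Filter.eventually_ge_atTop T] with S hS using r3' S hS)
  · refine ⟨![z0, z1, z2], ?_, pw _ _ _ d01 (nodal_disjoint h02) d21.symm, ?_⟩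
    · intro i
      fin_cases i
      · exact ⟨m _ b0, hT'.1.ne'⟩
      · exact ⟨m _ b1, hT'.2.1.ne⟩
      · exact ⟨m _ b2, hT'.2.2.1.ne'⟩
    · intro i
      fin_cases i
      · exact c0 b0 r0
      · exact c0 b1 r1
      · exact c0 b2 r2

end

lemma order_pos_of_cgrad_eq_zero {φ : ℂ → ℝ} (hφ : ContDiff ℝ 2 φ) {a c : ℂ} {n : ℕ} (hc : c ≠ 0)
    (h : Filter.Tendsto (fun z => cgrad φ z / (z - a) ^ n) (nhdsWithin a {a}ᶜ)
      (nhds (c * (n + 1) / 2))) (g : cgrad φ a = 0) : 1 ≤ n := by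
  by_contra! hn
  obtain rfl : n = 0 := by omega
  have h1 : Filter.Tendsto (cgrad φ) (nhdsWithin a {a}ᶜ) (nhds 0) := by
    rw [← g]
    exact (contDiff_cgrad hφ).continuous.continuousAt.tendsto.mono_left nhdsWithin_le_nhds
  have := tendsto_nhds_unique h (by simpa using h1)
  simp [hc] at this

lemma two_le_order_of_fderiv_cgrad {φ : ℂ → ℝ} (hφ : ContDiff ℝ 2 φ) {a c : ℂ} {n : ℕ}
    (hc : c ≠ 0) (h : Filter.Tendsto (fun z => cgrad φ z / (z - a) ^ n) (nhdsWithin a {a}ᶜ)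
      (nhds (c * (n + 1) / 2))) (g : cgrad φ a = 0) (g' : fderiv ℝ (cgrad φ) a = 0) : 2 ≤ n := by
  have h1 := order_pos_of_cgrad_eq_zero hφ hc h g
  by_contra! hn
  obtain rfl : n = 1 := by omega
  have hd : HasFDerivAt (cgrad φ) (0 : ℂ →L[ℝ] ℂ) a := by
    rw [← g']
    exact ((contDiff_cgrad hφ).differentiable (by norm_num) a).hasFDerivAt
  have h2 := (hasFDerivAt_iff_isLittleO.1 hd)
  simp only [g, sub_zero, zero_apply] at h2
  have h3 : Filter.Tendsto (fun z => cgrad φ z / (z - a) ^ 1) (nhdsWithin a {a}ᶜ) (nhds 0) := by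
    have := h2.tendsto_div_nhds_zero.mono_left (nhdsWithin_le_nhds (s := {a}ᶜ))
    simpa using this
  have := tendsto_nhds_unique h h3
  norm_num at this
  exact hc this

lemma ray_sign {φ : ℂ → ℝ} {c : ℂ} {N : ℕ} {θ t : ℝ} (ht : t = 1 ∨ t = -1) (hθ : |θ| < π / 2)
    (h : ∀ ε > 0, ∀ᶠ z in nhds (1 : ℂ), |φ z - (c * (z - 1) ^ N).re| ≤ ε * ‖z - 1‖ ^ N)
    (hc : 0 < t * (c * (-1) ^ N * Complex.exp (-(N * θ : ℝ) * Complex.I)).re) :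
    ∀ᶠ S : ℝ in Filter.atTop, 0 < t * φ (stripMap (S + θ * Complex.I)) := by
  refine ray_pos (φ := fun z => t * φ z) (c := t * c) (N := N) hθ ?_ ?_
  · intro ε hε
    filter_upwards [h ε hε] with z hz
    rw [mul_assoc, Complex.re_ofReal_mul, ← mul_sub, abs_mul]
    rcases ht with rfl | rfl <;> simpa using hz
  · rw [mul_assoc, mul_assoc, Complex.re_ofReal_mul, ← mul_assoc]
    exact hc

theorem exists_three_nodal {φ : ℂ → ℝ} (hφ : SubLinear φ) (hne : ∃ z, φ z ≠ 0)
    (h1 : φ 1 = 0) (hm : φ (-1) = 0) (g1 : cgrad φ 1 = 0) (g1' : fderiv ℝ (cgrad φ) 1 = 0)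
    (gm : cgrad φ (-1) = 0) :
    ∃ z : Fin 3 → ℂ, (∀ i, z i ∈ Metric.ball (0 : ℂ) 1 ∧ φ (z i) ≠ 0) ∧
      Pairwise (fun i j => Disjoint (nodal φ (z i)) (nodal φ (z j))) ∧
      ∀ i, (closure (nodal φ (z i)) ∩ (Metric.ball (0 : ℂ) 1)ᶜ).Nonempty := by
  have nz : ∀ a, ¬ ∀ᶠ z in nhds a, φ z = 0 := by
    intro a ha
    obtain ⟨z, hz⟩ := hne
    exact hz (hφ.eq_zero ha z)
  obtain ⟨n, c, hc, hn, he⟩ := (hφ.expansion h1).resolve_left (nz 1)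
  obtain ⟨n', c', hc', hn', he'⟩ := (hφ.expansion hm).resolve_left (nz (-1))
  have hn2 := two_le_order_of_fderiv_cgrad hφ.1 hc hn g1 g1'
  have hn1 := order_pos_of_cgrad_eq_zero hφ.1 hc' hn' gm
  obtain ⟨s, hs, θ, hθ, hθs⟩ := exists_angles (N := n + 1) (by omega)
    (γ := c * (-1) ^ (n + 1)) (mul_ne_zero hc (by simp))
  obtain ⟨s', hs', θ', -, hθs'⟩ := exists_angles (N := n' + 1) (by omega)
    (γ := c' * (-1) ^ (n' + 1) * (-1) ^ (n' + 1)) (mul_ne_zero (mul_ne_zero hc' (by simp)) (by simp))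
  have hem : ∀ ε > 0, ∀ᶠ z in nhds (1 : ℂ),
      |φ (-z) - (c' * (-1) ^ (n' + 1) * (z - 1) ^ (n' + 1)).re| ≤ ε * ‖z - 1‖ ^ (n' + 1) := by
    intro ε hε
    have ht : Filter.Tendsto (fun z : ℂ => -z) (nhds 1) (nhds (-1)) :=
      continuous_neg.tendsto 1
    filter_upwards [ht.eventually (he' ε hε)] with z hz
    have e : -z - -1 = -1 * (z - 1) := by ring
    rw [e, mul_pow, ← mul_assoc, norm_mul] at hz
    simpa using hz
  obtain ⟨j, hj, hjs⟩ : ∃ j < n' + 1, s' * (-1) ^ j = -s := by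
    rcases hs with rfl | rfl <;> rcases hs' with rfl | rfl
    · exact ⟨1, by omega, by norm_num⟩
    · exact ⟨0, by omega, by norm_num⟩
    · exact ⟨0, by omega, by norm_num⟩
    · exact ⟨1, by omega, by norm_num⟩
  have hs0 : -s = 1 ∨ -s = -1 := by
    rcases hs with rfl | rfl <;> simp
  have k0 := ray_sign (t := s) hs (hθs 0 (by omega)).1 he (by simpa using (hθs 0 (by omega)).2)
  have k1 := ray_sign (t := -s) hs0 (hθs 1 (by omega)).1 he (by simpa using (hθs 1 (by omega)).2)
  have k2 := ray_sign (t := s) hs (hθs 2 (by omega)).1 he (by simpa using (hθs 2 (by omega)).2)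
  have k3 := ray_sign (φ := fun z => φ (-z)) (t := -s) hs0 (hθs' j hj).1 hem
    (by rw [← hjs]; exact (hθs' j hj).2)
  have hb : ∀ i < 3, |θ i| < π / 2 := fun i hi => (hθs i (by omega)).1
  have hcont := hφ.1.continuous
  rcases hs with rfl | rfl
  · exact exists_three_nodal_aux hcont hθ hb (hθs' j hj).1
      (k0.mono fun _ h => by linarith) (k1.mono fun _ h => by linarith)
      (k2.mono fun _ h => by linarith) (k3.mono fun _ h => by linarith)
  · obtain ⟨z, hz⟩ := exists_three_nodal_aux (φ := fun z => -φ z) hcont.neg hθ hb (hθs' j hj).1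
      (k0.mono fun _ h => by linarith) (k1.mono fun _ h => by linarith)
      (k2.mono fun _ h => by linarith) (k3.mono fun _ h => by linarith)
    simp only [nodal_neg, neg_ne_zero] at hz
    exact ⟨z, hz⟩

section

lemma isPreconnected_compl_ball : IsPreconnected (Metric.ball (0 : ℂ) 1)ᶜ := by
  have : (Metric.ball (0 : ℂ) 1)ᶜ = Complex.exp '' {z | 0 ≤ z.re} := by
    ext z
    simp only [Set.mem_compl_iff, mem_ball_zero_iff, not_lt, Set.mem_image]
    constructor
    · intro h
      have hz : z ≠ 0 := by rintro rfl; norm_num at h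
      refine ⟨Complex.log z, ?_, Complex.exp_log hz⟩
      change 0 ≤ (Complex.log z).re
      rw [Complex.log_re]
      exact Real.log_nonneg h
    · rintro ⟨w, hw, rfl⟩
      rw [Complex.norm_exp]
      exact Real.one_le_exp hw
  rw [this]
  exact (convex_halfSpace_re_ge 0).isPreconnected.image _ Complex.continuous_exp.continuousOn

lemma IsPreconnected.inter_frontier {X : Type*} [TopologicalSpace X] {D Ω : Set X}
    (hD : IsPreconnected D) (hΩ : IsOpen Ω) (h1 : (D ∩ Ω).Nonempty) (h2 : ¬ D ⊆ Ω) :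
    (D ∩ frontier Ω).Nonempty := by
  by_contra hne
  rw [Set.not_nonempty_iff_eq_empty] at hne
  have hsub : D ⊆ Ω ∪ (closure Ω)ᶜ := by
    intro x hx
    by_contra h
    simp only [Set.mem_union, Set.mem_compl_iff, not_or, not_not] at h
    have : x ∈ D ∩ frontier Ω := ⟨hx, h.2, by rw [hΩ.interior_eq]; exact h.1⟩
    rw [hne] at this
    exact this
  obtain ⟨x, hxD, hx⟩ := Set.not_subset.1 h2
  have hx' := (hsub hxD).resolve_left hx
  obtain ⟨y, -, hy1, hy2⟩ := hD _ _ hΩ isClosed_closure.isOpen_compl hsub h1 ⟨x, hxD, hx'⟩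
  exact hy2 (subset_closure hy1)

/-- The component of the complement of `Ω` containing the exterior of the disc. -/
def outer (Ω : Set ℂ) : Set ℂ := connectedComponentIn Ωᶜ 2

section outer
variable {Ω : Set ℂ}

lemma two_mem_compl (hb : Ω ⊆ Metric.ball 0 1) : (2 : ℂ) ∈ Ωᶜ := fun h => by
  have := mem_ball_zero_iff.1 (hb h)
  norm_num at this

lemma outer_subset : outer Ω ⊆ Ωᶜ := connectedComponentIn_subset _ _

lemma isPreconnected_outer : IsPreconnected (outer Ω) := isPreconnected_connectedComponentIn

lemma two_mem_outer (hb : Ω ⊆ Metric.ball 0 1) : (2 : ℂ) ∈ outer Ω :=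
  mem_connectedComponentIn (two_mem_compl hb)

lemma subset_outer (hb : Ω ⊆ Metric.ball 0 1) {A : Set ℂ} (hA : IsPreconnected A)
    (hAΩ : A ⊆ Ωᶜ) (hne : (A ∩ outer Ω).Nonempty) : A ⊆ outer Ω := by
  have h := IsPreconnected.union' hne hA isPreconnected_outer
  exact Set.subset_union_left.trans (h.subset_connectedComponentIn (Or.inr (two_mem_outer hb))
    (Set.union_subset hAΩ outer_subset))

lemma subset_outer_of_two_mem {A : Set ℂ} (hA : IsPreconnected A)
    (hAΩ : A ⊆ Ωᶜ) (h2 : (2 : ℂ) ∈ A) : A ⊆ outer Ω :=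
  hA.subset_connectedComponentIn h2 hAΩ

lemma compl_ball_subset_outer (hb : Ω ⊆ Metric.ball 0 1) : (Metric.ball (0 : ℂ) 1)ᶜ ⊆ outer Ω :=
  subset_outer_of_two_mem isPreconnected_compl_ball (Set.compl_subset_compl.2 hb) (by simp)

lemma isClosed_outer (hΩ : IsOpen Ω) (hb : Ω ⊆ Metric.ball 0 1) : IsClosed (outer Ω) := by
  rw [← closure_subset_iff_isClosed]
  refine subset_outer hb isPreconnected_outer.closure
    (closure_minimal outer_subset hΩ.isClosed_compl) ⟨2, subset_closure ?_, ?_⟩ <;>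
  exact two_mem_outer hb

lemma frontier_outer_subset (hΩ : IsOpen Ω) (hb : Ω ⊆ Metric.ball 0 1) :
    frontier (outer Ω) ⊆ closure Ω := by
  intro x hx
  by_contra hxΩ
  have hxC : x ∈ outer Ω := (isClosed_outer hΩ hb).frontier_subset hx
  obtain ⟨r, hr, hr'⟩ := Metric.isOpen_iff.1 isClosed_closure.isOpen_compl x hxΩ
  have h1 : Metric.ball x r ⊆ outer Ω :=
    subset_outer hb (convex_ball x r).isPreconnected
      (fun y hy hyΩ => hr' hy (subset_closure hyΩ)) ⟨x, Metric.mem_ball_self hr, hxC⟩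
  exact hx.2 (mem_interior.2 ⟨_, h1, Metric.isOpen_ball, Metric.mem_ball_self hr⟩)

lemma isPreconnected_outer_union (hΩ : IsOpen Ω) (hb : Ω ⊆ Metric.ball 0 1)
    (hc : IsPreconnected Ω) (hne : Ω.Nonempty) : IsPreconnected (outer Ω ∪ Ω) := by
  obtain ⟨z, hz⟩ := hne
  have hfr : (frontier (outer Ω)).Nonempty := by
    rw [nonempty_frontier_iff]
    refine ⟨⟨2, two_mem_outer hb⟩, fun h => ?_⟩
    have : z ∈ outer Ω := by rw [h]; trivial
    exact outer_subset this hz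
  obtain ⟨x, hx⟩ := hfr
  have hxC : x ∈ outer Ω := (isClosed_outer hΩ hb).frontier_subset hx
  have hxΩ := frontier_outer_subset hΩ hb hx
  have h1 : IsPreconnected (Ω ∪ {x}) := hc.subset_closure Set.subset_union_left
    (Set.union_subset subset_closure (by simpa using hxΩ))
  have h2 := IsPreconnected.union x hxC (Or.inr rfl) isPreconnected_outer h1
  have : outer Ω ∪ (Ω ∪ {x}) = outer Ω ∪ Ω := by
    ext y; simp only [Set.mem_union, Set.mem_singleton_iff]
    constructor
    · rintro (h | h | rfl)
      exacts [Or.inl h, Or.inr h, Or.inl hxC]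
    · rintro (h | h)
      exacts [Or.inl h, Or.inr (Or.inl h)]
  rwa [this] at h2

lemma subset_compl_outer : Ω ⊆ (outer Ω)ᶜ := fun _ hx h => outer_subset h hx

lemma compl_outer_subset_ball (hb : Ω ⊆ Metric.ball 0 1) : (outer Ω)ᶜ ⊆ Metric.ball 0 1 := by
  rw [Set.compl_subset_comm]; exact compl_ball_subset_outer hb

lemma isPreconnected_compl_outer (hΩ : IsOpen Ω) (hb : Ω ⊆ Metric.ball 0 1)
    (hc : IsPreconnected Ω) (hne : Ω.Nonempty) : IsPreconnected (outer Ω)ᶜ := by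
  obtain ⟨z, hz⟩ := hne
  have hD : IsOpen (outer Ω)ᶜ := (isClosed_outer hΩ hb).isOpen_compl
  refine isPreconnected_of_forall z fun y hy => ?_
  refine ⟨connectedComponentIn (outer Ω)ᶜ y, connectedComponentIn_subset _ _, ?_,
    mem_connectedComponentIn hy, isPreconnected_connectedComponentIn⟩
  set G := connectedComponentIn (outer Ω)ᶜ y with hG
  have hGo : IsOpen G := hD.connectedComponentIn
  by_cases hGΩ : (G ∩ Ω).Nonempty
  · obtain ⟨w, hwG, hwΩ⟩ := hGΩ
    rw [hG, connectedComponentIn_eq hwG]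
    exact hc.subset_connectedComponentIn hwΩ subset_compl_outer hz
  exfalso
  have hdis : Disjoint G Ω := by
    rw [Set.disjoint_iff_inter_eq_empty, ← Set.not_nonempty_iff_eq_empty]; exact hGΩ
  have hclG : closure G ⊆ Ωᶜ := by
    have := hdis.closure_left hΩ
    exact fun x hx hxΩ => Set.disjoint_left.1 this hx hxΩ
  have hyG : y ∈ G := mem_connectedComponentIn hy
  have hfr : (frontier G).Nonempty := by
    rw [nonempty_frontier_iff]
    refine ⟨⟨y, hyG⟩, fun h => ?_⟩
    have : z ∈ G := by rw [h]; trivial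
    exact Set.disjoint_left.1 hdis this hz
  obtain ⟨x, hx⟩ := hfr
  have hxC : x ∈ outer Ω := by
    by_contra hxC
    have hxG : x ∈ G := by
      have h1 : IsPreconnected (G ∪ {x}) :=
        (isPreconnected_connectedComponentIn (x := y)).subset_closure Set.subset_union_left
          (Set.union_subset subset_closure (by simpa using hx.1))
      exact h1.subset_connectedComponentIn (Or.inl hyG)
        (Set.union_subset (connectedComponentIn_subset _ _) (by simpa using hxC)) (Or.inr rfl)
    exact hx.2 (by rwa [hGo.interior_eq])
  have := subset_outer hb (isPreconnected_connectedComponentIn (x := y) (F := (outer Ω)ᶜ)).closure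
    hclG ⟨x, hx.1, hxC⟩
  exact hy (this (subset_closure hyG))

/-- The hulls of disjoint sets touching the boundary of the disc are disjoint. -/
lemma disjoint_compl_outer {Ω' : Set ℂ} (hΩ : IsOpen Ω) (hb : Ω ⊆ Metric.ball 0 1)
    (hc : IsPreconnected Ω) (hne : Ω.Nonempty) (hb' : Ω' ⊆ Metric.ball 0 1)
    (hc' : IsPreconnected Ω') (hd : Disjoint Ω Ω')
    (ht : (closure Ω ∩ (Metric.ball (0 : ℂ) 1)ᶜ).Nonempty)
    (ht' : (closure Ω' ∩ (Metric.ball (0 : ℂ) 1)ᶜ).Nonempty) :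
    Disjoint (outer Ω)ᶜ (outer Ω')ᶜ := by
  have key : ∀ {A B : Set ℂ}, A ⊆ Metric.ball 0 1 → IsPreconnected A → Disjoint B A →
      B ⊆ Metric.ball 0 1 → (closure A ∩ (Metric.ball (0 : ℂ) 1)ᶜ).Nonempty → A ⊆ outer B := by
    intro A B hA hAc hAB hB ⟨x, hx, hx'⟩
    have h1 : IsPreconnected (A ∪ {x}) := hAc.subset_closure Set.subset_union_left
      (Set.union_subset subset_closure (by simpa using hx))
    have hxo := compl_ball_subset_outer hB hx'
    refine Set.subset_union_left.trans (subset_outer hB h1 ?_ ⟨x, Or.inr rfl, hxo⟩)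
    refine Set.union_subset (fun y hy hyB => Set.disjoint_left.1 hAB hyB hy) ?_
    simpa using outer_subset hxo
  have h1 : Ω' ⊆ outer Ω := key hb' hc' hd hb ht'
  have h2 : Ω ⊆ outer Ω' := key hb hc hd.symm hb' ht
  obtain ⟨z, hz⟩ := hne
  have h3 : (outer Ω)ᶜ ⊆ outer Ω' :=
    subset_outer hb' (isPreconnected_compl_outer hΩ hb hc ⟨z, hz⟩)
      (Set.compl_subset_compl.2 h1) ⟨z, subset_compl_outer hz, h2 hz⟩
  exact Set.disjoint_compl_right_iff_subset.2 h3

end outer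

lemma eq_zero_of_mem_frontier_nodal {φ : ℂ → ℝ} (hφ : Continuous φ) {z x : ℂ}
    (hx : x ∈ Metric.ball (0 : ℂ) 1) (hf : x ∈ frontier (nodal φ z)) : φ x = 0 := by
  by_contra h
  have hxn := mem_nodal hx h
  obtain ⟨y, hy, hyz⟩ := mem_closure_iff.1 hf.1 _ (isOpen_nodal hφ x) hxn
  have e : nodal φ z = nodal φ x := by
    by_contra hne
    exact Set.disjoint_left.1 (nodal_disjoint hne) hyz hy
  refine hf.2 ?_
  rw [(isOpen_nodal hφ z).interior_eq, e]
  exact hxn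

/-- Every hull of a nodal domain contains a nodal domain without holes. -/
lemma exists_nodal_simple {φ : ℂ → ℝ} (hφ : Continuous φ)
    (hp : ∀ a, φ a = 0 → ∃ᶠ z in nhds a, 0 < φ z) (hm : ∀ a, φ a = 0 → ∃ᶠ z in nhds a, φ z < 0)
    {a₀ : ℝ} (ha₀ : 0 < a₀)
    (harea : ∀ z ∈ Metric.ball (0 : ℂ) 1, φ z ≠ 0 → a₀ ≤ volume.real (nodal φ z))
    {z₀ : ℂ} (hz₀ : z₀ ∈ Metric.ball (0 : ℂ) 1) (hz₀' : φ z₀ ≠ 0) :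
    ∃ z ∈ Metric.ball (0 : ℂ) 1, φ z ≠ 0 ∧ nodal φ z ⊆ (outer (nodal φ z₀))ᶜ ∧
      IsPreconnected (nodal φ z)ᶜ := by
  have hball : ∀ z, nodal φ z ⊆ Metric.ball 0 1 := fun z x hx => (nodal_subset z hx).1
  set D₀ := (outer (nodal φ z₀))ᶜ with hD₀
  set 𝒮 : Set ℂ := {z | z ∈ D₀ ∧ φ z ≠ 0} with h𝒮
  have hD₀b : D₀ ⊆ Metric.ball 0 1 := compl_outer_subset_ball (hball _)
  have hsub : ∀ z ∈ 𝒮, nodal φ z ⊆ D₀ := by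
    intro z hz
    by_cases he : nodal φ z = nodal φ z₀
    · rw [he]; exact subset_compl_outer
    intro x hx hxo
    refine hz.1 (subset_outer (hball _) (isPreconnected_nodal z) ?_ ⟨x, hx, hxo⟩
      (mem_nodal (hD₀b hz.1) hz.2))
    exact fun y hy hy' => Set.disjoint_left.1 (nodal_disjoint he) hy hy'
  set v : ℂ → ℝ := fun z => volume.real (outer (nodal φ z))ᶜ with hv
  have hne : (v '' 𝒮).Nonempty := ⟨_, z₀, ⟨subset_compl_outer (mem_nodal hz₀ hz₀'), hz₀'⟩, rfl⟩
  have hbdd : BddBelow (v '' 𝒮) := ⟨0, by rintro _ ⟨z, -, rfl⟩; exact measureReal_nonneg⟩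
  obtain ⟨_, ⟨z, hz, rfl⟩, hlt⟩ := exists_lt_of_csInf_lt hne
    (show sInf (v '' 𝒮) < sInf (v '' 𝒮) + a₀ by linarith)
  have hzb := hD₀b hz.1
  have hzn := mem_nodal hzb hz.2
  refine ⟨z, hzb, hz.2, hsub z hz, ?_⟩
  suffices h : (outer (nodal φ z))ᶜ ⊆ nodal φ z by
    have : (nodal φ z)ᶜ = outer (nodal φ z) :=
      subset_antisymm (Set.compl_subset_comm.1 h) outer_subset
    rw [this]; exact isPreconnected_outer
  by_contra hns
  have hDc := isPreconnected_compl_outer (isOpen_nodal hφ z) (hball z) (isPreconnected_nodal z)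
    ⟨z, hzn⟩
  obtain ⟨x, hxD, hxf⟩ := IsPreconnected.inter_frontier hDc (isOpen_nodal hφ z)
    ⟨z, subset_compl_outer hzn, hzn⟩ hns
  have hDb := compl_outer_subset_ball (hball z)
  have hx0 := eq_zero_of_mem_frontier_nodal hφ (hDb hxD) hxf
  have hDo := (isClosed_outer (isOpen_nodal hφ z) (hball z)).isOpen_compl
  obtain ⟨y, hyD, hy0, hys⟩ : ∃ y ∈ (outer (nodal φ z))ᶜ, φ y ≠ 0 ∧
      Disjoint (nodal φ z) (nodal φ y) := by
    rcases lt_or_gt_of_ne hz.2 with h | h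
    · obtain ⟨y, hy, hyD⟩ := ((hp x hx0).and_eventually (hDo.mem_nhds hxD)).exists
      exact ⟨y, hyD, hy.ne', (nodal_disjoint_of_sign hφ hy h).symm⟩
    · obtain ⟨y, hy, hyD⟩ := ((hm x hx0).and_eventually (hDo.mem_nhds hxD)).exists
      exact ⟨y, hyD, hy.ne, nodal_disjoint_of_sign hφ h hy⟩
  have hyn := mem_nodal (hDb hyD) hy0
  have hysub : nodal φ y ⊆ (outer (nodal φ z))ᶜ := by
    intro w hw hwo
    exact hyD (subset_outer (hball z) (isPreconnected_nodal y)
      (fun t ht ht' => Set.disjoint_left.1 hys ht' ht) ⟨w, hw, hwo⟩ hyn)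
  have hDz : (outer (nodal φ z))ᶜ ⊆ D₀ := by
    refine Set.compl_subset_compl.2 (subset_outer_of_two_mem isPreconnected_outer ?_
      (two_mem_outer (hball _)))
    exact Set.subset_compl_comm.1 (hsub z hz)
  have hy𝒮 : y ∈ 𝒮 := ⟨hDz hyD, hy0⟩
  have hout : outer (nodal φ z) ∪ nodal φ z ⊆ outer (nodal φ y) := by
    refine subset_outer_of_two_mem (isPreconnected_outer_union (isOpen_nodal hφ z) (hball z)
      (isPreconnected_nodal z) ⟨z, hzn⟩) (Set.union_subset ?_ ?_) (Or.inl (two_mem_outer (hball z)))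
    · exact Set.subset_compl_comm.1 hysub
    · exact fun t ht ht' => Set.disjoint_left.1 hys ht ht'
  have hfin : volume (outer (nodal φ z))ᶜ ≠ ⊤ :=
    ((measure_mono hDb).trans_lt measure_ball_lt_top).ne
  have hdisj : Disjoint (outer (nodal φ y))ᶜ (nodal φ z) := by
    rw [Set.disjoint_left]
    exact fun t ht ht' => ht (hout (Or.inr ht'))
  have hun : (outer (nodal φ y))ᶜ ∪ nodal φ z ⊆ (outer (nodal φ z))ᶜ :=
    Set.union_subset (Set.compl_subset_compl.2 (Set.subset_union_left.trans hout))
      subset_compl_outer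
  have h1 : v y + volume.real (nodal φ z) ≤ v z := by
    rw [hv]
    have hfin2 := fun {A : Set ℂ} (hA : A ⊆ (outer (nodal φ z))ᶜ) =>
      ((measure_mono hA).trans_lt hfin.lt_top).ne
    rw [← measureReal_union hdisj (isOpen_nodal hφ z).measurableSet
      (hfin2 (Set.subset_union_left.trans hun)) (hfin2 subset_compl_outer)]
    exact measureReal_mono hun hfin
  have h2 := harea z hzb hz.2
  have h3 := csInf_le hbdd ⟨y, hy𝒮, rfl⟩
  linarith

end

lemma hasFDerivAt_indicator_pow {Ω : Set ℂ} (hΩ : IsOpen Ω) {φ : ℂ → ℝ} (hφ : Differentiable ℝ φ)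
    (h0 : ∀ z ∈ frontier Ω, φ z = 0) (k : ℕ) (z : ℂ) :
    HasFDerivAt (Ω.indicator fun z => φ z ^ (k + 2))
      (Ω.indicator (fun z => ((k + 2 : ℝ) * φ z ^ (k + 1)) • fderiv ℝ φ z) z) z := by
  by_cases hz : z ∈ Ω
  · rw [Set.indicator_of_mem hz]
    have h := (hφ z).hasFDerivAt.pow (k + 2)
    have e : (Ω.indicator fun z => φ z ^ (k + 2)) =ᶠ[nhds z] fun z => φ z ^ (k + 2) := by
      filter_upwards [hΩ.mem_nhds hz] with w hw using Set.indicator_of_mem hw _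
    refine HasFDerivAt.congr_of_eventuallyEq ?_ e
    have e' : ((k + 2 : ℝ) * φ z ^ (k + 1)) • fderiv ℝ φ z =
        ((k + 2) • φ z ^ (k + 2 - 1)) • fderiv ℝ φ z := by
      rw [nsmul_eq_mul]
      push_cast
      rfl
    rw [e']
    exact h
  rw [Set.indicator_of_notMem hz]
  by_cases hz' : z ∈ closure Ω
  · have hφz : φ z = 0 := h0 z ⟨hz', by rwa [hΩ.interior_eq]⟩
    rw [hasFDerivAt_iff_isLittleO]
    simp only [Set.indicator_of_notMem hz, sub_zero, zero_apply]
    have h1 : φ =O[nhds z] fun w => w - z := by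
      have := (hφ z).hasFDerivAt.isBigO_sub
      simpa [hφz] using this
    have h2 : (fun w => φ w ^ (k + 2)) =o[nhds z] fun w => w - z := by
      have h3 : (fun w => φ w ^ (k + 1)) =o[nhds z] fun _ => (1 : ℝ) := by
        rw [Asymptotics.isLittleO_one_iff]
        have h : Filter.Tendsto (fun w => φ w ^ (k + 1)) (nhds z) (nhds (φ z ^ (k + 1))) :=
          (hφ.continuous.pow (k + 1)).tendsto z
        rwa [hφz, zero_pow (Nat.succ_ne_zero k)] at h
      have h4 := h3.mul_isBigO h1.norm_right
      simp only [one_mul, ← pow_succ] at h4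
      exact h4.of_norm_right
    refine Asymptotics.IsBigO.trans_isLittleO (Asymptotics.IsBigO.of_bound 1 ?_) h2
    filter_upwards with w
    rw [one_mul]
    by_cases hw : w ∈ Ω
    · rw [Set.indicator_of_mem hw]
    · rw [Set.indicator_of_notMem hw, norm_zero]; exact norm_nonneg _
  · have e : (Ω.indicator fun z => φ z ^ (k + 2)) =ᶠ[nhds z] fun _ => 0 := by
      filter_upwards [isClosed_closure.isOpen_compl.mem_nhds hz'] with w hw
      exact Set.indicator_of_notMem (fun h => hw (subset_closure h)) _
    exact (hasFDerivAt_const (0 : ℝ) z).congr_of_eventuallyEq e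

lemma contDiff_indicator_pow {Ω : Set ℂ} (hΩ : IsOpen Ω) {φ : ℂ → ℝ} (hφ : ContDiff ℝ 1 φ)
    (h0 : ∀ z ∈ frontier Ω, φ z = 0) (k : ℕ) :
    ContDiff ℝ 1 (Ω.indicator fun z => φ z ^ (k + 2)) := by
  refine contDiff_one_iff_hasFDerivAt.2 ⟨_, ?_, hasFDerivAt_indicator_pow hΩ
    (hφ.differentiable (by norm_num)) h0 k⟩
  refine Continuous.indicator (fun z hz => by simp [h0 z hz]) ?_
  have := hφ.continuous_fderiv (by norm_num)
  have := hφ.continuous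
  fun_prop

/-- A Faber–Krahn type lower bound for the area of a nodal domain. -/
lemma area_lower_bound {Ω : Set ℂ} (hΩ : IsOpen Ω) (hb : Bornology.IsBounded Ω) {φ : ℂ → ℝ}
    (hφ : ContDiff ℝ 2 φ) (h0 : ∀ z ∈ frontier Ω, φ z = 0) {C : ℝ} (hC : 0 < C)
    (hpl : ∀ z ∈ Ω, |plap φ z| ≤ C * |φ z|) (hne : ∃ z ∈ Ω, φ z ≠ 0) :
    3 * π / C ≤ volume.real Ω := by
  have hφ1 : ContDiff ℝ 1 φ := hφ.of_le (by norm_num)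
  have hd : Differentiable ℝ φ := hφ1.differentiable (by norm_num)
  have hfin : volume Ω ≠ ⊤ := hb.measure_lt_top.ne
  have hcl : IsCompact (closure Ω) := hb.isCompact_closure
  have hout : ∀ (F : ℂ → ℝ), ∀ z ∉ closure Ω, Ω.indicator F z = 0 := fun F z hz =>
    Set.indicator_of_notMem (fun h => hz (subset_closure h)) _
  have hd2 := hasFDerivAt_indicator_pow hΩ hd h0
  have hcd := contDiff_indicator_pow hΩ hφ1 h0
  have cont : Continuous φ := hφ.continuous
  have cdx : Continuous (dx φ) := continuous_dx hφ1
  have cdy : Continuous (dy φ) := continuous_dy hφ1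
  have intΩ : ∀ {F : ℂ → ℝ}, Continuous F → IntegrableOn F Ω := fun hF =>
    (hF.continuousOn.integrableOn_compact hcl).mono_set subset_closure
  set I4 := ∫ z in Ω, φ z ^ 4 with hI4
  set J := ∫ z in Ω, φ z ^ 2 * (dx φ z ^ 2 + dy φ z ^ 2) with hJ
  have s1 : 4 * π * I4 ≤ 4 * volume.real Ω * J := by
    have hs := sobolev (U := Set.univ) (g := id) isOpen_univ differentiableOn_id (hcd 0)
      (hasCompactSupport_of_zero_off hcl (hout _)) (Set.subset_univ _)
      (fun z => Set.indicator_nonneg (fun z _ => by simpa using sq_nonneg (φ z)) z)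
    simp only [deriv_id, norm_one, one_pow, mul_one, zero_add] at hs
    have e1 : (fun z => Ω.indicator (fun z => φ z ^ 2) z ^ 2) = Ω.indicator fun z => φ z ^ 4 := by
      funext z
      by_cases hz : z ∈ Ω
      · simp [hz]; ring
      · simp [hz]
    have e2 : (fun z => gnorm (Ω.indicator fun z => φ z ^ 2) z) =
        Ω.indicator fun z => 2 * (|φ z| * gnorm φ z) := by
      funext z
      have hf := (hd2 0 z).fderiv
      simp only [zero_add] at hf
      rw [gnorm, dx, dy, hf]
      by_cases hz : z ∈ Ω
      · simp only [hz, Set.indicator_of_mem, smul_apply, smul_eq_mul]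
        rw [gnorm, dx, dy, ← mul_assoc (2 : ℝ) |φ z|, ← Real.sqrt_sq (x := 2 * |φ z|) (by positivity),
          ← Real.sqrt_mul (by positivity)]
        congr 1
        rw [mul_pow 2, sq_abs]
        push_cast
        ring
      · simp [hz]
    rw [e1, e2, integral_indicator hΩ.measurableSet, integral_indicator hΩ.measurableSet,
      integral_const_mul 2] at hs
    have cg : Continuous (gnorm φ) := by unfold gnorm; fun_prop
    have hcs := integral_mul_sq_le (μ := volume.restrict Ω) (u := fun _ => (1 : ℝ))
      (v := fun z => 2 * (|φ z| * gnorm φ z)) (by fun_prop) (by fun_prop)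
      (intΩ (by fun_prop)) (intΩ (by fun_prop))
    have e3 : (fun z => (2 * (|φ z| * gnorm φ z)) ^ 2) =
        fun z => 4 * (φ z ^ 2 * (dx φ z ^ 2 + dy φ z ^ 2)) := by
      funext z
      rw [mul_pow, mul_pow, sq_abs, gnorm_sq]; norm_num
    rw [e3] at hcs
    simp only [one_pow, integral_const, measureReal_restrict_apply_univ, smul_eq_mul,
      mul_one, one_mul, integral_const_mul] at hcs
    calc _ ≤ volume.real Ω * (4 * J) := hs.trans hcs
      _ = _ := by ring
  have s2 : 3 * J ≤ C * I4 := by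
    have hg := integral_mul_plap (D := Set.univ) (hcd 1)
      (hasCompactSupport_of_zero_off hcl (hout _)) (Set.subset_univ _)
      (fun z _ => hφ.contDiffAt (x := z))
    have e1 : (fun z => Ω.indicator (fun z => φ z ^ (1 + 2)) z * plap φ z) =
        Ω.indicator fun z => φ z ^ 3 * plap φ z := by
      funext z
      by_cases hz : z ∈ Ω <;> simp [hz]
    have e2 : (fun z => dx (Ω.indicator fun z => φ z ^ (1 + 2)) z * dx φ z +
        dy (Ω.indicator fun z => φ z ^ (1 + 2)) z * dy φ z) =
        Ω.indicator fun z => 3 * (φ z ^ 2 * (dx φ z ^ 2 + dy φ z ^ 2)) := by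
      funext z
      rw [dx, dy, (hd2 1 z).fderiv]
      by_cases hz : z ∈ Ω
      · simp only [hz, Set.indicator_of_mem, smul_apply, smul_eq_mul]
        rw [dx, dy]
        push_cast
        ring
      · simp [hz]
    rw [e1, e2, integral_indicator hΩ.measurableSet, integral_indicator hΩ.measurableSet,
      integral_const_mul] at hg
    have cpl : Continuous (plap φ) :=
      continuous_iff_continuousAt.2 fun z => continuousAt_plap hφ.contDiffAt
    have hle : ∫ z in Ω, -(φ z ^ 3 * plap φ z) ≤ ∫ z in Ω, C * φ z ^ 4 := by
      refine setIntegral_mono_on (intΩ (by fun_prop)) (intΩ (by fun_prop)) hΩ.measurableSet ?_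
      intro z hz
      have h1 := hpl z hz
      calc -(φ z ^ 3 * plap φ z) ≤ |φ z ^ 3 * plap φ z| := neg_le_abs _
        _ = |φ z| ^ 3 * |plap φ z| := by rw [abs_mul, abs_pow]
        _ ≤ |φ z| ^ 3 * (C * |φ z|) := by gcongr
        _ = C * |φ z| ^ 4 := by ring
        _ = C * φ z ^ 4 := by rw [Even.pow_abs (by decide)]
    rw [integral_neg, integral_const_mul, hg] at hle
    linarith
  have hpos : 0 < I4 := by
    rw [hI4, setIntegral_pos_iff_support_of_nonneg_ae
      (Filter.Eventually.of_forall fun z => by positivity) (intΩ (by fun_prop))]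
    obtain ⟨z, hz, hz'⟩ := hne
    refine IsOpen.measure_pos _ (IsOpen.inter ?_ hΩ) ⟨z, by simpa using hz', hz⟩
    exact (cont.pow 4).isOpen_support
  rw [div_le_iff₀ hC]
  have h5 : 3 * π * I4 ≤ volume.real Ω * C * I4 := by
    have : volume.real Ω * (3 * J) ≤ volume.real Ω * (C * I4) :=
      mul_le_mul_of_nonneg_left s2 measureReal_nonneg
    nlinarith
  exact le_of_mul_le_mul_right h5 hpos

/-- Each nodal domain of the difference of two solutions that is contained in a simply connected
region carries more than `4π` of total area. -/
lemma four_pi_lt_nodal {U V φ : ℂ → ℝ} (hU : ContDiff ℝ 2 U) (hV : ContDiff ℝ 2 V)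
    (hφ : ∀ z, φ z = U z - V z) {κ : ℝ} (hκ0 : 0 < κ) (hκ1 : κ < 1)
    (hUκ : ∀ z ∈ Metric.ball (0 : ℂ) 1, -plap U z ≤ κ * exp (2 * U z))
    (hVκ : ∀ z ∈ Metric.ball (0 : ℂ) 1, -plap V z ≤ κ * exp (2 * V z))
    (hUV : ∀ z ∈ Metric.ball (0 : ℂ) 1,
      plap U z - plap V z = -(exp (2 * U z) - exp (2 * V z)))
    (h0 : ∀ z, ‖z‖ = 1 → φ z = 0) {z : ℂ} (hz : z ∈ Metric.ball (0 : ℂ) 1) (hz' : φ z ≠ 0)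
    (hc : IsPreconnected (nodal φ z)ᶜ) :
    4 * π < ∫ w in nodal φ z, (exp (2 * U w) + exp (2 * V w)) := by
  have hφc : Continuous φ := by
    rw [show φ = fun z => U z - V z from funext hφ]
    exact hU.continuous.sub hV.continuous
  have hsub : nodal φ z ⊆ Metric.ball 0 1 := fun w hw => (nodal_subset z hw).1
  have hop := isOpen_nodal hφc z
  have hne : (nodal φ z).Nonempty := ⟨z, mem_nodal hz hz'⟩
  have hfr : ∀ w ∈ frontier (nodal φ z), φ w = 0 := by
    intro w hw
    have hw1 : ‖w‖ ≤ 1 := by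
      have : w ∈ closure (Metric.ball (0 : ℂ) 1) := closure_mono hsub (frontier_subset_closure hw)
      simpa using Metric.closure_ball_subset_closedBall this
    rcases hw1.lt_or_eq with h | h
    · exact eq_zero_of_mem_frontier_nodal hφc (by simpa using h) hw
    · exact h0 w h
  have hbd : Bornology.IsBounded (nodal φ z) := Metric.isBounded_ball.subset hsub
  rcases hz'.lt_or_gt with h | h
  · have h' : 0 < (fun w => -φ w) z := by simpa using h
    have hlt : ∀ w ∈ nodal φ z, U w < V w := by
      intro w hw
      rw [← nodal_neg] at hw
      have : 0 < -φ w := nodal_pos hφc.neg h' hw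
      rw [hφ] at this
      linarith
    have := sphere_covering hop hbd hne hc hκ0 hκ1 hV hU (fun w hw => hUκ w (hsub hw))
      (fun w hw => by have := hUV w (hsub hw); linarith) hlt
      (fun w hw => by have := hfr w hw; rw [hφ] at this; linarith)
    simpa only [add_comm] using this
  · have hlt : ∀ w ∈ nodal φ z, V w < U w := by
      intro w hw
      have := nodal_pos hφc h hw
      rw [hφ] at this
      linarith
    exact sphere_covering hop hbd hne hc hκ0 hκ1 hU hV (fun w hw => hVκ w (hsub hw))
      (fun w hw => hUV w (hsub hw)) hlt
      (fun w hw => by have := hfr w hw; rw [hφ] at this; linarith)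

theorem eq_zero_of_area_le {U V φ : ℂ → ℝ} (hU : ContDiff ℝ 2 U) (hV : ContDiff ℝ 2 V)
    (hφ : ∀ z, φ z = U z - V z) (hsl : SubLinear φ) {κ : ℝ} (hκ0 : 0 < κ) (hκ1 : κ < 1)
    (hUκ : ∀ z ∈ Metric.ball (0 : ℂ) 1, -plap U z ≤ κ * exp (2 * U z))
    (hVκ : ∀ z ∈ Metric.ball (0 : ℂ) 1, -plap V z ≤ κ * exp (2 * V z))
    (hUV : ∀ z ∈ Metric.ball (0 : ℂ) 1,
      plap U z - plap V z = -(exp (2 * U z) - exp (2 * V z)))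
    (h0 : ∀ z, ‖z‖ = 1 → φ z = 0) {C : ℝ} (hC : 0 < C)
    (hpl : ∀ z ∈ Metric.ball (0 : ℂ) 1, |plap φ z| ≤ C * |φ z|)
    (g1 : cgrad φ 1 = 0) (g1' : fderiv ℝ (cgrad φ) 1 = 0) (gm : cgrad φ (-1) = 0)
    (harea : ∫ z in Metric.ball (0 : ℂ) 1, (exp (2 * U z) + exp (2 * V z)) ≤ 12 * π) :
    ∀ z, φ z = 0 := by
  by_contra! hne
  have hφc : Continuous φ := hsl.1.continuous
  obtain ⟨z, hz, hdisj, hout⟩ := exists_three_nodal hsl hne (h0 1 (by simp)) (h0 (-1) (by simp))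
    g1 g1' gm
  have hp : ∀ a, φ a = 0 → ∃ᶠ z in nhds a, 0 < φ z := fun a ha => hsl.frequently_pos hne ha
  have hm : ∀ a, φ a = 0 → ∃ᶠ z in nhds a, φ z < 0 := by
    intro a ha
    have := hsl.neg.frequently_pos (a := a) (by simpa using hne) (by simpa using ha)
    simpa using this
  have hsub : ∀ z, nodal φ z ⊆ Metric.ball 0 1 := fun z w hw => (nodal_subset z hw).1
  have har : ∀ z ∈ Metric.ball (0 : ℂ) 1, φ z ≠ 0 → 3 * π / C ≤ volume.real (nodal φ z) := by
    intro z hz hz'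
    refine area_lower_bound (isOpen_nodal hφc z) (Metric.isBounded_ball.subset (hsub z)) hsl.1
      ?_ hC (fun w hw => hpl w (hsub z hw)) ⟨z, mem_nodal hz hz', hz'⟩
    intro w hw
    have hw1 : ‖w‖ ≤ 1 := by
      have : w ∈ closure (Metric.ball (0 : ℂ) 1) :=
        closure_mono (hsub z) (frontier_subset_closure hw)
      simpa using Metric.closure_ball_subset_closedBall this
    rcases hw1.lt_or_eq with h | h
    · exact eq_zero_of_mem_frontier_nodal hφc (by simpa using h) hw
    · exact h0 w h
  have hsimple := fun i => exists_nodal_simple hφc hp hm (by positivity : 0 < 3 * π / C) har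
    (hz i).1 (hz i).2
  choose w hw hw' hwsub hwc using hsimple
  have hdw : Pairwise (fun i j => Disjoint (nodal φ (w i)) (nodal φ (w j))) := by
    intro i j hij
    exact (disjoint_compl_outer (isOpen_nodal hφc _) (hsub _) (isPreconnected_nodal _)
      ⟨z i, mem_nodal (hz i).1 (hz i).2⟩ (hsub _) (isPreconnected_nodal _) (hdisj hij) (hout i) (hout j)).mono (hwsub i) (hwsub j)
  have hlt := fun i => four_pi_lt_nodal hU hV hφ hκ0 hκ1 hUκ hVκ hUV h0 (hw i) (hw' i) (hwc i)
  set F : ℂ → ℝ := fun z => exp (2 * U z) + exp (2 * V z) with hF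
  have hFc : Continuous F := by
    have := hU.continuous
    have := hV.continuous
    fun_prop
  have hFi : IntegrableOn F (Metric.ball 0 1) :=
    (hFc.continuousOn.integrableOn_compact (isCompact_closedBall 0 1)).mono_set
      Metric.ball_subset_closedBall
  have h1 : ∫ z in ⋃ i, nodal φ (w i), F z = ∑ i, ∫ z in nodal φ (w i), F z :=
    integral_iUnion_fintype (fun i => (isOpen_nodal hφc _).measurableSet) hdw
      (fun i => hFi.mono_set (hsub _))
  have h2 : ∫ z in ⋃ i, nodal φ (w i), F z ≤ ∫ z in Metric.ball (0 : ℂ) 1, F z :=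
    setIntegral_mono_set hFi (Filter.Eventually.of_forall fun z => by positivity)
      (Set.iUnion_subset fun i => hsub _).eventuallyLE
  rw [h1, Fin.sum_univ_three] at h2
  have := hlt 0
  have := hlt 1
  have := hlt 2
  linarith

lemma hasFDerivAt_norm_sq (z : ℂ) :
    HasFDerivAt (fun w : ℂ => ‖w‖ ^ 2) ((2 * z.re) • Complex.reCLM + (2 * z.im) • Complex.imCLM) z := by
  have h1 := (Complex.reCLM.hasFDerivAt (x := z)).mul (Complex.reCLM.hasFDerivAt (x := z))
  have h2 := (Complex.imCLM.hasFDerivAt (x := z)).mul (Complex.imCLM.hasFDerivAt (x := z))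
  have e : (fun w : ℂ => ‖w‖ ^ 2) = fun w => Complex.reCLM w * Complex.reCLM w +
      Complex.imCLM w * Complex.imCLM w := by
    funext w
    rw [Complex.sq_norm, Complex.normSq_apply]
    rfl
  rw [e]
  refine (h1.add h2).congr_fderiv ?_
  ext v
  simp
  ring

lemma plap_log_one_add_norm_sq (z : ℂ) :
    plap (fun w => Real.log (1 + ‖w‖ ^ 2)) z = 4 / (1 + ‖z‖ ^ 2) ^ 2 := by
  have hpos : ∀ w : ℂ, (1 + ‖w‖ ^ 2) ≠ 0 := fun w => by positivity
  have h1 : ∀ w : ℂ, HasFDerivAt (fun w : ℂ => Real.log (1 + ‖w‖ ^ 2))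
      ((1 + ‖w‖ ^ 2)⁻¹ • ((2 * w.re) • Complex.reCLM + (2 * w.im) • Complex.imCLM)) w := fun w =>
    ((hasFDerivAt_norm_sq w).const_add 1).log (hpos w)
  have ex : dx (fun w : ℂ => Real.log (1 + ‖w‖ ^ 2)) = fun w => (1 + ‖w‖ ^ 2)⁻¹ * (2 * w.re) := by
    funext w; simp [dx, (h1 w).fderiv]
  have ey : dy (fun w : ℂ => Real.log (1 + ‖w‖ ^ 2)) = fun w => (1 + ‖w‖ ^ 2)⁻¹ * (2 * w.im) := by
    funext w; simp [dy, (h1 w).fderiv]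
  have hi : HasFDerivAt (fun w : ℂ => (1 + ‖w‖ ^ 2)⁻¹)
      (-(((1 + ‖z‖ ^ 2) ^ 2)⁻¹) • ((2 * z.re) • Complex.reCLM + (2 * z.im) • Complex.imCLM)) z :=
    (hasDerivAt_inv (hpos z)).comp_hasFDerivAt z ((hasFDerivAt_norm_sq z).const_add 1)
  have hx := hi.mul ((Complex.reCLM.hasFDerivAt (x := z)).const_mul 2)
  have hy := hi.mul ((Complex.imCLM.hasFDerivAt (x := z)).const_mul 2)
  have e2 : ‖z‖ ^ 2 = z.re * z.re + z.im * z.im := by rw [Complex.sq_norm, Complex.normSq_apply]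
  have hp := hpos z
  rw [plap, ex, ey, dx, dy]
  erw [hx.fderiv, hy.fderiv]
  simp only [add_apply, smul_apply, Complex.reCLM_apply, Complex.imCLM_apply, Complex.one_re,
    Complex.one_im, Complex.I_re, Complex.I_im, smul_eq_mul]
  field_simp
  rw [e2]
  ring

lemma contDiff_log_one_add_norm_sq {n : WithTop ℕ∞} :
    ContDiff ℝ n (fun w : ℂ => Real.log (1 + ‖w‖ ^ 2)) :=
  (contDiff_const.add (contDiff_norm_sq ℝ)).log fun w => by positivity

lemma integral_ball_inv_sq :
    ∫ ξ in Metric.ball (0 : ℂ) 1, 1 / (1 + ‖ξ‖ ^ 2) ^ 2 = π / 2 := by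
  have e0 : (Metric.ball (0 : ℂ) 1).indicator (fun ξ : ℂ => 1 / (1 + ‖ξ‖ ^ 2) ^ 2) =
      fun ξ => (Set.Iio (1 : ℝ)).indicator (fun y => 1 / (1 + y ^ 2) ^ 2) ‖ξ‖ := by
    funext ξ
    by_cases h : ‖ξ‖ < 1 <;> simp [Set.indicator, h]
  rw [← integral_indicator Metric.isOpen_ball.measurableSet, e0, integral_fun_norm_addHaar]
  have hd : ∀ x ∈ Set.uIcc (0 : ℝ) 1, HasDerivAt (fun y : ℝ => -(1 / 2) / (1 + y ^ 2))
      (x * (1 / (1 + x ^ 2) ^ 2)) x := by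
    intro x _
    have hp : (1 + x ^ 2) ≠ 0 := by positivity
    have h1 : HasDerivAt (fun y : ℝ => 1 + y ^ 2) (2 * x) x := by
      simpa using (hasDerivAt_pow 2 x).const_add 1
    have := (h1.inv hp).const_mul (-(1 / 2))
    refine (this.congr_deriv ?_).congr_of_eventuallyEq (Filter.Eventually.of_forall fun y => ?_)
    · field_simp
    · simp [div_eq_mul_inv]
  have hInt := intervalIntegral.integral_eq_sub_of_hasDerivAt hd (by
    apply Continuous.intervalIntegrable
    refine continuous_id.mul (Continuous.div (by fun_prop) (by fun_prop) fun x => by positivity))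
  have e1 : ∀ y ∈ Set.Ioi (0 : ℝ), y ^ (Module.finrank ℝ ℂ - 1) •
      (Set.Iio (1 : ℝ)).indicator (fun y : ℝ => 1 / (1 + y ^ 2) ^ 2) y =
      (Set.Iio (1 : ℝ)).indicator (fun y : ℝ => y * (1 / (1 + y ^ 2) ^ 2)) y := by
    intro y _
    simp only [Complex.finrank_real_complex, smul_eq_mul, Nat.add_one_sub_one, pow_one]
    by_cases h : y ∈ Set.Iio (1 : ℝ) <;> simp [h]
  rw [setIntegral_congr_fun measurableSet_Ioi e1, setIntegral_indicator measurableSet_Iio,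
    Set.Ioi_inter_Iio, ← integral_Ioc_eq_integral_Ioo,
    ← intervalIntegral.integral_of_le zero_le_one, hInt]
  simp [Measure.real]
  ring

/-- A function whose radial derivative vanishes on the unit circle has Laplacian of mean zero. -/
lemma integral_ball_plap_eq_zero {S : ℂ → ℝ} (hS : ContDiff ℝ 2 S)
    (h0 : ∀ z : ℂ, ‖z‖ = 1 → fderiv ℝ S z z = 0) :
    ∫ z in Metric.ball (0 : ℂ) 1, plap S z = 0 := by
  have cpl : Continuous (plap S) :=
    continuous_iff_continuousAt.2 fun z => continuousAt_plap hS.contDiffAt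
  set w : ℂ → ℝ := fun z => fderiv ℝ S z z with hw
  have hw1 : ContDiff ℝ 1 w := (hS.fderiv_right (m := 1) (by norm_num)).clm_apply contDiff_id
  obtain ⟨C, hC⟩ := (isCompact_closedBall (0 : ℂ) 1).exists_bound_of_continuousOn
    (hw1.continuous_fderiv (by norm_num)).continuousOn
  have hwb : ∀ z ∈ Metric.ball (0 : ℂ) 1, |w z| ≤ C * (1 - ‖z‖ ^ 2) := by
    intro z hz
    have hz1 : ‖z‖ < 1 := by simpa using hz
    have hC0 : 0 ≤ C := (norm_nonneg _).trans (hC 0 (by simp))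
    rcases eq_or_ne z 0 with rfl | hne
    · simpa [hw] using hC0
    have hnz : ‖z‖ ≠ 0 := norm_ne_zero_iff.2 hne
    have hpz : 0 < ‖z‖ := norm_pos_iff.2 hne
    have hu : ‖(‖z‖⁻¹ : ℝ) • z‖ = 1 := by
      rw [norm_smul, norm_inv, norm_norm, inv_mul_cancel₀ hnz]
    have h1 := (convex_closedBall (0 : ℂ) 1).norm_image_sub_le_of_norm_fderiv_le (𝕜 := ℝ)
      (fun z _ => (hw1.differentiable (by norm_num)) z) hC
      (x := (‖z‖⁻¹ : ℝ) • z) (y := z) (mem_closedBall_zero_iff.2 hu.le) (by simpa using hz1.le)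
    have h2 : w ((‖z‖⁻¹ : ℝ) • z) = 0 := h0 _ hu
    rw [h2, sub_zero, Real.norm_eq_abs] at h1
    have h3 : ‖z - (‖z‖⁻¹ : ℝ) • z‖ = 1 - ‖z‖ := by
      have : z - (‖z‖⁻¹ : ℝ) • z = (1 - ‖z‖⁻¹ : ℝ) • z := by rw [sub_smul, one_smul]
      rw [this, norm_smul, Real.norm_eq_abs, abs_of_nonpos (by
        rw [sub_nonpos]; exact (one_le_inv₀ hpz).2 hz1.le)]
      field_simp
      ring
    rw [h3] at h1
    refine h1.trans (mul_le_mul_of_nonneg_left ?_ hC0)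
    nlinarith
  have hcz : ∀ n, ContDiff ℝ 1 fun z : ℂ => 1 - (‖z‖ ^ 2) ^ (n + 1) := fun n =>
    contDiff_const.sub ((contDiff_norm_sq ℝ).pow _)
  have hfr : ∀ n, ∀ z ∈ frontier (Metric.ball (0 : ℂ) 1), 1 - (‖z‖ ^ 2) ^ (n + 1) = 0 := by
    intro n z hz
    rw [frontier_ball _ one_ne_zero] at hz
    have : ‖z‖ = 1 := by simpa using hz
    simp [this]
  have hfd : ∀ n z, HasFDerivAt (fun z : ℂ => 1 - (‖z‖ ^ 2) ^ (n + 1))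
      (-(((n + 1 : ℕ) : ℝ) * (‖z‖ ^ 2) ^ n) • ((2 * z.re) • Complex.reCLM + (2 * z.im) • Complex.imCLM)) z := by
    intro n z
    have h1 : HasDerivAt (fun x : ℝ => 1 - x ^ (n + 1)) (-(((n + 1 : ℕ) : ℝ) * (‖z‖ ^ 2) ^ n))
        (‖z‖ ^ 2) := (hasDerivAt_pow (n + 1) (‖z‖ ^ 2)).const_sub 1
    exact HasDerivAt.comp_hasFDerivAt (h₂ := fun x : ℝ => 1 - x ^ (n + 1)) z h1
      (hasFDerivAt_norm_sq z)
  have hid : ∀ n : ℕ, ∫ z in Metric.ball (0 : ℂ) 1, (1 - (‖z‖ ^ 2) ^ (n + 1)) ^ 2 * plap S z =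
      ∫ z in Metric.ball (0 : ℂ) 1,
        (1 - (‖z‖ ^ 2) ^ (n + 1)) * (4 * (n + 1) * (‖z‖ ^ 2) ^ n) * w z := by
    intro n
    have hcd := contDiff_indicator_pow Metric.isOpen_ball (hcz n) (hfr n) 0
    have hg := integral_mul_plap (D := Set.univ) hcd
      (hasCompactSupport_of_zero_off (isCompact_closedBall (0 : ℂ) 1) fun z hz =>
        Set.indicator_of_notMem (fun h => hz (Metric.ball_subset_closedBall h)) _)
      (Set.subset_univ _) (fun z _ => hS.contDiffAt (x := z))
    rw [← integral_neg] at hg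
    rw [← integral_indicator Metric.isOpen_ball.measurableSet,
      ← integral_indicator Metric.isOpen_ball.measurableSet]
    convert hg using 2
    · funext z
      by_cases hz : z ∈ Metric.ball (0 : ℂ) 1 <;> simp only [hz, Set.indicator_of_mem,
        Set.indicator_of_notMem, not_false_eq_true, zero_add, zero_mul]
    · funext z
      have hh := hasFDerivAt_indicator_pow Metric.isOpen_ball
        ((hcz n).differentiable (by norm_num)) (hfr n) 0 z
      rw [dx, dy, hh.fderiv]
      by_cases hz : z ∈ Metric.ball (0 : ℂ) 1
      · simp only [hz, Set.indicator_of_mem]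
        rw [(hfd n z).fderiv]
        simp only [hw, fderiv_eq_dx_dy S z z, smul_apply, add_apply, Complex.reCLM_apply,
          Complex.imCLM_apply, Complex.one_re,
          Complex.one_im, Complex.I_re, Complex.I_im, smul_eq_mul]
        push_cast
        ring
      · simp [hz]
  obtain ⟨K, hK⟩ := (isCompact_closedBall (0 : ℂ) 1).exists_bound_of_continuousOn cpl.continuousOn
  have hlt : ∀ᵐ z ∂(volume.restrict (Metric.ball (0 : ℂ) 1)), ‖z‖ < 1 :=
    (ae_restrict_mem Metric.isOpen_ball.measurableSet).mono fun z hz => by simpa using hz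
  have hfin : IsFiniteMeasure (volume.restrict (Metric.ball (0 : ℂ) 1)) :=
    isFiniteMeasure_restrict.2 Metric.isBounded_ball.measure_lt_top.ne
  have t1 := tendsto_integral_of_dominated_convergence
    (μ := volume.restrict (Metric.ball (0 : ℂ) 1))
    (F := fun (n : ℕ) z => (1 - (‖z‖ ^ 2) ^ (n + 1)) ^ 2 * plap S z) (f := plap S)
    (fun _ => K) (fun n => by
      refine Continuous.aestronglyMeasurable ?_
      fun_prop) (integrable_const _) (fun n => by
      filter_upwards [hlt] with z hz
      have h1 := hK z (by simpa using hz.le)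
      have h2 : (‖z‖ ^ 2) ^ (n + 1) ≤ 1 := pow_le_one₀ (by positivity) (by nlinarith [norm_nonneg z])
      have h3 : 0 ≤ (‖z‖ ^ 2) ^ (n + 1) := by positivity
      rw [norm_mul, Real.norm_eq_abs, abs_of_nonneg (sq_nonneg _)]
      refine (mul_le_of_le_one_left (norm_nonneg _) ?_).trans h1
      nlinarith) (by
      filter_upwards [hlt] with z hz
      have h2 : Filter.Tendsto (fun n : ℕ => (‖z‖ ^ 2) ^ (n + 1)) Filter.atTop (nhds 0) :=
        (tendsto_pow_atTop_nhds_zero_of_lt_one (by positivity)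
          (by nlinarith [norm_nonneg z])).comp (Filter.tendsto_add_atTop_nat 1)
      have := ((h2.const_sub 1).pow 2).mul_const (plap S z)
      simpa using this)
  have t2 := tendsto_integral_of_dominated_convergence
    (μ := volume.restrict (Metric.ball (0 : ℂ) 1))
    (F := fun (n : ℕ) z => (1 - (‖z‖ ^ 2) ^ (n + 1)) * (4 * (n + 1) * (‖z‖ ^ 2) ^ n) * w z)
    (f := fun _ => 0)
    (fun _ => 4 * C) (fun n => by
      refine Continuous.aestronglyMeasurable ?_
      have := hw1.continuous
      fun_prop) (integrable_const _) (fun n => by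
      filter_upwards [hlt] with z hz
      have h1 := hwb z (by simpa using hz)
      have h0 : ‖z‖ ^ 2 ≤ 1 := by nlinarith [norm_nonneg z]
      have h2 : (‖z‖ ^ 2) ^ (n + 1) ≤ 1 := pow_le_one₀ (by positivity) h0
      have h3 : 0 ≤ (‖z‖ ^ 2) ^ (n + 1) := by positivity
      have h4 : ((n : ℝ) + 1) * (‖z‖ ^ 2) ^ n * (1 - ‖z‖ ^ 2) ≤ 1 := by
        have e := geom_sum_mul_neg (‖z‖ ^ 2) (n + 1)
        have : ((n : ℝ) + 1) * (‖z‖ ^ 2) ^ n ≤ ∑ i ∈ Finset.range (n + 1), (‖z‖ ^ 2) ^ i := by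
          have := Finset.card_nsmul_le_sum (Finset.range (n + 1)) (fun i => (‖z‖ ^ 2) ^ i)
            ((‖z‖ ^ 2) ^ n) (fun i hi => pow_le_pow_of_le_one (by positivity) h0
              (Nat.lt_succ_iff.1 (Finset.mem_range.1 hi)))
          simpa using this
        calc _ ≤ (∑ i ∈ Finset.range (n + 1), (‖z‖ ^ 2) ^ i) * (1 - ‖z‖ ^ 2) :=
              mul_le_mul_of_nonneg_right this (by linarith)
          _ = 1 - (‖z‖ ^ 2) ^ (n + 1) := e
          _ ≤ 1 := by linarith
      have hC0 : 0 ≤ C := (norm_nonneg _).trans (hC 0 (by simp))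
      rw [norm_mul, norm_mul, Real.norm_eq_abs, Real.norm_eq_abs, Real.norm_eq_abs,
        abs_of_nonneg (by linarith : 0 ≤ 1 - (‖z‖ ^ 2) ^ (n + 1)),
        abs_of_nonneg (by positivity : (0 : ℝ) ≤ 4 * (n + 1) * (‖z‖ ^ 2) ^ n)]
      calc _ ≤ 1 * (4 * (n + 1) * (‖z‖ ^ 2) ^ n) * (C * (1 - ‖z‖ ^ 2)) := by
            gcongr
            linarith
        _ = 4 * C * (((n : ℝ) + 1) * (‖z‖ ^ 2) ^ n * (1 - ‖z‖ ^ 2)) := by ring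
        _ ≤ 4 * C * 1 := mul_le_mul_of_nonneg_left h4 (by positivity)
        _ = 4 * C := mul_one _) (by
      filter_upwards [hlt] with z hz
      have h0 : ‖z‖ ^ 2 < 1 := by nlinarith [norm_nonneg z]
      have h2 := tendsto_pow_atTop_nhds_zero_of_lt_one (by positivity) h0
      have h3 := tendsto_self_mul_const_pow_of_lt_one (by positivity) h0
      have h4 := ((h2.comp (Filter.tendsto_add_atTop_nat 1)).const_sub 1).mul
        ((h3.add h2).const_mul 4)
      have h5 := h4.mul_const (w z)
      simp only [add_zero, mul_zero, zero_mul, Function.comp_def] at h5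
      refine h5.congr fun n => ?_
      ring)
  simp only [integral_zero] at t2
  exact tendsto_nhds_unique t1 (t2.congr fun n => (hid n).symm)

lemma mfe_contDiffAt {u : E3 → ℝ} {α : ℝ} (hu : MFE u α) {x : E3} (hx : x ≠ 0) :
    ContDiffAt ℝ ∞ u x :=
  hu.1.contDiffAt (isOpen_compl_singleton.mem_nhds hx)

lemma hom0_fderiv_smul {u : E3 → ℝ} (hu : Hom0 u) {r : ℝ} (hr : 0 < r) (x : E3) :
    fderiv ℝ u (r • x) = r⁻¹ • fderiv ℝ u x := by
  have h : u = fun x => u (r • x) := funext fun x => (hu x r hr).symm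
  have h2 := _root_.fderiv_comp_smul (𝕜 := ℝ) (f := u) (x := x) r
  rw [← h] at h2
  rw [h2, smul_smul, inv_mul_cancel₀ hr.ne', one_smul]

lemma hom0_fderiv_fderiv_smul {u : E3 → ℝ} (hu : Hom0 u) {r : ℝ} (hr : 0 < r) (x : E3) :
    fderiv ℝ (fderiv ℝ u) (r • x) = (r⁻¹ ^ 2) • fderiv ℝ (fderiv ℝ u) x := by
  have h : r⁻¹ • fderiv ℝ u = fun x => fderiv ℝ u (r • x) :=
    funext fun x => (hom0_fderiv_smul hu hr x).symm
  have h2 := _root_.fderiv_comp_smul (𝕜 := ℝ) (f := fderiv ℝ u) (x := x) r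
  have h3 : fderiv ℝ (r⁻¹ • fderiv ℝ u) x = r⁻¹ • fderiv ℝ (fderiv ℝ u) x :=
    congrFun (fderiv_const_smul_field (𝕜 := ℝ) (f := fderiv ℝ u) r⁻¹) x
  rw [← h, h3] at h2
  rw [pow_two, mul_smul, h2, smul_smul r⁻¹ r, inv_mul_cancel₀ hr.ne', one_smul]

lemma hom0_fderiv_fderiv_self {u : E3 → ℝ} (hu : Hom0 u) {x : E3} (hx : ContDiffAt ℝ 2 u x)
    (v : E3) : fderiv ℝ (fderiv ℝ u) x x v = -fderiv ℝ u x v := by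
  have hd : DifferentiableAt ℝ (fderiv ℝ u) x :=
    (hx.fderiv_right (m := 1) (by norm_num)).differentiableAt (by norm_num)
  have hd1 : HasFDerivAt (fderiv ℝ u) (fderiv ℝ (fderiv ℝ u) x) ((1 : ℝ) • x) := by
    rw [one_smul]; exact hd.hasFDerivAt
  have h1 : HasDerivAt (fun r : ℝ => r • x) x 1 := by
    simpa using (hasDerivAt_id (1 : ℝ)).smul_const x
  have h2 : HasDerivAt (fun r : ℝ => fderiv ℝ u (r • x)) (fderiv ℝ (fderiv ℝ u) x x) 1 :=
    HasFDerivAt.comp_hasDerivAt (f := fun r : ℝ => r • x) 1 hd1 h1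
  have h2' : HasDerivAt (fun r : ℝ => fderiv ℝ u (r • x) v) (fderiv ℝ (fderiv ℝ u) x x v) 1 := by
    have := h2.clm_apply (hasDerivAt_const (1 : ℝ) v)
    simpa using this
  have h3 : HasDerivAt (fun r : ℝ => (r⁻¹ • fderiv ℝ u x) v) (-fderiv ℝ u x v) 1 := by
    have := (hasDerivAt_inv (one_ne_zero (α := ℝ))).mul_const (fderiv ℝ u x v)
    simp only [one_pow, inv_one, neg_one_mul] at this
    exact this
  have h4 : (fun r : ℝ => (r⁻¹ • fderiv ℝ u x) v) =ᶠ[nhds 1] fun r => fderiv ℝ u (r • x) v := by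
    filter_upwards [lt_mem_nhds one_pos] with r hr
    rw [hom0_fderiv_smul hu hr]
  exact h2'.unique (h3.congr_of_eventuallyEq h4.symm)

lemma lap_eq {u : E3 → ℝ} (b : OrthonormalBasis (Fin 3) ℝ E3) (x : E3) :
    lap u x = ∑ i, fderiv ℝ (fderiv ℝ u) x (b i) (b i) := by
  have h1 := congrFun (InnerProductSpace.laplacian_eq_iteratedFDeriv_orthonormalBasis u b) x
  have h2 := congrFun (InnerProductSpace.laplacian_eq_iteratedFDeriv_orthonormalBasis u
    (EuclideanSpace.basisFun (Fin 3) ℝ)) x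
  have : lap u x = ∑ i, iteratedFDeriv ℝ 2 u x ![b i, b i] := by
    rw [← h1, h2]
    simp [lap]
  rw [this]
  simp [iteratedFDeriv_two_apply]

/-- A triple of pairwise orthogonal unit vectors. -/
structure Frame (p q y : E3) : Prop where
  hp : ‖p‖ = 1
  hq : ‖q‖ = 1
  hy : ‖y‖ = 1
  hpq : ⟪p, q⟫ = 0
  hpy : ⟪p, y⟫ = 0
  hqy : ⟪q, y⟫ = 0

lemma Frame.neg {p q y : E3} (h : Frame p q y) : Frame p q (-y) where
  hp := h.hp
  hq := h.hq
  hy := by rw [norm_neg, h.hy]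
  hpq := h.hpq
  hpy := by rw [inner_neg_right, h.hpy, neg_zero]
  hqy := by rw [inner_neg_right, h.hqy, neg_zero]

lemma Frame.orthonormal {p q y : E3} (h : Frame p q y) : Orthonormal ℝ ![p, q, y] := by
  have h1 : ⟪q, p⟫ = 0 := by rw [real_inner_comm, h.hpq]
  have h2 : ⟪y, p⟫ = 0 := by rw [real_inner_comm, h.hpy]
  have h3 : ⟪y, q⟫ = 0 := by rw [real_inner_comm, h.hqy]
  refine ⟨fun i => ?_, fun i j hij => ?_⟩
  · fin_cases i <;> simp [h.hp, h.hq, h.hy]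
  · fin_cases i <;> fin_cases j <;> simp_all [h.hpq, h.hpy, h.hqy]

def Frame.basis {p q y : E3} (h : Frame p q y) : OrthonormalBasis (Fin 3) ℝ E3 :=
  OrthonormalBasis.mk h.orthonormal (by
    have := h.orthonormal.linearIndependent.span_eq_top_of_card_eq_finrank (by simp)
    exact this.ge)

lemma Frame.lap_eq {p q y : E3} (h : Frame p q y) (u : E3 → ℝ) (x : E3) :
    lap u x = fderiv ℝ (fderiv ℝ u) x p p + fderiv ℝ (fderiv ℝ u) x q q +
      fderiv ℝ (fderiv ℝ u) x y y := by
  rw [Planar.lap_eq h.basis, Fin.sum_univ_three]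
  simp [Frame.basis]

lemma Frame.sum_eq {p q y : E3} (h : Frame p q y) (x : E3) :
    ⟪p, x⟫ • p + ⟪q, x⟫ • q + ⟪y, x⟫ • y = x := by
  have := h.basis.sum_repr' x
  rw [Fin.sum_univ_three] at this
  simpa [Frame.basis] using this

/-- Stereographic projection from `-y`, rescaled by `1 + ‖z‖²`. -/
def stereo (p q y : E3) (z : ℂ) : E3 :=
  (2 * z.re) • p + (2 * z.im) • q + (1 - ‖z‖ ^ 2) • y

def stereoX (p y : E3) (z : ℂ) : E3 := (2 : ℝ) • p - (2 * z.re) • y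

def stereoY (q y : E3) (z : ℂ) : E3 := (2 : ℝ) • q - (2 * z.im) • y

lemma hasFDerivAt_stereo (p q y : E3) (z : ℂ) :
    HasFDerivAt (stereo p q y)
      (Complex.reCLM.smulRight (stereoX p y z) + Complex.imCLM.smulRight (stereoY q y z)) z := by
  have h1 := ((Complex.reCLM.hasFDerivAt (x := z)).const_mul 2).smul_const p
  have h2 := ((Complex.imCLM.hasFDerivAt (x := z)).const_mul 2).smul_const q
  have h3 := ((hasFDerivAt_norm_sq z).const_sub 1).smul_const y
  refine ((h1.add h2).add h3).congr_fderiv ?_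
  ext v i
  simp [stereoX, stereoY]
  ring

lemma Frame.norm_sq_stereo {p q y : E3} (h : Frame p q y) (z : ℂ) :
    ‖stereo p q y z‖ ^ 2 = (1 + ‖z‖ ^ 2) ^ 2 := by
  have h1 : ⟪q, p⟫ = 0 := by rw [real_inner_comm, h.hpq]
  have h2 : ⟪y, p⟫ = 0 := by rw [real_inner_comm, h.hpy]
  have h3 : ⟪y, q⟫ = 0 := by rw [real_inner_comm, h.hqy]
  rw [← real_inner_self_eq_norm_sq]
  simp only [stereo, inner_add_left, inner_add_right, real_inner_smul_left, real_inner_smul_right,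
    h1, h2, h3, h.hpq, h.hpy, h.hqy]
  simp only [real_inner_self_eq_norm_sq, h.hp, h.hq, h.hy]
  have e2 : ‖z‖ ^ 2 = z.re * z.re + z.im * z.im := by rw [Complex.sq_norm, Complex.normSq_apply]
  rw [e2]
  ring

lemma Frame.norm_stereo {p q y : E3} (h : Frame p q y) (z : ℂ) :
    ‖stereo p q y z‖ = 1 + ‖z‖ ^ 2 :=
  (sq_eq_sq₀ (norm_nonneg _) (by positivity)).1 (h.norm_sq_stereo z)

lemma Frame.stereo_ne {p q y : E3} (h : Frame p q y) (z : ℂ) : stereo p q y z ≠ 0 := by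
  rw [← norm_ne_zero_iff, h.norm_stereo]
  positivity

lemma Refl_stereo {p q y : E3} (h : Frame p q y) (z : ℂ) :
    Refl y (stereo p q y z) = stereo p q (-y) z := by
  simp only [Refl, stereo, inner_add_left, real_inner_smul_left, h.hpy, h.hqy,
    real_inner_self_eq_norm_sq, h.hy]
  module

lemma stereo_inv {p q y : E3} {z : ℂ} (hz : ‖z‖ = 1) {t : ℝ} (ht : t ≠ 0) :
    stereo p q y (t⁻¹ • z) = (t⁻¹ ^ 2) • stereo p q (-y) (t • z) := by
  simp only [stereo, norm_smul, hz, Complex.smul_re, Complex.smul_im, smul_eq_mul, mul_one,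
    Real.norm_eq_abs, sq_abs, smul_add, smul_smul]
  congr 1
  · congr 2 <;> field_simp
  · rw [smul_neg, ← neg_smul]
    congr 1
    field_simp
    ring

section

/-- A function on the sphere read in the stereographic chart of a frame. -/
def pull (u : E3 → ℝ) (p q y : E3) (z : ℂ) : ℝ := u (stereo p q y z)

section
variable {u : E3 → ℝ} {α : ℝ} (hu : MFE u α) {p q y : E3} (h : Frame p q y)
include hu h

lemma hasFDerivAt_u (z : ℂ) : HasFDerivAt u (fderiv ℝ u (stereo p q y z)) (stereo p q y z) :=
  ((mfe_contDiffAt hu (h.stereo_ne z)).differentiableAt (by norm_num)).hasFDerivAt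

lemma contDiffAt_u_two (z : ℂ) : ContDiffAt ℝ 2 u (stereo p q y z) :=
  (mfe_contDiffAt hu (h.stereo_ne z)).of_le (by norm_cast)

lemma hasFDerivAt_fderiv_u (z : ℂ) : HasFDerivAt (fderiv ℝ u)
    (fderiv ℝ (fderiv ℝ u) (stereo p q y z)) (stereo p q y z) :=
  (((contDiffAt_u_two hu h z).fderiv_right (m := 1) (by norm_num)).differentiableAt
    (by norm_num)).hasFDerivAt

lemma contDiff_pull : ContDiff ℝ ∞ (pull u p q y) := by
  refine contDiff_iff_contDiffAt.2 fun z => ?_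
  refine ContDiffAt.comp (f := stereo p q y) z (mfe_contDiffAt hu (h.stereo_ne z)) ?_
  have h1 : ContDiff ℝ ∞ (Complex.reCLM : ℂ → ℝ) := Complex.reCLM.contDiff
  have h2 : ContDiff ℝ ∞ (Complex.imCLM : ℂ → ℝ) := Complex.imCLM.contDiff
  exact ((((contDiff_const.mul h1).smul contDiff_const).add
    ((contDiff_const.mul h2).smul contDiff_const)).add
    ((contDiff_const.sub (contDiff_norm_sq ℝ)).smul contDiff_const)).contDiffAt

lemma fderiv_pull (z v : ℂ) : fderiv ℝ (pull u p q y) z v =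
    fderiv ℝ u (stereo p q y z) (v.re • stereoX p y z + v.im • stereoY q y z) := by
  have := (hasFDerivAt_u hu h z).comp z (hasFDerivAt_stereo p q y z)
  have e : fderiv ℝ (pull u p q y) z = _ := HasFDerivAt.fderiv this
  rw [e]
  simp

lemma dx_pull (z : ℂ) : dx (pull u p q y) z = fderiv ℝ u (stereo p q y z) (stereoX p y z) := by
  rw [dx, fderiv_pull hu h]; simp

lemma dy_pull (z : ℂ) : dy (pull u p q y) z = fderiv ℝ u (stereo p q y z) (stereoY q y z) := by
  rw [dy, fderiv_pull hu h]; simp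

lemma fderiv_fderiv_stereo (z v : ℂ) {W : ℂ → E3} {W' : ℂ →L[ℝ] E3} (hW : HasFDerivAt W W' z) :
    fderiv ℝ (fun z => fderiv ℝ u (stereo p q y z) (W z)) z v =
      fderiv ℝ (fderiv ℝ u) (stereo p q y z) (v.re • stereoX p y z + v.im • stereoY q y z) (W z) +
        fderiv ℝ u (stereo p q y z) (W' v) := by
  have h1 : HasFDerivAt (fun z => fderiv ℝ u (stereo p q y z)) _ z :=
    HasFDerivAt.comp (f := stereo p q y) z (hasFDerivAt_fderiv_u hu h z)
      (hasFDerivAt_stereo p q y z)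
  rw [(h1.clm_apply hW).fderiv]
  simp [add_comm]

end

lemma hasFDerivAt_stereoX (p y : E3) (z : ℂ) :
    HasFDerivAt (stereoX p y) (-((2 : ℝ) • Complex.reCLM).smulRight y) z :=
  (((Complex.reCLM.hasFDerivAt (x := z)).const_mul 2).smul_const y).const_sub _

lemma hasFDerivAt_stereoY (q y : E3) (z : ℂ) :
    HasFDerivAt (stereoY q y) (-((2 : ℝ) • Complex.imCLM).smulRight y) z :=
  (((Complex.imCLM.hasFDerivAt (x := z)).const_mul 2).smul_const y).const_sub _

section
variable {u : E3 → ℝ} {α : ℝ} (hu : MFE u α) {p q y : E3} (h : Frame p q y)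
include hu h

lemma dx_dx_pull (z : ℂ) : dx (dx (pull u p q y)) z =
    fderiv ℝ (fderiv ℝ u) (stereo p q y z) (stereoX p y z) (stereoX p y z) -
      2 * fderiv ℝ u (stereo p q y z) y := by
  rw [show dx (pull u p q y) = _ from funext (dx_pull hu h), dx,
    fderiv_fderiv_stereo hu h z 1 (hasFDerivAt_stereoX p y z)]
  simp
  ring

lemma dy_dx_pull (z : ℂ) : dy (dx (pull u p q y)) z =
    fderiv ℝ (fderiv ℝ u) (stereo p q y z) (stereoY q y z) (stereoX p y z) := by
  rw [show dx (pull u p q y) = _ from funext (dx_pull hu h), dy,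
    fderiv_fderiv_stereo hu h z Complex.I (hasFDerivAt_stereoX p y z)]
  simp

lemma dx_dy_pull (z : ℂ) : dx (dy (pull u p q y)) z =
    fderiv ℝ (fderiv ℝ u) (stereo p q y z) (stereoX p y z) (stereoY q y z) := by
  rw [show dy (pull u p q y) = _ from funext (dy_pull hu h), dx,
    fderiv_fderiv_stereo hu h z 1 (hasFDerivAt_stereoY q y z)]
  simp

lemma dy_dy_pull (z : ℂ) : dy (dy (pull u p q y)) z =
    fderiv ℝ (fderiv ℝ u) (stereo p q y z) (stereoY q y z) (stereoY q y z) -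
      2 * fderiv ℝ u (stereo p q y z) y := by
  rw [show dy (pull u p q y) = _ from funext (dy_pull hu h), dy,
    fderiv_fderiv_stereo hu h z Complex.I (hasFDerivAt_stereoY q y z)]
  simp
  ring

lemma plap_pull_eq_lap (z : ℂ) : plap (pull u p q y) z = 4 * lap u (stereo p q y z) := by
  rw [plap, dx_dx_pull hu h, dy_dy_pull hu h, h.lap_eq]
  have hs := (contDiffAt_u_two hu h z).isSymmSndFDerivAt (by simp)
  have h1 := hom0_fderiv_fderiv_self hu.2.1 (contDiffAt_u_two hu h z) y
  have hp := hs.eq y p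
  have hq := hs.eq y q
  set H := fderiv ℝ (fderiv ℝ u) (stereo p q y z)
  set g := fderiv ℝ u (stereo p q y z)
  have e2 : ‖z‖ ^ 2 = z.re * z.re + z.im * z.im := by rw [Complex.sq_norm, Complex.normSq_apply]
  simp only [stereo, map_add, map_smul, add_apply, smul_apply, smul_eq_mul] at h1
  simp only [stereoX, stereoY, map_sub, map_smul, sub_apply, smul_apply, smul_eq_mul]
  rw [hp, hq]
  rw [e2] at h1
  linear_combination -4 * h1

lemma plap_pull (z : ℂ) : plap (pull u p q y) z =
    4 / (1 + ‖z‖ ^ 2) ^ 2 * (α - exp (2 * pull u p q y z)) := by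
  have hpos : 0 < 1 + ‖z‖ ^ 2 := by positivity
  have hr : 0 < (1 + ‖z‖ ^ 2)⁻¹ := by positivity
  have hS : (1 + ‖z‖ ^ 2)⁻¹ • stereo p q y z ∈ S2 := by
    rw [S2, mem_sphere_zero_iff_norm, norm_smul, h.norm_stereo, Real.norm_eq_abs,
      abs_of_pos hr, inv_mul_cancel₀ hpos.ne']
  have h1 := hu.2.2 _ hS
  rw [h.lap_eq, hom0_fderiv_fderiv_smul hu.2.1 hr, hu.2.1 _ _ hr, inv_inv] at h1
  simp only [smul_apply, smul_eq_mul] at h1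
  rw [plap_pull_eq_lap hu h, h.lap_eq, pull, ← h1]
  field_simp
  ring

end

end

section

lemma exists_frame {p y : E3} (hp : ‖p‖ = 1) (hy : ‖y‖ = 1) (hyp : ⟪y, p⟫ = 0) :
    ∃ q, Frame p q y := by
  obtain ⟨w, hw, hw0⟩ := (Submodule.ne_bot_iff _).1 (LinearMap.ker_ne_bot_of_finrank_lt
    (f := ((innerSL ℝ p).toLinearMap.prod (innerSL ℝ y).toLinearMap)) (by simp))
  have h1 : ⟪p, w⟫ = 0 ∧ ⟪y, w⟫ = 0 := by simpa using hw
  refine ⟨‖w‖⁻¹ • w, hp, ?_, hy, ?_, ?_, ?_⟩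
  · rw [norm_smul, norm_inv, norm_norm, inv_mul_cancel₀ (norm_ne_zero_iff.2 hw0)]
  · rw [real_inner_smul_right, h1.1, mul_zero]
  · rw [real_inner_comm, hyp]
  · rw [real_inner_smul_left, real_inner_comm, h1.2, mul_zero]

lemma stereo_one (p q y : E3) : stereo p q y 1 = (2 : ℝ) • p := by
  simp [stereo]

lemma stereo_neg_one (p q y : E3) : stereo p q y (-1) = (2 : ℝ) • -p := by
  simp [stereo]

lemma stereo_zero (p q y : E3) : stereo p q y 0 = y := by
  simp [stereo]

lemma pull_inv {u : E3 → ℝ} (hu : Hom0 u) (p q y : E3) {z : ℂ} (hz : ‖z‖ = 1) {t : ℝ}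
    (ht : 0 < t) : pull u p q y (t⁻¹ • z) = pull u p q (-y) (t • z) := by
  rw [pull, stereo_inv hz ht.ne', hu _ _ (by positivity), pull]

lemma pull_circle {u : E3 → ℝ} (hu : Hom0 u) (p q y : E3) {z : ℂ} (hz : ‖z‖ = 1) :
    pull u p q y z = pull u p q (-y) z := by
  simpa using pull_inv hu p q y hz one_pos

/-- The differential of a function at a point gives the derivative along the ray through it. -/
lemma hasDerivAt_ray {f : ℂ → ℝ} {z : ℂ} (hf : DifferentiableAt ℝ f z) :
    HasDerivAt (fun t : ℝ => f (t • z)) (fderiv ℝ f z z) 1 := by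
  have h1 : HasDerivAt (fun r : ℝ => r • z) z 1 := by
    simpa using (hasDerivAt_id (1 : ℝ)).smul_const z
  have hf1 : HasFDerivAt f (fderiv ℝ f z) ((1 : ℝ) • z) := by
    rw [one_smul]; exact hf.hasFDerivAt
  exact HasFDerivAt.comp_hasDerivAt (f := fun r : ℝ => r • z) 1 hf1 h1

lemma fderiv_ray_eq_zero {f : ℂ → ℝ} {z : ℂ} (hf : DifferentiableAt ℝ f z)
    (h : ∀ t : ℝ, 0 < t → f (t⁻¹ • z) = f (t • z)) : fderiv ℝ f z z = 0 := by
  have h1 := hasDerivAt_ray hf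
  have h2 : HasDerivAt (fun t : ℝ => f (t⁻¹ • z)) (fderiv ℝ f z z * -1) 1 := by
    have hi : HasDerivAt (fun t : ℝ => t⁻¹) (-1) 1 := by
      simpa using hasDerivAt_inv (one_ne_zero (α := ℝ))
    have h1' : HasDerivAt (fun t : ℝ => f (t • z)) (fderiv ℝ f z z) (1⁻¹) := by rwa [inv_one]
    exact HasDerivAt.comp (h₂ := fun t : ℝ => f (t • z)) 1 h1' hi
  have h4 : (fun t : ℝ => f (t • z)) =ᶠ[nhds 1] fun t => f (t⁻¹ • z) := by
    filter_upwards [lt_mem_nhds one_pos] with t ht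
    exact (h t ht).symm
  have := h2.unique (h1.congr_of_eventuallyEq h4.symm)
  linarith

section
variable {u : E3 → ℝ} {α : ℝ} (hu : MFE u α) {p q y : E3} (h : Frame p q y)
include hu h

lemma fderiv_pull_eq_zero {z : ℂ} {r : ℝ} {x : E3} (hr : 0 < r) (hz : stereo p q y z = r • x)
    (hx : fderiv ℝ u x = 0) : fderiv ℝ (pull u p q y) z = 0 := by
  ext v
  rw [fderiv_pull hu h, hz, hom0_fderiv_smul hu.2.1 hr, hx]
  simp

lemma umbilical_derivs {c : ℝ} (hp0 : fderiv ℝ u p = 0)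
    (hc : ∀ v : E3, ⟪v, p⟫ = 0 → iteratedFDeriv ℝ 2 u p ![v, v] = c * ‖v‖ ^ 2) :
    dx (dx (pull u p q y)) 1 = c ∧ dy (dx (pull u p q y)) 1 = 0 ∧
      dx (dy (pull u p q y)) 1 = 0 ∧ dy (dy (pull u p q y)) 1 = c := by
  have hp : p ≠ 0 := by rw [← norm_ne_zero_iff, h.hp]; exact one_ne_zero
  have hd : ContDiffAt ℝ 2 u p := (mfe_contDiffAt hu hp).of_le (by norm_cast)
  have hs := hd.isSymmSndFDerivAt (by simp)
  have h1 : ∀ v, fderiv ℝ (fderiv ℝ u) p p v = 0 := fun v => by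
    rw [hom0_fderiv_fderiv_self hu.2.1 hd, hp0]; simp
  have h2 : ∀ v, fderiv ℝ (fderiv ℝ u) p v p = 0 := fun v => by rw [hs.eq, h1]
  have hyp : ⟪y, p⟫ = 0 := by rw [real_inner_comm, h.hpy]
  have hqp : ⟪q, p⟫ = 0 := by rw [real_inner_comm, h.hpq]
  have hyy := hc y hyp
  have hqq := hc q hqp
  have hqy := hc (q + y) (by rw [inner_add_left, hyp, hqp, add_zero])
  rw [norm_add_sq_real, h.hq, h.hy, h.hqy] at hqy
  rw [h.hy] at hyy
  rw [h.hq] at hqq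
  simp only [iteratedFDeriv_two_apply, Matrix.cons_val_zero, Matrix.cons_val_one, map_add,
    add_apply] at hyy hqq hqy
  have hsy := hs.eq q y
  have h3 : fderiv ℝ (fderiv ℝ u) p q y = 0 := by linarith
  have h4 : fderiv ℝ (fderiv ℝ u) p y q = 0 := by linarith
  rw [dx_dx_pull hu h, dy_dx_pull hu h, dx_dy_pull hu h, dy_dy_pull hu h, stereo_one,
    hom0_fderiv_smul hu.2.1 two_pos, hp0, hom0_fderiv_fderiv_smul hu.2.1 two_pos]
  simp [stereoX, stereoY, h1, h2, h3, h4]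
  constructor <;> linarith

end

lemma abs_exp_sub_exp_le {a b M : ℝ} (ha : exp (2 * a) ≤ M) (hb : exp (2 * b) ≤ M) :
    |exp (2 * a) - exp (2 * b)| ≤ 2 * M * |a - b| := by
  have key : ∀ {a b : ℝ}, exp (2 * a) ≤ M → exp (2 * b) ≤ M →
      exp (2 * a) - exp (2 * b) ≤ 2 * M * |a - b| := by
    intro a b ha hb
    have h1 := add_one_le_exp (2 * b - 2 * a)
    have h2 : exp (2 * b) = exp (2 * a) * exp (2 * b - 2 * a) := by
      rw [← Real.exp_add]; congr 1; ring
    have h3 := exp_pos (2 * a)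
    calc exp (2 * a) - exp (2 * b) ≤ exp (2 * a) * (2 * (a - b)) := by rw [h2]; nlinarith
      _ ≤ exp (2 * a) * (2 * |a - b|) := by gcongr; exact le_abs_self _
      _ ≤ M * (2 * |a - b|) := by gcongr
      _ = 2 * M * |a - b| := by ring
  refine abs_sub_le_iff.2 ⟨key ha hb, ?_⟩
  rw [abs_sub_comm]
  exact key hb ha

end

/-- The conformal factor added to a chart representation, so that the equation becomes
`-Δ U = e^{2U} - 4 (α - 1) / (1 + ‖z‖²)²`. -/
def conf (f : ℂ → ℝ) (z : ℂ) : ℝ := f z + (Real.log 2 - Real.log (1 + ‖z‖ ^ 2))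

lemma contDiff_conf {f : ℂ → ℝ} (hf : ContDiff ℝ 2 f) : ContDiff ℝ 2 (conf f) :=
  hf.add (contDiff_const.sub contDiff_log_one_add_norm_sq)

lemma exp_conf (f : ℂ → ℝ) (z : ℂ) :
    exp (2 * conf f z) = 4 / (1 + ‖z‖ ^ 2) ^ 2 * exp (2 * f z) := by
  have hpos : 0 < 1 + ‖z‖ ^ 2 := by positivity
  rw [conf, mul_add, Real.exp_add, mul_comm (exp _)]
  congr 1
  rw [← Real.log_div two_ne_zero hpos.ne', two_mul, Real.exp_add,
    Real.exp_log (by positivity)]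
  field_simp
  norm_num

lemma plap_conf {f : ℂ → ℝ} (hf : ContDiff ℝ 2 f) (z : ℂ) :
    plap (conf f) z = plap f z - 4 / (1 + ‖z‖ ^ 2) ^ 2 := by
  have h2 : ContDiffAt ℝ 2 (fun w : ℂ => Real.log (1 + ‖w‖ ^ 2)) z :=
    contDiff_log_one_add_norm_sq.contDiffAt
  have h3 : plap (fun _ : ℂ => Real.log 2) z = 0 := by
    have e1 : dx (fun _ : ℂ => Real.log 2) = fun _ => 0 := by funext w; simp [dx]
    have e2 : dy (fun _ : ℂ => Real.log 2) = fun _ => 0 := by funext w; simp [dy]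
    rw [plap, e1, e2]
    simp [dx, dy]
  rw [show conf f = fun z => f z + (Real.log 2 - Real.log (1 + ‖z‖ ^ 2)) from rfl,
    plap_add hf.contDiffAt (contDiffAt_const.sub h2), plap_sub contDiffAt_const h2,
    plap_log_one_add_norm_sq, h3]
  ring

lemma fderiv_cgrad_eq_zero {φ : ℂ → ℝ} (hφ : ContDiff ℝ 2 φ) {z : ℂ}
    (h1 : dx (dx φ) z = 0) (h2 : dy (dx φ) z = 0) (h3 : dx (dy φ) z = 0) (h4 : dy (dy φ) z = 0) :
    fderiv ℝ (cgrad φ) z = 0 := by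
  have hd := hφ.differentiable (by norm_num)
  have e : cgrad φ = fun z => (((dx φ z : ℝ) : ℂ) - Complex.I * ((dy φ z : ℝ) : ℂ)) / 2 :=
    funext fun z => cgrad_eq (hd z)
  have hx : DifferentiableAt ℝ (dx φ) z :=
    differentiableAt_of_contDiffAt (contDiffAt_dx (m := 1) hφ.contDiffAt (by norm_num)) le_rfl
  have hy : DifferentiableAt ℝ (dy φ) z :=
    differentiableAt_of_contDiffAt (contDiffAt_dy (m := 1) hφ.contDiffAt (by norm_num)) le_rfl
  have ex : HasFDerivAt (dx φ) (0 : ℂ →L[ℝ] ℝ) z := by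
    refine hx.hasFDerivAt.congr_fderiv ?_
    ext v
    rw [fderiv_eq_dx_dy, h1, h2]
    simp
  have ey : HasFDerivAt (dy φ) (0 : ℂ →L[ℝ] ℝ) z := by
    refine hy.hasFDerivAt.congr_fderiv ?_
    ext v
    rw [fderiv_eq_dx_dy, h3, h4]
    simp
  have ex' := (Complex.ofRealCLM.hasFDerivAt (x := dx φ z)).comp z ex
  have ey' := (Complex.ofRealCLM.hasFDerivAt (x := dy φ z)).comp z ey
  have := (ex'.sub (ey'.const_mul Complex.I)).mul_const (2 : ℂ)⁻¹
  rw [e]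
  simp only [div_eq_mul_inv]
  refine (this.fderiv.trans ?_)
  ext v
  simp

theorem pull_eq_pull_neg {u : E3 → ℝ} {α : ℝ} (hα1 : 2 < α) (hα2 : α ≤ 3) (hu : MFE u α)
    {p q y : E3} (h : Frame p q y) (hump : UmbilicalCritical u p) (hc2 : fderiv ℝ u (-p) = 0) :
    ∀ z, pull u p q y z = pull u p q (-y) z := by
  obtain ⟨hp0, c, hc⟩ := hump
  set f := pull u p q y with hf
  set g := pull u p q (-y) with hg
  have cf : ContDiff ℝ 2 f := (contDiff_pull hu h).of_le (by norm_cast)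
  have cg : ContDiff ℝ 2 g := (contDiff_pull hu h.neg).of_le (by norm_cast)
  have df : Differentiable ℝ f := cf.differentiable (by norm_num)
  have dg : Differentiable ℝ g := cg.differentiable (by norm_num)
  have pf := plap_pull hu h
  have pg := plap_pull hu h.neg
  rw [← hf] at pf
  rw [← hg] at pg
  set φ : ℂ → ℝ := fun z => f z - g z with hφ
  have cφ : ContDiff ℝ 2 φ := cf.sub cg
  have pφ : ∀ z, plap φ z = -(4 / (1 + ‖z‖ ^ 2) ^ 2 * (exp (2 * f z) - exp (2 * g z))) := by
    intro z
    rw [hφ, plap_sub cf.contDiffAt cg.contDiffAt, pf, pg]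
    ring
  have hfac : ∀ z : ℂ, 4 / (1 + ‖z‖ ^ 2) ^ 2 ≤ 4 := by
    intro z
    refine div_le_self (by norm_num) (one_le_pow₀ ?_)
    have := sq_nonneg ‖z‖
    linarith
  have hbound : ∀ R : ℝ, ∃ M, 1 ≤ M ∧ ∀ z : ℂ, ‖z‖ ≤ R → exp (2 * f z) ≤ M ∧ exp (2 * g z) ≤ M := by
    intro R
    have c1 : Continuous fun z => exp (2 * f z) := by have := cf.continuous; fun_prop
    have c2 : Continuous fun z => exp (2 * g z) := by have := cg.continuous; fun_prop
    obtain ⟨M1, h1⟩ := (isCompact_closedBall (0 : ℂ) R).exists_bound_of_continuousOn c1.continuousOn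
    obtain ⟨M2, h2⟩ := (isCompact_closedBall (0 : ℂ) R).exists_bound_of_continuousOn c2.continuousOn
    refine ⟨max 1 (max M1 M2), le_max_left _ _, fun z hz => ⟨?_, ?_⟩⟩
    · exact ((le_abs_self _).trans (h1 z (by simpa using hz))).trans
        ((le_max_left _ _).trans (le_max_right _ _))
    · exact ((le_abs_self _).trans (h2 z (by simpa using hz))).trans
        ((le_max_right _ _).trans (le_max_right _ _))
  have hlin : ∀ R : ℝ, ∃ C, 0 < C ∧ ∀ z : ℂ, ‖z‖ ≤ R → |plap φ z| ≤ C * |φ z| := by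
    intro R
    obtain ⟨M, hM1, hM⟩ := hbound R
    refine ⟨4 * (2 * M), by positivity, fun z hz => ?_⟩
    rw [pφ, abs_neg, abs_mul, abs_of_nonneg (by positivity : 0 ≤ 4 / (1 + ‖z‖ ^ 2) ^ 2), mul_assoc]
    exact mul_le_mul (hfac z) (abs_exp_sub_exp_le (hM z hz).1 (hM z hz).2) (abs_nonneg _)
      (by norm_num)
  have hsl : SubLinear φ := by
    refine ⟨cφ, fun a => ?_⟩
    obtain ⟨C, -, hC⟩ := hlin (‖a‖ + 1)
    refine ⟨C, 1, one_pos, fun z hz => hC z ?_⟩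
    have := norm_add_le (z - a) a
    rw [sub_add_cancel] at this
    linarith
  obtain ⟨M, hM1, hM⟩ := hbound 1
  obtain ⟨C, hC0, hC⟩ := hlin 1
  set κ := 1 - 1 / (2 * M) with hκ
  have hM2 : 1 / (2 * M) ≤ 1 / 2 := one_div_le_one_div_of_le (by norm_num) (by linarith)
  have hM3 : 0 < 1 / (2 * M) := by positivity
  have hsub : ∀ {F : ℂ → ℝ}, ContDiff ℝ 2 F →
      (∀ z, plap F z = 4 / (1 + ‖z‖ ^ 2) ^ 2 * (α - exp (2 * F z))) →
      (∀ z : ℂ, ‖z‖ ≤ 1 → exp (2 * F z) ≤ M) →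
      ∀ z ∈ Metric.ball (0 : ℂ) 1, -plap (conf F) z ≤ κ * exp (2 * conf F z) := by
    intro F hF hpF hFM z hz
    have hz1 : ‖z‖ ≤ 1 := le_of_lt (by simpa using hz)
    have h1 : 1 / (2 * M) * exp (2 * F z) ≤ 1 / 2 := by
      calc _ ≤ 1 / (2 * M) * M := mul_le_mul_of_nonneg_left (hFM z hz1) hM3.le
        _ = 1 / 2 := by field_simp
    rw [plap_conf hF, hpF, exp_conf]
    have h2 : 0 ≤ 4 / (1 + ‖z‖ ^ 2) ^ 2 := by positivity
    rw [hκ]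
    nlinarith
  have hdx : dx φ = fun z => dx f z - dx g z := funext fun z => dx_sub (df z) (dg z)
  have hdy : dy φ = fun z => dy f z - dy g z := funext fun z => dy_sub (df z) (dg z)
  have hgrad : ∀ z, fderiv ℝ f z = 0 → fderiv ℝ g z = 0 → cgrad φ z = 0 := by
    intro z h1 h2
    rw [cgrad_eq (cφ.differentiable (by norm_num) z), hdx, hdy]
    simp [dx, dy, h1, h2]
  have d1 : ∀ {F : ℂ → ℝ}, ContDiff ℝ 2 F → DifferentiableAt ℝ (dx F) 1 := fun hF =>
    differentiableAt_of_contDiffAt (contDiffAt_dx (m := 1) hF.contDiffAt (by norm_num)) le_rfl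
  have d2 : ∀ {F : ℂ → ℝ}, ContDiff ℝ 2 F → DifferentiableAt ℝ (dy F) 1 := fun hF =>
    differentiableAt_of_contDiffAt (contDiffAt_dy (m := 1) hF.contDiffAt (by norm_num)) le_rfl
  obtain ⟨f1, f2, f3, f4⟩ := umbilical_derivs hu h hp0 hc
  obtain ⟨g1, g2, g3, g4⟩ := umbilical_derivs hu h.neg hp0 hc
  rw [← hf] at f1 f2 f3 f4
  rw [← hg] at g1 g2 g3 g4
  have harea : ∫ z in Metric.ball (0 : ℂ) 1, (exp (2 * conf f z) + exp (2 * conf g z)) ≤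
      12 * π := by
    have hS : ∫ z in Metric.ball (0 : ℂ) 1, plap (fun z => f z + g z) z = 0 := by
      refine integral_ball_plap_eq_zero (cf.add cg) fun z hz => ?_
      refine fderiv_ray_eq_zero ((df z).add (dg z)) fun t ht => ?_
      have e1 := pull_inv hu.2.1 p q y hz ht
      have e2 := pull_inv hu.2.1 p q (-y) hz ht
      rw [neg_neg] at e2
      rw [hf, hg, e1, e2, add_comm]
    have e : (fun z => exp (2 * conf f z) + exp (2 * conf g z)) = fun z =>
        8 * α * (1 / (1 + ‖z‖ ^ 2) ^ 2) - plap (fun z => f z + g z) z := by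
      funext z
      rw [exp_conf, exp_conf, plap_add cf.contDiffAt cg.contDiffAt, pf, pg]
      ring
    have i1 : IntegrableOn (fun z : ℂ => 8 * α * (1 / (1 + ‖z‖ ^ 2) ^ 2)) (Metric.ball 0 1) := by
      have : Continuous (fun z : ℂ => 8 * α * (1 / (1 + ‖z‖ ^ 2) ^ 2)) :=
        continuous_const.mul (continuous_const.div (by fun_prop) fun z => by positivity)
      exact (this.continuousOn.integrableOn_compact (isCompact_closedBall 0 1)).mono_set
        Metric.ball_subset_closedBall
    have i2 : IntegrableOn (plap fun z => f z + g z) (Metric.ball (0 : ℂ) 1) := by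
      have : Continuous (plap fun z => f z + g z) :=
        continuous_iff_continuousAt.2 fun z => continuousAt_plap (cf.add cg).contDiffAt
      exact (this.continuousOn.integrableOn_compact (isCompact_closedBall 0 1)).mono_set
        Metric.ball_subset_closedBall
    rw [e, integral_sub i1 i2, hS, integral_const_mul, integral_ball_inv_sq]
    nlinarith [pi_pos]
  have hzero := eq_zero_of_area_le (U := conf f) (V := conf g) (φ := φ) (contDiff_conf cf)
    (contDiff_conf cg) (fun z => by simp only [hφ, conf]; ring) hsl (κ := κ) (by linarith)
    (by linarith) (hsub cf pf fun z hz => (hM z hz).1) (hsub cg pg fun z hz => (hM z hz).2)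
    (fun z _ => by rw [plap_conf cf, plap_conf cg, exp_conf, exp_conf, pf, pg]; ring)
    (fun z hz => sub_eq_zero.2 (pull_circle hu.2.1 p q y hz)) hC0
    (fun z hz => hC z (le_of_lt (by simpa using hz)))
    (hgrad 1 (fderiv_pull_eq_zero hu h two_pos (stereo_one p q y) hp0)
      (fderiv_pull_eq_zero hu h.neg two_pos (stereo_one p q (-y)) hp0))
    (fderiv_cgrad_eq_zero cφ (by rw [hdx, dx_sub (d1 cf) (d1 cg), f1, g1, sub_self])
      (by rw [hdx, dy_sub (d1 cf) (d1 cg), f2, g2, sub_self])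
      (by rw [hdy, dx_sub (d2 cf) (d2 cg), f3, g3, sub_self])
      (by rw [hdy, dy_sub (d2 cf) (d2 cg), f4, g4, sub_self]))
    (hgrad (-1) (fderiv_pull_eq_zero hu h two_pos (stereo_neg_one p q y) hc2)
      (fderiv_pull_eq_zero hu h.neg two_pos (stereo_neg_one p q (-y)) hc2)) harea
  exact fun z => sub_eq_zero.1 (hzero z)

/-- Every point of the sphere other than `-y` is, up to scaling, in the range of the chart. -/
lemma Frame.exists_stereo {p q y : E3} (h : Frame p q y) {x : E3} (hx : ‖x‖ = 1)
    (hxy : 1 + ⟪y, x⟫ ≠ 0) : ∃ z, stereo p q y z = (2 / (1 + ⟪y, x⟫)) • x := by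
  have hs := h.sum_eq x
  have hn : ⟪p, x⟫ ^ 2 + ⟪q, x⟫ ^ 2 + ⟪y, x⟫ ^ 2 = 1 := by
    have := congrArg (fun w => ⟪w, x⟫) hs
    simp only [inner_add_left, real_inner_smul_left, real_inner_self_eq_norm_sq, hx] at this
    linarith
  refine ⟨⟨⟪p, x⟫ / (1 + ⟪y, x⟫), ⟪q, x⟫ / (1 + ⟪y, x⟫)⟩, ?_⟩
  rw [stereo, Complex.sq_norm, Complex.normSq_apply]
  generalize ⟪p, x⟫ = a at *
  generalize ⟪q, x⟫ = b at *
  generalize ⟪y, x⟫ = c at *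
  rw [← hs]
  simp only [smul_add, smul_smul]
  congr 1
  · congr 2 <;> ring
  · congr 1
    field_simp
    linear_combination -hn

end Planar

end

theorem stmt13 (α : ℝ) (hα1 : 2 < α) (hα2 : α ≤ 3) (u : E3 → ℝ) (hu : MFE u α)
    (p : E3) (hp : p ∈ S2) (hump : UmbilicalCritical u p)
    (hc2 : fderiv ℝ u (-p) = 0) :
    ∀ y ∈ S2, ⟪y, p⟫ = 0 → ∀ x ∈ S2, u (Refl y x) = u x := by
  intro y hy hyp x hx
  have hx1 : ‖x‖ = 1 := mem_sphere_zero_iff_norm.1 hx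
  obtain ⟨q, h⟩ := Planar.exists_frame (mem_sphere_zero_iff_norm.1 hp)
    (mem_sphere_zero_iff_norm.1 hy) hyp
  have hz := Planar.pull_eq_pull_neg hα1 hα2 hu h hump hc2
  by_cases hxy : 1 + ⟪y, x⟫ = 0
  · have hxy' : x = -y := by
      have : ‖y + x‖ ^ 2 = 0 := by
        rw [norm_add_sq_real, h.hy, hx1]
        linarith
      exact (neg_eq_of_add_eq_zero_right (norm_eq_zero.1 (pow_eq_zero_iff two_ne_zero |>.1 this))).symm
    have h0 := hz 0
    simp only [Planar.pull, Planar.stereo_zero] at h0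
    rw [hxy', ← h0]
    congr 1
    rw [Refl, inner_neg_left, real_inner_self_eq_norm_sq, h.hy]
    module
  · obtain ⟨z, hzx⟩ := h.exists_stereo hx1 hxy
    have hpos : 0 < 1 + ⟪y, x⟫ := by
      refine lt_of_le_of_ne ?_ (Ne.symm hxy)
      have := abs_real_inner_le_norm y x
      rw [h.hy, hx1, one_mul] at this
      linarith [neg_abs_le ⟪y, x⟫]
    have hr : 0 < 2 / (1 + ⟪y, x⟫) := by positivity
    have h0 := hz z
    simp only [Planar.pull] at h0
    rw [← Planar.Refl_stereo h, hzx, hu.2.1 _ _ hr] at h0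
    rw [h0, show Refl y ((2 / (1 + ⟪y, x⟫)) • x) = (2 / (1 + ⟪y, x⟫)) • Refl y x by
      simp only [Refl, real_inner_smul_left]; module, hu.2.1 _ _ hr]
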